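/- Let Ω ⊆ ℂ^n be an open set, 0 < α < 1, and let g be a smooth map from Ω to the positive definite Hermitian n×n complex matrices. Let φ : Ω → ℝ be differentiable with locally Lipschitz gradient (so that, by Rademacher's theorem, the gradient of φ is differentiable at almost every point of Ω, and at such points the complex Hessian H(φ)(z) is defined). Let f : Ω → ℝ be α-Hölder continuous on every compact subset of Ω, and suppose that for almost every z ∈ Ω the matrix g(z) + H(φ)(z) is positive semidefinite and det(g(z) + H(φ)(z)) = e^{f(z)}·det g(z). Then φ is twice continuously differentiable on Ω and its second derivative is α-Hölder continuous on every compact subset of Ω; that is, φ belongs to C^{2,α}_loc(Ω). -/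

import Mathlib

open scoped ComplexOrder

/-- The complex Hessian of a real-valued function `u` on `ℂⁿ` at a point `z` where the (real)
gradient of `u` is differentiable:
`H(u)(z)_{jk} = (1/4)(u_{x_j x_k} + u_{y_j y_k}) + (i/4)(u_{x_j y_k} − u_{y_j x_k})`,
representing `∂²u/∂z_j∂z̄_k`. -/
noncomputable def cHess {n : ℕ} (u : (Fin n → ℂ) → ℝ) (z : Fin n → ℂ) :
    Matrix (Fin n) (Fin n) ℂ :=
  Matrix.of fun j k =>
    (((fderiv ℝ (fun y => fderiv ℝ u y (Pi.single k (1 : ℂ))) z (Pi.single j (1 : ℂ))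
        + fderiv ℝ (fun y => fderiv ℝ u y (Pi.single k (Complex.I))) z
            (Pi.single j (Complex.I))) / 4 : ℝ) : ℂ)
      + Complex.I *
        (((fderiv ℝ (fun y => fderiv ℝ u y (Pi.single k (Complex.I))) z (Pi.single j (1 : ℂ))
          - fderiv ℝ (fun y => fderiv ℝ u y (Pi.single k (1 : ℂ))) z
              (Pi.single j (Complex.I))) / 4 : ℝ) : ℂ)

namespace CMA
open Matrix
open scoped ComplexOrder Matrix

/-- quadratic form of a matrix -/
noncomputable def qf {n : ℕ} (A : Matrix (Fin n) (Fin n) ℂ) (c : Fin n → ℂ) : ℝ :=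
  (star c ⬝ᵥ A *ᵥ c).re

/-- Ellipticity with constant `l`. -/
def Ell {n : ℕ} (l : ℝ) (A : Matrix (Fin n) (Fin n) ℂ) : Prop :=
  A.IsHermitian ∧ ∀ c : Fin n → ℂ, l * ∑ i, ‖c i‖ ^ 2 ≤ qf A c

theorem herm_diag {n : ℕ} {A : Matrix (Fin n) (Fin n) ℂ} (hA : A.IsHermitian) :
    ∃ (U : Matrix (Fin n) (Fin n) ℂ) (s : Fin n → ℝ), Uᴴ * U = 1 ∧ U * Uᴴ = 1 ∧
      A = Uᴴ * diagonal (fun i => (s i : ℂ)) * U := by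
  refine ⟨star (hA.eigenvectorUnitary : Matrix (Fin n) (Fin n) ℂ), hA.eigenvalues, ?_, ?_, ?_⟩
  · rw [← star_eq_conjTranspose, star_star]; exact Unitary.mul_star_self_of_mem hA.eigenvectorUnitary.2
  · rw [← star_eq_conjTranspose, star_star]; exact Unitary.star_mul_self_of_mem hA.eigenvectorUnitary.2
  · rw [← star_eq_conjTranspose, star_star]
    conv_lhs => rw [hA.spectral_theorem, Unitary.conjStarAlgAut_apply]
    rfl

theorem qf_conj {n : ℕ} (C D : Matrix (Fin n) (Fin n) ℂ) (c : Fin n → ℂ) :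
    qf (Cᴴ * D * C) c = qf D (C *ᵥ c) := by
  unfold qf
  rw [← mulVec_mulVec, ← mulVec_mulVec, dotProduct_mulVec, star_mulVec]

theorem qf_diag {n : ℕ} (s : Fin n → ℝ) (c : Fin n → ℂ) :
    qf (diagonal (fun i => (s i : ℂ))) c = ∑ i, s i * ‖c i‖ ^ 2 := by
  unfold qf
  simp only [dotProduct, mulVec_diagonal, Pi.star_apply, Complex.re_sum]
  refine Finset.sum_congr rfl fun i _ => ?_
  rw [mul_left_comm]
  simp only [RCLike.star_def, Complex.conj_mul']
  norm_cast

theorem qf_one {n : ℕ} (c : Fin n → ℂ) : qf 1 c = ∑ i, ‖c i‖ ^ 2 := by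
  have := qf_diag (fun _ => 1) c
  simpa using this

theorem Ell.posDef {n : ℕ} {l : ℝ} (hl : 0 < l) {A : Matrix (Fin n) (Fin n) ℂ} (hA : Ell l A) :
    A.PosDef := by
  obtain ⟨U, s, h1, h2, h3⟩ := herm_diag hA.1
  have hs : ∀ i, 0 < s i := by
    intro i
    have := hA.2 (Uᴴ *ᵥ Pi.single i 1)
    have e : qf A (Uᴴ *ᵥ Pi.single i 1) = s i := by
      rw [h3, qf_conj, mulVec_mulVec, h2, one_mulVec, qf_diag]
      rw [Finset.sum_eq_single i] <;> simp +contextual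
    have e2 : ∑ j, ‖(Uᴴ *ᵥ Pi.single i (1:ℂ)) j‖ ^ 2 = 1 := by
      rw [← qf_one]
      have : (1 : Matrix (Fin n) (Fin n) ℂ) = Uᴴ * 1 * U := by rw [mul_one, h1]
      rw [this, qf_conj, mulVec_mulVec, h2, one_mulVec, qf_one]
      rw [Finset.sum_eq_single i] <;> simp +contextual
    rw [e, e2] at this; linarith
  rw [h3]
  refine PosDef.conjTranspose_mul_mul_same (posDef_diagonal_iff.2 fun i => by exact_mod_cast hs i) ?_
  exact (mulVec_injective_of_isUnit (IsUnit.of_mul_eq_one Uᴴ h2))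

theorem simdiag {n : ℕ} {A P : Matrix (Fin n) (Fin n) ℂ} (hA : A.IsHermitian) {l : ℝ} (hl : 0 < l)
    (hP : Ell l P) :
    ∃ (C D : Matrix (Fin n) (Fin n) ℂ) (s : Fin n → ℝ), C * D = 1 ∧ D * C = 1 ∧ P = Cᴴ * C ∧
      A = Cᴴ * diagonal (fun i => (s i : ℂ)) * C := by
  obtain ⟨U, p, h1, h2, h3⟩ := herm_diag hP.1
  have hp : ∀ i, 0 < p i := by
    have := hP.posDef hl
    intro i
    have e : qf P (Uᴴ *ᵥ Pi.single i 1) = p i := by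
      rw [h3, qf_conj, mulVec_mulVec, h2, one_mulVec, qf_diag]
      rw [Finset.sum_eq_single i] <;> simp +contextual
    have h0 : Uᴴ *ᵥ Pi.single i (1:ℂ) ≠ 0 := by
      intro h
      have := congrArg (fun v => U *ᵥ v) h
      simp only [mulVec_mulVec, h2, one_mulVec, mulVec_zero] at this
      simpa using congrFun this i
    have := this.dotProduct_mulVec_pos h0
    rw [← e]; exact (Complex.pos_iff.1 this).1
  set R : Matrix (Fin n) (Fin n) ℂ := diagonal (fun i => ((Real.sqrt (p i) : ℝ) : ℂ)) with hR
  set R' : Matrix (Fin n) (Fin n) ℂ := diagonal (fun i => (((Real.sqrt (p i))⁻¹ : ℝ) : ℂ)) with hR'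
  have hRH : Rᴴ = R := by
    rw [hR, diagonal_conjTranspose]; congr 1; ext i; simp
  have hR'H : R'ᴴ = R' := by
    rw [hR', diagonal_conjTranspose]; congr 1; ext i; simp
  have hRR : R * R' = 1 := by
    rw [hR, hR', diagonal_mul_diagonal, ← diagonal_one]; congr 1; ext i
    rw [← Complex.ofReal_mul, mul_inv_cancel₀ (Real.sqrt_pos.2 (hp i)).ne']; simp
  have hRR' : R' * R = 1 := by
    rw [hR, hR', diagonal_mul_diagonal, ← diagonal_one]; congr 1; ext i
    rw [← Complex.ofReal_mul, inv_mul_cancel₀ (Real.sqrt_pos.2 (hp i)).ne']; simp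
  have hR2 : R * R = diagonal (fun i => (p i : ℂ)) := by
    rw [hR, diagonal_mul_diagonal]; congr 1; ext i
    rw [← Complex.ofReal_mul, Real.mul_self_sqrt (hp i).le]
  have hS : (R' * U * A * Uᴴ * R').IsHermitian := by
    have : R' * U * A * Uᴴ * R' = (Uᴴ * R')ᴴ * A * (Uᴴ * R') := by
      rw [conjTranspose_mul, conjTranspose_conjTranspose, hR'H]; simp only [mul_assoc]
    rw [this]
    exact isHermitian_conjTranspose_mul_mul _ hA
  obtain ⟨V, s, k1, k2, k3⟩ := herm_diag hS
  refine ⟨V * R * U, Uᴴ * R' * Vᴴ, s, ?_, ?_, ?_, ?_⟩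
  · calc V * R * U * (Uᴴ * R' * Vᴴ) = V * (R * ((U * Uᴴ) * R')) * Vᴴ := by simp only [mul_assoc]
      _ = 1 := by rw [h2, one_mul, hRR, mul_one, k2]
  · calc Uᴴ * R' * Vᴴ * (V * R * U) = Uᴴ * (R' * ((Vᴴ * V) * R)) * U := by simp only [mul_assoc]
      _ = 1 := by rw [k1, one_mul, hRR', mul_one, h1]
  · rw [conjTranspose_mul, conjTranspose_mul, hRH]
    calc P = Uᴴ * (R * R) * U := by rw [hR2, ← h3]
      _ = Uᴴ * (R * ((Vᴴ * V) * R)) * U := by rw [k1, one_mul]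
      _ = _ := by simp only [mul_assoc]
  · rw [conjTranspose_mul, conjTranspose_mul, hRH]
    calc A = (Uᴴ * (R * R') * U) * A * (Uᴴ * (R' * R) * U) := by
            rw [hRR, hRR', mul_one, h1, one_mul, mul_one]
      _ = Uᴴ * R * (R' * U * A * Uᴴ * R') * R * U := by simp only [mul_assoc]
      _ = Uᴴ * R * (Vᴴ * diagonal (fun i => (s i : ℂ)) * V) * R * U := by rw [← k3]
      _ = _ := by simp only [mul_assoc]

theorem abs_qf_le {n : ℕ} {A : Matrix (Fin n) (Fin n) ℂ} {L : ℝ} (hL : ∀ i j, ‖A i j‖ ≤ L)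
    (c : Fin n → ℂ) : |qf A c| ≤ n * L * ∑ i, ‖c i‖ ^ 2 := by
  rcases Nat.eq_zero_or_pos n with rfl | hn
  · simp [qf]
  have hL0 : 0 ≤ L := (norm_nonneg _).trans (hL ⟨0, hn⟩ ⟨0, hn⟩)
  calc |qf A c| ≤ ‖star c ⬝ᵥ A *ᵥ c‖ := Complex.abs_re_le_norm _
    _ ≤ ∑ i, ‖c i‖ * ∑ j, L * ‖c j‖ := by
        refine (norm_sum_le _ _).trans (Finset.sum_le_sum fun i _ => ?_)
        rw [norm_mul]; simp only [Pi.star_apply, norm_star]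
        refine mul_le_mul_of_nonneg_left ?_ (norm_nonneg _)
        change ‖∑ j, A i j * c j‖ ≤ _
        refine (norm_sum_le _ _).trans (Finset.sum_le_sum fun j _ => ?_)
        rw [norm_mul]; exact mul_le_mul_of_nonneg_right (hL i j) (norm_nonneg _)
    _ = L * (∑ i, ‖c i‖) ^ 2 := by rw [← Finset.mul_sum, ← Finset.sum_mul]; ring
    _ ≤ L * (n * ∑ i, ‖c i‖ ^ 2) := by
        refine mul_le_mul_of_nonneg_left ?_ hL0
        have := sq_sum_le_card_mul_sum_sq (s := (Finset.univ : Finset (Fin n))) (f := fun i => ‖c i‖)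
        simpa using this
    _ = _ := by ring

theorem one_var {x M : ℝ} (hx : 0 < x) (hM : x ≤ M) :
    (x - 1) ^ 2 / (1 + Real.sqrt M) ^ 2 ≤ x - 1 - Real.log x := by
  set y := Real.sqrt x with hy
  have hy0 : 0 < y := Real.sqrt_pos.2 hx
  have hyx : x = y ^ 2 := (Real.sq_sqrt hx.le).symm
  have hyM : y ≤ Real.sqrt M := Real.sqrt_le_sqrt hM
  have hlog : Real.log x ≤ 2 * (y - 1) := by
    rw [hyx, Real.log_pow]; push_cast
    have := Real.log_le_sub_one_of_pos hy0
    linarith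
  rw [div_le_iff₀ (by positivity)]
  have h1 : (y - 1) ^ 2 ≤ x - 1 - Real.log x := by nlinarith
  have h2 : (x - 1) ^ 2 = (y - 1) ^ 2 * (1 + y) ^ 2 := by rw [hyx]; ring
  rw [h2]
  have h3 : (1 + y) ^ 2 ≤ (1 + Real.sqrt M) ^ 2 := by gcongr
  have : 0 ≤ (y-1)^2 := sq_nonneg _
  calc (y - 1) ^ 2 * (1 + y) ^ 2 ≤ (y - 1) ^ 2 * (1 + Real.sqrt M) ^ 2 := by gcongr
    _ ≤ _ := by gcongr

/-- sum of squares norm of a matrix -/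
noncomputable def nsq {n : ℕ} (A : Matrix (Fin n) (Fin n) ℂ) : ℝ := ∑ i, ∑ j, ‖A i j‖ ^ 2

/-- simultaneous diagonalization with bounds -/
theorem simdiag_bd {n : ℕ} {A P : Matrix (Fin n) (Fin n) ℂ} {l L : ℝ} (hl : 0 < l)
    (hA : Ell l A) (hP : Ell l P) (hAL : ∀ i j, ‖A i j‖ ≤ L) (hPL : ∀ i j, ‖P i j‖ ≤ L) :
    ∃ (C D : Matrix (Fin n) (Fin n) ℂ) (s : Fin n → ℝ), C * D = 1 ∧ D * C = 1 ∧ P = Cᴴ * C ∧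
      A = Cᴴ * diagonal (fun i => (s i : ℂ)) * C ∧ (∀ i, 0 < s i) ∧ (∀ i, s i ≤ n * L / l) ∧
      ∀ k i, ‖C k i‖ ^ 2 ≤ L := by
  obtain ⟨C, D, s, h1, h2, h3, h4⟩ := simdiag hA.1 hl hP
  have key : ∀ i, qf A (D *ᵥ Pi.single i 1) = s i ∧ qf P (D *ᵥ Pi.single i 1) = 1 := by
    intro i
    constructor
    · rw [h4, qf_conj, mulVec_mulVec, h1, one_mulVec, qf_diag]
      rw [Finset.sum_eq_single i] <;> simp +contextual
    · have : P = Cᴴ * 1 * C := by rw [mul_one]; exact h3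
      rw [this, qf_conj, mulVec_mulVec, h1, one_mulVec, qf_one]
      rw [Finset.sum_eq_single i] <;> simp +contextual
  refine ⟨C, D, s, h1, h2, h3, h4, ?_, ?_, ?_⟩
  · intro i
    have h0 : D *ᵥ Pi.single i (1:ℂ) ≠ 0 := by
      intro h
      have := (key i).2
      rw [h] at this; simp [qf] at this
    rw [← (key i).1]
    exact (Complex.pos_iff.1 ((hA.posDef hl).dotProduct_mulVec_pos h0)).1
  · intro i
    have a := abs_qf_le hAL (D *ᵥ Pi.single i 1)
    have b := hP.2 (D *ᵥ Pi.single i 1)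
    rw [(key i).1] at a; rw [(key i).2] at b
    have a' := (le_abs_self _).trans a
    rw [le_div_iff₀ hl]
    have hnL : 0 ≤ n * L := by
      rcases Nat.eq_zero_or_pos n with rfl | hn
      · simp
      · exact mul_nonneg (Nat.cast_nonneg _) ((norm_nonneg _).trans (hAL ⟨0, hn⟩ ⟨0, hn⟩))
    calc s i * l ≤ (n * L * ∑ j, ‖(D *ᵥ Pi.single i 1) j‖ ^ 2) * l := by gcongr
      _ = n * L * (l * ∑ j, ‖(D *ᵥ Pi.single i 1) j‖ ^ 2) := by ring
      _ ≤ n * L * 1 := by gcongr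
      _ = n * L := mul_one _
  · intro k i
    have : (P i i).re = ∑ k, ‖C k i‖ ^ 2 := by
      rw [h3, mul_apply, Complex.re_sum]
      refine Finset.sum_congr rfl fun k _ => ?_
      rw [conjTranspose_apply, RCLike.star_def, Complex.conj_mul']
      norm_cast
    calc ‖C k i‖ ^ 2 ≤ ∑ k, ‖C k i‖ ^ 2 :=
          Finset.single_le_sum (f := fun k => ‖C k i‖ ^ 2) (fun _ _ => by positivity) (Finset.mem_univ k)
      _ = (P i i).re := this.symm
      _ ≤ ‖P i i‖ := Complex.re_le_norm _
      _ ≤ L := hPL i i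

/-- A1: sharp concavity of log det. -/
theorem A1 (n : ℕ) {l : ℝ} (hl : 0 < l) (L : ℝ) : ∃ c > 0, ∀ A P : Matrix (Fin n) (Fin n) ℂ,
    Ell l A → Ell l P → (∀ i j, ‖A i j‖ ≤ L) → (∀ i j, ‖P i j‖ ≤ L) →
    c * nsq (A - P) ≤ (P⁻¹ * (A - P)).trace.re - (Real.log A.det.re - Real.log P.det.re) := by
  refine ⟨((n * n * n * L ^ 2 + 1) * (1 + Real.sqrt (n * L / l)) ^ 2)⁻¹, by positivity, ?_⟩
  intro A P hA hP hAL hPL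
  obtain ⟨C, D, s, h1, h2, h3, h4, hs, hsM, hC⟩ := simdiag_bd hl hA hP hAL hPL
  have hdet : ‖C.det‖ ^ 2 ≠ 0 := by
    have : C.det * D.det = 1 := by rw [← det_mul, h1, det_one]
    have : C.det ≠ 0 := left_ne_zero_of_mul_eq_one this
    positivity
  have hdP : P.det.re = ‖C.det‖ ^ 2 := by
    rw [h3, det_mul, det_conjTranspose, RCLike.star_def, Complex.conj_mul']; norm_cast
  have hdA : A.det.re = ‖C.det‖ ^ 2 * ∏ i, s i := by
    rw [h4, det_mul, det_mul, det_conjTranspose, det_diagonal, mul_right_comm, RCLike.star_def,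
      Complex.conj_mul']; norm_cast
  have hprod : ∏ i, s i ≠ 0 := (Finset.prod_pos fun i _ => hs i).ne'
  have hlog : Real.log A.det.re - Real.log P.det.re = ∑ i, Real.log (s i) := by
    rw [hdA, hdP, Real.log_mul hdet hprod, Real.log_prod (fun i _ => (hs i).ne')]; ring
  have hinv : P⁻¹ = D * Dᴴ := by
    apply inv_eq_left_inv
    rw [h3]
    calc D * Dᴴ * (Cᴴ * C) = D * (C * D)ᴴ * C := by rw [conjTranspose_mul]; simp only [mul_assoc]
      _ = 1 := by rw [h1, conjTranspose_one, mul_one, h2]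
  have hdiff : A - P = Cᴴ * diagonal (fun i => ((s i - 1 : ℝ) : ℂ)) * C := by
    have : diagonal (fun i => ((s i - 1 : ℝ) : ℂ)) = diagonal (fun i => (s i : ℂ)) - 1 := by
      rw [← diagonal_one, diagonal_sub]; congr 1; ext i; simp
    rw [this, mul_sub, sub_mul, mul_one, ← h4, ← h3]
  have htr : (P⁻¹ * (A - P)).trace.re = ∑ i, (s i - 1) := by
    have : P⁻¹ * (A - P) = D * (diagonal (fun i => ((s i - 1 : ℝ) : ℂ)) * C) := by
      rw [hinv, hdiff]
      calc D * Dᴴ * (Cᴴ * diagonal (fun i => ((s i - 1 : ℝ) : ℂ)) * C) =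
          D * (C * D)ᴴ * (diagonal (fun i => ((s i - 1 : ℝ) : ℂ)) * C) := by
            rw [conjTranspose_mul]; simp only [mul_assoc]
        _ = _ := by rw [h1, conjTranspose_one, mul_one]
    rw [this, trace_mul_comm, mul_assoc, h1, mul_one, trace_diagonal, Complex.re_sum]
    simp
  rw [hlog, htr, ← Finset.sum_sub_distrib]
  have hn : nsq (A - P) ≤ (n * n * n * L ^ 2 + 1) * ∑ i, (s i - 1) ^ 2 := by
    have hent : ∀ i j, ‖(A - P) i j‖ ^ 2 ≤ n * L ^ 2 * ∑ k, (s k - 1) ^ 2 := by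
      intro i j
      have hL0 : 0 ≤ L := (norm_nonneg _).trans (hAL i j)
      have e : ‖(A - P) i j‖ ≤ L * ∑ k, |s k - 1| := by
        rw [hdiff, mul_apply, Finset.mul_sum]
        refine (norm_sum_le _ _).trans (Finset.sum_le_sum fun k _ => ?_)
        rw [mul_diagonal, norm_mul, norm_mul, conjTranspose_apply, norm_star, Complex.norm_real,
          Real.norm_eq_abs]
        have : ‖C k i‖ * ‖C k j‖ ≤ L := by nlinarith [hC k i, hC k j, sq_nonneg (‖C k i‖ - ‖C k j‖)]
        calc ‖C k i‖ * |s k - 1| * ‖C k j‖ = (‖C k i‖ * ‖C k j‖) * |s k - 1| := by ring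
          _ ≤ L * |s k - 1| := by gcongr
      calc ‖(A - P) i j‖ ^ 2 ≤ (L * ∑ k, |s k - 1|) ^ 2 := by gcongr
        _ = L ^ 2 * (∑ k, |s k - 1|) ^ 2 := by ring
        _ ≤ L ^ 2 * (n * ∑ k, (s k - 1) ^ 2) := by
            gcongr
            have := sq_sum_le_card_mul_sum_sq (s := (Finset.univ : Finset (Fin n))) (f := fun i => |s i - 1|)
            simpa using this
        _ = _ := by ring
    calc nsq (A - P) ≤ ∑ i : Fin n, ∑ j : Fin n, n * L ^ 2 * ∑ k, (s k - 1) ^ 2 :=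
          Finset.sum_le_sum fun i _ => Finset.sum_le_sum fun j _ => hent i j
      _ = n * n * n * L ^ 2 * ∑ k, (s k - 1) ^ 2 := by simp; ring
      _ ≤ _ := by
        have : 0 ≤ ∑ k, (s k - 1) ^ 2 := Finset.sum_nonneg fun _ _ => sq_nonneg _
        linarith
  have hsum : (∑ i, (s i - 1) ^ 2) / (1 + Real.sqrt (n * L / l)) ^ 2 ≤
      ∑ i, (s i - 1 - Real.log (s i)) := by
    rw [Finset.sum_div]
    exact Finset.sum_le_sum fun i _ => one_var (hs i) (hsM i)
  refine le_trans ?_ hsum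
  rw [mul_inv, le_div_iff₀ (by positivity)]
  have p1 : (0:ℝ) < n * n * n * L ^ 2 + 1 := by positivity
  have p2 : (0:ℝ) < (1 + Real.sqrt (n * L / l)) ^ 2 := by positivity
  calc (n * n * n * L ^ 2 + 1 : ℝ)⁻¹ * ((1 + Real.sqrt (n * L / l)) ^ 2)⁻¹ * nsq (A - P) *
        (1 + Real.sqrt (n * L / l)) ^ 2 = (n * n * n * L ^ 2 + 1 : ℝ)⁻¹ * nsq (A - P) := by
          field_simp
    _ ≤ (n * n * n * L ^ 2 + 1 : ℝ)⁻¹ * ((n * n * n * L ^ 2 + 1) * ∑ i, (s i - 1) ^ 2) := by gcongr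
    _ = _ := by field_simp

/-- det as a continuous multilinear map -/
noncomputable def cmdet (n : ℕ) : ContinuousMultilinearMap ℂ (fun _ : Fin n => Fin n → ℂ) ℂ :=
  { (Matrix.detRowAlternating (R := ℂ) (n := Fin n)).toMultilinearMap with
    cont := by
      change Continuous fun M : Fin n → Fin n → ℂ => Matrix.det (M : Matrix (Fin n) (Fin n) ℂ)
      exact Continuous.matrix_det (A := fun M : Fin n → Fin n → ℂ => Matrix.of M) continuous_id }

theorem det_updateRow_eq {n : ℕ} (A : Matrix (Fin n) (Fin n) ℂ) (l : Fin n) (v : Fin n → ℂ) :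
    (A.updateRow l v).det = ∑ m, A.adjugate m l * v m := by
  have : v = ∑ m, v m • (Pi.single m (1:ℂ) : Fin n → ℂ) := by
    ext i; simp [Finset.sum_apply, Pi.single_apply]
  conv_lhs => rw [this]
  have h := map_sum ((Matrix.detRowAlternating (R := ℂ) (n := Fin n)).toMultilinearMap.toLinearMap A l)
    (fun m => v m • (Pi.single m (1:ℂ) : Fin n → ℂ)) Finset.univ
  refine h.trans (Finset.sum_congr rfl fun m _ => ?_)
  rw [map_smul, adjugate_apply, smul_eq_mul, mul_comm]; rfl

theorem hasFDerivAt_det {n : ℕ} {F : Type*} [NormedAddCommGroup F] [NormedSpace ℝ F]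
    {M : F → Matrix (Fin n) (Fin n) ℂ} {M' : Fin n → Fin n → (F →L[ℝ] ℂ)} {x : F}
    (h : ∀ i j, HasFDerivAt (fun y => M y i j) (M' i j) x) :
    HasFDerivAt (fun y => (M y).det)
      (∑ l, ∑ m, (M x).adjugate m l • M' l m) x := by
  have h1 : HasFDerivAt (fun y => (fun i j => M y i j : Fin n → Fin n → ℂ))
      (ContinuousLinearMap.pi fun i => ContinuousLinearMap.pi fun j => M' i j) x := by
    rw [hasFDerivAt_pi]; intro i; rw [hasFDerivAt_pi]; intro j; exact h i j
  have h2 := (((cmdet n).hasFDerivAt (fun i j => M x i j)).restrictScalars ℝ).comp x h1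
  refine h2.congr_fderiv ?_
  ext v
  simp only [ContinuousLinearMap.comp_apply, ContinuousLinearMap.coe_restrictScalars',
    ContinuousMultilinearMap.linearDeriv_apply, _root_.sum_apply, _root_.smul_apply, smul_eq_mul]
  refine Finset.sum_congr rfl fun l _ => ?_
  exact det_updateRow_eq (M x) l _

theorem hasDerivAt_det {n : ℕ} (A B : Matrix (Fin n) (Fin n) ℂ) (t : ℝ) :
    HasDerivAt (fun s : ℝ => (A + (s:ℂ) • B).det) (((A + (t:ℂ) • B).adjugate * B).trace) t := by
  have h : ∀ i j, HasFDerivAt (fun s : ℝ => (A + (s:ℂ) • B) i j)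
      (ContinuousLinearMap.smulRight (1 : ℝ →L[ℝ] ℝ) (B i j)) t := by
    intro i j
    have : HasDerivAt (fun s : ℝ => A i j + (s:ℂ) * B i j) (1 * B i j) t :=
      ((Complex.ofRealCLM.hasDerivAt (x := t)).mul_const _).const_add _
    rw [one_mul] at this
    exact this.hasFDerivAt
  have := (hasFDerivAt_det h).hasDerivAt
  refine this.congr_deriv ?_
  simp only [_root_.sum_apply, _root_.smul_apply, trace, diag, mul_apply]
  rw [Finset.sum_comm]
  simp

theorem det_lip (n : ℕ) (L : ℝ) (hL : 0 ≤ L) : ∃ C, 0 ≤ C ∧ ∀ A B : Matrix (Fin n) (Fin n) ℂ, ∀ η, 0 ≤ η →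
    (∀ i j, ‖A i j‖ ≤ L) → (∀ i j, ‖B i j‖ ≤ L) → (∀ i j, ‖A i j - B i j‖ ≤ η) →
    ‖A.det - B.det‖ ≤ C * η := by
  refine ⟨‖cmdet n‖ * n * L ^ (n - 1), by positivity, ?_⟩
  intro A B η hη hA hB hAB
  have h := (cmdet n).norm_image_sub_le (fun i j => A i j) (fun i j => B i j)
  have nA : ‖(fun i j => A i j : Fin n → Fin n → ℂ)‖ ≤ L :=
    (pi_norm_le_iff_of_nonneg hL).2 fun i => (pi_norm_le_iff_of_nonneg hL).2 fun j => hA i j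
  have nB : ‖(fun i j => B i j : Fin n → Fin n → ℂ)‖ ≤ L :=
    (pi_norm_le_iff_of_nonneg hL).2 fun i => (pi_norm_le_iff_of_nonneg hL).2 fun j => hB i j
  have nAB : ‖(fun i j => A i j : Fin n → Fin n → ℂ) - (fun i j => B i j)‖ ≤ η :=
    (pi_norm_le_iff_of_nonneg hη).2 fun i => (pi_norm_le_iff_of_nonneg hη).2 fun j => hAB i j
  refine h.trans ?_
  rw [Fintype.card_fin]
  gcongr
  exact max_le nA nB

theorem adj_lip (n : ℕ) (L : ℝ) (hL : 0 ≤ L) : ∃ C, 0 ≤ C ∧ ∀ A B : Matrix (Fin n) (Fin n) ℂ, ∀ η, 0 ≤ η →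
    (∀ i j, ‖A i j‖ ≤ L) → (∀ i j, ‖B i j‖ ≤ L) → (∀ i j, ‖A i j - B i j‖ ≤ η) →
    ∀ i j, ‖A.adjugate i j - B.adjugate i j‖ ≤ C * η := by
  obtain ⟨C, hC, h⟩ := det_lip n (L + 1) (by linarith)
  refine ⟨C, hC, fun A B η hη hA hB hAB i j => ?_⟩
  rw [adjugate_apply, adjugate_apply]
  have hs : ∀ k, ‖(Pi.single i 1 : Fin n → ℂ) k‖ ≤ 1 := by
    intro k; rw [Pi.single_apply]; split_ifs <;> simp
  refine h _ _ η hη ?_ ?_ ?_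
  · intro a b; rw [updateRow_apply]; split_ifs
    · linarith [hs b]
    · linarith [hA a b]
  · intro a b; rw [updateRow_apply]; split_ifs
    · linarith [hs b]
    · linarith [hB a b]
  · intro a b; rw [updateRow_apply, updateRow_apply]; split_ifs
    · simpa using hη
    · exact hAB a b

theorem adj_bd (n : ℕ) (L : ℝ) (hL : 0 ≤ L) : ∃ C, 0 ≤ C ∧ ∀ A : Matrix (Fin n) (Fin n) ℂ,
    (∀ i j, ‖A i j‖ ≤ L) → ∀ i j, ‖A.adjugate i j‖ ≤ C := by
  obtain ⟨C, hC, h⟩ := adj_lip n L hL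
  refine ⟨C * L + ∑ i, ∑ j, ‖(0 : Matrix (Fin n) (Fin n) ℂ).adjugate i j‖, by positivity, fun A hA i j => ?_⟩
  have := h A 0 L hL hA (fun _ _ => by simpa using hL) (by simpa using hA) i j
  have h2 : ‖(0 : Matrix (Fin n) (Fin n) ℂ).adjugate i j‖ ≤
      ∑ i, ∑ j, ‖(0 : Matrix (Fin n) (Fin n) ℂ).adjugate i j‖ := by
    refine (Finset.single_le_sum (f := fun j => ‖(0 : Matrix (Fin n) (Fin n) ℂ).adjugate i j‖) (fun _ _ => norm_nonneg _) (Finset.mem_univ j)).trans ?_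
    exact Finset.single_le_sum (f := fun i => ∑ j, ‖(0 : Matrix (Fin n) (Fin n) ℂ).adjugate i j‖) (fun _ _ => by positivity) (Finset.mem_univ i)
  calc ‖A.adjugate i j‖ = ‖(A.adjugate i j - (0 : Matrix (Fin n) (Fin n) ℂ).adjugate i j) + (0 : Matrix (Fin n) (Fin n) ℂ).adjugate i j‖ := by rw [sub_add_cancel]
    _ ≤ _ := (norm_add_le _ _).trans (add_le_add this h2)

theorem qf_eig {n : ℕ} {A U : Matrix (Fin n) (Fin n) ℂ} {s : Fin n → ℝ} (h1 : Uᴴ * U = 1)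
    (h2 : U * Uᴴ = 1) (h3 : A = Uᴴ * diagonal (fun i => (s i : ℂ)) * U) (i : Fin n) :
    qf A (Uᴴ *ᵥ Pi.single i 1) = s i ∧ ∑ j, ‖(Uᴴ *ᵥ Pi.single i (1:ℂ)) j‖ ^ 2 = 1 := by
  constructor
  · rw [h3, qf_conj, mulVec_mulVec, h2, one_mulVec, qf_diag]
    rw [Finset.sum_eq_single i] <;> simp +contextual
  · rw [← qf_one]
    have : (1 : Matrix (Fin n) (Fin n) ℂ) = Uᴴ * 1 * U := by rw [mul_one, h1]
    rw [this, qf_conj, mulVec_mulVec, h2, one_mulVec, qf_one]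
    rw [Finset.sum_eq_single i] <;> simp +contextual

theorem det_diagform {n : ℕ} {A U : Matrix (Fin n) (Fin n) ℂ} {s : Fin n → ℝ}
    (h2 : U * Uᴴ = 1) (h3 : A = Uᴴ * diagonal (fun i => (s i : ℂ)) * U) :
    A.det = ((∏ i, s i : ℝ) : ℂ) := by
  rw [h3, det_mul, det_mul, mul_right_comm, mul_comm Uᴴ.det, ← det_mul, h2, det_one, one_mul,
    det_diagonal]
  norm_cast

theorem Ell.det_ge {n : ℕ} {l : ℝ} (hl : 0 < l) {A : Matrix (Fin n) (Fin n) ℂ} (hA : Ell l A) :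
    l ^ n ≤ A.det.re := by
  obtain ⟨U, s, h1, h2, h3⟩ := herm_diag hA.1
  rw [det_diagform h2 h3, Complex.ofReal_re]
  have : ∀ i, l ≤ s i := by
    intro i
    have := hA.2 (Uᴴ *ᵥ Pi.single i 1)
    rw [(qf_eig h1 h2 h3 i).1, (qf_eig h1 h2 h3 i).2] at this; linarith
  calc l ^ n = ∏ i : Fin n, l := by simp
    _ ≤ _ := Finset.prod_le_prod (fun _ _ => hl.le) fun i _ => this i

theorem herm_det_real {n : ℕ} {A : Matrix (Fin n) (Fin n) ℂ} (hA : A.IsHermitian) :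
    A.det = (A.det.re : ℂ) := by
  obtain ⟨U, s, h1, h2, h3⟩ := herm_diag hA
  rw [det_diagform h2 h3, Complex.ofReal_re]

theorem qf_diagform {n : ℕ} {A U : Matrix (Fin n) (Fin n) ℂ} {s : Fin n → ℝ} (h1 : Uᴴ * U = 1)
    (h3 : A = Uᴴ * diagonal (fun i => (s i : ℂ)) * U) (c : Fin n → ℂ) :
    qf A c = ∑ i, s i * ‖(U *ᵥ c) i‖ ^ 2 ∧ ∑ i, ‖c i‖ ^ 2 = ∑ i, ‖(U *ᵥ c) i‖ ^ 2 := by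
  constructor
  · rw [h3, qf_conj, qf_diag]
  · rw [← qf_one, ← qf_one]
    have : (1 : Matrix (Fin n) (Fin n) ℂ) = Uᴴ * 1 * U := by rw [mul_one, h1]
    conv_lhs => rw [this]
    rw [qf_conj]

/-- A6: psd, bounded, det bounded below implies elliptic -/
theorem ell_of_det (n : ℕ) (L : ℝ) (hL : 0 ≤ L) {d : ℝ} (hd : 0 < d) : ∃ l > 0, ∀ A : Matrix (Fin n) (Fin n) ℂ,
    A.PosSemidef → (∀ i j, ‖A i j‖ ≤ L) → d ≤ A.det.re → Ell l A := by
  set M : ℝ := 1 + n * L with hM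
  have hM1 : 1 ≤ M := by have : 0 ≤ n * L := by positivity
                         linarith
  refine ⟨d / M ^ n, by positivity, fun A hA hAL hdet => ⟨hA.isHermitian, ?_⟩⟩
  obtain ⟨U, s, h1, h2, h3⟩ := herm_diag hA.isHermitian
  have s0 : ∀ i, 0 ≤ s i := by
    intro i; rw [← (qf_eig h1 h2 h3 i).1]
    exact (Complex.nonneg_iff.1 (hA.dotProduct_mulVec_nonneg _)).1
  have sM : ∀ i, s i ≤ M := by
    intro i
    have := (le_abs_self _).trans (abs_qf_le hAL (Uᴴ *ᵥ Pi.single i 1))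
    rw [(qf_eig h1 h2 h3 i).1, (qf_eig h1 h2 h3 i).2] at this; linarith
  rw [det_diagform h2 h3, Complex.ofReal_re] at hdet
  have sl : ∀ i, d / M ^ n ≤ s i := by
    intro i
    rw [div_le_iff₀ (by positivity)]
    refine hdet.trans ?_
    rw [← Finset.mul_prod_erase _ _ (Finset.mem_univ i)]
    refine mul_le_mul_of_nonneg_left ?_ (s0 i)
    calc ∏ j ∈ Finset.univ.erase i, s j ≤ ∏ j ∈ Finset.univ.erase i, M :=
          Finset.prod_le_prod (fun j _ => s0 j) fun j _ => sM j
      _ = M ^ (Finset.univ.erase i).card := by simp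
      _ ≤ M ^ n := by
          refine pow_le_pow_right₀ hM1 ?_
          simpa using Finset.card_erase_le (s := (Finset.univ : Finset (Fin n))) (a := i)
  intro c
  obtain ⟨e1, e2⟩ := qf_diagform h1 h3 c
  rw [e1, e2, Finset.mul_sum]
  exact Finset.sum_le_sum fun i _ => mul_le_mul_of_nonneg_right (sl i) (by positivity)

/-- A2: ellipticity of the adjugate -/
theorem adj_ell (n : ℕ) {l : ℝ} (hl : 0 < l) (L : ℝ) (hL : 0 ≤ L) : ∃ l' > 0, ∀ A : Matrix (Fin n) (Fin n) ℂ,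
    Ell l A → (∀ i j, ‖A i j‖ ≤ L) → Ell l' A.adjugate := by
  set M : ℝ := 1 + n * L with hM
  have hM1 : 1 ≤ M := by have : 0 ≤ n * L := by positivity
                         linarith
  refine ⟨l ^ n / M, by positivity, fun A hA hAL => ?_⟩
  obtain ⟨U, s, h1, h2, h3⟩ := herm_diag hA.1
  have sl : ∀ i, l ≤ s i := by
    intro i
    have := hA.2 (Uᴴ *ᵥ Pi.single i 1)
    rw [(qf_eig h1 h2 h3 i).1, (qf_eig h1 h2 h3 i).2] at this; linarith
  have s0 : ∀ i, 0 < s i := fun i => hl.trans_le (sl i)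
  have sM : ∀ i, s i ≤ M := by
    intro i
    have := (le_abs_self _).trans (abs_qf_le hAL (Uᴴ *ᵥ Pi.single i 1))
    rw [(qf_eig h1 h2 h3 i).1, (qf_eig h1 h2 h3 i).2] at this; linarith
  have hdet := hA.det_ge hl
  have hdr := herm_det_real hA.1
  set d := A.det.re with hd
  have hadj : A.adjugate = Uᴴ * diagonal (fun i => ((d * (s i)⁻¹ : ℝ) : ℂ)) * U := by
    have hmul : A * (Uᴴ * diagonal (fun i => ((d * (s i)⁻¹ : ℝ) : ℂ)) * U) = A.det • 1 := by
      rw [hdr]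
      conv_lhs => rw [h3]
      calc Uᴴ * diagonal (fun i => (s i : ℂ)) * U * (Uᴴ * diagonal (fun i => ((d * (s i)⁻¹ : ℝ) : ℂ)) * U)
          = Uᴴ * (diagonal (fun i => (s i : ℂ)) * ((U * Uᴴ) * diagonal (fun i => ((d * (s i)⁻¹ : ℝ) : ℂ)))) * U := by
            simp only [mul_assoc]
        _ = Uᴴ * ((d : ℂ) • (1 : Matrix (Fin n) (Fin n) ℂ)) * U := by
            rw [h2, one_mul, diagonal_mul_diagonal]
            congr 2
            rw [← diagonal_one, ← diagonal_smul]; congr 1; ext i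
            have : (s i : ℂ) ≠ 0 := by exact_mod_cast (s0 i).ne'
            simp; field_simp
        _ = _ := by rw [mul_smul_comm, smul_mul_assoc, mul_one, h1]
    have hu : IsUnit A.det := by
      rw [hdr, isUnit_iff_ne_zero]
      have : 0 < d := lt_of_lt_of_le (by positivity) hdet
      exact_mod_cast this.ne'
    have e := congrArg (fun X => A.adjugate * X) hmul
    simp only [← mul_assoc] at e
    rw [adjugate_mul, smul_mul_assoc, smul_mul_assoc, smul_mul_assoc, one_mul, mul_smul_comm, mul_one] at e
    exact ((smul_right_injective _ hu.ne_zero e)).symm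
  refine ⟨?_, ?_⟩
  · exact hA.1.adjugate
  · intro c
    obtain ⟨e1, e2⟩ := qf_diagform h1 hadj c
    rw [e1, e2, Finset.mul_sum]
    refine Finset.sum_le_sum fun i _ => mul_le_mul_of_nonneg_right ?_ (by positivity)
    rw [div_eq_mul_inv]
    have : M⁻¹ ≤ (s i)⁻¹ := inv_anti₀ (s0 i) (sM i)
    have := s0 i
    have hd0 : 0 ≤ d := (by positivity : (0:ℝ) ≤ l ^ n).trans hdet
    gcongr

end CMA

namespace CMA
open Matrix MeasureTheory
open scoped ComplexOrder Matrix

/-- the space -/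
abbrev E (n : ℕ) := Fin n → ℂ

abbrev Sm {n : ℕ} (F : E n → ℂ) : Prop := ContDiff ℝ (⊤ : ℕ∞) F

/-- Wirtinger-type derivative -/
noncomputable def dd {n : ℕ} (σ : ℂ) (j : Fin n) (F : E n → ℂ) (x : E n) : ℂ :=
  (fderiv ℝ F x (Pi.single j 1) + σ * fderiv ℝ F x (Pi.single j Complex.I)) / 2

variable {n : ℕ}

theorem sm_fderiv {F : E n → ℂ} (hF : Sm F) (v : E n) : Sm (fun x => fderiv ℝ F x v) :=
  (hF.fderiv_right (m := (⊤ : ℕ∞)) (by simp)).clm_apply contDiff_const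

theorem sm_dd {F : E n → ℂ} (hF : Sm F) (σ : ℂ) (j : Fin n) : Sm (dd σ j F) := by
  unfold dd
  exact ((sm_fderiv hF _).add (contDiff_const.mul (sm_fderiv hF _))).div_const _

theorem Sm.diff {F : E n → ℂ} (hF : Sm F) : Differentiable ℝ F := hF.differentiable (by simp)

theorem fderiv_comm {F : E n → ℂ} (hF : Sm F) (v w : E n) (x : E n) :
    fderiv ℝ (fun y => fderiv ℝ F y v) x w = fderiv ℝ (fun y => fderiv ℝ F y w) x v := by
  have hd : DifferentiableAt ℝ (fderiv ℝ F) x :=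
    ((hF.fderiv_right (m := (⊤ : ℕ∞)) (by simp)).differentiable (by simp)) x
  have h1 : ∀ v, HasFDerivAt (fun y => fderiv ℝ F y v) ((fderiv ℝ (fderiv ℝ F) x).flip v) x := by
    intro v
    have := hd.hasFDerivAt.clm_apply (hasFDerivAt_const v x)
    refine this.congr_fderiv ?_
    ext w; simp
  rw [(h1 v).fderiv, (h1 w).fderiv]
  exact second_derivative_symmetric (f := F) (fun y => (hF.diff y).hasFDerivAt) hd.hasFDerivAt w v

theorem fderiv_dd {F : E n → ℂ} (hF : Sm F) (σ : ℂ) (j : Fin n) (x v : E n) :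
    fderiv ℝ (dd σ j F) x v = (fderiv ℝ (fun y => fderiv ℝ F y (Pi.single j 1)) x v +
      σ * fderiv ℝ (fun y => fderiv ℝ F y (Pi.single j Complex.I)) x v) / 2 := by
  have h1 := ((sm_fderiv hF (Pi.single j 1)).diff x).hasFDerivAt
  have h2 := ((sm_fderiv hF (Pi.single j Complex.I)).diff x).hasFDerivAt
  have := (h1.add (h2.const_mul σ)).mul_const ((2:ℂ)⁻¹)
  have e : dd σ j F = fun y => (fderiv ℝ F y (Pi.single j 1) + σ * fderiv ℝ F y (Pi.single j Complex.I)) * (2:ℂ)⁻¹ := by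
    ext y; simp [dd, div_eq_mul_inv]
  rw [e]
  erw [this.fderiv]
  simp; ring

theorem dd_comm {F : E n → ℂ} (hF : Sm F) (σ τ : ℂ) (j k : Fin n) (x : E n) :
    dd σ j (dd τ k F) x = dd τ k (dd σ j F) x := by
  conv_lhs => unfold dd
  conv_rhs => unfold dd
  simp only [← dd.eq_def]
  change (fderiv ℝ (dd τ k F) x _ + σ * fderiv ℝ (dd τ k F) x _) / 2 =
    (fderiv ℝ (dd σ j F) x _ + τ * fderiv ℝ (dd σ j F) x _) / 2
  simp only [fderiv_dd hF]
  rw [fderiv_comm hF (Pi.single k 1) (Pi.single j 1), fderiv_comm hF (Pi.single k Complex.I) (Pi.single j 1),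
    fderiv_comm hF (Pi.single k 1) (Pi.single j Complex.I), fderiv_comm hF (Pi.single k Complex.I) (Pi.single j Complex.I)]
  ring

theorem dd_mul {F G : E n → ℂ} (hF : Differentiable ℝ F) (hG : Differentiable ℝ G) (σ : ℂ) (j : Fin n) (x : E n) :
    dd σ j (fun y => F y * G y) x = dd σ j F x * G x + F x * dd σ j G x := by
  unfold dd
  rw [((hF x).hasFDerivAt.fun_mul (hG x).hasFDerivAt).fderiv]
  simp; ring

theorem dd_sum {ι : Type*} (s : Finset ι) {F : ι → E n → ℂ} (hF : ∀ i, Differentiable ℝ (F i)) (σ : ℂ) (j : Fin n) (x : E n) :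
    dd σ j (fun y => ∑ i ∈ s, F i y) x = ∑ i ∈ s, dd σ j (F i) x := by
  unfold dd
  rw [(HasFDerivAt.fun_sum fun i _ => (hF i x).hasFDerivAt).fderiv]
  simp [Finset.mul_sum]
  rw [← Finset.sum_add_distrib, Finset.sum_div]

theorem dd_det {M : E n → Matrix (Fin n) (Fin n) ℂ} (hM : ∀ i j, Differentiable ℝ (fun x => M x i j))
    (σ : ℂ) (j : Fin n) (x : E n) :
    dd σ j (fun y => (M y).det) x = ∑ l, ∑ m, (M x).adjugate m l * dd σ j (fun y => M y l m) x := by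
  unfold dd
  rw [(hasFDerivAt_det fun i j => (hM i j x).hasFDerivAt).fderiv]
  simp [Finset.mul_sum, ← Finset.sum_add_distrib, Finset.sum_div]
  refine Finset.sum_congr rfl fun _ _ => Finset.sum_congr rfl fun _ _ => by ring

theorem sm_det {M : E n → Matrix (Fin n) (Fin n) ℂ} (hM : ∀ i j, Sm (fun x => M x i j)) :
    Sm (fun y => (M y).det) := by
  simp only [det_apply]
  refine ContDiff.sum fun σ _ => ?_
  exact (contDiff_prod fun i _ => hM _ _).const_smul _

theorem sm_updateRow {M : E n → Matrix (Fin n) (Fin n) ℂ} (hM : ∀ i j, Sm (fun x => M x i j))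
    (j : Fin n) (v : Fin n → ℂ) (a b : Fin n) : Sm (fun x => (M x).updateRow j v a b) := by
  simp only [updateRow_apply]
  split_ifs
  · exact contDiff_const
  · exact hM _ _

theorem sm_adj {M : E n → Matrix (Fin n) (Fin n) ℂ} (hM : ∀ i j, Sm (fun x => M x i j)) (i j : Fin n) :
    Sm (fun y => (M y).adjugate i j) := by
  simp only [adjugate_apply]
  exact sm_det fun a b => sm_updateRow hM _ _ a b

theorem adj_antisymm (A : Matrix (Fin n) (Fin n) ℂ) {j l : Fin n} (hjl : l ≠ j) (k m : Fin n) :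
    (A.updateRow j (Pi.single k 1)).adjugate m l = - (A.updateRow j (Pi.single m 1)).adjugate k l := by
  rw [adjugate_apply, adjugate_apply]
  set N := (A.updateRow j (Pi.single m 1)).updateRow l (Pi.single k 1) with hN
  have : (A.updateRow j (Pi.single k 1)).updateRow l (Pi.single m 1) = N.submatrix (Equiv.swap j l) id := by
    ext a b
    rw [hN]
    simp only [submatrix_apply, updateRow_apply, id]
    by_cases hal : a = l
    · subst hal
      simp [hjl.symm]
    · by_cases haj : a = j
      · subst haj; simp [hal]
      · rw [Equiv.swap_apply_of_ne_of_ne haj hal]; simp [hal, haj]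
  rw [this, det_permute, Equiv.Perm.sign_swap hjl.symm]
  simp

/-- Piola identity -/
theorem piola {G : Fin n → E n → ℂ} (hG : ∀ m, Sm (G m)) (σ τ : ℂ)
    (hsym : ∀ k m x, dd σ k (G m) x = dd σ m (G k) x) (j : Fin n) (x : E n) :
    ∑ k, dd σ k (fun y => (Matrix.of fun l m => dd τ l (G m) y).adjugate k j) x = 0 := by
  set h : E n → Matrix (Fin n) (Fin n) ℂ := fun y => Matrix.of fun l m => dd τ l (G m) y with hh
  have hsm : ∀ i j, Sm (fun x => h x i j) := fun i j => sm_dd (hG j) τ i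
  set T : Fin n → Fin n → Fin n → ℂ := fun l k m => dd σ k (fun y => h y l m) x with hT
  have Tsym : ∀ l k m, T l k m = T l m k := by
    intro l k m
    change dd σ k (dd τ l (G m)) x = dd σ m (dd τ l (G k)) x
    rw [dd_comm (hG m), dd_comm (hG k)]
    have : dd σ k (G m) = dd σ m (G k) := funext (hsym k m)
    rw [this]
  have e1 : ∀ k, dd σ k (fun y => (h y).adjugate k j) x =
      ∑ l ∈ Finset.univ.erase j, ∑ m, ((h x).updateRow j (Pi.single k 1)).adjugate m l * T l k m := by
    intro k
    simp only [adjugate_apply _ k j]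
    rw [dd_det (fun a b => (sm_updateRow hsm j _ a b).diff)]
    rw [← Finset.add_sum_erase _ _ (Finset.mem_univ j)]
    have z : ∑ m, ((h x).updateRow j (Pi.single k 1)).adjugate m j *
        dd σ k (fun y => (h y).updateRow j (Pi.single k 1) j m) x = 0 := by
      refine Finset.sum_eq_zero fun m _ => ?_
      simp [dd, updateRow_self]
    rw [z, zero_add]
    refine Finset.sum_congr rfl fun l hl => Finset.sum_congr rfl fun m _ => ?_
    have hlj := Finset.ne_of_mem_erase hl
    simp only [updateRow_ne hlj, hT]
  rw [Finset.sum_congr rfl fun k _ => e1 k, Finset.sum_comm]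
  refine Finset.sum_eq_zero fun l hl => ?_
  have hlj := Finset.ne_of_mem_erase hl
  have : ∑ k, ∑ m, ((h x).updateRow j (Pi.single k 1)).adjugate m l * T l k m =
      - ∑ k, ∑ m, ((h x).updateRow j (Pi.single k 1)).adjugate m l * T l k m := by
    conv_lhs => rw [Finset.sum_comm]
    rw [← Finset.sum_neg_distrib]
    refine Finset.sum_congr rfl fun k _ => ?_
    rw [← Finset.sum_neg_distrib]
    refine Finset.sum_congr rfl fun m _ => ?_
    rw [adj_antisymm _ hlj m k, Tsym]; ring
  exact self_eq_neg.1 this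

theorem integrable_cs {F : E n → ℂ} (hF : Continuous F) (hc : HasCompactSupport F) :
    Integrable F := hF.integrable_of_hasCompactSupport hc

theorem ibp_fderiv {F G : E n → ℂ} (hF : Sm F) (hG : Sm G) (hc : HasCompactSupport F) (v : E n) :
    ∫ x, F x * fderiv ℝ G x v = - ∫ x, fderiv ℝ F x v * G x := by
  have hcf : HasCompactSupport (fun x => fderiv ℝ F x v) := hc.fderiv_apply ℝ v
  exact integral_mul_fderiv_eq_neg_fderiv_mul_of_integrable
    (integrable_cs ((sm_fderiv hF v).continuous.mul hG.continuous) (hcf.mul_right))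
    (integrable_cs (hF.continuous.mul (sm_fderiv hG v).continuous) (hc.mul_right))
    (integrable_cs (hF.continuous.mul hG.continuous) (hc.mul_right))
    (fun x _ => hF.diff x) (fun x _ => hG.diff x)

theorem hcs_dd {F : E n → ℂ} (hc : HasCompactSupport F) (σ : ℂ) (j : Fin n) : HasCompactSupport (dd σ j F) := by
  have h1 := hc.fderiv_apply ℝ (Pi.single j 1 : E n)
  have h2 := hc.fderiv_apply ℝ (Pi.single j Complex.I : E n)
  have h3 : HasCompactSupport (fun x => (2⁻¹ : ℂ) * (fderiv ℝ F x (Pi.single j 1) + σ * fderiv ℝ F x (Pi.single j Complex.I))) :=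
    (h1.add (h2.mul_left (f := fun _ => σ))).mul_left (f := fun _ => (2⁻¹ : ℂ))
  have e : dd σ j F = fun x => (2⁻¹ : ℂ) * (fderiv ℝ F x (Pi.single j 1) + σ * fderiv ℝ F x (Pi.single j Complex.I)) := by
    ext x; simp [dd]; ring
  rw [e]; exact h3

theorem ibp_dd {F G : E n → ℂ} (hF : Sm F) (hG : Sm G) (hc : HasCompactSupport F) (σ : ℂ) (j : Fin n) :
    ∫ x, F x * dd σ j G x = - ∫ x, dd σ j F x * G x := by
  have i1 := ibp_fderiv hF hG hc (Pi.single j 1)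
  have i2 := ibp_fderiv hF hG hc (Pi.single j Complex.I)
  have c1 : Integrable fun x => F x * fderiv ℝ G x (Pi.single j 1) :=
    integrable_cs (hF.continuous.mul (sm_fderiv hG _).continuous) (hc.mul_right)
  have c2 : Integrable fun x => F x * fderiv ℝ G x (Pi.single j Complex.I) :=
    integrable_cs (hF.continuous.mul (sm_fderiv hG _).continuous) (hc.mul_right)
  have c3 : Integrable fun x => fderiv ℝ F x (Pi.single j 1) * G x :=
    integrable_cs ((sm_fderiv hF _).continuous.mul hG.continuous) ((hc.fderiv_apply ℝ _).mul_right)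
  have c4 : Integrable fun x => fderiv ℝ F x (Pi.single j Complex.I) * G x :=
    integrable_cs ((sm_fderiv hF _).continuous.mul hG.continuous) ((hc.fderiv_apply ℝ _).mul_right)
  have e1 : ∀ x, F x * dd σ j G x = (F x * fderiv ℝ G x (Pi.single j 1)) * 2⁻¹ +
      (F x * fderiv ℝ G x (Pi.single j Complex.I)) * (σ * 2⁻¹) := by intro x; unfold dd; ring
  have e2 : ∀ x, dd σ j F x * G x = (fderiv ℝ F x (Pi.single j 1) * G x) * 2⁻¹ +
      (fderiv ℝ F x (Pi.single j Complex.I) * G x) * (σ * 2⁻¹) := by intro x; unfold dd; ring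
  simp only [e1, e2]
  rw [integral_add (c1.mul_const _) (c2.mul_const _), integral_add (c3.mul_const _) (c4.mul_const _),
    integral_mul_const, integral_mul_const, integral_mul_const, integral_mul_const, i1, i2]
  ring

/-- complex Hessian matrix of smooth function via dd -/
noncomputable def hs (u : E n → ℂ) (x : E n) : Matrix (Fin n) (Fin n) ℂ :=
  Matrix.of fun l m => dd (-Complex.I) l (dd Complex.I m u) x

/-- first divergence formula -/
theorem div1 {u w ψ : E n → ℂ} (hu : Sm u) (hw : Sm w) (hψ : Sm ψ) (hc : HasCompactSupport ψ) :
    ∫ x, ψ x * ((hs u x).adjugate * hs w x).trace =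
      - ∫ x, ∑ k, ∑ j, (hs u x).adjugate k j * dd (-Complex.I) j w x * dd Complex.I k ψ x := by
  have hsm : ∀ i j, Sm (fun x => hs u x i j) := fun i j => sm_dd (sm_dd hu _ j) _ i
  set X : Fin n → E n → ℂ := fun k x => ∑ j, (hs u x).adjugate k j * dd (-Complex.I) j w x with hX
  have Xsm : ∀ k, Sm (X k) := fun k => ContDiff.sum fun j _ => (sm_adj hsm k j).mul (sm_dd hw _ j)
  have hdiv : ∀ x, ((hs u x).adjugate * hs w x).trace = ∑ k, dd Complex.I k (X k) x := by
    intro x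
    have e : ∀ k, dd Complex.I k (X k) x = ∑ j, (dd Complex.I k (fun y => (hs u y).adjugate k j) x *
        dd (-Complex.I) j w x + (hs u x).adjugate k j * dd Complex.I k (dd (-Complex.I) j w) x) := by
      intro k
      rw [hX]
      rw [dd_sum _ (fun j => (sm_adj hsm k j).diff.fun_mul (sm_dd hw _ j).diff)]
      refine Finset.sum_congr rfl fun j _ => dd_mul (sm_adj hsm k j).diff (sm_dd hw _ j).diff _ _ _
    simp only [e, Finset.sum_add_distrib]
    have z : ∑ k, ∑ j, dd Complex.I k (fun y => (hs u y).adjugate k j) x * dd (-Complex.I) j w x = 0 := by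
      rw [Finset.sum_comm]
      refine Finset.sum_eq_zero fun j _ => ?_
      rw [← Finset.sum_mul]
      have := piola (G := fun m => dd Complex.I m u) (fun m => sm_dd hu _ m) Complex.I (-Complex.I)
        (fun k m x => dd_comm hu _ _ _ _ _) j x
      change (∑ k, dd Complex.I k (fun y => (hs u y).adjugate k j) x) * _ = 0
      erw [this]; rw [zero_mul]
    rw [z, zero_add, trace]
    simp only [diag, mul_apply]
    refine Finset.sum_congr rfl fun k _ => Finset.sum_congr rfl fun j _ => ?_
    rw [dd_comm hw]; rfl
  simp only [hdiv, Finset.mul_sum]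
  have i1 : ∀ k ∈ (Finset.univ : Finset (Fin n)), Integrable (fun x => ψ x * dd Complex.I k (X k) x) := fun k _ =>
    integrable_cs (hψ.continuous.mul (sm_dd (Xsm k) _ _).continuous) hc.mul_right
  rw [integral_finset_sum _ i1, integral_finset_sum]
  · rw [← Finset.sum_neg_distrib]
    refine Finset.sum_congr rfl fun k _ => ?_
    rw [ibp_dd hψ (Xsm k) hc]
    congr 2; ext x; rw [mul_comm, hX, Finset.sum_mul]
  · intro k _
    refine (integrable_cs ((Xsm k).continuous.mul (sm_dd hψ Complex.I k).continuous) (hcs_dd hc _ _).mul_left).congr ?_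
    refine Filter.Eventually.of_forall fun x => ?_
    simp only [hX, Pi.mul_apply, Finset.sum_mul]

/-- real bilinear forms -/
abbrev Bil (n : ℕ) := E n →L[ℝ] E n →L[ℝ] ℝ

variable {n : ℕ}

/-- second derivative -/
noncomputable def D2 (u : E n → ℝ) (x : E n) : Bil n := fderiv ℝ (fderiv ℝ u) x

/-- complex Hessian part of a bilinear form -/
noncomputable def hC (S : Bil n) : Matrix (Fin n) (Fin n) ℂ :=
  Matrix.of fun j k =>
    (((S (Pi.single j 1) (Pi.single k 1) + S (Pi.single j Complex.I) (Pi.single k Complex.I)) / 4 : ℝ) : ℂ)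
      + Complex.I * (((S (Pi.single j 1) (Pi.single k Complex.I)
          - S (Pi.single j Complex.I) (Pi.single k 1)) / 4 : ℝ) : ℂ)

theorem hC_apply (S : Bil n) (j k : Fin n) : hC S j k =
    (((S (Pi.single j 1) (Pi.single k 1) + S (Pi.single j Complex.I) (Pi.single k Complex.I)) / 4 : ℝ) : ℂ)
      + Complex.I * (((S (Pi.single j 1) (Pi.single k Complex.I)
          - S (Pi.single j Complex.I) (Pi.single k 1)) / 4 : ℝ) : ℂ) := rfl

theorem hC_add (S T : Bil n) : hC (S + T) = hC S + hC T := by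
  ext j k; simp only [hC_apply, _root_.add_apply, Matrix.add_apply]; push_cast; ring

theorem hC_smul (c : ℝ) (S : Bil n) : hC (c • S) = (c : ℂ) • hC S := by
  ext j k; simp only [hC_apply, _root_.smul_apply, Matrix.smul_apply, smul_eq_mul]; push_cast; ring

theorem hC_sub (S T : Bil n) : hC (S - T) = hC S - hC T := by
  ext j k; simp only [hC_apply, _root_.sub_apply, Matrix.sub_apply]; push_cast; ring

theorem hC_zero : hC (0 : Bil n) = 0 := by
  ext j k; simp only [hC_apply, _root_.zero_apply, Matrix.zero_apply]; push_cast; ring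

theorem norm_single_le (j : Fin n) {z : ℂ} (hz : ‖z‖ ≤ 1) : ‖(Pi.single j z : E n)‖ ≤ 1 := by
  rw [Pi.norm_single]; exact hz

theorem bil_le {S : Bil n} {K : ℝ} (hS : ‖S‖ ≤ K) {v w : E n} (hv : ‖v‖ ≤ 1) (hw : ‖w‖ ≤ 1) : |S v w| ≤ K := by
  have := S.le_opNorm₂ v w
  rw [Real.norm_eq_abs] at this
  have hK : 0 ≤ K := le_trans (norm_nonneg S) hS
  calc |S v w| ≤ ‖S‖ * ‖v‖ * ‖w‖ := this
    _ ≤ K * 1 * 1 := by gcongr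
    _ = K := by ring

theorem hC_norm_le {S : Bil n} {K : ℝ} (hS : ‖S‖ ≤ K) (j k : Fin n) : ‖hC S j k‖ ≤ K := by
  have h1 : ∀ j, ‖(Pi.single j 1 : E n)‖ ≤ 1 := fun j => norm_single_le j (by simp)
  have h2 : ∀ j, ‖(Pi.single j Complex.I : E n)‖ ≤ 1 := fun j => norm_single_le j (by simp)
  have a := abs_le.1 (bil_le hS (h1 j) (h1 k))
  have b := abs_le.1 (bil_le hS (h2 j) (h2 k))
  have c := abs_le.1 (bil_le hS (h1 j) (h2 k))
  have d := abs_le.1 (bil_le hS (h2 j) (h1 k))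
  rw [hC_apply]
  refine (norm_add_le _ _).trans ?_
  rw [norm_mul, Complex.norm_I, one_mul, Complex.norm_real, Complex.norm_real, Real.norm_eq_abs, Real.norm_eq_abs]
  have e1 : |(S (Pi.single j 1) (Pi.single k 1) + S (Pi.single j Complex.I) (Pi.single k Complex.I)) / 4| ≤ K / 2 :=
    abs_le.2 ⟨by linarith, by linarith⟩
  have e2 : |(S (Pi.single j 1) (Pi.single k Complex.I) - S (Pi.single j Complex.I) (Pi.single k 1)) / 4| ≤ K / 2 :=
    abs_le.2 ⟨by linarith, by linarith⟩
  linarith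

theorem hC_herm {S : Bil n} (hS : ∀ v w, S v w = S w v) : (hC S).IsHermitian := by
  ext j k
  rw [conjTranspose_apply, hC_apply, hC_apply]
  simp only [RCLike.star_def, map_add, map_mul, Complex.conj_ofReal, Complex.conj_I]
  rw [hS (Pi.single k 1) (Pi.single j 1), hS (Pi.single k Complex.I) (Pi.single j Complex.I),
    hS (Pi.single k 1) (Pi.single j Complex.I), hS (Pi.single k Complex.I) (Pi.single j 1)]
  push_cast; ring

theorem vec_decomp (c : E n) : c = ∑ j, ((c j).re • (Pi.single j 1 : E n) + (c j).im • (Pi.single j Complex.I : E n)) := by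
  ext i
  simp only [Finset.sum_apply, Pi.add_apply, Pi.smul_apply, Pi.single_apply]
  rw [Finset.sum_eq_single i]
  · simp [Complex.re_add_im]
  · intro j _ hj; simp [hj.symm]
  · simp

/-- multiplication by I decomposition -/
theorem vec_decompI (c : E n) : (Complex.I • c : E n) = ∑ j, ((-(c j).im) • (Pi.single j 1 : E n) + (c j).re • (Pi.single j Complex.I : E n)) := by
  rw [vec_decomp (Complex.I • c)]
  refine Finset.sum_congr rfl fun j _ => ?_
  simp

theorem qf_hC {S : Bil n} (hS : ∀ v w, S v w = S w v) (c : E n) :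
    qf (hC S) (star c) = (S c c + S (Complex.I • c) (Complex.I • c)) / 4 := by
  have e1 : S c c = ∑ j, ∑ k, ((c j).re * (c k).re * S (Pi.single j 1) (Pi.single k 1) +
      (c j).re * (c k).im * S (Pi.single j 1) (Pi.single k Complex.I) +
      (c j).im * (c k).re * S (Pi.single j Complex.I) (Pi.single k 1) +
      (c j).im * (c k).im * S (Pi.single j Complex.I) (Pi.single k Complex.I)) := by
    conv_lhs => rw [vec_decomp c]
    simp only [map_sum, map_add, map_smul, _root_.sum_apply, _root_.add_apply, _root_.smul_apply, smul_eq_mul]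
    refine Finset.sum_congr rfl fun j _ => ?_
    rw [Finset.mul_sum, Finset.mul_sum, ← Finset.sum_add_distrib]
    refine Finset.sum_congr rfl fun k _ => ?_
    rw [hS (Pi.single k 1) (Pi.single j 1), hS (Pi.single k Complex.I) (Pi.single j Complex.I),
      hS (Pi.single k 1) (Pi.single j Complex.I), hS (Pi.single k Complex.I) (Pi.single j 1)]
    ring
  have e2 : S (Complex.I • c) (Complex.I • c) = ∑ j, ∑ k, ((c j).im * (c k).im * S (Pi.single j 1) (Pi.single k 1) -
      (c j).im * (c k).re * S (Pi.single j 1) (Pi.single k Complex.I) -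
      (c j).re * (c k).im * S (Pi.single j Complex.I) (Pi.single k 1) +
      (c j).re * (c k).re * S (Pi.single j Complex.I) (Pi.single k Complex.I)) := by
    conv_lhs => rw [vec_decompI c]
    simp only [map_sum, map_add, map_smul, _root_.sum_apply, _root_.add_apply, _root_.smul_apply, smul_eq_mul]
    refine Finset.sum_congr rfl fun j _ => ?_
    rw [Finset.mul_sum, Finset.mul_sum, ← Finset.sum_add_distrib]
    refine Finset.sum_congr rfl fun k _ => ?_
    rw [hS (Pi.single k 1) (Pi.single j 1), hS (Pi.single k Complex.I) (Pi.single j Complex.I),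
      hS (Pi.single k 1) (Pi.single j Complex.I), hS (Pi.single k Complex.I) (Pi.single j 1)]
    ring
  rw [e1, e2, ← Finset.sum_add_distrib, Finset.sum_div]
  unfold qf
  simp only [dotProduct, mulVec, Complex.re_sum, star_star]
  refine Finset.sum_congr rfl fun j _ => ?_
  rw [← Finset.sum_add_distrib, Finset.sum_div, Finset.mul_sum, Complex.re_sum]
  refine Finset.sum_congr rfl fun k _ => ?_
  rw [hC_apply]
  simp [Pi.star_apply]
  ring

/-- L^B S -/
noncomputable def LB (B : Matrix (Fin n) (Fin n) ℂ) (S : Bil n) : ℝ := (B * hC S).trace.re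

theorem LB_add (B) (S T : Bil n) : LB B (S + T) = LB B S + LB B T := by
  unfold LB; rw [hC_add, mul_add, trace_add, Complex.add_re]
theorem LB_smul (B) (c : ℝ) (S : Bil n) : LB B (c • S) = c * LB B S := by
  unfold LB; rw [hC_smul, mul_smul_comm, trace_smul]; simp

theorem trace_bd {B A : Matrix (Fin n) (Fin n) ℂ} {b a : ℝ} (hB : ∀ i j, ‖B i j‖ ≤ b)
    (hA : ∀ i j, ‖A i j‖ ≤ a) (hb : 0 ≤ b) : |(B * A).trace.re| ≤ n * n * b * a := by
  refine (Complex.abs_re_le_norm _).trans ?_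
  simp only [trace, diag, mul_apply]
  calc ‖∑ i, ∑ j, B i j * A j i‖ ≤ ∑ i : Fin n, ∑ j : Fin n, b * a := by
        refine (norm_sum_le _ _).trans (Finset.sum_le_sum fun i _ => ?_)
        refine (norm_sum_le _ _).trans (Finset.sum_le_sum fun j _ => ?_)
        rw [norm_mul]; exact mul_le_mul (hB i j) (hA j i) (norm_nonneg _) hb
    _ = _ := by simp; ring

theorem LB_bd {B : Matrix (Fin n) (Fin n) ℂ} {b : ℝ} (hb : 0 ≤ b) (hB : ∀ i j, ‖B i j‖ ≤ b) (S : Bil n) :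
    |LB B S| ≤ n * n * b * ‖S‖ :=
  trace_bd hB (fun i j => hC_norm_le le_rfl i j) hb

/-- tensor square -/
noncomputable def tp (p q : E n →L[ℝ] ℝ) : Bil n := ContinuousLinearMap.smulRight p q

theorem tp_apply (p q : E n →L[ℝ] ℝ) (v w : E n) : tp p q v w = p v * q w := by
  simp [tp]

theorem LB_tp (B : Matrix (Fin n) (Fin n) ℂ) (p : E n →L[ℝ] ℝ) :
    LB B (tp p p) = qf B (fun j => ((p (Pi.single j 1) : ℂ) - Complex.I * p (Pi.single j Complex.I)) / 2) := by
  unfold LB qf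
  have : hC (tp p p) = vecMulVec (fun j => ((p (Pi.single j 1) : ℂ) - Complex.I * p (Pi.single j Complex.I)) / 2)
      (star (fun j => ((p (Pi.single j 1) : ℂ) - Complex.I * p (Pi.single j Complex.I)) / 2)) := by
    ext j k
    rw [hC_apply, vecMulVec_apply]
    simp only [tp_apply, Pi.star_apply, RCLike.star_def, map_div₀, map_sub, map_mul, Complex.conj_ofReal, Complex.conj_I]
    have h2 : (starRingEnd ℂ) 2 = 2 := Complex.conj_ofNat 2
    rw [h2]
    push_cast
    ring_nf
    rw [Complex.I_sq]; ring
  rw [this, mul_vecMulVec, trace_vecMulVec, dotProduct_comm]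

/-- ellipticity in terms of covectors -/
theorem LB_ell {B : Matrix (Fin n) (Fin n) ℂ} {l : ℝ} (hl : 0 ≤ l) (hB : Ell l B) (p : E n →L[ℝ] ℝ) :
    l / (16 * (n + 1) ^ 2) * ‖p‖ ^ 2 ≤ LB B (tp p p) := by
  rw [LB_tp]
  refine le_trans ?_ (hB.2 _)
  set c : E n := (fun j => ((p (Pi.single j 1) : ℂ) - Complex.I * p (Pi.single j Complex.I)) / 2) with hc
  have hnorm : ∀ j, |p (Pi.single j 1)| ≤ 2 * ‖c j‖ ∧ |p (Pi.single j Complex.I)| ≤ 2 * ‖c j‖ := by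
    intro j
    have h1 := Complex.abs_re_le_norm (c j)
    have h2 := Complex.abs_im_le_norm (c j)
    have e1 : (c j).re = p (Pi.single j 1) / 2 := by simp [hc]
    have e2 : (c j).im = - p (Pi.single j Complex.I) / 2 := by simp [hc]
    rw [e1, abs_div, abs_two] at h1
    rw [e2, abs_div, abs_two, abs_neg] at h2
    constructor <;> linarith
  have hp : ‖p‖ ≤ ∑ j, 4 * ‖c j‖ := by
    refine p.opNorm_le_bound (by positivity) fun v => ?_
    conv_lhs => rw [vec_decomp v]
    rw [map_sum, Finset.sum_mul]
    refine (norm_sum_le _ _).trans (Finset.sum_le_sum fun j _ => ?_)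
    rw [map_add, map_smul, map_smul]
    refine (norm_add_le _ _).trans ?_
    rw [norm_smul, norm_smul, Real.norm_eq_abs, Real.norm_eq_abs, Real.norm_eq_abs, Real.norm_eq_abs]
    have a1 := (Complex.abs_re_le_norm (v j)).trans (norm_le_pi_norm v j)
    have a2 := (Complex.abs_im_le_norm (v j)).trans (norm_le_pi_norm v j)
    have := hnorm j
    calc _ ≤ ‖v‖ * (2 * ‖c j‖) + ‖v‖ * (2 * ‖c j‖) := by
          gcongr; exacts [this.1, this.2]
      _ = _ := by ring
  have h2 : (∑ j, ‖c j‖) ^ 2 ≤ n * ∑ j, ‖c j‖ ^ 2 := by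
    have := sq_sum_le_card_mul_sum_sq (s := (Finset.univ : Finset (Fin n))) (f := fun i => ‖c i‖)
    simpa using this
  have h3 : ‖p‖ ^ 2 ≤ 16 * (n * ∑ j, ‖c j‖ ^ 2) := by
    rw [← Finset.mul_sum] at hp
    calc ‖p‖ ^ 2 ≤ (4 * ∑ j, ‖c j‖) ^ 2 := by gcongr
      _ = 16 * (∑ j, ‖c j‖) ^ 2 := by ring
      _ ≤ _ := by gcongr
  rw [div_mul_eq_mul_div, div_le_iff₀ (by positivity)]
  have h0 : 0 ≤ ∑ j, ‖c j‖ ^ 2 := by positivity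
  calc l * ‖p‖ ^ 2 ≤ l * (16 * (n * ∑ j, ‖c j‖ ^ 2)) := by gcongr
    _ ≤ l * (16 * ((n+1)^2 * ∑ j, ‖c j‖ ^ 2)) := by
        gcongr
        nlinarith
    _ = _ := by ring

end CMA

namespace CMA
open MeasureTheory Filter Topology
open scoped ComplexOrder Matrix

section LL
variable {n : ℕ} {F : Type*} [NormedAddCommGroup F] [NormedSpace ℝ F] [FiniteDimensional ℝ F]

theorem ll_ball {v : E n → F} (hv : LocallyLipschitz v) (R : ℝ) :
    ∃ K : NNReal, LipschitzOnWith K v (Metric.closedBall 0 R) :=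
  LocallyLipschitzOn.exists_lipschitzOnWith_of_compact (isCompact_closedBall _ _) hv.locallyLipschitzOn

theorem ll_ae {v : E n → F} (hv : LocallyLipschitz v) : ∀ᵐ x, DifferentiableAt ℝ v x := by
  have h : ∀ k : ℕ, ∀ᵐ x, x ∈ Metric.ball (0 : E n) k → DifferentiableAt ℝ v x := by
    intro k
    obtain ⟨K, hK⟩ := ll_ball hv k
    have := (hK.mono Metric.ball_subset_closedBall).ae_differentiableWithinAt (μ := volume) Metric.isOpen_ball.measurableSet
    rw [ae_restrict_iff' Metric.isOpen_ball.measurableSet] at this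
    filter_upwards [this] with x hx hxk
    exact (hx hxk).differentiableAt (Metric.isOpen_ball.mem_nhds hxk)
  filter_upwards [ae_all_iff.2 h] with x hx
  obtain ⟨k, hk⟩ := exists_nat_gt ‖x‖
  exact hx k (by simpa using hk)

theorem ll_fderiv_bd {v : E n → F} (hv : LocallyLipschitz v) (R : ℝ) :
    ∃ K : ℝ, 0 ≤ K ∧ ∀ x, ‖x‖ ≤ R → ‖fderiv ℝ v x‖ ≤ K := by
  obtain ⟨K, hK⟩ := ll_ball hv (R + 1)
  refine ⟨K, K.2, fun x hx => norm_fderiv_le_of_lipschitzOn ℝ ?_ hK⟩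
  refine Filter.mem_of_superset (Metric.ball_mem_nhds x one_pos) fun y hy => ?_
  have h1 : dist y x < 1 := hy
  rw [dist_eq_norm] at h1
  rw [mem_closedBall_zero_iff]
  calc ‖y‖ = ‖(y - x) + x‖ := by simp
    _ ≤ ‖y - x‖ + ‖x‖ := norm_add_le _ _
    _ ≤ R + 1 := by linarith

/-- locally bounded measurable -/
structure LBM (v : E n → F) : Prop where
  meas : AEStronglyMeasurable v volume
  bd : ∀ R, ∃ K : ℝ, 0 ≤ K ∧ ∀ x, ‖x‖ ≤ R → ‖v x‖ ≤ K

theorem lbm_cont {v : E n → F} (hv : Continuous v) : LBM v := by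
  refine ⟨hv.aestronglyMeasurable, fun R => ?_⟩
  obtain ⟨K, hK⟩ := (isCompact_closedBall (0 : E n) R).exists_bound_of_continuousOn hv.continuousOn
  exact ⟨max K 0, le_max_right _ _, fun x hx => (hK x (by simpa using hx)).trans (le_max_left _ _)⟩

theorem lbm_fderiv {v : E n → F} (hv : LocallyLipschitz v) : LBM (fderiv ℝ v) := by
  refine ⟨?_, ll_fderiv_bd hv⟩
  borelize F
  exact (measurable_fderiv ℝ v).aestronglyMeasurable

theorem LBM.locInt {v : E n → F} (hv : LBM v) : LocallyIntegrable v volume := by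
  rw [locallyIntegrable_iff]
  intro k hk
  obtain ⟨R, hR⟩ := hk.isBounded.subset_closedBall 0
  obtain ⟨K, -, hK⟩ := hv.bd R
  refine Measure.integrableOn_of_bounded (M := K) hk.measure_lt_top.ne hv.meas ?_
  filter_upwards [ae_restrict_mem hk.measurableSet] with x hx
  exact hK x (by simpa using hR hx)

theorem cs_ball {k : E n → ℝ} (hk : HasCompactSupport k) : ∃ R : ℝ, 0 < R ∧ ∀ x, k x ≠ 0 → ‖x‖ ≤ R := by
  obtain ⟨R, hR⟩ := hk.isCompact.isBounded.subset_closedBall 0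
  exact ⟨max R 1, by positivity, fun x hx => by
    have := hR (subset_tsupport _ hx)
    rw [mem_closedBall_zero_iff] at this; exact this.trans (le_max_left _ _)⟩

/-- integrability of cutoff times loc bounded -/
theorem LBM.int_smul {v : E n → F} (hv : LBM v) {k : E n → ℝ} (hk : Continuous k) (hc : HasCompactSupport k) :
    Integrable (fun x => k x • v x) volume :=
  hv.locInt.integrable_smul_left_of_hasCompactSupport hk hc

/-- mollification -/
noncomputable def mol (k : E n → ℝ) (v : E n → F) (x : E n) : F := ∫ t, k t • v (x - t)

theorem LBM.shift {v : E n → F} (hv : LBM v) (x : E n) : LBM (fun t => v (x - t)) := by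
  constructor
  · exact hv.meas.comp_quasiMeasurePreserving (quasiMeasurePreserving_sub_left volume x)
  · intro R
    obtain ⟨K, h0, hK⟩ := hv.bd (‖x‖ + R)
    exact ⟨K, h0, fun t ht => hK _ ((norm_sub_le _ _).trans (by linarith))⟩

theorem mol_int {v : E n → F} (hv : LBM v) {k : E n → ℝ} (hk : Continuous k) (hc : HasCompactSupport k) (x : E n) :
    Integrable (fun t => k t • v (x - t)) volume :=
  (hv.shift x).int_smul hk hc

theorem mol_hasFDerivAt {v : E n → F} (hv : LocallyLipschitz v) {k : E n → ℝ} (hk : Continuous k)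
    (hc : HasCompactSupport k) (x : E n) : HasFDerivAt (mol k v) (mol k (fderiv ℝ v) x) x := by
  obtain ⟨R, hR0, hR⟩ := cs_ball hc
  obtain ⟨K, hK⟩ := ll_ball hv (‖x‖ + 1 + R)
  have hcv := hv.continuous
  have hm : AEStronglyMeasurable (fun t => k t • fderiv ℝ v (x - t)) volume :=
    (mol_int (lbm_fderiv hv) hk hc x).aestronglyMeasurable
  refine (hasFDerivAt_integral_of_dominated_loc_of_lip (F := fun x t => k t • v (x - t))
    (bound := fun t => |k t| * K) (s := Metric.ball x 1) (Metric.ball_mem_nhds x one_pos) ?_ ?_ hm ?_ ?_ ?_).2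
  · exact Eventually.of_forall fun y => (mol_int (lbm_cont hcv) hk hc y).aestronglyMeasurable
  · exact mol_int (lbm_cont hcv) hk hc x
  · refine Eventually.of_forall fun t => ?_
    by_cases ht : k t = 0
    · simp only [ht, zero_smul]
      exact (LipschitzWith.const (0:F)).lipschitzOnWith.weaken bot_le
    · have htR := hR t ht
      refine LipschitzOnWith.of_dist_le_mul fun y hy z hz => ?_
      have hb : ∀ y ∈ Metric.ball x 1, y - t ∈ Metric.closedBall (0 : E n) (‖x‖ + 1 + R) := by
        intro y hy
        have h1 : ‖y - x‖ < 1 := by rw [← dist_eq_norm]; exact hy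
        rw [mem_closedBall_zero_iff]
        calc ‖y - t‖ = ‖(y - x) + x - t‖ := by simp
          _ ≤ ‖(y - x) + x‖ + ‖t‖ := norm_sub_le _ _
          _ ≤ ‖y - x‖ + ‖x‖ + ‖t‖ := by gcongr; exact norm_add_le _ _
          _ ≤ _ := by linarith
      have := hK.dist_le_mul _ (hb y hy) _ (hb z hz)
      rw [dist_sub_right] at this
      rw [dist_eq_norm, ← smul_sub, norm_smul, ← dist_eq_norm, Real.norm_eq_abs, Real.coe_nnabs, abs_mul, abs_abs,
        NNReal.abs_eq, mul_assoc]
      gcongr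
  · exact ((hk.abs).mul continuous_const).integrable_of_hasCompactSupport (by
      exact (hc.comp_left (g := fun s : ℝ => |s|) abs_zero).mul_right)
  · have := ll_ae hv
    have h2 : ∀ᵐ t, DifferentiableAt ℝ v (x - t) := (quasiMeasurePreserving_sub_left volume x).ae this
    filter_upwards [h2] with t ht
    have h3 : HasFDerivAt (fun y => v (y - t)) (fderiv ℝ v (x - t)) x := by
      exact (hasFDerivAt_comp_sub t).2 ht.hasFDerivAt
    exact h3.const_smul (k t)

theorem mol_contDiff {v : E n → F} (hv : LBM v) {k : E n → ℝ} (hk : ContDiff ℝ (⊤ : ℕ∞) k)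
    (hc : HasCompactSupport k) : ContDiff ℝ (⊤ : ℕ∞) (mol k v) :=
  hc.contDiff_convolution_left (n := ⊤) (ContinuousLinearMap.lsmul ℝ ℝ) hk hv.locInt

end LL

end CMA

namespace CMA
open MeasureTheory Filter Topology
open scoped ComplexOrder Matrix
variable {n : ℕ}

/-- C^{1,1}_loc functions on ℂⁿ -/
structure LC (u : E n → ℝ) : Prop where
  diff : Differentiable ℝ u
  lip : LocallyLipschitz (fderiv ℝ u)

section mollif
variable {F : Type*} [NormedAddCommGroup F] [NormedSpace ℝ F] [FiniteDimensional ℝ F]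

noncomputable def bmp (n k : ℕ) : ContDiffBump (0 : E n) where
  rIn := 1 / (2 * (k + 1))
  rOut := 1 / (k + 1)
  rIn_pos := by positivity
  rIn_lt_rOut := by
    apply one_div_lt_one_div_of_lt <;> nlinarith [(Nat.cast_nonneg k : (0:ℝ) ≤ k)]

noncomputable def kb (n k : ℕ) : E n → ℝ := (bmp n k).normed volume

theorem kb_nonneg (k : ℕ) (x : E n) : 0 ≤ kb n k x := (bmp n k).nonneg_normed x
theorem kb_smooth (k : ℕ) : ContDiff ℝ (⊤ : ℕ∞) (kb n k) := (bmp n k).contDiff_normed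
theorem kb_cs (k : ℕ) : HasCompactSupport (kb n k) := (bmp n k).hasCompactSupport_normed
theorem kb_int (k : ℕ) : ∫ x, kb n k x = 1 := (bmp n k).integral_normed
theorem kb_cont (k : ℕ) : Continuous (kb n k) := (kb_smooth k).continuous
theorem kb_integrable (k : ℕ) : Integrable (kb n k) := (kb_cont k).integrable_of_hasCompactSupport (kb_cs k)
theorem kb_supp (k : ℕ) {x : E n} (hx : kb n k x ≠ 0) : ‖x‖ ≤ 1 / (k + 1) := by
  have : x ∈ Function.support ((bmp n k).normed volume) := hx
  rw [ContDiffBump.support_normed_eq, mem_ball_zero_iff] at this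
  exact this.le
theorem kb_supp1 (k : ℕ) {x : E n} (hx : kb n k x ≠ 0) : ‖x‖ ≤ 1 := by
  refine (kb_supp k hx).trans ?_
  rw [div_le_one (by positivity)]; linarith [(Nat.cast_nonneg k : (0:ℝ) ≤ k)]

theorem mol_tendsto {v : E n → F} (hv : LBM v) : ∀ᵐ x, Tendsto (fun k => mol (kb n k) v x) atTop (𝓝 (v x)) := by
  have := FiniteDimensional.complete ℝ F
  refine ContDiffBump.ae_convolution_tendsto_right_of_locallyIntegrable (φ := fun k => bmp n k) (K := 2) ?_ ?_ hv.locInt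
  · exact tendsto_one_div_add_atTop_nhds_zero_nat
  · refine Eventually.of_forall fun k => ?_
    show (1:ℝ) / (k + 1) ≤ 2 * (1 / (2 * (k + 1)))
    have : (0:ℝ) < k + 1 := by positivity
    apply le_of_eq; field_simp

theorem mol_tendsto_cont {v : E n → F} (hv : Continuous v) (x : E n) : Tendsto (fun k => mol (kb n k) v x) atTop (𝓝 (v x)) := by
  have := FiniteDimensional.complete ℝ F
  refine ContDiffBump.convolution_tendsto_right_of_continuous (φ := fun k => bmp n k) ?_ hv x
  exact tendsto_one_div_add_atTop_nhds_zero_nat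

theorem mol_bd {v : E n → F} {K : ℝ} {x : E n} (hK : ∀ y, ‖y‖ ≤ ‖x‖ + 1 → ‖v y‖ ≤ K) (k : ℕ) :
    ‖mol (kb n k) v x‖ ≤ K := by
  have h := norm_integral_le_of_norm_le (f := fun t => kb n k t • v (x - t)) (g := fun t => kb n k t * K)
    (μ := volume) ((kb_integrable k).mul_const K) (Eventually.of_forall fun t => ?_)
  · rw [integral_mul_const, kb_int, one_mul] at h
    exact h
  · rw [norm_smul, Real.norm_eq_abs, abs_of_nonneg (kb_nonneg k t)]
    by_cases ht : kb n k t = 0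
    · simp [ht]
    · have := kb_supp1 k ht
      exact mul_le_mul_of_nonneg_left (hK _ ((norm_sub_le _ _).trans (by linarith))) (kb_nonneg k t)

end mollif

theorem LC.c1 {u : E n → ℝ} (h : LC u) : ContDiff ℝ 1 u := by
  rw [contDiff_one_iff_fderiv]; exact ⟨h.diff, h.lip.continuous⟩

theorem LC.cont {u : E n → ℝ} (h : LC u) : Continuous u := h.diff.continuous
theorem LC.contD {u : E n → ℝ} (h : LC u) : Continuous (fderiv ℝ u) := h.lip.continuous
theorem LC.ll {u : E n → ℝ} (h : LC u) : LocallyLipschitz u := h.c1.locallyLipschitz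
theorem LC.ae {u : E n → ℝ} (h : LC u) : ∀ᵐ x, DifferentiableAt ℝ (fderiv ℝ u) x := ll_ae h.lip
theorem LC.lbm {u : E n → ℝ} (h : LC u) : LBM (D2 u) := lbm_fderiv h.lip

theorem LC.of_c2 {u : E n → ℝ} (h : ContDiff ℝ 2 u) : LC u :=
  ⟨h.differentiable (by norm_num), (h.fderiv_right (m := 1) (by norm_num)).locallyLipschitz⟩

theorem D2_symm {u : E n → ℝ} (h : Differentiable ℝ u) {x : E n} (hx : DifferentiableAt ℝ (fderiv ℝ u) x) (v w : E n) :
    D2 u x v w = D2 u x w v :=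
  second_derivative_symmetric (fun y => (h y).hasFDerivAt) hx.hasFDerivAt v w

theorem D2_symm' {u : E n → ℝ} (h : Differentiable ℝ u) (x : E n) (v w : E n) :
    D2 u x v w = D2 u x w v := by
  by_cases hx : DifferentiableAt ℝ (fderiv ℝ u) x
  · exact D2_symm h hx v w
  · simp [D2, fderiv_zero_of_not_differentiableAt hx]

/-- mollifier derivatives -/
theorem mol_fderiv {u : E n → ℝ} (h : LC u) {k : E n → ℝ} (hk : Continuous k) (hc : HasCompactSupport k) :
    fderiv ℝ (mol k u) = mol k (fderiv ℝ u) :=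
  funext fun x => (mol_hasFDerivAt h.ll hk hc x).fderiv

theorem mol_D2 {u : E n → ℝ} (h : LC u) {k : E n → ℝ} (hk : Continuous k) (hc : HasCompactSupport k) (x : E n) :
    D2 (mol k u) x = mol k (D2 u) x := by
  unfold D2
  rw [mol_fderiv h hk hc]
  exact (mol_hasFDerivAt h.lip hk hc x).fderiv

/-! closure -/
section LLclos
variable {F : Type*} [NormedAddCommGroup F] [NormedSpace ℝ F]
theorem ll_add {f g : E n → F} (hf : LocallyLipschitz f) (hg : LocallyLipschitz g) : LocallyLipschitz (fun x => f x + g x) := by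
  have h : LocallyLipschitz (fun p : F × F => p.1 + p.2) := (contDiff_fst.add contDiff_snd : ContDiff ℝ 1 _).locallyLipschitz
  exact h.comp (hf.prodMk hg)
theorem ll_smul {f : E n → ℝ} {g : E n → F} (hf : LocallyLipschitz f) (hg : LocallyLipschitz g) : LocallyLipschitz (fun x => f x • g x) := by
  have h : LocallyLipschitz (fun p : ℝ × F => p.1 • p.2) := (contDiff_fst.smul contDiff_snd : ContDiff ℝ 1 _).locallyLipschitz
  exact h.comp (hf.prodMk hg)
end LLclos

theorem LC.add {u v : E n → ℝ} (hu : LC u) (hv : LC v) : LC (fun x => u x + v x) := by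
  refine ⟨hu.diff.add hv.diff, ?_⟩
  have : fderiv ℝ (fun x => u x + v x) = fun x => fderiv ℝ u x + fderiv ℝ v x := by
    ext1 x; exact fderiv_fun_add (hu.diff x) (hv.diff x)
  rw [this]; exact ll_add hu.lip hv.lip

theorem D2_add {u v : E n → ℝ} (hu : LC u) (hv : LC v) {x : E n} (hx : DifferentiableAt ℝ (fderiv ℝ u) x)
    (hy : DifferentiableAt ℝ (fderiv ℝ v) x) : D2 (fun x => u x + v x) x = D2 u x + D2 v x := by
  have : fderiv ℝ (fun x => u x + v x) = fun x => fderiv ℝ u x + fderiv ℝ v x := by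
    ext1 x; exact fderiv_fun_add (hu.diff x) (hv.diff x)
  unfold D2; rw [this]; exact fderiv_fun_add hx hy

theorem fderiv_mulf {u v : E n → ℝ} (hu : LC u) (hv : LC v) :
    fderiv ℝ (fun x => u x * v x) = fun x => u x • fderiv ℝ v x + v x • fderiv ℝ u x := by
  ext1 x; exact fderiv_fun_mul (hu.diff x) (hv.diff x)

theorem LC.mul {u v : E n → ℝ} (hu : LC u) (hv : LC v) : LC (fun x => u x * v x) := by
  refine ⟨hu.diff.mul hv.diff, ?_⟩
  rw [fderiv_mulf hu hv]; exact ll_add (ll_smul hu.ll hv.lip) (ll_smul hv.ll hu.lip)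

theorem LC.const (c : ℝ) : LC (fun _ : E n => c) := LC.of_c2 contDiff_const

theorem D2_const (c : ℝ) (x : E n) : D2 (fun _ : E n => c) x = 0 := by
  unfold D2
  have : fderiv ℝ (fun _ : E n => c) = fun _ => 0 := by ext1 y; simp
  rw [this]; simp

theorem LC.smul {u : E n → ℝ} (c : ℝ) (hu : LC u) : LC (fun x => c * u x) := (LC.const c).mul hu

theorem D2_smul {u : E n → ℝ} (c : ℝ) (hu : LC u) (x : E n) : D2 (fun x => c * u x) x = c • D2 u x := by
  unfold D2
  have : fderiv ℝ (fun x => c * u x) = fun x => c • fderiv ℝ u x := by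
    ext1 x; exact fderiv_const_mul (hu.diff x) c
  rw [this]
  exact congrFun (fderiv_const_smul_field (𝕜 := ℝ) (f := fderiv ℝ u) c) x

theorem LC.neg {u : E n → ℝ} (hu : LC u) : LC (fun x => - u x) := by simpa using hu.smul (-1)
theorem LC.sub {u v : E n → ℝ} (hu : LC u) (hv : LC v) : LC (fun x => u x - v x) := by
  simpa [sub_eq_add_neg] using hu.add hv.neg
theorem D2_sub {u v : E n → ℝ} (hu : LC u) (hv : LC v) {x : E n} (hx : DifferentiableAt ℝ (fderiv ℝ u) x)
    (hy : DifferentiableAt ℝ (fderiv ℝ v) x) : D2 (fun x => u x - v x) x = D2 u x - D2 v x := by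
  have : fderiv ℝ (fun x => u x - v x) = fun x => fderiv ℝ u x - fderiv ℝ v x := by
    ext1 x; exact fderiv_fun_sub (hu.diff x) (hv.diff x)
  unfold D2; rw [this]; exact fderiv_fun_sub hx hy

theorem fderiv_compf {G : ℝ → ℝ} {v : E n → ℝ} (hv : LC v) (hG : ∀ x, ContDiffAt ℝ 2 G (v x)) :
    fderiv ℝ (fun x => G (v x)) = fun x => deriv G (v x) • fderiv ℝ v x := by
  ext1 x
  have h1 := ((hG x).differentiableAt (by norm_num)).hasDerivAt
  exact (h1.comp_hasFDerivAt x (hv.diff x).hasFDerivAt).fderiv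

theorem cda_deriv {G : ℝ → ℝ} {t : ℝ} (hG : ContDiffAt ℝ 2 G t) : ContDiffAt ℝ 1 (deriv G) t := by
  have := hG.fderiv_right (m := 1) (by norm_num)
  have h2 : deriv G = fun s => fderiv ℝ G s 1 := by ext s; exact fderiv_apply_one_eq_deriv.symm
  rw [h2]
  exact this.clm_apply contDiffAt_const

theorem LC.comp {G : ℝ → ℝ} {v : E n → ℝ} (hv : LC v) (hG : ∀ x, ContDiffAt ℝ 2 G (v x)) :
    LC (fun x => G (v x)) := by
  refine ⟨fun x => ((hG x).differentiableAt (by norm_num)).comp x (hv.diff x), ?_⟩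
  rw [fderiv_compf hv hG]
  refine ll_smul ?_ hv.lip
  intro x
  obtain ⟨K, t, ht, hK⟩ := (cda_deriv (hG x)).exists_lipschitzOnWith
  obtain ⟨K2, s, hs, hK2⟩ := hv.ll x
  refine ⟨K * K2, s ∩ v ⁻¹' t, inter_mem hs (hv.cont.continuousAt ht), ?_⟩
  exact hK.comp (hK2.mono Set.inter_subset_left) (fun y hy => hy.2)

theorem D2_comp {G : ℝ → ℝ} {v : E n → ℝ} (hv : LC v) (hG : ∀ x, ContDiffAt ℝ 2 G (v x)) {x : E n}
    (hx : DifferentiableAt ℝ (fderiv ℝ v) x) : D2 (fun x => G (v x)) x =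
      deriv G (v x) • D2 v x + deriv (deriv G) (v x) • tp (fderiv ℝ v x) (fderiv ℝ v x) := by
  unfold D2; rw [fderiv_compf hv hG]
  have h1 := ((cda_deriv (hG x)).differentiableAt (by norm_num)).hasDerivAt
  have h2 := h1.comp_hasFDerivAt x (hv.diff x).hasFDerivAt
  refine Eq.trans (h2.smul hx.hasFDerivAt).fderiv ?_
  unfold tp
  congr 1
  ext p q; simp [mul_assoc]

theorem aff_fderiv {u : E n → ℝ} (hu : Differentiable ℝ u) (a : E n) (r : ℝ) :
    fderiv ℝ (fun x => u (a + r • x)) = fun x => r • fderiv ℝ u (a + r • x) := by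
  ext1 x
  have h1 : HasFDerivAt (fun x : E n => a + r • x) (r • ContinuousLinearMap.id ℝ (E n)) x :=
    ((hasFDerivAt_id x).const_smul r).const_add a
  have := ((hu (a + r • x)).hasFDerivAt.comp x h1).fderiv
  refine this.trans ?_
  ext y; simp

theorem ll_aff {F : Type*} [NormedAddCommGroup F] [NormedSpace ℝ F] {w : E n → F} (hw : LocallyLipschitz w) (a : E n) (r : ℝ) :
    LocallyLipschitz (fun x => w (a + r • x)) := by
  have h : LocallyLipschitz (fun x : E n => a + r • x) :=
    (by fun_prop : ContDiff ℝ 1 (fun x : E n => a + r • x)).locallyLipschitz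
  exact hw.comp h

theorem LC.aff {u : E n → ℝ} (hu : LC u) (a : E n) (r : ℝ) : LC (fun x => u (a + r • x)) := by
  refine ⟨hu.diff.comp ((differentiable_const a).add (differentiable_id.const_smul r)), ?_⟩
  rw [aff_fderiv hu.diff]
  exact ll_smul (LipschitzWith.const r).locallyLipschitz (ll_aff hu.lip a r)

theorem D2_aff {u : E n → ℝ} (hu : LC u) (a : E n) (r : ℝ) {x : E n} (hx : DifferentiableAt ℝ (fderiv ℝ u) (a + r • x)) :
    D2 (fun x => u (a + r • x)) x = (r ^ 2) • D2 u (a + r • x) := by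
  unfold D2
  rw [aff_fderiv hu.diff]
  have h1 : HasFDerivAt (fun x : E n => a + r • x) (r • ContinuousLinearMap.id ℝ (E n)) x :=
    ((hasFDerivAt_id x).const_smul r).const_add a
  have := ((HasFDerivAt.comp (g := fderiv ℝ u) x hx.hasFDerivAt h1).const_smul r).fderiv
  refine Eq.trans this ?_
  ext y z; simp; ring

/-- affine a.e. transfer -/
theorem ae_aff {p : E n → Prop} (h : ∀ᵐ x, p x) (a : E n) {r : ℝ} (hr : r ≠ 0) : ∀ᵐ x, p (a + r • x) := by
  have h1 : ∀ᵐ x, p (a + x) := (quasiMeasurePreserving_add_left volume a).ae h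
  have h2 : Measure.QuasiMeasurePreserving (fun x : E n => r • x) volume volume := by
    refine ⟨measurable_const_smul r, ?_⟩
    rw [Measure.map_addHaar_smul volume hr]
    exact Measure.smul_absolutelyContinuous
  exact h2.ae h1

theorem LC.of_smooth {u : E n → ℝ} (h : ContDiff ℝ (⊤ : ℕ∞) u) : LC u :=
  ⟨h.differentiable (by simp), ((h.fderiv_right (m := (⊤ : ℕ∞)) (by simp)).of_le (by simp) : ContDiff ℝ 1 _).locallyLipschitz⟩

/-! link to `hs` -/
theorem fderiv_ofReal {u : E n → ℝ} (hu : Differentiable ℝ u) (x v : E n) :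
    fderiv ℝ (fun y => (u y : ℂ)) x v = (fderiv ℝ u x v : ℂ) := by
  have := (Complex.ofRealCLM.hasFDerivAt.comp x (hu x).hasFDerivAt).fderiv
  have h2 := congrArg (fun L => L v) this
  exact h2

theorem hs_eq {u : E n → ℝ} (hu : ContDiff ℝ (⊤ : ℕ∞) u) (x : E n) : hs (fun y => (u y : ℂ)) x = hC (D2 u x) := by
  have hd : Differentiable ℝ u := hu.differentiable (by simp)
  have hd2 : Differentiable ℝ (fderiv ℝ u) := (hu.fderiv_right (m := (⊤ : ℕ∞)) (by simp)).differentiable (by simp)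
  have h1 : ∀ v w : E n, fderiv ℝ (fun y => fderiv ℝ u y v) x w = D2 u x w v := by
    intro v w
    have := ((hd2 x).hasFDerivAt.clm_apply (hasFDerivAt_const v x)).fderiv
    rw [this]; simp [D2]
  have hdv : ∀ v : E n, Differentiable ℝ (fun y => fderiv ℝ u y v) := fun v => hd2.clm_apply (differentiable_const v)
  ext l m
  show dd (-Complex.I) l (dd Complex.I m (fun y => (u y : ℂ))) x = _
  have e : dd Complex.I m (fun y => (u y : ℂ)) = fun y => (1/2 : ℂ) * (((fderiv ℝ u y (Pi.single m 1) : ℝ) : ℂ) + Complex.I * ((fderiv ℝ u y (Pi.single m Complex.I) : ℝ) : ℂ)) := by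
    ext y; simp only [dd, fderiv_ofReal hd]; ring
  have e2 : ∀ w, fderiv ℝ (dd Complex.I m (fun y => (u y : ℂ))) x w = (1/2 : ℂ) * ((D2 u x w (Pi.single m 1) : ℂ) + Complex.I * (D2 u x w (Pi.single m Complex.I) : ℂ)) := by
    intro w
    have a1 : DifferentiableAt ℝ (fun y => ((fderiv ℝ u y (Pi.single m 1) : ℝ) : ℂ)) x :=
      Complex.ofRealCLM.differentiableAt.comp x (hdv _ x)
    have a2 : DifferentiableAt ℝ (fun y => ((fderiv ℝ u y (Pi.single m Complex.I) : ℝ) : ℂ)) x :=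
      Complex.ofRealCLM.differentiableAt.comp x (hdv _ x)
    rw [e, fderiv_const_mul (a1.fun_add (a2.const_mul _)), fderiv_fun_add a1 (a2.const_mul _), fderiv_const_mul a2]
    simp only [_root_.smul_apply, _root_.add_apply, smul_eq_mul]
    rw [fderiv_ofReal (hdv _), fderiv_ofReal (hdv _), h1, h1]
  rw [show dd (-Complex.I) l (dd Complex.I m (fun y => (u y : ℂ))) x = (1/2 : ℂ) * (fderiv ℝ (dd Complex.I m (fun y => (u y : ℂ))) x (Pi.single l 1) + (-Complex.I) * fderiv ℝ (dd Complex.I m (fun y => (u y : ℂ))) x (Pi.single l Complex.I)) from by rw [dd]; ring]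
  rw [e2, e2, hC_apply]
  push_cast
  ring_nf
  rw [Complex.I_sq]; ring

theorem cHess_eq {u : E n → ℝ} {z : E n} (h : DifferentiableAt ℝ (fderiv ℝ u) z) : cHess u z = hC (D2 u z) := by
  have h1 : ∀ v w : E n, fderiv ℝ (fun y => fderiv ℝ u y v) z w = D2 u z w v := by
    intro v w
    have := (h.hasFDerivAt.clm_apply (hasFDerivAt_const v z)).fderiv
    rw [this]; simp [D2]
  ext j k
  simp only [cHess, Matrix.of_apply, h1, hC_apply]

theorem bil_eval_cont (v w : E n) : Continuous (fun S : Bil n => S v w) := by fun_prop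

theorem hC_cont : Continuous (hC : Bil n → Matrix (Fin n) (Fin n) ℂ) := by
  refine continuous_matrix fun i j => ?_
  have h1 := fun v w : E n => bil_eval_cont v w
  simp only [hC_apply]
  exact (Complex.continuous_ofReal.comp (((h1 _ _).add (h1 _ _)).div_const 4)).add
    (continuous_const.mul (Complex.continuous_ofReal.comp (((h1 _ _).sub (h1 _ _)).div_const 4)))

/-- auxiliary trace function -/
noncomputable def tr2 (A B : Matrix (Fin n) (Fin n) ℂ) : ℝ := (A.adjugate * B).trace.re

theorem tradj_cont : Continuous (fun p : Matrix (Fin n) (Fin n) ℂ × Matrix (Fin n) (Fin n) ℂ => tr2 p.1 p.2) :=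
  Complex.continuous_re.comp ((continuous_fst.matrix_adjugate.matrix_mul continuous_snd).matrix_trace)

/-- linearised operator -/
noncomputable def LU (u w : E n → ℝ) (x : E n) : ℝ := LB (hC (D2 u x)).adjugate (D2 w x)

theorem sm_D2_cont {u : E n → ℝ} (h : ContDiff ℝ (⊤ : ℕ∞) u) : Continuous (D2 u) :=
  ((h.fderiv_right (m := (⊤ : ℕ∞)) (by simp)).fderiv_right (m := (⊤ : ℕ∞)) (by simp)).continuous

theorem LBc_cont {f g : E n → Bil n} (hf : Continuous f) (hg : Continuous g) :
    Continuous (fun x => LB (hC (f x)).adjugate (g x)) := by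
  have h1 := hC_cont.comp hf
  have h2 := hC_cont.comp hg
  have h3 := tradj_cont.comp (h1.prodMk h2)
  have h4 : (fun x => LB (hC (f x)).adjugate (g x)) = (fun p : Matrix (Fin n) (Fin n) ℂ × Matrix (Fin n) (Fin n) ℂ => tr2 p.1 p.2) ∘ fun x => ((hC ∘ f) x, (hC ∘ g) x) := rfl
  rw [h4]
  exact h3

theorem LBc_lim {f g : ℕ → Bil n} {S T : Bil n} (hf : Tendsto f atTop (𝓝 S)) (hg : Tendsto g atTop (𝓝 T)) :
    Tendsto (fun x => LB (hC (f x)).adjugate (g x)) atTop (𝓝 (LB (hC S).adjugate T)) := by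
  have h1 := (hC_cont.tendsto S).comp hf
  have h2 := (hC_cont.tendsto T).comp hg
  have h3 := (tradj_cont.tendsto (hC S, hC T)).comp (h1.prodMk_nhds h2)
  have h4 : (fun x => LB (hC (f x)).adjugate (g x)) = (fun p : Matrix (Fin n) (Fin n) ℂ × Matrix (Fin n) (Fin n) ℂ => tr2 p.1 p.2) ∘ fun x => ((hC ∘ f) x, (hC ∘ g) x) := rfl
  rw [h4]
  exact h3

theorem LU_cont {u w : E n → ℝ} (hu : ContDiff ℝ (⊤ : ℕ∞) u) (hw : ContDiff ℝ (⊤ : ℕ∞) w) : Continuous (LU u w) :=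
  LBc_cont (sm_D2_cont hu) (sm_D2_cont hw)

theorem adj_herm {A : Matrix (Fin n) (Fin n) ℂ} (h : A.IsHermitian) : A.adjugate.IsHermitian := by
  exact h.adjugate

theorem dd_conj {u : E n → ℝ} (hu : Differentiable ℝ u) (j : Fin n) (x : E n) :
    star (dd Complex.I j (fun y => (u y : ℂ)) x) = dd (-Complex.I) j (fun y => (u y : ℂ)) x := by
  simp [dd, fderiv_ofReal hu]

theorem T1_smooth {u w ψ : E n → ℝ} (hu : ContDiff ℝ (⊤ : ℕ∞) u) (hw : ContDiff ℝ (⊤ : ℕ∞) w)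
    (hψ : ContDiff ℝ (⊤ : ℕ∞) ψ) (hcw : HasCompactSupport w) (hc : HasCompactSupport ψ) :
    ∫ x, ψ x * LU u w x = ∫ x, w x * LU u ψ x := by
  have cs : ∀ {v : E n → ℝ}, HasCompactSupport v → HasCompactSupport (fun y => (v y : ℂ)) := fun h =>
    h.comp_left (g := fun t : ℝ => (t : ℂ)) (by simp)
  have sm : ∀ {v : E n → ℝ}, ContDiff ℝ (⊤ : ℕ∞) v → Sm (fun y => (v y : ℂ)) := fun h =>
    Complex.ofRealCLM.contDiff.comp h
  have d1 := div1 (sm hu) (sm hw) (sm hψ) (cs hc)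
  have d2 := div1 (sm hu) (sm hψ) (sm hw) (cs hcw)
  have key : ∀ {v w : E n → ℝ}, ContDiff ℝ (⊤ : ℕ∞) v → ContDiff ℝ (⊤ : ℕ∞) w → HasCompactSupport v →
      ∫ x, v x * LU u w x = (∫ x, (v x : ℂ) * ((hs (fun y => (u y : ℂ)) x).adjugate * hs (fun y => (w y : ℂ)) x).trace).re := by
    intro v w hv hw hcv
    rw [← RCLike.re_eq_complex_re, ← integral_re]
    · refine integral_congr_ae (Eventually.of_forall fun x => ?_)
      simp only [RCLike.re_eq_complex_re, Complex.re_ofReal_mul]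
      rw [hs_eq hu, hs_eq hw]; rfl
    · refine Continuous.integrable_of_hasCompactSupport ?_ ((cs hcv).mul_right)
      refine (Complex.continuous_ofReal.comp hv.continuous).mul ?_
      have e1 : (fun x => hs (fun y => (u y : ℂ)) x) = fun x => hC (D2 u x) := funext fun x => hs_eq hu x
      have e2 : (fun x => hs (fun y => (w y : ℂ)) x) = fun x => hC (D2 w x) := funext fun x => hs_eq hw x
      have c1 : Continuous (fun x => hs (fun y => (u y : ℂ)) x) := by rw [e1]; exact hC_cont.comp (sm_D2_cont hu)
      have c2 : Continuous (fun x => hs (fun y => (w y : ℂ)) x) := by rw [e2]; exact hC_cont.comp (sm_D2_cont hw)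
      exact (c1.matrix_adjugate.matrix_mul c2).matrix_trace
  rw [key hψ hw hc, key hw hψ hcw, d1, d2, Complex.neg_re, Complex.neg_re]
  have hh : ∀ x, (hs (fun y => (u y : ℂ)) x).adjugate.IsHermitian := fun x => by
    rw [hs_eq hu]; exact adj_herm (hC_herm (D2_symm' (hu.differentiable (by simp)) x))
  have hwd : Differentiable ℝ w := hw.differentiable (by simp)
  have hψd : Differentiable ℝ ψ := hψ.differentiable (by simp)
  have : ∀ x, (∑ k, ∑ j, (hs (fun y => (u y : ℂ)) x).adjugate k j * dd (-Complex.I) j (fun y => (ψ y : ℂ)) x * dd Complex.I k (fun y => (w y : ℂ)) x)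
     = (starRingEnd ℂ) (∑ k, ∑ j, (hs (fun y => (u y : ℂ)) x).adjugate k j * dd (-Complex.I) j (fun y => (w y : ℂ)) x * dd Complex.I k (fun y => (ψ y : ℂ)) x) := by
    intro x
    rw [map_sum, Finset.sum_comm]
    refine Finset.sum_congr rfl fun k _ => ?_
    rw [map_sum]
    refine Finset.sum_congr rfl fun j _ => ?_
    rw [map_mul, map_mul, ← (hh x).apply j k, ← dd_conj hwd, ← dd_conj hψd]
    simp only [RCLike.star_def, Complex.conj_conj]
    ring
  simp_rw [this]
  rw [integral_conj, Complex.conj_re]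

theorem LU_bd (n : ℕ) {K : ℝ} (hK : 0 ≤ K) : ∃ C, 0 ≤ C ∧ ∀ S T : Bil n, ‖S‖ ≤ K → |LB (hC S).adjugate T| ≤ C * ‖T‖ := by
  obtain ⟨C, hC0, h⟩ := adj_bd n K hK
  refine ⟨n * n * C, by positivity, fun S T hS => ?_⟩
  exact LB_bd hC0 (h _ (fun i j => hC_norm_le hS i j)) T

theorem dct {f : ℕ → E n → ℝ} {g : E n → ℝ} {R C : ℝ} (hm : ∀ k, AEStronglyMeasurable (f k) volume)
    (hb : ∀ k x, ‖x‖ ≤ R → |f k x| ≤ C) (hs : ∀ k x, R < ‖x‖ → f k x = 0)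
    (hl : ∀ᵐ x, Tendsto (fun k => f k x) atTop (𝓝 (g x))) :
    Tendsto (fun k => ∫ x, f k x) atTop (𝓝 (∫ x, g x)) := by
  refine tendsto_integral_of_dominated_convergence ((Metric.closedBall (0 : E n) R).indicator fun _ => C) hm ?_ ?_ hl
  · exact (integrable_indicator_iff Metric.isClosed_closedBall.measurableSet).2
      (integrableOn_const (isCompact_closedBall _ _).measure_lt_top.ne)
  · intro k
    refine Eventually.of_forall fun x => ?_
    by_cases hx : ‖x‖ ≤ R
    · rw [Set.indicator_of_mem (by simpa using hx)]; exact hb k x hx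
    · rw [hs k x (not_le.1 hx), Set.indicator_of_notMem (by simpa using hx)]; simp

theorem mol_zero {F : Type*} [NormedAddCommGroup F] [NormedSpace ℝ F] {v : E n → F} {R : ℝ}
    (hv : ∀ x, R < ‖x‖ → v x = 0) (k : ℕ) {x : E n} (hx : R + 1 < ‖x‖) : mol (kb n k) v x = 0 := by
  unfold mol
  rw [← integral_zero (E n) F (μ := volume)]
  refine integral_congr_ae (Eventually.of_forall fun t => ?_)
  by_cases ht : kb n k t = 0
  · simp [ht]
  · have := kb_supp1 k ht
    have h2 : ‖x‖ ≤ ‖x - t‖ + ‖t‖ := by simpa using norm_add_le (x - t) t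
    simp only; rw [hv (x - t) (by linarith), smul_zero]

theorem cs_of_zero {v : E n → ℝ} {R : ℝ} (hv : ∀ x, R < ‖x‖ → v x = 0) : HasCompactSupport v :=
  HasCompactSupport.intro (isCompact_closedBall (0 : E n) R) fun x hx => hv x (by simpa using hx)

theorem zero_of_cs {v : E n → ℝ} (hv : HasCompactSupport v) : ∃ R : ℝ, 0 < R ∧ ∀ x, R < ‖x‖ → v x = 0 := by
  obtain ⟨R, h0, h⟩ := cs_ball hv
  exact ⟨R, h0, fun x hx => by by_contra h1; exact absurd (h x h1) (not_le.2 hx)⟩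

theorem LC.mol_smooth {u : E n → ℝ} (h : LC u) (k : ℕ) : ContDiff ℝ (⊤ : ℕ∞) (mol (kb n k) u) :=
  mol_contDiff (lbm_cont h.cont) (kb_smooth k) (kb_cs k)

/-- convergence of LU under mollification -/
theorem LU_lim {u w ψ : E n → ℝ} (hu : LC u) (hw : LC w) (hψ : LC ψ) {R : ℝ} (hz : ∀ x, R < ‖x‖ → ψ x = 0) :
    Tendsto (fun k => ∫ x, mol (kb n k) ψ x * LU (mol (kb n k) u) (mol (kb n k) w) x) atTop (𝓝 (∫ x, ψ x * LU u w x)) := by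
  obtain ⟨K1, hK10, hK1⟩ := hu.lbm.bd (R + 1 + 1)
  obtain ⟨K2, hK20, hK2⟩ := hw.lbm.bd (R + 1 + 1)
  obtain ⟨K3, hK30, hK3⟩ := (lbm_cont hψ.cont).bd (R + 1 + 1)
  obtain ⟨C, hC0, hCb⟩ := LU_bd n hK10
  refine dct (R := R + 1) (C := K3 * (C * K2)) ?_ ?_ ?_ ?_
  · intro k
    refine Continuous.aestronglyMeasurable ((hψ.mol_smooth k).continuous.mul ?_)
    exact LU_cont (hu.mol_smooth k) (hw.mol_smooth k)
  · intro k x hx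
    rw [abs_mul]
    have a1 : |mol (kb n k) ψ x| ≤ K3 := mol_bd (fun y hy => hK3 y (by linarith)) k
    have a2 : ‖D2 (mol (kb n k) w) x‖ ≤ K2 := by
      rw [mol_D2 hw (kb_cont k) (kb_cs k)]; exact mol_bd (fun y hy => hK2 y (by linarith)) k
    have a3 : ‖D2 (mol (kb n k) u) x‖ ≤ K1 := by
      rw [mol_D2 hu (kb_cont k) (kb_cs k)]; exact mol_bd (fun y hy => hK1 y (by linarith)) k
    have a4 := hCb _ (D2 (mol (kb n k) w) x) a3
    exact mul_le_mul a1 (a4.trans (by gcongr)) (abs_nonneg _) hK30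
  · intro k x hx
    rw [mol_zero hz k hx, zero_mul]
  · filter_upwards [mol_tendsto hu.lbm, mol_tendsto hw.lbm] with x h1 h2
    have h3 := mol_tendsto_cont hψ.cont x
    refine h3.mul ?_
    have e1 : ∀ k, LU (mol (kb n k) u) (mol (kb n k) w) x = LB (hC (mol (kb n k) (D2 u) x)).adjugate (mol (kb n k) (D2 w) x) := by
      intro k; unfold LU; rw [mol_D2 hu (kb_cont k) (kb_cs k), mol_D2 hw (kb_cont k) (kb_cs k)]
    simp_rw [e1]
    exact LBc_lim h1 h2

theorem T1_cs {u w ψ : E n → ℝ} (hu : LC u) (hw : LC w) (hψ : LC ψ)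
    (hcw : HasCompactSupport w) (hc : HasCompactSupport ψ) :
    ∫ x, ψ x * LU u w x = ∫ x, w x * LU u ψ x := by
  obtain ⟨R1, -, hR1⟩ := zero_of_cs hcw
  obtain ⟨R2, -, hR2⟩ := zero_of_cs hc
  refine tendsto_nhds_unique (LU_lim hu hw hψ hR2) ?_
  refine (LU_lim hu hψ hw hR1).congr fun k => ?_
  exact T1_smooth (hu.mol_smooth k) (hψ.mol_smooth k) (hw.mol_smooth k) (cs_of_zero fun x => mol_zero hR2 k) (cs_of_zero fun x => mol_zero hR1 k)

/-- smooth cutoff equal to 1 on the ball of radius R -/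
theorem exists_cutoff (n : ℕ) (R : ℝ) : ∃ χ : E n → ℝ, ContDiff ℝ (⊤ : ℕ∞) χ ∧ HasCompactSupport χ ∧
    (∀ x, ‖x‖ ≤ R → χ x = 1) ∧ ∀ x, 0 ≤ χ x ∧ χ x ≤ 1 := by
  let b : ContDiffBump (0 : E n) := ⟨max R 1, max R 1 + 1, by positivity, by linarith⟩
  refine ⟨b, b.contDiff, b.hasCompactSupport, fun x hx => b.one_of_mem_closedBall ?_, fun x => ⟨b.nonneg, b.le_one⟩⟩
  rw [mem_closedBall_zero_iff]; exact hx.trans (le_max_left _ _)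

theorem D2_congr {u v : E n → ℝ} {x : E n} (h : u =ᶠ[𝓝 x] v) : D2 u x = D2 v x := by
  unfold D2
  exact (h.fderiv).fderiv_eq

theorem D2_zero_out {ψ : E n → ℝ} {R : ℝ} (hz : ∀ x, R < ‖x‖ → ψ x = 0) {x : E n} (hx : R < ‖x‖) : D2 ψ x = 0 := by
  have : ψ =ᶠ[𝓝 x] fun _ => 0 := by
    filter_upwards [(isOpen_lt continuous_const continuous_norm).mem_nhds hx] with y hy
    exact hz y hy
  rw [D2_congr this, D2_const]

theorem LB_zero (B : Matrix (Fin n) (Fin n) ℂ) : LB B 0 = 0 := by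
  unfold LB; rw [hC_zero]; simp

theorem T1 {u w ψ : E n → ℝ} (hu : LC u) (hw : LC w) (hψ : LC ψ) (hc : HasCompactSupport ψ) :
    ∫ x, ψ x * LU u w x = ∫ x, w x * LU u ψ x := by
  obtain ⟨R, -, hR⟩ := zero_of_cs hc
  obtain ⟨χ, h1, h2, h3, -⟩ := exists_cutoff n (R + 1)
  have := T1_cs hu ((LC.of_smooth h1).mul hw) hψ h2.mul_right hc
  have e1 : ∀ x, ψ x * LU u w x = ψ x * LU u (fun x => χ x * w x) x := by
    intro x
    by_cases hx : R < ‖x‖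
    · simp [hR x hx]
    · congr 1; unfold LU; congr 1
      apply D2_congr
      have : ∀ᶠ y in 𝓝 x, ‖y‖ < R + 1 := (isOpen_lt continuous_norm continuous_const).mem_nhds (by simp at hx ⊢; linarith)
      filter_upwards [this] with y hy
      rw [h3 y hy.le, one_mul]
  have e2 : ∀ x, w x * LU u ψ x = (χ x * w x) * LU u ψ x := by
    intro x
    by_cases hx : R < ‖x‖
    · unfold LU; rw [D2_zero_out hR hx, LB_zero]; simp
    · rw [h3 x (by linarith), one_mul]
  simp_rw [e1, e2]
  exact this

theorem LBm {f g : E n → Bil n} (hf : AEStronglyMeasurable f volume) (hg : AEStronglyMeasurable g volume) :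
    AEStronglyMeasurable (fun x => LB (hC (f x)).adjugate (g x)) volume := by
  have h0 : Continuous (fun p : Bil n × Bil n => (hC p.1, hC p.2)) :=
    (hC_cont.comp continuous_fst).prodMk (hC_cont.comp continuous_snd)
  have h1 := tradj_cont.comp h0
  have h2 := h1.comp_aestronglyMeasurable (hf.prodMk hg)
  exact h2

theorem LU_meas {u w : E n → ℝ} (hu : LC u) (hw : LC w) : AEStronglyMeasurable (LU u w) volume :=
  LBm hu.lbm.meas hw.lbm.meas

/-- bounded on a ball, zero outside -/
theorem int_of_bd {f : E n → ℝ} {R C : ℝ} (hm : AEStronglyMeasurable f volume)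
    (hb : ∀ x, ‖x‖ ≤ R → |f x| ≤ C) (hs : ∀ x, R < ‖x‖ → f x = 0) : Integrable f volume := by
  have h1 : Integrable ((Metric.closedBall (0 : E n) R).indicator fun _ => C) volume :=
    (integrable_indicator_iff Metric.isClosed_closedBall.measurableSet).2
      (integrableOn_const (isCompact_closedBall _ _).measure_lt_top.ne)
  refine h1.mono' hm (Eventually.of_forall fun x => ?_)
  by_cases hx : ‖x‖ ≤ R
  · rw [Set.indicator_of_mem (by simpa using hx)]; exact hb x hx
  · rw [hs x (not_le.1 hx), Set.indicator_of_notMem (by simpa using hx)]; simp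

theorem LU_bd_ball {u w : E n → ℝ} (hu : LC u) (hw : LC w) (R : ℝ) : ∃ C, 0 ≤ C ∧ ∀ x, ‖x‖ ≤ R → |LU u w x| ≤ C := by
  obtain ⟨K, hK, h1⟩ := hu.lbm.bd R
  obtain ⟨K2, hK2, h2⟩ := hw.lbm.bd R
  obtain ⟨C, hC0, h⟩ := LU_bd n hK
  refine ⟨C * K2, by positivity, fun x hx => (h _ _ (h1 x hx)).trans ?_⟩
  exact mul_le_mul_of_nonneg_left (h2 x hx) hC0

theorem LU_int {u w θ : E n → ℝ} (hu : LC u) (hw : LC w) (hm : AEStronglyMeasurable θ volume) {R C : ℝ}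
    (hb : ∀ x, ‖x‖ ≤ R → |θ x| ≤ C) (hs : ∀ x, R < ‖x‖ → θ x = 0) : Integrable (fun x => θ x * LU u w x) volume := by
  obtain ⟨K, hK, h⟩ := LU_bd_ball hu hw R
  refine int_of_bd (R := R) (C := C * K) (hm.mul (LU_meas hu hw)) (fun x hx => ?_) (fun x hx => by simp [hs x hx])
  rw [abs_mul]
  exact mul_le_mul (hb x hx) (h x hx) (abs_nonneg _) ((abs_nonneg _).trans (hb x hx))

theorem LU_congr {u v w : E n → ℝ} {x : E n} (h : w =ᶠ[𝓝 x] v) : LU u w x = LU u v x := by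
  unfold LU; rw [D2_congr h]

theorem LU_const (u : E n → ℝ) (c : ℝ) (x : E n) : LU u (fun _ => c) x = 0 := by
  unfold LU; rw [D2_const, LB_zero]

theorem LB_sub (B : Matrix (Fin n) (Fin n) ℂ) (S T : Bil n) : LB B (S - T) = LB B S - LB B T := by
  unfold LB; rw [hC_sub, Matrix.mul_sub, Matrix.trace_sub, Complex.sub_re]

theorem LU_sub {u v w : E n → ℝ} (hv : LC v) (hw : LC w) {x : E n} (h1 : DifferentiableAt ℝ (fderiv ℝ v) x)
    (h2 : DifferentiableAt ℝ (fderiv ℝ w) x) : LU u (fun x => v x - w x) x = LU u v x - LU u w x := by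
  unfold LU; rw [D2_sub hv hw h1 h2, LB_sub]

theorem LU_smul {u v : E n → ℝ} (c : ℝ) (hv : LC v) (x : E n) : LU u (fun x => c * v x) x = c * LU u v x := by
  unfold LU; rw [D2_smul c hv, LB_smul]

theorem LU_comp {u : E n → ℝ} {G : ℝ → ℝ} {v : E n → ℝ} (hv : LC v) (hG : ∀ x, ContDiffAt ℝ 2 G (v x)) {x : E n}
    (hx : DifferentiableAt ℝ (fderiv ℝ v) x) : LU u (fun x => G (v x)) x =
      deriv G (v x) * LU u v x + deriv (deriv G) (v x) * LB (hC (D2 u x)).adjugate (tp (fderiv ℝ v x) (fderiv ℝ v x)) := by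
  unfold LU; rw [D2_comp hv hG hx, LB_add, LB_smul, LB_smul]


/-- integral of `LU u F` vanishes -/
theorem LU_int_zero {u F : E n → ℝ} (hu : LC u) (hF : LC F) (hc : HasCompactSupport F) :
    Integrable (LU u F) volume ∧ ∫ x, LU u F x = 0 := by
  have h := T1 hu (LC.const 1) hF hc
  simp only [LU_const, mul_zero, integral_zero, one_mul] at h
  refine ⟨?_, h.symm⟩
  obtain ⟨R, -, hR⟩ := zero_of_cs hc
  obtain ⟨K, hK, h1⟩ := LU_bd_ball hu hF R
  refine int_of_bd (LU_meas hu hF) h1 fun x hx => ?_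
  unfold LU; rw [D2_zero_out hR hx, LB_zero]

/-- convex smooth function -/
noncomputable def cvx (t : ℝ) : ℝ := ∫ s in (0:ℝ)..t, Real.smoothTransition s

theorem cvx_hasDeriv (t : ℝ) : HasDerivAt cvx (Real.smoothTransition t) t :=
  intervalIntegral.integral_hasDerivAt_right (Real.smoothTransition.continuous.intervalIntegrable _ _)
    (Real.smoothTransition.continuous.stronglyMeasurableAtFilter _ _) Real.smoothTransition.continuousAt

theorem cvx_deriv : deriv cvx = Real.smoothTransition := funext fun t => (cvx_hasDeriv t).deriv

theorem cvx_contDiff : ContDiff ℝ 2 cvx := by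
  have : ContDiff ℝ (1 + 1) cvx := by
    rw [contDiff_succ_iff_deriv]
    refine ⟨fun t => (cvx_hasDeriv t).differentiableAt, by simp, ?_⟩
    rw [cvx_deriv]; exact_mod_cast Real.smoothTransition.contDiff (n := 1)
  exact_mod_cast this

theorem cvx_zero {t : ℝ} (ht : t ≤ 0) : cvx t = 0 := by
  unfold cvx
  rw [intervalIntegral.integral_symm, intervalIntegral.integral_congr (g := fun _ => 0)]
  · simp
  · intro s hs
    rw [Set.uIcc_of_le ht] at hs
    exact Real.smoothTransition.zero_of_nonpos hs.2

theorem wmp {u w p : E n → ℝ} (hu : LC u) (hw : LC w) (hp : ContDiff ℝ (⊤ : ℕ∞) p) {s1 s2 R m : ℝ} (hs : s1 < s2)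
    (hR : ∀ x, p x ≤ s2 → ‖x‖ ≤ R) (hm : ∀ x, s1 ≤ p x → p x ≤ s2 → m ≤ w x)
    (hel : ∀ᵐ x, p x < s2 → ∀ l, 0 ≤ LB (hC (D2 u x)).adjugate (tp l l))
    (hL : ∀ᵐ x, p x < s2 → LU u w x < 0) : ∀ x, p x < s2 → m ≤ w x := by
  set mid := (s1 + s2) / 2 with hmid
  have hm1 : s1 < mid := by rw [hmid]; linarith
  have hm2 : mid < s2 := by rw [hmid]; linarith
  set χ : E n → ℝ := fun x => Real.smoothTransition ((s2 - p x) / (s2 - mid)) with hχ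
  have hχs : ContDiff ℝ (⊤ : ℕ∞) χ := Real.smoothTransition.contDiff.comp ((contDiff_const.sub hp).div_const _)
  have hχ1 : ∀ x, p x ≤ mid → χ x = 1 := fun x hx => Real.smoothTransition.one_of_one_le (by
    rw [le_div_iff₀ (by linarith)]; linarith)
  have hχ0 : ∀ x, s2 ≤ p x → χ x = 0 := fun x hx => Real.smoothTransition.zero_of_nonpos (by
    apply div_nonpos_of_nonpos_of_nonneg <;> linarith)
  set G : ℝ → ℝ := fun t => cvx (m - t) with hG
  have hGd : ∀ t, HasDerivAt G (-Real.smoothTransition (m - t)) t := fun t => by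
    have := (cvx_hasDeriv (m - t)).comp t ((hasDerivAt_id t).const_sub m)
    rw [mul_neg_one] at this
    exact this
  have hGd' : deriv G = fun t => -Real.smoothTransition (m - t) := funext fun t => (hGd t).deriv
  have hG2 : ∀ t, 0 ≤ deriv (deriv G) t := by
    intro t
    rw [hGd']
    have : Monotone fun t => -Real.smoothTransition (m - t) := by
      intro a b hab
      exact neg_le_neg (Real.smoothTransition.monotone (by linarith))
    exact this.deriv_nonneg
  have hGc : ContDiff ℝ 2 G := cvx_contDiff.comp (contDiff_const.sub contDiff_id)
  have hGw : LC (fun x => G (w x)) := hw.comp fun x => hGc.contDiffAt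
  set F : E n → ℝ := fun x => χ x * G (w x) with hFdef
  have hF : LC F := (LC.of_smooth hχs).mul hGw
  have hcs : HasCompactSupport F := cs_of_zero (R := R) fun x hx => by
    have : s2 ≤ p x := by by_contra h; exact absurd (hR x (by linarith)) (by linarith)
    simp [hFdef, hχ0 x this]
  have hpc : Continuous p := hp.continuous
  have hF0 : ∀ x, s1 < p x → F x = 0 := fun x hx => by
    by_cases h : s2 ≤ p x
    · simp [hFdef, hχ0 x h]
    · have := hm x hx.le (by linarith)
      simp only [hFdef, hG]; rw [cvx_zero (by linarith), mul_zero]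
  obtain ⟨hi, h0⟩ := LU_int_zero hu hF hcs
  have key : ∀ᵐ x, 0 ≤ LU u F x ∧ (p x < mid → w x < m → 0 < LU u F x) := by
    filter_upwards [hel, hL, hw.ae] with x h1 h2 h3
    by_cases hx : p x < mid
    · have e : F =ᶠ[𝓝 x] fun x => G (w x) := by
        filter_upwards [(isOpen_lt hpc continuous_const).mem_nhds hx] with y hy
        simp only [hFdef]; rw [hχ1 y (le_of_lt hy), one_mul]
      have h4 := h1 (by linarith) (fderiv ℝ w x)
      have h5 := h2 (by linarith)
      have e2 : LU u F x = -Real.smoothTransition (m - w x) * LU u w x + deriv (deriv G) (w x) *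
          LB (hC (D2 u x)).adjugate (tp (fderiv ℝ w x) (fderiv ℝ w x)) := by
        rw [LU_congr e]; unfold LU
        rw [D2_comp hw (fun x => hGc.contDiffAt) h3, LB_add, LB_smul, LB_smul, hGd']
      have h6 := mul_nonneg (hG2 (w x)) h4
      have h7 := Real.smoothTransition.nonneg (m - w x)
      rw [e2]
      refine ⟨by nlinarith, fun _ hw => ?_⟩
      have h8 := Real.smoothTransition.pos_of_pos (sub_pos.2 hw)
      nlinarith
    · have e : F =ᶠ[𝓝 x] fun _ => 0 := by
        filter_upwards [(isOpen_lt continuous_const hpc).mem_nhds (show s1 < p x by linarith)] with y hy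
        exact hF0 y hy
      rw [LU_congr e, LU_const]
      exact ⟨le_rfl, fun h => absurd h hx⟩
  have hz := (integral_eq_zero_iff_of_nonneg_ae (key.mono fun x hx => hx.1) hi).1 h0
  have hopen : IsOpen {x | p x < mid ∧ w x < m} := (isOpen_lt hpc continuous_const).inter (isOpen_lt hw.cont continuous_const)
  have hnull : volume {x | p x < mid ∧ w x < m} = 0 := by
    rw [measure_eq_zero_iff_ae_notMem]
    filter_upwards [hz, key] with x h1 h2 h3
    have := h2.2 h3.1 h3.2
    rw [h1] at this; simp at this
  have hemp := (hopen.measure_eq_zero_iff volume).1 hnull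
  intro x hx
  by_contra hlt
  by_cases h : p x < mid
  · have : x ∈ ({x | p x < mid ∧ w x < m} : Set (E n)) := ⟨h, not_le.1 hlt⟩
    rw [hemp] at this; exact this
  · exact hlt (hm x (by linarith) hx.le)

/-- squared Euclidean norm -/
noncomputable def q (x : E n) : ℝ := ∑ i, ((x i).re ^ 2 + (x i).im ^ 2)

theorem q_eq (x : E n) : q x = ∑ i, ‖x i‖ ^ 2 := by
  unfold q; refine Finset.sum_congr rfl fun i _ => ?_
  rw [Complex.sq_norm, Complex.normSq_apply]; ring

theorem q_smooth : ContDiff ℝ (⊤ : ℕ∞) (q : E n → ℝ) := by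
  unfold q
  refine ContDiff.sum fun i _ => ?_
  have h : ContDiff ℝ (⊤ : ℕ∞) (fun x : E n => x i) := contDiff_apply ℝ ℂ i
  exact ((Complex.reCLM.contDiff.comp h).pow 2).add ((Complex.imCLM.contDiff.comp h).pow 2)

theorem q_nonneg (x : E n) : 0 ≤ q x := by unfold q; positivity

theorem norm_le_q (x : E n) : ‖x‖ ^ 2 ≤ q x := by
  have : ‖x‖ ≤ √(q x) := by
    rw [pi_norm_le_iff_of_nonneg (Real.sqrt_nonneg _)]
    intro i
    apply Real.le_sqrt_of_sq_le
    rw [q_eq]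
    exact Finset.single_le_sum (f := fun i => ‖x i‖ ^ 2) (fun i _ => by positivity) (Finset.mem_univ i)
  calc ‖x‖ ^ 2 ≤ √(q x) ^ 2 := by gcongr
    _ = q x := Real.sq_sqrt (q_nonneg x)

theorem q_le (x : E n) : q x ≤ (n * ‖x‖) ^ 2 := by
  rw [q_eq]
  calc ∑ i, ‖x i‖ ^ 2 ≤ ∑ i : Fin n, ‖x‖ ^ 2 := Finset.sum_le_sum fun i _ => by gcongr; exact norm_le_pi_norm x i
    _ = n * ‖x‖ ^ 2 := by simp
    _ ≤ (n * ‖x‖) ^ 2 := by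
        rw [mul_pow]; gcongr
        have : (n : ℕ) ≤ n ^ 2 := Nat.le_self_pow (by norm_num) n
        exact_mod_cast this

theorem q_smul (t : ℝ) (x : E n) : q (t • x) = t ^ 2 * q x := by
  unfold q; rw [Finset.mul_sum]; refine Finset.sum_congr rfl fun i _ => ?_
  simp; ring

theorem q_zero_iff {x : E n} : q x = 0 ↔ x = 0 := by
  constructor
  · intro h
    have := norm_le_q x
    rw [h] at this
    have h2 : ‖x‖ = 0 := by nlinarith [norm_nonneg x]
    exact norm_eq_zero.1 h2
  · rintro rfl; simp [q]

theorem q_euler (x : E n) : fderiv ℝ q x x = 2 * q x := by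
  have h1 : HasFDerivAt q (fderiv ℝ q x) ((1:ℝ) • x) := by
    rw [one_smul]; exact (q_smooth.differentiable (by simp) x).hasFDerivAt
  have h2 : HasDerivAt (fun t : ℝ => t • x) x 1 := by
    simpa using (hasDerivAt_id (1:ℝ)).smul_const x
  have h3 := h1.comp_hasDerivAt (1:ℝ) h2
  have h4 : HasDerivAt (fun t : ℝ => t ^ 2 * q x) (2 * q x) 1 := by
    simpa using ((hasDerivAt_pow 2 (1:ℝ)).mul_const (q x))
  have e : (q ∘ fun t : ℝ => t • x) = fun t : ℝ => t ^ 2 * q x := funext fun t => q_smul t x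
  rw [e] at h3
  exact h3.unique h4

theorem q_grad (x : E n) : 4 * q x ≤ ‖fderiv ℝ q x‖ ^ 2 := by
  by_cases hx : x = 0
  · subst hx; simp [q]
  have h1 : 2 * q x ≤ ‖fderiv ℝ q x‖ * ‖x‖ := by
    rw [← q_euler]; exact (le_abs_self _).trans ((fderiv ℝ q x).le_opNorm x)
  have h2 := norm_le_q x
  have h3 : 0 < ‖x‖ := norm_pos_iff.2 hx
  have h4 : 0 < q x := by nlinarith
  have h5 : (2 * q x) ^ 2 ≤ ‖fderiv ℝ q x‖ ^ 2 * q x := by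
    calc (2 * q x) ^ 2 ≤ (‖fderiv ℝ q x‖ * ‖x‖) ^ 2 := by gcongr
      _ = ‖fderiv ℝ q x‖ ^ 2 * ‖x‖ ^ 2 := by ring
      _ ≤ _ := by gcongr
  nlinarith

theorem fderiv_shift (f : E n → ℝ) (a : E n) : fderiv ℝ (fun x => f (x - a)) = fun x => fderiv ℝ f (x - a) :=
  funext fun x => fderiv_comp_sub a

theorem D2_shift (f : E n → ℝ) (a x : E n) : D2 (fun x => f (x - a)) x = D2 f (x - a) := by
  unfold D2; rw [fderiv_shift]; exact fderiv_comp_sub a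

theorem sm_ae {f : E n → ℝ} (hf : ContDiff ℝ (⊤ : ℕ∞) f) (x : E n) : DifferentiableAt ℝ (fderiv ℝ f) x :=
  (hf.fderiv_right (m := 1) (by norm_cast)).differentiable (by simp) x

theorem q_shift_smooth (a : E n) : ContDiff ℝ (⊤ : ℕ∞) (fun x => q (x - a)) :=
  q_smooth.comp (contDiff_id.sub contDiff_const)

/-- the barrier -/
theorem barrier {u : E n → ℝ} {l K : ℝ} (hl : 0 < l) (hK0 : 0 ≤ K) (hell : ∀ᵐ x, Ell l (hC (D2 u x)))
    (hK : ∀ᵐ x, ‖D2 u x‖ ≤ K) (y x0 : E n) (Q R2 : ℝ) (hR2 : 0 < R2) :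
    ∃ β κ : ℝ, 0 < β ∧ 0 < κ ∧ LC (fun x => Real.exp (-β * q (x - y)) - Real.exp (-β * R2) - κ * q (x - x0)) ∧
     ∀ᵐ x, R2 / 2 ≤ q (x - y) → ‖x‖ ≤ Q → q (x - y) ≤ Q → 
      0 < LU u (fun x => Real.exp (-β * q (x - y)) - Real.exp (-β * R2) - κ * q (x - x0)) x := by
  obtain ⟨l', hl', hadj⟩ := adj_ell n hl K hK0
  obtain ⟨C, hC0, hbd⟩ := LU_bd n hK0
  obtain ⟨D, hD0, hD⟩ := (LC.of_smooth (q_smooth (n := n))).lbm.bd (|Q| + ‖y‖ + ‖x0‖)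
  set c := l' / (16 * (n + 1) ^ 2) with hc
  have hcpos : 0 < c := by positivity
  set β := (C * D + 1) / (2 * c * R2) with hβ
  have hβ0 : 0 < β := by positivity
  set κ := β * Real.exp (-β * Q) / (2 * (C * D + 1)) with hκ
  have hκ0 : 0 < κ := by positivity
  have s1 : ContDiff ℝ (⊤ : ℕ∞) (fun x : E n => -β * q (x - y)) := contDiff_const.mul (q_shift_smooth y)
  have l1 : LC (fun x : E n => q (x - y)) := LC.of_smooth (q_shift_smooth y)
  have l2 : LC (fun x : E n => q (x - x0)) := LC.of_smooth (q_shift_smooth x0)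
  set G : ℝ → ℝ := fun t => Real.exp (-β * t) with hG
  have hGc : ContDiff ℝ 2 G := Real.contDiff_exp.comp (contDiff_const.mul contDiff_id)
  have hGd : deriv G = fun t => -β * G t := by
    funext t
    have := ((hasDerivAt_id t).const_mul (-β)).exp
    simp only [hG]
    rw [show (fun t => Real.exp (-β * t)) = fun x => Real.exp (-β * id x) from rfl, this.deriv]; simp; ring
  have hGdd : deriv (deriv G) = fun t => β ^ 2 * G t := by
    rw [hGd]; funext t
    rw [deriv_const_mul _ ((hGc.differentiable (by simp)) t), hGd]; ring
  have l3 : LC (fun x : E n => G (q (x - y))) := l1.comp fun x => hGc.contDiffAt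
  have l4 : LC (fun x : E n => G (q (x - y)) - Real.exp (-β * R2)) := l3.sub (LC.const _)
  have l5 : LC (fun x : E n => κ * q (x - x0)) := l2.smul κ
  refine ⟨β, κ, hβ0, hκ0, l4.sub l5, ?_⟩
  filter_upwards [hell, hK, l1.ae, l2.ae, l3.ae, l4.ae, l5.ae] with x h1 h2 d1 d2 d3 d4 d5 hx1 hx2 hx3
  change 0 < LU u (fun x => (G (q (x - y)) - Real.exp (-β * R2)) - κ * q (x - x0)) x
  have d0 : DifferentiableAt ℝ (fderiv ℝ (fun _ : E n => Real.exp (-β * R2))) x := by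
    simp
  have e1 : LU u (fun x : E n => q (x - y)) x = LB (hC (D2 u x)).adjugate (D2 q (x - y)) := by
    unfold LU; rw [D2_shift]
  have e2 : LU u (fun x : E n => q (x - x0)) x = LB (hC (D2 u x)).adjugate (D2 q (x - x0)) := by
    unfold LU; rw [D2_shift]
  rw [LU_sub l4 l5 d4 d5, LU_sub l3 (LC.const _) d3 d0, LU_const, LU_smul κ l2, sub_zero,
    LU_comp l1 (fun x => hGc.contDiffAt) d1, e1, e2, fderiv_shift, hGdd, hGd]
  have a1 := LB_ell hl'.le (hadj _ h1 (fun i j => hC_norm_le h2 i j)) (fderiv ℝ q (x - y))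
  have a2 := abs_le.1 (hbd _ (D2 q (x - y)) h2)
  have a3 := abs_le.1 (hbd _ (D2 q (x - x0)) h2)
  have n1 : ‖D2 q (x - y)‖ ≤ D := hD _ (by
    have := norm_sub_le x y; have := le_abs_self Q; have := norm_nonneg x0; linarith)
  have n2 : ‖D2 q (x - x0)‖ ≤ D := hD _ (by
    have := norm_sub_le x x0; have := le_abs_self Q; have := norm_nonneg y; linarith)
  have a4 := q_grad (x - y)
  rw [← hc] at a1
  set A := LB (hC (D2 u x)).adjugate (tp (fderiv ℝ q (x - y)) (fderiv ℝ q (x - y)))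
  set B1 := LB (hC (D2 u x)).adjugate (D2 q (x - y))
  set B2 := LB (hC (D2 u x)).adjugate (D2 q (x - x0))
  have b1 : B1 ≤ C * D := a2.2.trans (by gcongr)
  have b2 : B2 ≤ C * D := a3.2.trans (by gcongr)
  have b3 : 2 * c * R2 ≤ A := by nlinarith
  have b4 : C * D + 1 ≤ β * A := by
    calc C * D + 1 = β * (2 * c * R2) := by rw [hβ]; field_simp
      _ ≤ _ := by gcongr
  have g1 : Real.exp (-β * Q) ≤ G (q (x - y)) := Real.exp_le_exp.2 (by nlinarith)
  have g0 : 0 < Real.exp (-β * Q) := Real.exp_pos _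
  have k1 : κ * (C * D + 1) = β * Real.exp (-β * Q) / 2 := by rw [hκ]; field_simp
  have c1 : β * Real.exp (-β * Q) ≤ β * G (q (x - y)) * (β * A - B1) := by
    have : β * Real.exp (-β * Q) * 1 ≤ β * G (q (x - y)) * (β * A - B1) := by
      apply mul_le_mul _ (by linarith) (by norm_num) (by positivity)
      gcongr
    linarith
  have c2 : κ * B2 ≤ β * Real.exp (-β * Q) / 2 := by rw [← k1]; gcongr; linarith
  have c3 : 0 < β * Real.exp (-β * Q) := by positivity
  nlinarith

theorem smp {u : E n → ℝ} (hu : LC u) {l K : ℝ} (hl : 0 < l) (hK0 : 0 ≤ K) (hell : ∀ᵐ x, Ell l (hC (D2 u x)))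
    (hK : ∀ᵐ x, ‖D2 u x‖ ≤ K) {v : E n → ℝ} {r : ℝ} (hvc : ContinuousOn v (Metric.ball 0 r))
    (hv0 : ∀ x, ‖x‖ < r → 0 ≤ v x)
    (happ : ∀ δ > 0, ∃ v' : E n → ℝ, LC v' ∧ (∀ x, ‖x‖ < r → |v' x - v x| ≤ δ) ∧ ∀ᵐ x, ‖x‖ < r → LU u v' x ≤ 0)
    (h0 : v 0 = 0) : ∀ y, (n + 1) * ‖y‖ < r → v y = 0 := by
  intro y hy
  by_contra hvy
  have hr : 0 < r := lt_of_le_of_lt (by positivity) hy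
  set ρ := (n + 1) * ‖y‖ with hρ
  have hρ0 : 0 ≤ ρ := by positivity
  have hsub : Metric.closedBall (0 : E n) ρ ⊆ Metric.ball 0 r := Metric.closedBall_subset_ball hy
  set Z : Set (E n) := Metric.closedBall 0 ρ ∩ v ⁻¹' {0} with hZ
  have hZc : IsCompact Z :=
    (isCompact_closedBall _ _).of_isClosed_subset
      ((hvc.mono hsub).preimage_isClosed_of_isClosed Metric.isClosed_closedBall isClosed_singleton) Set.inter_subset_left
  have hZn : Z.Nonempty := ⟨0, by simp [hρ0], h0⟩
  have hqc : ∀ a : E n, Continuous fun x => q (x - a) := fun a => (q_shift_smooth a).continuous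
  obtain ⟨x0, hx0, hmin⟩ := hZc.exists_isMinOn hZn (hqc y).continuousOn
  set R2 := q (x0 - y) with hR2
  have hR2pos : 0 < R2 := by
    rcases (q_nonneg (x0 - y)).lt_or_eq with h | h
    · exact h
    · exfalso
      have := q_zero_iff.1 h.symm
      rw [sub_eq_zero] at this
      exact hvy (this ▸ hx0.2)
  have hR2y : R2 ≤ (n * ‖y‖) ^ 2 := by
    have h1 : q (x0 - y) ≤ q (0 - y) := hmin ⟨by simp [hρ0], h0⟩
    have h2 := q_le (0 - y)
    rw [zero_sub, norm_neg] at h2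
    rw [zero_sub] at h1
    exact h1.trans h2
  have hpos : ∀ x, q (x - y) < R2 → 0 < v x := by
    intro x hx
    have h1 := norm_le_q (x - y)
    have h2 : ‖x - y‖ ≤ n * ‖y‖ := by
      apply abs_le_of_sq_le_sq' _ (by positivity) |>.2
      linarith
    have h3 : ‖x‖ ≤ ρ := by
      have := norm_le_norm_sub_add x y
      rw [hρ]; linarith
    rcases (hv0 x (by linarith)).lt_or_eq with h | h
    · exact h
    · exfalso
      have : q (x0 - y) ≤ q (x - y) := hmin ⟨by simpa using h3, h.symm⟩
      linarith
  have hx0r : ‖x0‖ < r := lt_of_le_of_lt (by simpa using hx0.1) hy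
  have hvx0 : v x0 = 0 := hx0.2
  -- small neighbourhood
  have hnb : ∀ᶠ x in 𝓝 x0, ‖x‖ < r ∧ R2 / 2 < q (x - y) ∧ q (x - y) < R2 + 1 :=
    by
    filter_upwards [(isOpen_lt continuous_norm continuous_const).mem_nhds hx0r,
      (isOpen_lt continuous_const (hqc y)).mem_nhds (show R2 / 2 < q (x0 - y) by linarith),
      (isOpen_lt (hqc y) continuous_const).mem_nhds (show q (x0 - y) < R2 + 1 by linarith)] with x h1 h2 h3
    exact ⟨h1, h2, h3⟩
  obtain ⟨δ, hδ, hball⟩ := Metric.eventually_nhds_iff.1 hnb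
  set s2 := δ ^ 2 / 2 with hs2
  have hs2pos : 0 < s2 := by positivity
  have hD : ∀ x, q (x - x0) ≤ s2 → ‖x‖ < r ∧ R2 / 2 < q (x - y) ∧ q (x - y) < R2 + 1 := by
    intro x hx
    apply hball
    rw [dist_eq_norm]
    have h1 := norm_le_q (x - x0)
    have h2 : ‖x - x0‖ ^ 2 < δ ^ 2 := by rw [hs2] at hx; nlinarith
    exact lt_of_pow_lt_pow_left₀ 2 hδ.le h2
  obtain ⟨β, κ, hβ, hκ, hLC, hbar⟩ := barrier hl hK0 hell hK y x0 (max r (R2 + 1)) R2 hR2pos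
  set h : E n → ℝ := fun x => Real.exp (-β * q (x - y)) - Real.exp (-β * R2) - κ * q (x - x0) with hh
  have hhx0 : h x0 = 0 := by simp [hh, q_zero_iff.2, hR2]
  have hh1 : ∀ x, h x ≤ 1 := by
    intro x
    have a1 : Real.exp (-β * q (x - y)) ≤ 1 := Real.exp_le_one_iff.2 (by nlinarith [q_nonneg (x - y)])
    have a2 := Real.exp_pos (-β * R2)
    have a3 := mul_nonneg hκ.le (q_nonneg (x - x0))
    simp only [hh]; linarith
  set sh : Set (E n) := {x | s2 / 2 ≤ q (x - x0) ∧ q (x - x0) ≤ s2} with hsh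
  have shcl : IsClosed sh := (isClosed_le continuous_const (hqc x0)).inter (isClosed_le (hqc x0) continuous_const)
  have shbd : ∀ x, q (x - x0) ≤ s2 → ‖x‖ ≤ r := fun x hx => (hD x hx).1.le
  have shc : IsCompact sh := (isCompact_closedBall (0 : E n) r).of_isClosed_subset shcl
    fun x hx => by simpa using shbd x hx.2
  have shv : ContinuousOn v sh := hvc.mono fun x hx => by simpa using (hD x hx.2).1
  have Kc : IsCompact (sh ∩ {x | 0 ≤ h x}) := shc.inter_right (isClosed_le continuous_const hLC.cont)
  have hKpos : ∀ x ∈ sh ∩ {x | 0 ≤ h x}, 0 < v x := by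
    rintro x ⟨hx1, hx2⟩
    apply hpos
    have a3 : 0 < κ * q (x - x0) := mul_pos hκ (by have := hx1.1; linarith)
    have a4 : Real.exp (-β * R2) < Real.exp (-β * q (x - y)) := by
      simp only [hh, Set.mem_setOf_eq] at hx2; linarith
    have a5 := Real.exp_lt_exp.1 a4
    nlinarith
  obtain ⟨σ0, hσ0, hσ⟩ := Kc.exists_forall_le' (shv.mono Set.inter_subset_left) hKpos
  set ε := σ0 / 2 with hε
  have hε0 : 0 < ε := by positivity
  have hpos2 : ∀ x ∈ sh, 0 < v x - ε * h x := by
    intro x hx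
    by_cases hx0 : 0 ≤ h x
    · have := hσ x ⟨hx, hx0⟩
      have := mul_le_mul_of_nonneg_left (hh1 x) hε0.le
      linarith
    · have := hv0 x (hD x hx.2).1
      push Not at hx0
      nlinarith
  obtain ⟨σ, hσpos, hσ'⟩ := shc.exists_forall_le' (shv.sub (hLC.cont.const_mul ε).continuousOn) hpos2
  obtain ⟨v', hv'LC, hv'1, hv'2⟩ := happ (σ / 4) (by positivity)
  have lw : LC (fun x => v' x - ε * h x) := hv'LC.sub (hLC.smul ε)
  have fin := wmp (m := 3 * σ / 4) hu lw (q_shift_smooth x0) (show s2 / 2 < s2 by linarith) shbd ?_ ?_ ?_ x0 ?_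
  · have := abs_le.1 (hv'1 x0 hx0r)
    rw [hhx0] at fin; rw [hvx0] at this
    simp at fin
    linarith [this.2]
  · intro x h1 h2
    have a1 : σ ≤ v x - ε * h x := hσ' x ⟨h1, h2⟩
    have a2 := abs_le.1 (hv'1 x (hD x h2).1)
    linarith [a2.1]
  · obtain ⟨l', hl', hadj⟩ := adj_ell n hl K hK0
    filter_upwards [hell, hK] with x h1 h2 _ p
    refine le_trans ?_ (LB_ell hl'.le (hadj _ h1 (fun i j => hC_norm_le h2 i j)) p)
    positivity
  · filter_upwards [hbar, hv'2, hv'LC.ae, (hLC.smul ε).ae] with x h1 h2 d1 d2 hx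
    have a := hD x hx.le
    have b1 := h1 a.2.1.le (a.1.le.trans (le_max_left _ _)) (a.2.2.le.trans (le_max_right _ _))
    have b2 := h2 a.1
    rw [LU_sub hv'LC (hLC.smul ε) d1 d2, LU_smul ε hLC]
    nlinarith
  · simp [q_zero_iff.2, hs2pos]

theorem ae_sub_left {p : E n → Prop} (h : ∀ᵐ x, p x) (a : E n) : ∀ᵐ x, p (a - x) := by
  have := ae_aff h a (r := -1) (by norm_num)
  filter_upwards [this] with x hx
  have e : a - x = a + (-1 : ℝ) • x := by module
  rw [e]; exact hx

theorem mol_mem {F : Type*} [NormedAddCommGroup F] [NormedSpace ℝ F] [FiniteDimensional ℝ F]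
    {v : E n → F} (hv : LBM v) {k : E n → ℝ} (hk : Continuous k)
    (hc : HasCompactSupport k) (h0 : ∀ x, 0 ≤ k x) (h1 : ∫ x, k x = 1) {C : Set F}
    (hC1 : Convex ℝ C) (hC2 : IsClosed C) {x : E n}
    (h : ∀ᵐ y, k (x - y) ≠ 0 → v y ∈ C) : mol k v x ∈ C := by
  have hmk : Measurable (fun t => ENNReal.ofReal (k t)) := hk.measurable.ennreal_ofReal
  have hfin : ∀ᵐ t : E n, ENNReal.ofReal (k t) < ⊤ := ae_of_all _ fun t => ENNReal.ofReal_lt_top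
  have hitg : Integrable k volume := hk.integrable_of_hasCompactSupport hc
  have hp : IsProbabilityMeasure ((volume : Measure (E n)).withDensity fun t => ENNReal.ofReal (k t)) := by
    constructor
    rw [withDensity_apply _ MeasurableSet.univ, Measure.restrict_univ,
      ← ofReal_integral_eq_lintegral_ofReal hitg (ae_of_all _ h0), h1, ENNReal.ofReal_one]
  have e : mol k v x = ∫ t, v (x - t) ∂((volume : Measure (E n)).withDensity fun t => ENNReal.ofReal (k t)) := by
    rw [integral_withDensity_eq_integral_toReal_smul hmk hfin]
    simp [mol, ENNReal.toReal_ofReal (h0 _)]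
  rw [e]
  refine hC1.integral_mem hC2 ?_ ?_
  · rw [ae_withDensity_iff hmk]
    have := ae_sub_left h x
    filter_upwards [this] with t ht hne
    apply ht
    rw [sub_sub_cancel]
    intro h; rw [h] at hne; simp at hne
  · rw [integrable_withDensity_iff_integrable_smul' hmk hfin]
    have := mol_int hv hk hc x
    simpa [ENNReal.toReal_ofReal (h0 _)] using this

theorem mol_norm_le {F : Type*} [NormedAddCommGroup F] [NormedSpace ℝ F] [FiniteDimensional ℝ F]
    {v : E n → F} (hv : LBM v) {k : E n → ℝ} (hk : Continuous k)
    (hc : HasCompactSupport k) (h0 : ∀ x, 0 ≤ k x) (h1 : ∫ x, k x = 1) {K : ℝ} {x : E n}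
    (h : ∀ᵐ y, k (x - y) ≠ 0 → ‖v y‖ ≤ K) : ‖mol k v x‖ ≤ K := by
  have := mol_mem (C := Metric.closedBall (0 : F) K) hv hk hc h0 h1 (convex_closedBall (0 : F) K)
    Metric.isClosed_closedBall (x := x) (by simpa using h)
  simpa using this

theorem lip_of_D2 {u : E n → ℝ} (hu : LC u) {a : E n} {R K : ℝ}
    (h : ∀ᵐ x, ‖x - a‖ < R → ‖D2 u x‖ ≤ K) {x y : E n} (hx : ‖x - a‖ < R) (hy : ‖y - a‖ < R) :
    ‖fderiv ℝ u x - fderiv ℝ u y‖ ≤ K * ‖x - y‖ := by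
  set R' := max ‖x - a‖ ‖y - a‖ with hR'
  have hlt : R' < R := max_lt hx hy
  have key : ∀ᶠ k : ℕ in atTop, ‖mol (kb n k) (fderiv ℝ u) x - mol (kb n k) (fderiv ℝ u) y‖ ≤ K * ‖x - y‖ := by
    have : ∀ᶠ k : ℕ in atTop, 1 / ((k:ℝ) + 1) < R - R' :=
      tendsto_one_div_add_atTop_nhds_zero_nat.eventually (gt_mem_nhds (by linarith))
    filter_upwards [this] with k hk
    refine Convex.norm_image_sub_le_of_norm_hasFDerivWithin_le (s := Metric.closedBall a R')
      (f' := fun z => mol (kb n k) (D2 u) z) (fun z _ => ?_) (fun z hz => ?_)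
      (convex_closedBall a R') ?_ ?_
    · exact (mol_hasFDerivAt hu.lip (kb_cont k) (kb_cs k) z).hasFDerivWithinAt
    · refine mol_norm_le hu.lbm (kb_cont k) (kb_cs k) (kb_nonneg k) (kb_int k) ?_
      · filter_upwards [h] with t ht hne
        apply ht
        have h1 := kb_supp k hne
        rw [mem_closedBall_iff_norm] at hz
        have : t - a = (z - a) - (z - t) := by abel
        rw [this]
        refine lt_of_le_of_lt (norm_sub_le _ _) ?_
        linarith
    · rw [mem_closedBall_iff_norm]; exact le_max_right _ _
    · rw [mem_closedBall_iff_norm]; exact le_max_left _ _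
  have l1 := ((mol_tendsto_cont hu.contD x).sub (mol_tendsto_cont hu.contD y)).norm
  exact le_of_tendsto l1 key

/-- quadratic polynomials -/
noncomputable def qd (c : ℝ) (p : E n →L[ℝ] ℝ) (S : Bil n) (x : E n) : ℝ := c + p x + S x x / 2

theorem qd_smooth (c : ℝ) (p : E n →L[ℝ] ℝ) (S : Bil n) : ContDiff ℝ (⊤ : ℕ∞) (qd c p S) := by
  unfold qd
  have h : ContDiff ℝ (⊤ : ℕ∞) (fun x => S x x) := S.contDiff.clm_apply contDiff_id
  exact (contDiff_const.add p.contDiff).add (h.div_const 2)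

theorem qd_lc (c : ℝ) (p : E n →L[ℝ] ℝ) (S : Bil n) : LC (qd c p S) := LC.of_smooth (qd_smooth c p S)

theorem qd_fderiv (c : ℝ) (p : E n →L[ℝ] ℝ) {S : Bil n} (hS : ∀ v w, S v w = S w v) :
    fderiv ℝ (qd c p S) = fun x => p + S x := by
  funext x
  have h1 : HasFDerivAt (fun x => S x x) _ x := S.hasFDerivAt.clm_apply (hasFDerivAt_id x)
  have h2 : HasFDerivAt (qd c p S) _ x := ((hasFDerivAt_const c x).add p.hasFDerivAt).add (h1.mul_const (1/2 : ℝ)) |>.congr_of_eventuallyEq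
    (Filter.Eventually.of_forall fun y => by simp [qd]; ring)
  rw [h2.fderiv]
  ext v
  simp
  rw [hS v x]; ring

theorem qd_D2 (c : ℝ) (p : E n →L[ℝ] ℝ) {S : Bil n} (hS : ∀ v w, S v w = S w v) (x : E n) :
    D2 (qd c p S) x = S := by
  unfold D2
  rw [qd_fderiv c p hS]
  exact (S.hasFDerivAt.const_add p).fderiv

end CMA

namespace CMA
open MeasureTheory Filter Topology
open scoped ComplexOrder Matrix
set_option maxSynthPendingDepth 3
variable {n : ℕ}

/-- real part of the determinant of the complex Hessian part -/
noncomputable def dt (S : Bil n) : ℝ := (hC S).det.re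

theorem dt_cont : Continuous (dt : Bil n → ℝ) :=
  Complex.continuous_re.comp (hC_cont.matrix_det)

theorem dt_lip (n : ℕ) {K : ℝ} (hK : 0 ≤ K) : ∃ C, 0 ≤ C ∧ ∀ S T : Bil n, ‖S‖ ≤ K → ‖T‖ ≤ K →
    ∀ η, 0 ≤ η → (∀ i j, ‖hC S i j - hC T i j‖ ≤ η) → |dt S - dt T| ≤ C * η := by
  obtain ⟨C, hC0, h⟩ := det_lip n K hK
  refine ⟨C, hC0, fun S T hS hT η h0 hη => ?_⟩
  have h1 := h (hC S) (hC T) η h0 (fun i j => hC_norm_le hS i j) (fun i j => hC_norm_le hT i j) hη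
  refine le_trans ?_ h1
  unfold dt
  rw [← Complex.sub_re]
  exact Complex.abs_re_le_norm _

theorem dt_bd (n : ℕ) {K : ℝ} (hK : 0 ≤ K) : ∃ C, 0 ≤ C ∧ ∀ S : Bil n, ‖S‖ ≤ K → |dt S| ≤ C := by
  obtain ⟨C, hC0, h⟩ := dt_lip n hK
  refine ⟨C * K + |dt (0 : Bil n)|, by positivity, fun S hS => ?_⟩
  have hz : ‖(0 : Bil n)‖ ≤ K := by rw [norm_zero]; exact hK
  have := h S 0 hS hz K hK (fun i j => by
    rw [hC_zero, Matrix.zero_apply, sub_zero]; exact hC_norm_le hS i j)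
  have h2 : dt S = (dt S - dt (0 : Bil n)) + dt (0 : Bil n) := by ring
  rw [h2]; exact (abs_add_le _ _).trans (by linarith)

theorem dtm {f : E n → Bil n} (hf : AEStronglyMeasurable f volume) :
    AEStronglyMeasurable (fun x => dt (f x)) volume := by
  have := dt_cont.comp_aestronglyMeasurable hf
  exact this

theorem dt_hasDeriv (S T : Bil n) (t : ℝ) :
    HasDerivAt (fun s : ℝ => dt (S + s • T)) (LB (hC (S + t • T)).adjugate T) t := by
  have h := Complex.reCLM.hasFDerivAt.comp_hasDerivAt t (hasDerivAt_det (hC S) (hC T) t)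
  have e : (fun s : ℝ => dt (S + s • T)) = Complex.reCLM ∘ fun s : ℝ => (hC S + (s:ℂ) • hC T).det := by
    funext s; simp [dt, hC_add, hC_smul]
  rw [e]
  refine h.congr_deriv ?_; symm; unfold LB
  rw [hC_add, hC_smul]; rfl

theorem lbm_comb {f g : E n → Bil n} (hf : LBM f) (hg : LBM g) (t : ℝ) : LBM (fun x => f x + t • g x) where
  meas := hf.meas.add (hg.meas.const_smul t)
  bd := fun R => by
    obtain ⟨K1, h1, h2⟩ := hf.bd R
    obtain ⟨K2, h3, h4⟩ := hg.bd R
    refine ⟨K1 + |t| * K2, by positivity, fun x hx => (norm_add_le _ _).trans ?_⟩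
    rw [norm_smul, Real.norm_eq_abs]
    have := mul_le_mul_of_nonneg_left (h4 x hx) (abs_nonneg t)
    linarith [h2 x hx]

theorem det_mvt {f g : E n → Bil n} (hf : LBM f) (hg : LBM g) {θ : E n → ℝ}
    (hm : AEStronglyMeasurable θ volume) {R C : ℝ} (hb : ∀ x, ‖x‖ ≤ R → |θ x| ≤ C)
    (hs : ∀ x, R < ‖x‖ → θ x = 0) : ∃ t ∈ Set.Ioo (0:ℝ) 1,
      ∫ x, θ x * (dt (f x + g x) - dt (f x)) =
      ∫ x, θ x * LB (hC (f x + t • g x)).adjugate (g x) := by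
  by_cases hCn : 0 ≤ C
  swap
  · have hz : ∀ x, θ x = 0 := fun x => by
      rcases le_or_gt ‖x‖ R with h | h
      · have := hb x h; have := abs_nonneg (θ x); linarith
      · exact hs x h
    exact ⟨1/2, by norm_num, by simp [hz]⟩
  obtain ⟨K1, h1, h2⟩ := hf.bd R
  obtain ⟨K2, h3, h4⟩ := hg.bd R
  have hK : 0 ≤ K1 + 2 * K2 := by positivity
  have hcomb : ∀ t : ℝ, t ∈ Set.Ioo (-1:ℝ) 2 → ∀ x, ‖x‖ ≤ R → ‖f x + t • g x‖ ≤ K1 + 2 * K2 := by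
    intro t ht x hx
    refine (norm_add_le _ _).trans ?_
    rw [norm_smul, Real.norm_eq_abs]
    have ha : |t| ≤ 2 := abs_le.2 ⟨by linarith [ht.1], by linarith [ht.2]⟩
    have := mul_le_mul ha (h4 x hx) (norm_nonneg _) (by norm_num)
    linarith [h2 x hx]
  obtain ⟨Cd, hCd, hd⟩ := dt_bd n hK
  obtain ⟨CL, hCL, hL⟩ := LU_bd n hK
  have hitg : ∀ t : ℝ, t ∈ Set.Ioo (-1:ℝ) 2 → Integrable (fun x => θ x * dt (f x + t • g x)) volume := by
    intro t ht
    refine int_of_bd (R := R) (C := C * Cd) (hm.mul (dtm (lbm_comb hf hg t).meas)) ?_ ?_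
    · intro x hx
      rw [abs_mul]
      exact mul_le_mul (hb x hx) (hd _ (hcomb t ht x hx)) (abs_nonneg _) hCn
    · intro x hx; rw [hs x hx, zero_mul]
  have hder : ∀ t : ℝ, t ∈ Set.Ioo (-1:ℝ) 2 → HasDerivAt (fun t : ℝ => ∫ x, θ x * dt (f x + t • g x))
      (∫ x, θ x * LB (hC (f x + t • g x)).adjugate (g x)) t := by
    intro t ht
    refine (hasDerivAt_integral_of_dominated_loc_of_deriv_le (s := Set.Ioo (-1:ℝ) 2)
      (bound := (Metric.closedBall (0:E n) R).indicator fun _ => C * (CL * K2))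
      (F := fun t x => θ x * dt (f x + t • g x))
      (F' := fun t x => θ x * LB (hC (f x + t • g x)).adjugate (g x))
      (Ioo_mem_nhds ht.1 ht.2) (Eventually.of_forall fun t => hm.mul (dtm (lbm_comb hf hg t).meas))
      (hitg t ht) (hm.mul (LBm (lbm_comb hf hg t).meas hg.meas)) (ae_of_all _ fun x s hs' => ?_)
      ?_ (ae_of_all _ fun x s _ => ?_)).2
    · by_cases hx : ‖x‖ ≤ R
      · rw [Set.indicator_of_mem (by simpa using hx), Real.norm_eq_abs, abs_mul]
        refine mul_le_mul (hb x hx) ((hL _ _ (hcomb s hs' x hx)).trans ?_) (abs_nonneg _) hCn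
        exact mul_le_mul_of_nonneg_left (h4 x hx) hCL
      · rw [hs x (not_le.1 hx), Set.indicator_of_notMem (by simpa using hx)]; simp
    · exact (integrable_indicator_iff Metric.isClosed_closedBall.measurableSet).2
        (integrableOn_const (isCompact_closedBall _ _).measure_lt_top.ne)
    · exact (dt_hasDeriv (f x) (g x) s).const_mul (θ x)
  obtain ⟨t, ht, e⟩ := exists_hasDerivAt_eq_slope (fun t : ℝ => ∫ x, θ x * dt (f x + t • g x))
    (fun t => ∫ x, θ x * LB (hC (f x + t • g x)).adjugate (g x)) (a := 0) (b := 1) one_pos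
    (fun t ht => (hder t ⟨by linarith [ht.1], by linarith [ht.2]⟩).continuousAt.continuousWithinAt)
    (fun t ht => hder t ⟨by linarith [ht.1], by linarith [ht.2]⟩)
  refine ⟨t, ht, ?_⟩
  have e0 := hitg 0 (by norm_num)
  have e1 := hitg 1 (by norm_num)
  have q1 := integral_sub e1 e0
  rw [sub_zero, div_one] at e
  rw [e, ← q1]
  refine integral_congr_ae (ae_of_all _ fun x => ?_)
  have z1 : f x + (1:ℝ) • g x = f x + g x := by rw [one_smul]
  have z0 : f x + (0:ℝ) • g x = f x := by rw [zero_smul]; exact add_zero _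
  simp only [z1, z0]; ring

theorem det_mvt_lc {u v θ : E n → ℝ} (hu : LC u) (hv : LC v)
    (hm : AEStronglyMeasurable θ volume) {R C : ℝ} (hb : ∀ x, ‖x‖ ≤ R → |θ x| ≤ C)
    (hs : ∀ x, R < ‖x‖ → θ x = 0) : ∃ t ∈ Set.Ioo (0:ℝ) 1, 
      LC (fun x => v x + t * (u x - v x)) ∧ 
      (∀ᵐ x, D2 (fun x => v x + t * (u x - v x)) x = (1 - t) • D2 v x + t • D2 u x) ∧
      ∫ x, θ x * (dt (D2 u x) - dt (D2 v x)) =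
      ∫ x, θ x * LU (fun x => v x + t * (u x - v x)) (fun x => u x - v x) x := by
  have hg : LBM (fun x => D2 u x + (-1 : ℝ) • D2 v x) := lbm_comb hu.lbm hv.lbm (-1)
  obtain ⟨t, ht, e⟩ := det_mvt hv.lbm hg hm hb hs
  have hlc : LC (fun x => v x + t * (u x - v x)) := hv.add ((hu.sub hv).smul t)
  have hD : ∀ᵐ x, D2 (fun x => v x + t * (u x - v x)) x = D2 v x + t • (D2 u x - D2 v x) := by
    filter_upwards [hu.ae, hv.ae, (hu.sub hv).ae, ((hu.sub hv).smul t).ae] with x h1 h2 h3 h4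
    rw [D2_add hv ((hu.sub hv).smul t) h2 h4, D2_smul t (hu.sub hv), D2_sub hu hv h1 h2]
  refine ⟨t, ht, hlc, ?_, ?_⟩
  · filter_upwards [hD] with x hx
    rw [hx]; module
  · have e1 : (fun x => θ x * (dt (D2 u x) - dt (D2 v x))) =
        fun x => θ x * (dt (D2 v x + (D2 u x + (-1 : ℝ) • D2 v x)) - dt (D2 v x)) := by
      funext x
      have : D2 v x + (D2 u x + (-1 : ℝ) • D2 v x) = D2 u x := by module
      rw [this]
    rw [e1, e]
    refine integral_congr_ae ?_
    filter_upwards [hD, hu.ae, hv.ae] with x hx h1 h2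
    have h3 : D2 u x + (-1 : ℝ) • D2 v x = D2 u x - D2 v x := by module
    simp only [LU]
    rw [hx, D2_sub hu hv h1 h2, h3]

theorem det_test {u v ψ : E n → ℝ} (hu : LC u) (hv : LC v) (hψ : LC ψ) (hc : HasCompactSupport ψ) :
    ∃ t ∈ Set.Ioo (0:ℝ) 1, ∫ x, ψ x * (dt (D2 u x) - dt (D2 v x)) =
      ∫ x, (u x - v x) * LB (hC ((1 - t) • D2 v x + t • D2 u x)).adjugate (D2 ψ x) := by
  obtain ⟨R, hR, hz⟩ := zero_of_cs hc
  obtain ⟨C, hC0, hb⟩ := (lbm_cont hψ.cont).bd R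
  obtain ⟨t, ht, h1, h2, h3⟩ := det_mvt_lc hu hv hψ.cont.aestronglyMeasurable hb hz
  refine ⟨t, ht, ?_⟩
  rw [h3, T1 h1 (hu.sub hv) hψ hc]
  refine integral_congr_ae ?_
  filter_upwards [h2] with x hx
  simp only [LU, hx]

theorem mol_comm {F : Type*} [NormedAddCommGroup F] [NormedSpace ℝ F] (k : E n → ℝ) (v : E n → F) (x : E n) :
    mol k v x = ∫ t, k (x - t) • v t := by
  unfold mol
  rw [← integral_sub_left_eq_self (fun t => k t • v (x - t)) volume x]
  simp

theorem molD2 {u k : E n → ℝ} (hu : Continuous u) (hk : ContDiff ℝ (⊤ : ℕ∞) k) (hc : HasCompactSupport k) (x : E n) :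
    D2 (mol k u) x = ∫ t, u t • D2 k (x - t) := by
  obtain ⟨R, hR, hz⟩ := zero_of_cs hc
  obtain ⟨χ, c1, c2, c3, c4⟩ := exists_cutoff n (‖x‖ + 1 + R)
  have hk' : LC k := LC.of_smooth hk
  have hcu : Continuous (fun t => χ t * u t) := c1.continuous.mul hu
  have hcs : HasCompactSupport (fun t => χ t * u t) := c2.mul_right
  have hout : ∀ y : E n, ‖y‖ ≤ ‖x‖ + 1 → ∀ t : E n, ‖x‖ + 1 + R < ‖t‖ → R < ‖y - t‖ := by
    intro y hy t ht
    have := norm_sub_norm_le t y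
    rw [norm_sub_rev] at this
    linarith
  have e1 : D2 (mol k u) x = D2 (mol (fun t => χ t * u t) k) x := by
    apply D2_congr
    have : ∀ᶠ y in 𝓝 x, ‖y‖ < ‖x‖ + 1 := continuous_norm.continuousAt.eventually_lt continuousAt_const (by simp)
    filter_upwards [this] with y hy
    rw [mol_comm, mol]
    refine integral_congr_ae (ae_of_all _ fun t => ?_)
    simp only [smul_eq_mul]
    rcases le_or_gt ‖t‖ (‖x‖ + 1 + R) with h | h
    · rw [c3 t h]; ring
    · rw [hz _ (hout y hy.le t h)]; ring
  rw [e1, mol_D2 hk' hcu hcs, mol]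
  refine integral_congr_ae (ae_of_all _ fun t => ?_)
  simp only
  rcases le_or_gt ‖t‖ (‖x‖ + 1 + R) with h | h
  · rw [c3 t h, one_mul]
  · rw [D2_zero_out hz (hout x (by linarith) t h), smul_zero, smul_zero]

/-- second order Taylor bound -/
theorem taylor2 {u : E n → ℝ} (hu : LC u) {a : E n} {R K : ℝ} (hK : 0 ≤ K)
    (h : ∀ᵐ x, ‖x - a‖ < R → ‖D2 u x‖ ≤ K) {x y : E n} (hx : ‖x - a‖ < R) (hy : ‖y - a‖ < R) :
    |u y - u x - fderiv ℝ u x (y - x)| ≤ K * ‖y - x‖ ^ 2 := by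
  have h1 := Convex.norm_image_sub_le_of_norm_hasFDerivWithin_le' (s := segment ℝ x y) (f := u)
    (f' := fun z => fderiv ℝ u z) (φ := fderiv ℝ u x) (C := K * ‖y - x‖) (x := x) (y := y)
    (fun z _ => (hu.diff z).hasFDerivAt.hasFDerivWithinAt) ?_ (convex_segment x y)
    (left_mem_segment ℝ x y) (right_mem_segment ℝ x y)
  · rw [Real.norm_eq_abs] at h1
    nlinarith
  · intro z hz
    have hzb : z ∈ Metric.ball a R := (convex_ball a R).segment_subset
      (by rwa [mem_ball_iff_norm]) (by rwa [mem_ball_iff_norm]) hz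
    rw [mem_ball_iff_norm] at hzb
    refine (lip_of_D2 hu h hzb hx).trans (mul_le_mul_of_nonneg_left ?_ hK)
    obtain ⟨s, hs, rfl⟩ := (segment_eq_image' ℝ x y ▸ hz : z ∈ (fun θ : ℝ => x + θ • (y - x)) '' Set.Icc 0 1)
    simp only [add_sub_cancel_left, norm_smul, Real.norm_eq_abs, abs_of_nonneg hs.1]
    exact mul_le_of_le_one_left (norm_nonneg _) hs.2

theorem ulim {F : Type*} [NormedAddCommGroup F] [ProperSpace F] {a : ℕ → F} {B : ℝ}
    (h : ∀ᶠ k in (hyperfilter ℕ : Filter ℕ), ‖a k‖ ≤ B) : ∃ l, Tendsto a (hyperfilter ℕ) (𝓝 l) := by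
  obtain ⟨l, _, hl⟩ := (isCompact_closedBall (0:F) B).ultrafilter_le_nhds' ((hyperfilter ℕ).map a) (by
    rw [Ultrafilter.mem_map]
    filter_upwards [h] with k hk
    simpa using hk)
  exact ⟨l, hl⟩

theorem compactness {C : Set (Bil n)} (hconv : Convex ℝ C) (hcl : IsClosed C) {K : ℝ} (hK0 : 0 ≤ K)
    (hK : ∀ S ∈ C, ‖S‖ ≤ K) {u : ℕ → E n → ℝ} (hu : ∀ k, LC (u k)) (h0 : ∀ k, u k 0 = 0)
    (h1 : ∀ k, fderiv ℝ (u k) 0 = 0) {R δ : ℕ → ℝ} (hR : Tendsto R atTop atTop)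
    (hδ : Tendsto δ atTop (𝓝 0)) {F0 : ℝ} (hD : ∀ k, ∀ᵐ x, ‖x‖ < R k → D2 (u k) x ∈ C)
    (hdet : ∀ k, ∀ᵐ x, ‖x‖ < R k → |dt (D2 (u k) x) - F0| ≤ δ k) :
    ∃ v, LC v ∧ v 0 = 0 ∧ fderiv ℝ v 0 = 0 ∧ (∀ᵐ x, D2 v x ∈ C) ∧ (∀ᵐ x, dt (D2 v x) = F0) ∧
      ∀ r η : ℝ, 0 < η → ∀ᶠ k in (hyperfilter ℕ : Filter ℕ), ∀ x, ‖x‖ ≤ r → |u k x - v x| ≤ η := by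
  have hRe : ∀ r : ℝ, ∀ᶠ k in (hyperfilter ℕ : Filter ℕ), r < R k := fun r =>
    Nat.hyperfilter_le_atTop (hR.eventually_gt_atTop r)
  have hb : ∀ k, ∀ᵐ x, ‖x - 0‖ < R k → ‖D2 (u k) x‖ ≤ K := fun k => by
    filter_upwards [hD k] with x hx h
    exact hK _ (hx (by simpa using h))
  have hlip : ∀ k x y, ‖x‖ < R k → ‖y‖ < R k → ‖fderiv ℝ (u k) x - fderiv ℝ (u k) y‖ ≤ K * ‖x - y‖ :=
    fun k x y hx hy => lip_of_D2 (hu k) (hb k) (by simpa using hx) (by simpa using hy)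
  have hgr : ∀ k x, ‖x‖ < R k → ‖fderiv ℝ (u k) x‖ ≤ K * ‖x‖ := fun k x hx => by
    have := hlip k x 0 hx (by rw [norm_zero]; exact (norm_nonneg x).trans_lt hx)
    rwa [h1, sub_zero, sub_zero] at this
  have htay : ∀ k x y, ‖x‖ < R k → ‖y‖ < R k → |u k y - u k x - fderiv ℝ (u k) x (y - x)| ≤ K * ‖y - x‖ ^ 2 :=
    fun k x y hx hy => taylor2 (hu k) hK0 (hb k) (by simpa using hx) (by simpa using hy)
  have hsize : ∀ k x, ‖x‖ < R k → |u k x| ≤ K * ‖x‖ ^ 2 := fun k x hx => by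
    have := htay k 0 x (by rw [norm_zero]; exact (norm_nonneg x).trans_lt hx) hx
    simpa [h0, h1] using this
  have lim1 : ∀ x, ∃ l, Tendsto (fun k => u k x) (hyperfilter ℕ) (𝓝 l) := fun x =>
    ulim (B := K * ‖x‖ ^ 2) ((hRe ‖x‖).mono fun k hk => hsize k x hk)
  have lim2 : ∀ x, ∃ l, Tendsto (fun k => fderiv ℝ (u k) x) (hyperfilter ℕ) (𝓝 l) := fun x =>
    ulim (B := K * ‖x‖) ((hRe ‖x‖).mono fun k hk => hgr k x hk)
  choose v hv using lim1
  choose p hp using lim2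
  have vtay : ∀ x y, |v y - v x - p x (y - x)| ≤ K * ‖y - x‖ ^ 2 := fun x y => by
    have t1 : Tendsto (fun k => |u k y - u k x - fderiv ℝ (u k) x (y - x)|) (hyperfilter ℕ)
        (𝓝 |v y - v x - p x (y - x)|) :=
      (((hv y).sub (hv x)).sub (((ContinuousLinearMap.apply ℝ ℝ (y - x)).continuous.tendsto (p x)).comp (hp x))).abs
    refine le_of_tendsto t1 ?_
    filter_upwards [hRe ‖x‖, hRe ‖y‖] with k a b using htay k x y a b
  have vder : ∀ x, HasFDerivAt v (p x) x := fun x => by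
    refine HasFDerivAt.of_isLittleO ?_
    rw [Asymptotics.isLittleO_iff]
    intro c hc
    have : ∀ᶠ y in 𝓝 x, K * ‖y - x‖ < c := by
      have hcont : Continuous fun y : E n => K * ‖y - x‖ := by fun_prop
      exact hcont.continuousAt.eventually_lt continuousAt_const (by simpa using hc)
    filter_upwards [this] with y hy
    rw [Real.norm_eq_abs]
    refine (vtay x y).trans ?_
    nlinarith [norm_nonneg (y - x)]
  have plip : ∀ x y, ‖p x - p y‖ ≤ K * ‖x - y‖ := fun x y => by
    refine le_of_tendsto ((hp x).sub (hp y)).norm ?_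
    filter_upwards [hRe ‖x‖, hRe ‖y‖] with k a b using hlip k x y a b
  have hfd : fderiv ℝ v = p := funext fun x => (vder x).fderiv
  have hLC : LC v := by
    refine ⟨fun x => (vder x).differentiableAt, ?_⟩
    rw [hfd]
    have : LipschitzWith K.toNNReal p := LipschitzWith.of_dist_le_mul fun x y => by
      rw [dist_eq_norm, dist_eq_norm, Real.coe_toNNReal _ hK0]; exact plip x y
    exact this.locallyLipschitz
  have hv0 : v 0 = 0 := tendsto_nhds_unique (hv 0) (by simp [h0])
  have hp0 : p 0 = 0 := tendsto_nhds_unique (hp 0) (by simp [h1])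
  have hunif : ∀ r η : ℝ, 0 < η → ∀ᶠ k in (hyperfilter ℕ : Filter ℕ), ∀ x, ‖x‖ ≤ r → |u k x - v x| ≤ η := by
    intro r η hη
    rcases lt_or_ge r 0 with hr | hr
    · exact Eventually.of_forall fun k x hx => absurd (norm_nonneg x) (by linarith)
    set L := K * r + 1 with hL
    have hLp : 0 < L := by positivity
    have ulip : ∀ k, r < R k → ∀ x y, ‖x‖ ≤ r → ‖y‖ ≤ r → |u k x - u k y| ≤ L * ‖x - y‖ := by
      intro k hk x y hx hy
      have := Convex.norm_image_sub_le_of_norm_fderiv_le (𝕜 := ℝ) (f := u k) (C := L) (s := Metric.closedBall 0 r)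
        (fun z _ => (hu k).diff z) (fun z hz => ?_) (convex_closedBall 0 r)
        (show y ∈ _ by simpa using hy) (show x ∈ _ by simpa using hx)
      · exact this
      · have hz' : ‖z‖ ≤ r := by simpa using hz
        have := hgr k z (hz'.trans_lt hk)
        nlinarith
    have vlip : ∀ x y, ‖x‖ ≤ r → ‖y‖ ≤ r → |v x - v y| ≤ L * ‖x - y‖ := by
      intro x y hx hy
      refine le_of_tendsto ((hv x).sub (hv y)).abs ?_
      filter_upwards [hRe r] with k hk using ulip k hk x y hx hy
    obtain ⟨t, ht1, ht2, ht3⟩ := (isCompact_closedBall (0 : E n) r).finite_cover_balls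
      (e := η / (3 * L)) (by positivity)
    have hev : ∀ᶠ k in (hyperfilter ℕ : Filter ℕ), ∀ y ∈ t, |u k y - v y| < η / 3 := by
      rw [eventually_all_finite ht2]
      intro y _
      have := ((hv y).sub_const (v y)).abs
      rw [sub_self, abs_zero] at this
      exact this.eventually (gt_mem_nhds (by positivity))
    filter_upwards [hev, hRe r] with k hk hRk x hx
    have hxm := ht3 (show x ∈ Metric.closedBall 0 r by simpa using hx)
    simp only [Set.mem_iUnion, Metric.mem_ball, dist_eq_norm] at hxm
    obtain ⟨y, hy, hxy⟩ := hxm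
    have hyr : ‖y‖ ≤ r := by simpa using ht1 hy
    have a1 := ulip k hRk x y hx hyr
    have a2 := vlip y x hyr hx
    rw [norm_sub_rev] at a2
    have a3 := hk y hy
    have a4 : L * ‖x - y‖ ≤ η / 3 := by
      rw [lt_div_iff₀ (by positivity)] at hxy; nlinarith
    have : u k x - v x = (u k x - u k y) + (u k y - v y) + (v y - v x) := by ring
    rw [this]
    refine (abs_add_three _ _ _).trans ?_
    linarith
  refine ⟨v, hLC, hv0, by rw [hfd, hp0], ?_, ?_, hunif⟩
  · have hmem : ∀ j x, mol (kb n j) (D2 v) x ∈ C := by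
      intro j x
      rw [← mol_D2 hLC (kb_cont j) (kb_cs j)]
      refine hcl.mem_of_tendsto (b := (hyperfilter ℕ : Filter ℕ)) (f := fun k => D2 (mol (kb n j) (u k)) x) ?_ ?_
      · rw [tendsto_iff_norm_sub_tendsto_zero]
        have hkc : Continuous (D2 (kb n j)) := sm_D2_cont (kb_smooth j)
        obtain ⟨r, hr, hz⟩ := zero_of_cs (kb_cs (n := n) j)
        have hDz : ∀ t, r + ‖x‖ < ‖t‖ → D2 (kb n j) (x - t) = 0 := fun t ht => by
          apply D2_zero_out hz
          have := norm_sub_norm_le t x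
          rw [norm_sub_rev] at this
          linarith
        have hcs : HasCompactSupport fun t => ‖D2 (kb n j) (x - t)‖ :=
          cs_of_zero (R := r + ‖x‖) fun t ht => by rw [hDz t ht, norm_zero]
        have hcont : Continuous fun t => ‖D2 (kb n j) (x - t)‖ := (hkc.comp (by fun_prop)).norm
        have hI : Integrable (fun t => ‖D2 (kb n j) (x - t)‖) volume := hcont.integrable_of_hasCompactSupport hcs
        set A := ∫ t, ‖D2 (kb n j) (x - t)‖ with hA
        have hA0 : 0 ≤ A := integral_nonneg fun _ => norm_nonneg _
        rw [Metric.tendsto_nhds]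
        intro ε hε
        filter_upwards [hunif (r + ‖x‖) (ε / (2 * (A + 1))) (by positivity)] with k hk
        rw [dist_zero_right, norm_norm, molD2 (hu k).cont (kb_smooth j) (kb_cs j),
          molD2 hLC.cont (kb_smooth j) (kb_cs j)]
        have hi : ∀ w : E n → ℝ, Continuous w → Integrable (fun t => w t • D2 (kb n j) (x - t)) volume := by
          intro w hw
          have hc1 : Continuous (fun t => w t • D2 (kb n j) (x - t)) := hw.smul (hkc.comp (by fun_prop))
          refine hc1.integrable_of_hasCompactSupport ?_
          refine HasCompactSupport.of_support_subset_isCompact (isCompact_closedBall (0 : E n) (r + ‖x‖)) ?_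
          intro t ht
          by_contra h
          rw [mem_closedBall_zero_iff, not_le] at h
          exact ht (by simp only [hDz t h, smul_zero])
        rw [← integral_sub (hi _ (hu k).cont) (hi _ hLC.cont)]
        have hbd : ‖∫ t, (u k t • D2 (kb n j) (x - t) - v t • D2 (kb n j) (x - t))‖ ≤
            ∫ t, ε / (2 * (A + 1)) * ‖D2 (kb n j) (x - t)‖ := by
          refine norm_integral_le_of_norm_le (hI.const_mul _) (ae_of_all _ fun t => ?_)
          rw [← sub_smul, norm_smul]
          rcases le_or_gt ‖t‖ (r + ‖x‖) with h | h
          · exact mul_le_mul_of_nonneg_right (hk t h) (norm_nonneg _)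
          · rw [hDz t h, norm_zero, mul_zero, mul_zero]
        rw [integral_const_mul, ← hA] at hbd
        refine hbd.trans_lt ?_
        rw [div_mul_eq_mul_div, div_lt_iff₀ (by positivity)]
        nlinarith
      · filter_upwards [hRe (‖x‖ + 1)] with k hk
        rw [mol_D2 (hu k) (kb_cont j) (kb_cs j)]
        refine mol_mem (hu k).lbm (kb_cont j) (kb_cs j) (kb_nonneg j) (kb_int j) hconv hcl ?_
        filter_upwards [hD k] with y hy hne
        apply hy
        have h2 := kb_supp1 j hne
        have h3 := norm_sub_norm_le y x
        rw [norm_sub_rev] at h3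
        linarith
    filter_upwards [mol_tendsto hLC.lbm] with x hx
    exact hcl.mem_of_tendsto hx (Eventually.of_forall fun j => hmem j x)
  · have hvb : ∀ x, ‖D2 v x‖ ≤ K := fun x => by
      unfold D2; rw [hfd]
      refine norm_fderiv_le_of_lip' ℝ hK0 (Eventually.of_forall fun y => plip y x)
    obtain ⟨CL, hCL, hLb⟩ := LU_bd n hK0
    have hloc : LBM (fun x => dt (D2 v x) - F0) := by
      obtain ⟨Cd, h2, h3⟩ := dt_bd n hK0
      refine ⟨(dtm hLC.lbm.meas).sub aestronglyMeasurable_const, fun r => ⟨Cd + |F0|, by positivity, fun x _ => ?_⟩⟩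
      exact (norm_sub_le _ _).trans (add_le_add (h3 _ (hvb x)) le_rfl)
    have := ae_eq_zero_of_integral_contDiff_smul_eq_zero hloc.locInt (fun ψ hψ hc => ?_)
    · filter_upwards [this] with x hx; linarith
    · have hψL : LC ψ := LC.of_smooth hψ
      obtain ⟨r, hr, hz⟩ := zero_of_cs hc
      obtain ⟨B, hB, hBb⟩ := hψL.lbm.bd r
      have hψi : Integrable ψ volume := hψ.continuous.integrable_of_hasCompactSupport hc
      set V := ((volume : Measure (E n)).real (Metric.closedBall 0 r)) with hV
      have key : ∀ η : ℝ, 0 < η → |∫ x, ψ x • (dt (D2 v x) - F0)| ≤ η * (CL * B * V) + η * ∫ x, |ψ x| := by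
        intro η hη
        have hex : ∀ᶠ k in (hyperfilter ℕ : Filter ℕ), |δ k| < η := by
          have := hδ.abs
          rw [abs_zero] at this
          exact Nat.hyperfilter_le_atTop (this.eventually (gt_mem_nhds hη))
        obtain ⟨k, k1, k2, k3⟩ := (hex.and ((hRe r).and (hunif r η hη))).exists
        obtain ⟨t, ht, e⟩ := det_test (hu k) hLC hψL hc
        have i1 : Integrable (fun x => ψ x * (dt (D2 (u k) x) - dt (D2 v x))) volume := by
          obtain ⟨Ku, hKu, hKb⟩ := (hu k).lbm.bd r
          obtain ⟨Cd, h2, h3⟩ := dt_bd n hK0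
          obtain ⟨Cu, h4, h5⟩ := dt_bd n hKu
          have hm : LBM (fun x => dt (D2 (u k) x) - dt (D2 v x)) := by
            refine ⟨(dtm (hu k).lbm.meas).sub (dtm hLC.lbm.meas), fun s => ?_⟩
            obtain ⟨Ku, hKu, hKb⟩ := (hu k).lbm.bd s
            obtain ⟨Cu, h4, h5⟩ := dt_bd n hKu
            exact ⟨Cu + Cd, by positivity, fun x hx => (norm_sub_le _ _).trans (add_le_add (h5 _ (hKb x hx)) (h3 _ (hvb x)))⟩
          simpa using hm.int_smul hψ.continuous hc
        have i2 : Integrable (fun x => ψ x * (dt (D2 v x) - F0)) volume := by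
          simpa using hloc.int_smul hψ.continuous hc
        have e2 : ∫ x, ψ x • (dt (D2 v x) - F0) = (∫ x, ψ x * (dt (D2 (u k) x) - F0)) -
            ∫ x, ψ x * (dt (D2 (u k) x) - dt (D2 v x)) := by
          rw [← integral_sub ?_ i1]
          · refine integral_congr_ae (ae_of_all _ fun x => ?_)
            simp only [smul_eq_mul]; ring
          · refine (i1.add i2).congr (ae_of_all _ fun x => ?_)
            simp only [Pi.add_apply]; ring
        have b1 : |∫ x, ψ x * (dt (D2 (u k) x) - F0)| ≤ η * ∫ x, |ψ x| := by
          rw [← integral_const_mul, ← Real.norm_eq_abs]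
          refine norm_integral_le_of_norm_le (hψi.abs.const_mul _) ?_
          filter_upwards [hdet k] with x hx
          rw [Real.norm_eq_abs, abs_mul, mul_comm]
          rcases le_or_gt ‖x‖ r with h | h
          · refine mul_le_mul_of_nonneg_right ?_ (abs_nonneg _)
            exact (hx (h.trans_lt k2)).trans ((le_abs_self _).trans k1.le)
          · rw [hz x h]; simp
        have b2 : |∫ x, ψ x * (dt (D2 (u k) x) - dt (D2 v x))| ≤ η * (CL * B * V) := by
          rw [e]
          have hi : Integrable ((Metric.closedBall (0 : E n) r).indicator fun _ => η * (CL * B)) volume :=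
            (integrable_indicator_iff Metric.isClosed_closedBall.measurableSet).2
              (integrableOn_const (isCompact_closedBall _ _).measure_lt_top.ne)
          have : η * (CL * B * V) = ∫ x, (Metric.closedBall (0 : E n) r).indicator (fun _ => η * (CL * B)) x := by
            rw [integral_indicator Metric.isClosed_closedBall.measurableSet, setIntegral_const, ← hV, smul_eq_mul]; ring
          rw [this, ← Real.norm_eq_abs]
          refine norm_integral_le_of_norm_le hi ?_
          filter_upwards [hb k] with x hx
          rw [Real.norm_eq_abs, abs_mul]
          rcases le_or_gt ‖x‖ r with h | h
          · rw [Set.indicator_of_mem (by simpa using h)]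
            refine mul_le_mul (k3 x h) ?_ (abs_nonneg _) hη.le
            have hn : ‖(1 - t) • D2 v x + t • D2 (u k) x‖ ≤ K := by
              refine (norm_add_le _ _).trans ?_
              rw [norm_smul, norm_smul, Real.norm_eq_abs, Real.norm_eq_abs, abs_of_pos ht.1,
                abs_of_pos (by linarith [ht.2])]
              have a1 := hx (by rw [sub_zero]; exact h.trans_lt k2)
              have a2 := hvb x
              nlinarith [ht.1, ht.2]
            exact (hLb _ _ hn).trans (mul_le_mul_of_nonneg_left (hBb x h) hCL)
          · rw [D2_zero_out hz h, LB_zero, abs_zero, mul_zero, Set.indicator_of_notMem (by simpa using h)]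
        rw [e2]
        exact (abs_sub _ _).trans (by linarith)
      have hψ0 : 0 ≤ ∫ x, |ψ x| := integral_nonneg fun _ => abs_nonneg _
      have hV0 : 0 ≤ V := by positivity
      by_contra hne
      have hpos : 0 < |∫ x, ψ x • (dt (D2 v x) - F0)| := abs_pos.2 hne
      set Q := |∫ x, ψ x • (dt (D2 v x) - F0)| with hQ
      set Z := CL * B * V + ∫ x, |ψ x| with hZ
      have hZ0 : 0 ≤ Z := by positivity
      have := key (Q / (2 * (Z + 1))) (by positivity)
      rw [← mul_add, ← hZ, div_mul_eq_mul_div, le_div_iff₀ (by positivity)] at this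
      nlinarith

/-- squared `L²` norm on the unit ball -/
noncomputable def L2 (w : E n → ℝ) : ℝ := ∫ x in Metric.ball (0 : E n) 1, w x ^ 2

/-- a weak Cauchy-Schwarz inequality -/
theorem cs_ineq {F f g : E n → ℝ} {a b C : ℝ} (ha : 0 < a) (hb : 0 < b) (hC : 0 ≤ C)
    (hf : ∀ x, 0 ≤ f x) (hg : ∀ x, 0 ≤ g x) (hfi : Integrable f) (hgi : Integrable g)
    (hfa : ∫ x, f x ≤ a ^ 2) (hgb : ∫ x, g x ≤ b ^ 2)
    (h : ∀ᵐ x, |F x| ≤ C * (√(f x) * √(g x))) : |∫ x, F x| ≤ C * (a * b) := by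
  have hi : Integrable (fun x => C * ((b / a * f x + a / b * g x) / 2)) :=
    (((hfi.const_mul _).add (hgi.const_mul _)).div_const 2).const_mul C
  have h1 : |∫ x, F x| ≤ ∫ x, C * ((b / a * f x + a / b * g x) / 2) := by
    rw [← Real.norm_eq_abs]
    refine norm_integral_le_of_norm_le hi ?_
    filter_upwards [h] with x hx
    rw [Real.norm_eq_abs]
    refine hx.trans (mul_le_mul_of_nonneg_left ?_ hC)
    have e1 := Real.sq_sqrt (hf x)
    have e2 := Real.sq_sqrt (hg x)
    set p := √(f x)
    set r := √(g x)
    rw [← e1, ← e2]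
    have e3 : (b / a * p ^ 2 + a / b * r ^ 2) / 2 - p * r = (b * p - a * r) ^ 2 / (2 * a * b) := by
      field_simp; ring
    have e4 : 0 ≤ (b * p - a * r) ^ 2 / (2 * a * b) := by positivity
    linarith
  refine h1.trans ?_
  rw [integral_const_mul, integral_div, integral_add (hfi.const_mul _) (hgi.const_mul _), integral_const_mul,
    integral_const_mul]
  refine mul_le_mul_of_nonneg_left ?_ hC
  have e1 : b / a * ∫ x, f x ≤ b / a * a ^ 2 := by gcongr
  have e2 : a / b * ∫ x, g x ≤ a / b * b ^ 2 := by gcongr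
  have e3 : b / a * a ^ 2 = a * b := by field_simp
  have e4 : a / b * b ^ 2 = a * b := by field_simp
  linarith

theorem l2_ind_int {w : E n → ℝ} (hw : Continuous w) :
    Integrable ((Metric.ball (0 : E n) 1).indicator (fun x => w x ^ 2)) := by
  rw [integrable_indicator_iff Metric.isOpen_ball.measurableSet]
  exact ((hw.pow 2).continuousOn.integrableOn_compact (isCompact_closedBall (0 : E n) 1)).mono_set
    Metric.ball_subset_closedBall

theorem l2_ind {w : E n → ℝ} : 
    ∫ x, (Metric.ball (0 : E n) 1).indicator (fun x => w x ^ 2) x = L2 w :=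
  integral_indicator Metric.isOpen_ball.measurableSet

noncomputable def V1 (n : ℕ) : ℝ := (volume (Metric.ball (0 : E n) 1)).toReal

theorem V1_nonneg : 0 ≤ V1 n := ENNReal.toReal_nonneg

theorem l1_le {w F : E n → ℝ} (hw : Continuous w) {ε H : ℝ} (hε : 0 < ε) (hH : 0 ≤ H)
    (h2 : L2 w ≤ ε ^ 2) (hF : ∀ᵐ x, ‖x‖ < 1 → |F x| ≤ H * |w x|) (hz : ∀ᵐ x, 1 ≤ ‖x‖ → F x = 0) :
    |∫ x, F x| ≤ H * (ε * (V1 n + 1)) := by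
  have hI : Integrable ((Metric.ball (0 : E n) 1).indicator (fun _ => (1:ℝ))) := by
    rw [integrable_indicator_iff Metric.isOpen_ball.measurableSet]
    exact integrableOn_const measure_ball_lt_top.ne
  refine cs_ineq (f := (Metric.ball (0 : E n) 1).indicator (fun x => w x ^ 2))
    (g := (Metric.ball (0 : E n) 1).indicator (fun _ => 1)) hε (by have := V1_nonneg (n := n); linarith) hH
    (fun x => Set.indicator_nonneg (fun _ _ => sq_nonneg _) _)
    (fun x => Set.indicator_nonneg (fun _ _ => zero_le_one) _) (l2_ind_int hw) hI (by rw [l2_ind]; exact h2) ?_ ?_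
  · rw [integral_indicator Metric.isOpen_ball.measurableSet, setIntegral_const, smul_eq_mul, mul_one]
    change V1 n ≤ _
    have := V1_nonneg (n := n)
    nlinarith
  · filter_upwards [hF, hz] with x h1 h2
    by_cases hx : ‖x‖ < 1
    · have hx' : x ∈ Metric.ball (0 : E n) 1 := by simpa using hx
      rw [Set.indicator_of_mem hx', Set.indicator_of_mem hx', Real.sqrt_sq_eq_abs]
      simpa using h1 hx
    · rw [h2 (not_lt.1 hx), abs_zero]
      positivity

/-- the standard cutoff -/
noncomputable def psb (n : ℕ) : ContDiffBump (0 : E n) where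
  rIn := 7/8
  rOut := 15/16
  rIn_pos := by norm_num
  rIn_lt_rOut := by norm_num

noncomputable def ps (x : E n) : ℝ := psb n x

theorem ps_smooth : ContDiff ℝ (⊤ : ℕ∞) (ps : E n → ℝ) := (psb n).contDiff
theorem ps_lc : LC (ps : E n → ℝ) := LC.of_smooth ps_smooth
theorem ps_cs : HasCompactSupport (ps : E n → ℝ) := (psb n).hasCompactSupport
theorem ps_nonneg (x : E n) : 0 ≤ ps x := (psb n).nonneg
theorem ps_le (x : E n) : ps x ≤ 1 := (psb n).le_one
theorem ps_one {x : E n} (hx : ‖x‖ ≤ 7/8) : ps x = 1 :=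
  (psb n).one_of_mem_closedBall (by simpa [psb] using hx)
theorem ps_zero {x : E n} (hx : 15/16 < ‖x‖) : ps x = 0 :=
  (psb n).zero_of_le_dist (by simpa [psb] using hx.le)

/-- hypotheses for the flatness improvement -/
structure Hyp (l K σ ε : ℝ) (u : E n → ℝ) (c : ℝ) (p : E n →L[ℝ] ℝ) (S : Bil n) : Prop where
  lc : LC u
  ell : ∀ᵐ x, ‖x‖ < 1 → Ell l (hC (D2 u x))
  bd : ∀ᵐ x, ‖x‖ < 1 → ‖D2 u x‖ ≤ K
  sym : ∀ v w, S v w = S w v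
  ellS : Ell l (hC S)
  bdS : ‖S‖ ≤ K
  det : ∀ᵐ x, ‖x‖ < 1 → |dt (D2 u x) - dt S| ≤ σ
  l2 : L2 (fun x => u x - qd c p S x) ≤ ε ^ 2
  hσ : 0 ≤ σ
  hε : 0 < ε

theorem nsq_entry (A : Matrix (Fin n) (Fin n) ℂ) (i j : Fin n) : ‖A i j‖ ≤ √(nsq A) := by
  apply Real.le_sqrt_of_sq_le
  unfold nsq
  refine le_trans ?_ (Finset.single_le_sum (f := fun i => ∑ j, ‖A i j‖ ^ 2) (fun i _ => by positivity) (Finset.mem_univ i))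
  exact Finset.single_le_sum (f := fun j => ‖A i j‖ ^ 2) (fun i _ => by positivity) (Finset.mem_univ j)

theorem nsq_nonneg (A : Matrix (Fin n) (Fin n) ℂ) : 0 ≤ nsq A := by unfold nsq; positivity

theorem nsq_cont : Continuous (nsq : Matrix (Fin n) (Fin n) ℂ → ℝ) := by
  unfold nsq; fun_prop

theorem nsq_bd {A : Matrix (Fin n) (Fin n) ℂ} {K : ℝ} (hA : ∀ i j, ‖A i j‖ ≤ K) : nsq A ≤ n * (n * K ^ 2) := by
  unfold nsq
  calc _ ≤ ∑ i : Fin n, ∑ j : Fin n, K ^ 2 := by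
        gcongr with i _ j _; exact hA i j
    _ = _ := by simp

theorem log_le {a b m σ : ℝ} (hm : 0 < m) (ha : m ≤ a) (hb : m ≤ b) (h : |a - b| ≤ σ) : Real.log b - Real.log a ≤ σ / m := by
  have hσ : 0 ≤ σ := (abs_nonneg _).trans h
  have h1 : 0 < a := by linarith
  have h2 : 0 < b := by linarith
  rw [← Real.log_div h2.ne' h1.ne']
  have h3 := Real.log_le_sub_one_of_pos (div_pos h2 h1)
  refine h3.trans ?_
  rw [div_sub_one h1.ne']
  have h4 := abs_le.1 h
  calc (b - a) / a ≤ σ / a := by gcongr; linarith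
    _ ≤ σ / m := by gcongr

theorem D2_bd_cs {ψ : E n → ℝ} (hψ : ContDiff ℝ (⊤ : ℕ∞) ψ) (hc : HasCompactSupport ψ) : ∃ M, 0 ≤ M ∧ ∀ x, ‖D2 ψ x‖ ≤ M := by
  obtain ⟨R, hR, hz⟩ := zero_of_cs hc
  obtain ⟨M, h0, h1⟩ := (lbm_cont (sm_D2_cont hψ)).bd R
  refine ⟨M, h0, fun x => ?_⟩
  by_cases hx : R < ‖x‖
  · rw [D2_zero_out hz hx, norm_zero]; exact h0
  · exact h1 x (not_lt.1 hx)

theorem nsqm {f : E n → Bil n} (hf : AEStronglyMeasurable f volume) (S : Bil n) :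
    AEStronglyMeasurable (fun x => nsq (hC (f x) - hC S)) volume :=
  ((nsq_cont.comp (continuous_id.sub continuous_const)).comp hC_cont).comp_aestronglyMeasurable hf

theorem ps_nsq_int {u : E n → ℝ} (hu : LC u) (S : Bil n) : Integrable (fun x => ps x * nsq (hC (D2 u x) - hC S)) := by
  obtain ⟨K, hK, hb⟩ := hu.lbm.bd (15/16)
  refine int_of_bd (R := 15/16) (C := n * (n * (K + ‖S‖) ^ 2)) ((ps_smooth.continuous.aestronglyMeasurable).mul (nsqm hu.lbm.meas S)) ?_ ?_
  · intro x hx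
    rw [abs_mul, abs_of_nonneg (ps_nonneg x), abs_of_nonneg (nsq_nonneg _)]
    have := nsq_bd (A := hC (D2 u x) - hC S) (K := K + ‖S‖) (fun i j => (norm_sub_le _ _).trans
      (add_le_add (hC_norm_le (hb x hx) i j) (hC_norm_le le_rfl i j)))
    nlinarith [ps_le x, ps_nonneg x, nsq_nonneg (hC (D2 u x) - hC S)]
  · intro x hx
    rw [ps_zero hx, zero_mul]

theorem trace_inv {l : ℝ} (hl : 0 < l) {S : Bil n} (hS : Ell l (hC S)) (T : Bil n) :
    ((hC S)⁻¹ * hC T).trace.re = (dt S)⁻¹ * LB (hC S).adjugate T := by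
  have h1 : (hC S).det = (dt S : ℂ) := herm_det_real hS.1
  rw [Matrix.inv_def, h1, Ring.inverse_eq_inv', Matrix.smul_mul, Matrix.trace_smul, smul_eq_mul, ← Complex.ofReal_inv,
    Complex.re_ofReal_mul]
  rfl

theorem ps_w_LB (n : ℕ) {K : ℝ} (hK : 0 ≤ K) : ∃ C, 0 ≤ C ∧ ∀ w : E n → ℝ, ∀ v : E n → ℝ, LC w → LC v → ∀ ε > 0, L2 w ≤ ε ^ 2 →
    (∀ᵐ x, ‖x‖ < 1 → ‖D2 v x‖ ≤ K) → |∫ x, ps x * LU v w x| ≤ C * ε := by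
  obtain ⟨C, hC0, hC⟩ := LU_bd n hK
  obtain ⟨M, hM0, hM⟩ := D2_bd_cs (ps_smooth (n := n)) ps_cs
  refine ⟨C * M * (V1 n + 1), by have := V1_nonneg (n := n); positivity, fun w v hw hv ε hε h2 hb => ?_⟩
  rw [T1 hv hw ps_lc ps_cs]
  refine (l1_le hw.cont (H := C * M) hε (by positivity) h2 ?_ ?_).trans (by linarith)
  · filter_upwards [hb] with x hx h1
    rw [abs_mul, mul_comm]
    gcongr
    exact (hC _ _ (hx h1)).trans (by gcongr; exact hM x)
  · refine Eventually.of_forall fun x hx => ?_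
    unfold LU
    rw [D2_zero_out (fun y => ps_zero) (by linarith), LB_zero, mul_zero]

theorem Fa (n : ℕ) {l K : ℝ} (hl : 0 < l) (hK : 0 ≤ K) : ∃ C, 0 < C ∧ ∀ σ ε u c p, ∀ S : Bil n, Hyp l K σ ε u c p S →
    ∫ x, ps x * nsq (hC (D2 u x) - hC S) ≤ C * (ε + σ) := by
  obtain ⟨a, ha, hA⟩ := A1 n hl K
  obtain ⟨C1, hC1, h1⟩ := ps_w_LB n hK
  set m := l ^ n with hm
  have hm0 : 0 < m := by positivity
  obtain ⟨Vp, hVp⟩ : ∃ V, V = ∫ x, (ps x : ℝ) ∂(volume : Measure (E n)) := ⟨_, rfl⟩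
  have hVp0 : 0 ≤ Vp := by rw [hVp]; exact integral_nonneg ps_nonneg
  refine ⟨(m⁻¹ * C1 + Vp / m) / a + 1, by positivity, fun σ ε u c p S H => ?_⟩
  have hv := qd_lc c p S
  have hw := H.lc.sub hv
  have hdS : m ≤ dt S := Ell.det_ge hl H.ellS
  have key : ∀ᵐ x, ps x * nsq (hC (D2 u x) - hC S) ≤ 
      ((dt S)⁻¹ * (ps x * LU (qd c p S) (fun x => u x - qd c p S x) x) + ps x * (σ / m)) / a := by
    filter_upwards [H.ell, H.bd, H.det, H.lc.ae, hv.ae] with x h2 h3 h4 h5 h6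
    by_cases hx : ‖x‖ < 1
    · have e1 := hA (hC (D2 u x)) (hC S) (h2 hx) H.ellS (hC_norm_le (h3 hx)) (hC_norm_le H.bdS)
      rw [← hC_sub, trace_inv hl H.ellS, hC_sub] at e1
      have e2 := log_le hm0 (Ell.det_ge hl (h2 hx)) hdS (h4 hx)
      have e3 : LU (qd c p S) (fun x => u x - qd c p S x) x = LB (hC S).adjugate (D2 u x - S) := by
        unfold LU
        rw [D2_sub H.lc hv h5 h6, qd_D2 c p H.sym]
      rw [e3, le_div_iff₀ ha]
      have e4 : a * nsq (hC (D2 u x) - hC S) ≤ (dt S)⁻¹ * LB (hC S).adjugate (D2 u x - S) + σ / m := by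
        have e5 : Real.log (dt S) - Real.log (dt (D2 u x)) ≤ σ / m := e2
        unfold dt at e5
        linarith
      have := mul_le_mul_of_nonneg_left e4 (ps_nonneg x)
      linarith
    · rw [ps_zero (by linarith)]; simp
  have hi1 : Integrable (fun x => ps x * LU (qd c p S) (fun x => u x - qd c p S x) x) := 
    LU_int hv hw ps_smooth.continuous.aestronglyMeasurable (R := 15/16) (C := 1)
      (fun x _ => by rw [abs_of_nonneg (ps_nonneg x)]; exact ps_le x) (fun x hx => ps_zero hx)
  have hi2 : Integrable (ps : E n → ℝ) := ps_smooth.continuous.integrable_of_hasCompactSupport ps_cs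
  have h7 := integral_mono_ae (ps_nsq_int H.lc S) (((hi1.const_mul (dt S)⁻¹).add (hi2.mul_const (σ / m))).div_const a) key
  refine h7.trans ?_
  simp only [Pi.add_apply]
  rw [integral_div, integral_add (hi1.const_mul _) (hi2.mul_const _), integral_const_mul, integral_mul_const, ← hVp]
  have h8 := h1 _ _ hw hv ε H.hε H.l2 (Eventually.of_forall fun x _ => by rw [qd_D2 c p H.sym]; exact H.bdS)
  have h9 : (dt S)⁻¹ * ∫ x, ps x * LU (qd c p S) (fun x => u x - qd c p S x) x ≤ m⁻¹ * (C1 * ε) := by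
    have hd0 : 0 < dt S := by linarith
    calc _ ≤ (dt S)⁻¹ * (C1 * ε) := by gcongr; exact (le_abs_self _).trans h8
      _ ≤ _ := by have := H.hε; gcongr
  have hε := H.hε
  have hσ := H.hσ
  calc _ ≤ (m⁻¹ * (C1 * ε) + Vp * (σ / m)) / a := by gcongr
    _ ≤ ((m⁻¹ * C1 + Vp / m) * (ε + σ)) / a := by
        gcongr
        have i1 : 0 ≤ m⁻¹ * C1 * σ := by positivity
        have i2 : 0 ≤ Vp / m * ε := by positivity
        have i3 : Vp * (σ / m) = Vp / m * σ := by ring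
        nlinarith
    _ ≤ _ := by rw [mul_div_right_comm]; gcongr; linarith

theorem qf_add (A B : Matrix (Fin n) (Fin n) ℂ) (c : Fin n → ℂ) : qf (A + B) c = qf A c + qf B c := by
  unfold qf; rw [Matrix.add_mulVec, dotProduct_add, Complex.add_re]

theorem qf_smulr (t : ℝ) (A : Matrix (Fin n) (Fin n) ℂ) (c : Fin n → ℂ) : qf ((t:ℂ) • A) c = t * qf A c := by
  unfold qf; rw [Matrix.smul_mulVec, dotProduct_smul, smul_eq_mul, Complex.re_ofReal_mul]

theorem ell_convex (l : ℝ) : Convex ℝ {S : Bil n | Ell l (hC S)} := by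
  intro S hS T hT a b ha hb hab
  simp only [Set.mem_setOf_eq] at *
  rw [hC_add, hC_smul, hC_smul]
  refine ⟨?_, fun c => ?_⟩
  · have h1 := hS.1
    have h2 := hT.1
    unfold Matrix.IsHermitian at *
    rw [Matrix.conjTranspose_add, Matrix.conjTranspose_smul, Matrix.conjTranspose_smul, h1, h2]
    simp
  · rw [qf_add, qf_smulr, qf_smulr]
    have h1 := mul_le_mul_of_nonneg_left (hS.2 c) ha
    have h2 := mul_le_mul_of_nonneg_left (hT.2 c) hb
    have : l * ∑ i, ‖c i‖ ^ 2 = a * (l * ∑ i, ‖c i‖ ^ 2) + b * (l * ∑ i, ‖c i‖ ^ 2) := by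
      rw [← add_mul, hab, one_mul]
    linarith

theorem qf_contA (c : Fin n → ℂ) : Continuous (fun A : Matrix (Fin n) (Fin n) ℂ => qf A c) := by
  unfold qf
  exact Complex.continuous_re.comp (continuous_const.dotProduct (continuous_id.matrix_mulVec continuous_const))

theorem ell_closed (l : ℝ) : IsClosed {S : Bil n | Ell l (hC S)} := by
  have h1 : IsClosed {S : Bil n | (hC S)ᴴ = hC S} :=
    isClosed_eq (hC_cont.matrix_conjTranspose) hC_cont
  have h2 : IsClosed {S : Bil n | ∀ c : Fin n → ℂ, l * ∑ i, ‖c i‖ ^ 2 ≤ qf (hC S) c} := by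
    simp only [Set.setOf_forall]
    exact isClosed_iInter fun c => isClosed_le continuous_const ((qf_contA c).comp hC_cont)
  exact h1.inter h2

theorem comb_norm {S T : Bil n} {K t : ℝ} (hS : ‖S‖ ≤ K) (hT : ‖T‖ ≤ K) (ht : t ∈ Set.Ioo (0:ℝ) 1) :
    ‖(1 - t) • S + t • T‖ ≤ K := by
  refine (norm_add_le _ _).trans ?_
  rw [norm_smul, norm_smul, Real.norm_eq_abs, Real.norm_eq_abs, abs_of_pos ht.1, abs_of_pos (by linarith [ht.2])]
  nlinarith [ht.1, ht.2]

theorem comb_ell {S T : Bil n} {l t : ℝ} (hS : Ell l (hC S)) (hT : Ell l (hC T)) (ht : t ∈ Set.Ioo (0:ℝ) 1) :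
    Ell l (hC ((1 - t) • S + t • T)) :=
  ell_convex l hS hT (by linarith [ht.2]) ht.1.le (by ring)

theorem w_LB_int {w ψ : E n → ℝ} {f : E n → Bil n} (hw : Continuous w) (hψ : LC ψ) {R : ℝ} 
    (hz : ∀ x, R < ‖x‖ → ψ x = 0) (hf : LBM f) : Integrable (fun x => w x * LB (hC (f x)).adjugate (D2 ψ x)) := by
  obtain ⟨C1, h1, h1'⟩ := (lbm_cont hw).bd R
  obtain ⟨C2, h2, h2'⟩ := hf.bd R
  obtain ⟨C3, h3, h3'⟩ := hψ.lbm.bd R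
  obtain ⟨C, h4, h4'⟩ := LU_bd n h2
  refine int_of_bd (R := R) (C := C1 * (C * C3)) (hw.aestronglyMeasurable.mul (LBm hf.meas hψ.lbm.meas)) ?_ ?_
  · intro x hx
    rw [abs_mul]
    gcongr
    · exact h1' x hx
    · exact (h4' _ _ (h2' x hx)).trans (by gcongr; exact h3' x hx)
  · intro x hx
    rw [D2_zero_out hz hx, LB_zero, mul_zero]

theorem lbm_const (S : Bil n) : LBM (fun _ : E n => S) := lbm_cont continuous_const

theorem Fb (n : ℕ) {l K : ℝ} (hl : 0 < l) (hK : 0 ≤ K) : ∃ C, 0 < C ∧ ∀ σ ε u c p, ∀ S : Bil n, Hyp l K σ ε u c p S →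
    ∀ ψ : E n → ℝ, LC ψ → (∀ x, 7/8 < ‖x‖ → ψ x = 0) → ∀ M, 0 ≤ M → (∀ᵐ x, ‖D2 ψ x‖ ≤ M) →
    |(∫ x, (u x - qd c p S x) * LB (hC S).adjugate (D2 ψ x)) - ∫ x, ψ x * (dt (D2 u x) - dt S)| ≤ C * M * (ε * √(ε + σ)) := by
  obtain ⟨C1, hC1, h1⟩ := Fa n hl hK
  obtain ⟨C2, hC2, h2⟩ := adj_lip n K hK
  refine ⟨(n * n * C2 + 1) * √C1, by positivity, fun σ ε u c p S H ψ hψ hz M hM hb => ?_⟩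
  have hv := qd_lc c p S
  obtain ⟨t, ht, e⟩ := det_test H.lc hv hψ (cs_of_zero hz)
  simp only [qd_D2 c p H.sym] at e
  rw [e, abs_sub_comm]
  have hwc := (H.lc.sub hv).cont
  have hf : LBM (fun x => (1 - t) • S + t • D2 u x) := by
    have := lbm_comb (lbm_const ((1 - t) • S)) H.lc.lbm t
    exact this
  rw [← integral_sub (w_LB_int hwc hψ hz hf) (w_LB_int hwc hψ hz (lbm_const S))]
  have hσ := H.hσ
  have hε := H.hε
  have key := cs_ineq (F := fun x => (u x - qd c p S x) * LB (hC ((1 - t) • S + t • D2 u x)).adjugate (D2 ψ x) -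
      (u x - qd c p S x) * LB (hC S).adjugate (D2 ψ x)) (f := (Metric.ball (0 : E n) 1).indicator (fun x => (u x - qd c p S x) ^ 2))
    (g := fun x => ps x * nsq (hC (D2 u x) - hC S)) (a := ε) (b := √(C1 * (ε + σ))) (C := n * n * C2 * M)
    hε (by positivity) (by positivity) (fun x => Set.indicator_nonneg (fun _ _ => sq_nonneg _) _)
    (fun x => mul_nonneg (ps_nonneg x) (nsq_nonneg _)) (l2_ind_int hwc) (ps_nsq_int H.lc S) (by rw [l2_ind]; exact H.l2)
    (by rw [Real.sq_sqrt (by positivity)]; exact h1 σ ε u c p S H) ?_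
  · refine key.trans ?_
    rw [Real.sqrt_mul hC1.le]
    have : n * n * C2 * M * (ε * (√C1 * √(ε + σ))) = (n * n * C2) * (√C1 * M * (ε * √(ε + σ))) := by ring
    rw [this]
    have h0 : 0 ≤ √C1 * M * (ε * √(ε + σ)) := by positivity
    nlinarith
  · filter_upwards [hb, H.bd] with x hbx hbd
    by_cases hx : 7/8 < ‖x‖
    · rw [D2_zero_out hz hx, LB_zero, LB_zero]; simp; positivity
    · have hx1 : ‖x‖ < 1 := by linarith
      have hx' : x ∈ Metric.ball (0 : E n) 1 := by simpa using hx1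
      rw [Set.indicator_of_mem hx', Real.sqrt_sq_eq_abs, ps_one (not_lt.1 hx), one_mul, ← mul_sub, abs_mul]
      have e3 : LB (hC ((1 - t) • S + t • D2 u x)).adjugate (D2 ψ x) - LB (hC S).adjugate (D2 ψ x) =
          (((hC ((1 - t) • S + t • D2 u x)).adjugate - (hC S).adjugate) * hC (D2 ψ x)).trace.re := by
        unfold LB
        rw [Matrix.sub_mul, Matrix.trace_sub, Complex.sub_re]
      rw [e3]
      have e4 := h2 (hC ((1 - t) • S + t • D2 u x)) (hC S) (√(nsq (hC (D2 u x) - hC S))) (Real.sqrt_nonneg _)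
        (hC_norm_le (comb_norm H.bdS (hbd hx1) ht)) (hC_norm_le H.bdS) (fun i j => by
          have : hC ((1 - t) • S + t • D2 u x) i j - hC S i j = (t : ℂ) * (hC (D2 u x) - hC S) i j := by
            simp [hC_add, hC_smul]; ring
          rw [this, norm_mul, Complex.norm_real, Real.norm_eq_abs, abs_of_pos ht.1]
          have := nsq_entry (hC (D2 u x) - hC S) i j
          nlinarith [ht.1, ht.2, norm_nonneg ((hC (D2 u x) - hC S) i j)])
      have e5 := trace_bd (B := (hC ((1 - t) • S + t • D2 u x)).adjugate - (hC S).adjugate) (A := hC (D2 ψ x))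
        (fun i j => e4 i j) (hC_norm_le hbx) (by positivity)
      calc _ ≤ |u x - qd c p S x| * (n * n * (C2 * √(nsq (hC (D2 u x) - hC S))) * M) := by gcongr
        _ = _ := by ring

theorem gradsq_int {w : E n → ℝ} (hw : LC w) : Integrable (fun x => ps x * ‖fderiv ℝ w x‖ ^ 2) :=
  (ps_smooth.continuous.mul (hw.contD.norm.pow 2)).integrable_of_hasCompactSupport ps_cs.mul_right

theorem LU_sq {u w : E n → ℝ} (hw : LC w) {x : E n} (hx : DifferentiableAt ℝ (fderiv ℝ w) x) :
    LU u (fun x => w x ^ 2) x = 2 * (w x * LU u w x) + 2 * LB (hC (D2 u x)).adjugate (tp (fderiv ℝ w x) (fderiv ℝ w x)) := by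
  rw [LU_comp (G := fun s => s ^ 2) hw (fun x => contDiff_id.contDiffAt.pow 2) hx]
  have h1 : deriv (fun s : ℝ => s ^ 2) = fun s => 2 * s := by funext s; simp
  have h2 : deriv (fun s : ℝ => 2 * s) = fun s => 2 := by funext s; simpa using (((hasDerivAt_id s).const_mul (2:ℝ)).deriv)
  rw [h1, h2]; ring

theorem Fc (n : ℕ) {l K : ℝ} (hl : 0 < l) (hK : 0 ≤ K) : ∃ C, 0 < C ∧ ∀ σ ε u c p, ∀ S : Bil n, Hyp l K σ ε u c p S →
    ∫ x, ps x * ‖fderiv ℝ (fun x => u x - qd c p S x) x‖ ^ 2 ≤ C * (ε ^ 2 + ε * σ) := by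
  obtain ⟨l', hl', hA⟩ := adj_ell n hl K hK
  obtain ⟨C1, hC1, h1⟩ := LU_bd n hK
  obtain ⟨M, hM0, hM⟩ := D2_bd_cs (ps_smooth (n := n)) ps_cs
  have hV := V1_nonneg (n := n)
  set a := l' / (16 * ((n:ℝ) + 1) ^ 2) with ha
  have ha0 : 0 < a := by positivity
  refine ⟨(C1 * M + 2 * (V1 n + 1)) / (2 * a) + 1, by positivity, fun σ ε u c p S H => ?_⟩
  have hv := qd_lc c p S
  have hw := H.lc.sub hv
  have hσ := H.hσ
  have hε := H.hε
  obtain ⟨Cw, hCw, hCw'⟩ := (lbm_cont hw.cont).bd (15/16)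
  have hθm : AEStronglyMeasurable (fun x => ps x * (u x - qd c p S x)) volume :=
    (ps_smooth.continuous.mul hw.cont).aestronglyMeasurable
  have hθb : ∀ x : E n, ‖x‖ ≤ 15/16 → |ps x * (u x - qd c p S x)| ≤ Cw := fun x hx => by
    rw [abs_mul, abs_of_nonneg (ps_nonneg x)]
    have := hCw' x hx
    rw [Real.norm_eq_abs] at this
    nlinarith [ps_nonneg x, ps_le x, abs_nonneg (u x - qd c p S x)]
  have hθz : ∀ x : E n, 15/16 < ‖x‖ → ps x * (u x - qd c p S x) = 0 := fun x hx => by rw [ps_zero hx, zero_mul]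
  obtain ⟨t, ht, h2, h3, h4⟩ := det_mvt_lc H.lc hv hθm hθb hθz
  simp only [qd_D2 c p H.sym] at h3 h4
  have hbt : ∀ᵐ x, ‖x‖ < 1 → ‖D2 (fun x => qd c p S x + t * (u x - qd c p S x)) x‖ ≤ K := by
    filter_upwards [h3, H.bd] with x e1 e2 hx
    rw [e1]; exact comb_norm H.bdS (e2 hx) ht
  have het : ∀ᵐ x, ‖x‖ < 1 → Ell l (hC (D2 (fun x => qd c p S x + t * (u x - qd c p S x)) x)) := by
    filter_upwards [h3, H.ell] with x e1 e2 hx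
    rw [e1]; exact comb_ell H.ellS (e2 hx) ht
  set ut := fun x => qd c p S x + t * (u x - qd c p S x) with hut
  set w := fun x => u x - qd c p S x with hwd
  have hw2 : LC (fun x => w x ^ 2) := by
    have := hw.mul hw
    simpa only [← pow_two] using this
  have hpm : ∀ x : E n, ‖x‖ ≤ 15/16 → |ps x| ≤ 1 := fun x _ => by rw [abs_of_nonneg (ps_nonneg x)]; exact ps_le x
  have i1 := LU_int h2 hw2 (ps_smooth.continuous.aestronglyMeasurable) hpm (fun x => ps_zero)
  have i2 := LU_int h2 hw hθm hθb hθz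
  -- main inequality
  have key : 2 * a * ∫ x, ps x * ‖fderiv ℝ w x‖ ^ 2 ≤ (∫ x, ps x * LU ut (fun x => w x ^ 2) x) - 2 * ∫ x, (ps x * w x) * LU ut w x := by
    rw [← integral_const_mul, ← integral_const_mul, ← integral_sub i1 (i2.const_mul 2)]
    refine integral_mono_ae ((gradsq_int hw).const_mul _) (i1.sub (i2.const_mul 2)) ?_
    filter_upwards [hw.ae, hbt, het] with x e1 e2 e3
    by_cases hx : ‖x‖ < 1
    · rw [LU_sq hw e1]
      have e4 := LB_ell hl'.le (hA _ (e3 hx) (hC_norm_le (e2 hx))) (fderiv ℝ w x)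
      have e5 := mul_le_mul_of_nonneg_left e4 (ps_nonneg x)
      rw [← ha] at e5
      linarith
    · rw [ps_zero (by linarith)]; simp
  have b1 : |∫ x, ps x * LU ut (fun x => w x ^ 2) x| ≤ C1 * M * ε ^ 2 := by
    rw [T1 h2 hw2 ps_lc ps_cs]
    have i3 : Integrable (fun x => (C1 * M) * (Metric.ball (0 : E n) 1).indicator (fun x => w x ^ 2) x) := (l2_ind_int hw.cont).const_mul _
    rw [← Real.norm_eq_abs]
    refine (norm_integral_le_of_norm_le i3 ?_).trans ?_
    · filter_upwards [hbt] with x e1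
      by_cases hx : ‖x‖ < 1
      · have hx' : x ∈ Metric.ball (0 : E n) 1 := by simpa using hx
        rw [Set.indicator_of_mem hx', Real.norm_eq_abs, abs_mul, abs_of_nonneg (sq_nonneg _), mul_comm]
        gcongr
        exact (h1 _ _ (e1 hx)).trans (by gcongr; exact hM x)
      · unfold LU
        rw [D2_zero_out (fun y => ps_zero) (by linarith : (15:ℝ)/16 < ‖x‖), LB_zero, mul_zero, norm_zero]
        have := Set.indicator_nonneg (s := Metric.ball (0 : E n) 1) (f := fun x => w x ^ 2) (fun _ _ => sq_nonneg _) x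
        positivity
    · rw [integral_const_mul, l2_ind]
      gcongr
      exact H.l2
  have b2 : |∫ x, (ps x * w x) * (dt (D2 u x) - dt S)| ≤ σ * (ε * (V1 n + 1)) := by
    refine l1_le hw.cont hε hσ H.l2 ?_ ?_
    · filter_upwards [H.det] with x e1 hx
      rw [abs_mul, abs_mul, abs_of_nonneg (ps_nonneg x)]
      have := e1 hx
      calc ps x * |w x| * |dt (D2 u x) - dt S| ≤ 1 * |w x| * σ := by gcongr; exact ps_le x
        _ = _ := by ring
    · refine Eventually.of_forall fun x hx => ?_
      rw [ps_zero (by linarith)]; simp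
  rw [← h4] at key
  have f1 := abs_le.1 b1
  have f2 := abs_le.1 b2
  have f3 : 2 * a * ∫ x, ps x * ‖fderiv ℝ w x‖ ^ 2 ≤ (C1 * M + 2 * (V1 n + 1)) * (ε ^ 2 + ε * σ) := by
    have g1 : 0 ≤ C1 * M * (ε * σ) := by positivity
    have g2 : 0 ≤ 2 * (V1 n + 1) * ε ^ 2 := by positivity
    nlinarith
  have f4 : ∫ x, ps x * ‖fderiv ℝ w x‖ ^ 2 ≤ (C1 * M + 2 * (V1 n + 1)) / (2 * a) * (ε ^ 2 + ε * σ) := by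
    rw [div_mul_eq_mul_div, le_div_iff₀ (by positivity)]
    linarith
  have g3 : 0 ≤ ε ^ 2 + ε * σ := by positivity
  linarith

/-- bump supported in `(a/4, a)` -/
noncomputable def eb (a : ℝ) (ha : 0 < a) : ContDiffBump (5 * a / 8 : ℝ) where
  rIn := a / 8
  rOut := 3 * a / 8
  rIn_pos := by positivity
  rIn_lt_rOut := by linarith

theorem eb_zero {a : ℝ} (ha : 0 < a) {s : ℝ} (h : s ≤ a / 4 ∨ a ≤ s) : eb a ha s = 0 := by
  refine (eb a ha).zero_of_le_dist ?_
  rw [Real.dist_eq]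
  change 3 * a / 8 ≤ _
  rcases h with h | h
  · rw [abs_of_neg (by linarith)]; linarith
  · rw [abs_of_pos (by linarith)]; linarith

theorem eb_one {a : ℝ} (ha : 0 < a) {s : ℝ} (h : |s - 5 * a / 8| ≤ a / 8) : eb a ha s = 1 :=
  (eb a ha).one_of_mem_closedBall (by rw [mem_closedBall_iff_norm]; exact h)

theorem exists_eta (n : ℕ) {a : ℝ} (ha : 0 < a) : ∃ η : ℝ → ℝ, ContDiff ℝ (⊤ : ℕ∞) η ∧ (∀ s, 0 ≤ η s) ∧
    (∀ s, s ≤ a / 4 ∨ a ≤ s → η s = 0) ∧ (∃ m > 0, ∀ s, |s - 5 * a / 8| ≤ a / 8 → m ≤ η s) ∧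
    Integrable (fun s => s ^ (n - 1) * η s) ∧ ∫ s, s ^ (n - 1) * η s = 1 := by
  have hi : Integrable (fun s => s ^ (n - 1) * eb a ha s) :=
    ((continuous_id.pow _).mul (eb a ha).continuous).integrable_of_hasCompactSupport (eb a ha).hasCompactSupport.mul_left
  set m := ∫ s, s ^ (n - 1) * eb a ha s with hm
  have hnn : ∀ s, 0 ≤ s ^ (n - 1) * eb a ha s := by
    intro s
    by_cases hs : s ≤ a / 4
    · rw [eb_zero ha (Or.inl hs), mul_zero]
    · have : 0 < s := by linarith
      exact mul_nonneg (by positivity) (eb a ha).nonneg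
  have hm0 : 0 < m := by
    rw [hm, integral_pos_iff_support_of_nonneg hnn hi]
    have hopen : IsOpen (Function.support fun s => s ^ (n - 1) * eb a ha s) :=
      (((continuous_id.pow _).mul (eb a ha).continuous)).isOpen_support
    refine hopen.measure_pos _ ⟨5 * a / 8, ?_⟩
    rw [Function.mem_support, eb_one ha (by simp; positivity)]
    positivity
  refine ⟨fun s => m⁻¹ * eb a ha s, contDiff_const.mul (eb a ha).contDiff, fun s => mul_nonneg (by positivity) (eb a ha).nonneg,
    fun s hs => by simp [eb_zero ha hs], ⟨m⁻¹, by positivity, fun s hs => by simp [eb_one ha hs]⟩, ?_, ?_⟩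
  · have := hi.const_mul m⁻¹
    refine this.congr (Eventually.of_forall fun s => ?_)
    simp only []; ring
  · have : (fun s => s ^ (n - 1) * (m⁻¹ * eb a ha s)) = fun s => m⁻¹ * (s ^ (n - 1) * eb a ha s) := by funext s; ring
    rw [this, integral_const_mul, ← hm, inv_mul_cancel₀ hm0.ne']

theorem exists_Gam (hn : 0 < n) {a b : ℝ} (ha : 0 < a) (hab : a ≤ b) {δ : ℝ → ℝ} (hδ : Continuous δ)
    (hz : ∀ s, s ≤ a / 4 ∨ b ≤ s → δ s = 0) (hI : ∫ s, s ^ (n - 1) * δ s = 0) :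
    ∃ Γ : ℝ → ℝ, ContDiff ℝ 2 Γ ∧ (∀ s, b ≤ s → Γ s = 0) ∧ ∀ s, n * deriv Γ s + s * deriv (deriv Γ) s = δ s := by
  set ω : ℝ → ℝ := fun s => s ^ (n - 1) * δ s with hω
  have hωc : Continuous ω := (continuous_id.pow _).mul hδ
  set h : ℝ → ℝ := fun s => ∫ τ in (0:ℝ)..s, ω τ with hh
  have hd : ∀ s, HasDerivAt h (ω s) s := fun s => intervalIntegral.integral_hasDerivAt_right
    (hωc.intervalIntegrable _ _) (hωc.stronglyMeasurableAtFilter _ _) hωc.continuousAt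
  have hω0 : ∀ s, s ≤ a / 4 ∨ b ≤ s → ω s = 0 := fun s hs => by simp only [hω]; rw [hz s hs, mul_zero]
  have h0 : ∀ s, s ≤ a / 4 → h s = 0 := by
    intro s hs
    simp only [hh]
    rw [intervalIntegral.integral_congr (g := fun _ => 0)]
    · simp
    · intro τ hτ
      refine hω0 τ (Or.inl ?_)
      rcases Set.mem_uIcc.1 hτ with h | h
      · linarith [h.2]
      · linarith [h.2]
  have h1 : ∀ s, b ≤ s → h s = 0 := by
    intro s hs
    simp only [hh]
    rw [intervalIntegral.integral_eq_integral_of_support_subset, hI]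
    intro τ hτ
    by_contra hcon
    refine hτ (hω0 τ ?_)
    by_contra hc2
    push Not at hc2
    exact hcon ⟨by linarith [hc2.1], by linarith [hc2.2]⟩
  set γ : ℝ → ℝ := fun s => h s / s ^ n with hγ
  have hγ0 : ∀ s, s ≤ a / 4 → γ s = 0 := fun s hs => by simp only [hγ]; rw [h0 s hs, zero_div]
  have hγ1 : ∀ s, b ≤ s → γ s = 0 := fun s hs => by simp only [hγ]; rw [h1 s hs, zero_div]
  set γ1 : ℝ → ℝ := fun s => (δ s - n * γ s) / s with hγ1d
  have hγd : ∀ s, HasDerivAt γ (γ1 s) s := by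
    intro s
    by_cases hs : s < a / 4
    · have e : γ =ᶠ[𝓝 s] fun _ => 0 := by
        filter_upwards [Iio_mem_nhds hs] with t ht
        exact hγ0 t (le_of_lt ht)
      have e2 : γ1 s = 0 := by simp only [hγ1d]; rw [hz s (Or.inl hs.le), hγ0 s hs.le]; simp
      rw [e2]
      exact (hasDerivAt_const s (0:ℝ)).congr_of_eventuallyEq e
    · have hs0 : 0 < s := by push Not at hs; linarith
      have := (hd s).div (hasDerivAt_pow n s) (by positivity)
      refine this.congr_deriv ?_
      simp only [hγ1d, hγ, hω]
      obtain ⟨k, rfl⟩ : ∃ k, n = k + 1 := ⟨n - 1, by omega⟩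
      simp only [Nat.add_sub_cancel, pow_succ]
      field_simp
  have hγc : Continuous γ := continuous_iff_continuousAt.2 fun s => (hγd s).continuousAt
  have hγ1c : Continuous γ1 := by
    refine continuous_iff_continuousAt.2 fun s => ?_
    by_cases hs : s < a / 4
    · have e : γ1 =ᶠ[𝓝 s] fun _ => 0 := by
        filter_upwards [Iio_mem_nhds hs] with t ht
        have ht' : t < a / 4 := ht
        simp only [hγ1d]; rw [hz t (Or.inl ht'.le), hγ0 t ht'.le]; simp
      exact continuousAt_const.congr e.symm
    · have hs0 : s ≠ 0 := by push Not at hs; intro h; rw [h] at hs; linarith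
      exact ((hδ.sub (continuous_const.mul hγc)).continuousAt).div continuousAt_id hs0
  have dγ : deriv γ = γ1 := funext fun s => (hγd s).deriv
  have hγC : ContDiff ℝ 1 γ := contDiff_one_iff_deriv.2 ⟨fun s => (hγd s).differentiableAt, by rw [dγ]; exact hγ1c⟩
  have hΓ : ∀ s, HasDerivAt (fun s => ∫ τ in b..s, γ τ) (γ s) s := fun s => intervalIntegral.integral_hasDerivAt_right
    (hγc.intervalIntegrable _ _) (hγc.stronglyMeasurableAtFilter _ _) hγc.continuousAt
  have dΓ : deriv (fun s => ∫ τ in b..s, γ τ) = γ := funext fun s => (hΓ s).deriv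
  refine ⟨fun s => ∫ τ in b..s, γ τ, ?_, ?_, ?_⟩
  · rw [show (2 : WithTop ℕ∞) = 1 + 1 from by norm_num, contDiff_succ_iff_deriv]
    refine ⟨fun s => (hΓ s).differentiableAt, by simp, by rw [dΓ]; exact hγC⟩
  · intro s hs
    simp only []
    rw [intervalIntegral.integral_congr (g := fun _ => 0)]
    · simp
    · intro τ hτ
      rw [Set.uIcc_of_le hs] at hτ
      exact hγ1 τ hτ.1
  · intro s
    rw [dΓ, dγ]
    by_cases hs : s = 0
    · rw [hs, hγ0 0 (by linarith), hz 0 (Or.inl (by linarith))]; simp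
    · simp only [hγ1d]; field_simp; ring

theorem c2_bd {f : ℝ → ℝ} (hf : ContDiff ℝ 2 f) (b : ℝ) (hz : ∀ s, b ≤ s → f s = 0) :
    ∃ C, 0 ≤ C ∧ ∀ s, 0 ≤ s → |f s| ≤ C ∧ |deriv f s| ≤ C ∧ |deriv (deriv f) s| ≤ C := by
  have h1 : ContDiff ℝ 1 (deriv f) := by
    rw [show (2 : WithTop ℕ∞) = 1 + 1 from by norm_num, contDiff_succ_iff_deriv] at hf
    exact hf.2.2
  have h2 : Continuous (deriv (deriv f)) := (contDiff_one_iff_deriv.1 h1).2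
  have hB : ∀ g : ℝ → ℝ, Continuous g → (∀ s, b < s → g s = 0) → ∃ C, 0 ≤ C ∧ ∀ s, 0 ≤ s → |g s| ≤ C := by
    intro g hg hgz
    obtain ⟨C, hC⟩ := (isCompact_Icc (a := (0:ℝ)) (b := b)).exists_bound_of_continuousOn hg.continuousOn
    refine ⟨|C|, abs_nonneg _, fun s hs => ?_⟩
    by_cases hsb : s ≤ b
    · exact (hC s ⟨hs, hsb⟩).trans (le_abs_self _)
    · rw [hgz s (not_le.1 hsb), abs_zero]; positivity
  have z0 : ∀ s, b < s → f =ᶠ[𝓝 s] fun _ => 0 := fun s hs => by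
    filter_upwards [Ioi_mem_nhds hs] with t ht using hz t (le_of_lt ht)
  have z1 : ∀ s, b < s → deriv f s = 0 := fun s hs => by rw [(z0 s hs).deriv_eq]; simp
  have z2 : ∀ s, b < s → deriv (deriv f) s = 0 := fun s hs => by rw [((z0 s hs).deriv).deriv_eq]; simp
  obtain ⟨C0, p0, q0⟩ := hB f hf.continuous (fun s hs => hz s hs.le)
  obtain ⟨C1, p1, q1⟩ := hB _ h1.continuous z1
  obtain ⟨C2, p2, q2⟩ := hB _ h2 z2
  exact ⟨C0 + C1 + C2, by positivity, fun s hs => ⟨by linarith [q0 s hs], by linarith [q1 s hs], by linarith [q2 s hs]⟩⟩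

/-- multiplication by `I` -/
noncomputable def Jm (n : ℕ) : E n →L[ℝ] E n := (Complex.I • ContinuousLinearMap.id ℂ (E n)).restrictScalars ℝ

theorem Jm_apply (v : E n) : Jm n v = Complex.I • v := rfl

noncomputable def qT (S : Bil n) : Bil n := (2 * dt S)⁻¹ • (S + S.bilinearComp (Jm n) (Jm n))

theorem qT_apply (S : Bil n) (v w : E n) : qT S v w = (2 * dt S)⁻¹ * (S v w + S (Complex.I • v) (Complex.I • w)) := by
  simp [qT, Jm_apply]; ring

theorem qT_sym {S : Bil n} (hS : ∀ v w, S v w = S w v) (v w : E n) : qT S v w = qT S w v := by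
  rw [qT_apply, qT_apply, hS v, hS (Complex.I • v)]

theorem qT_inv (S : Bil n) (v w : E n) : qT S (Complex.I • v) (Complex.I • w) = qT S v w := by
  rw [qT_apply, qT_apply, smul_smul, smul_smul, Complex.I_mul_I]
  simp [add_comm]

theorem qT_hC (S : Bil n) : hC (qT S) = ((dt S)⁻¹ : ℂ) • hC S := by
  have h1 : hC (S.bilinearComp (Jm n) (Jm n)) = hC S := by
    have e1 : ∀ j : Fin n, Jm n (Pi.single j 1) = Pi.single j Complex.I := fun j => by
      rw [Jm_apply]; ext i; by_cases h : i = j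
      · subst h; simp
      · simp [h]
    have e2 : ∀ j : Fin n, Jm n (Pi.single j Complex.I) = - Pi.single j 1 := fun j => by
      rw [Jm_apply]; ext i; by_cases h : i = j
      · subst h; simp
      · simp [h]
    ext j k
    rw [hC_apply, hC_apply]
    simp only [ContinuousLinearMap.bilinearComp_apply, e1, e2, map_neg, neg_neg, ContinuousLinearMap.neg_apply]
    push_cast; ring
  rw [qT, hC_smul, hC_add, h1]
  ext i j
  simp only [Matrix.smul_apply, Matrix.add_apply, smul_eq_mul]
  push_cast
  rw [mul_inv]; ring

theorem qT_vec {S : Bil n} (hS : ∀ v w, S v w = S w v) (z : E n) :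
    (fun j => ((qT S z (Pi.single j 1) : ℂ) - Complex.I * qT S z (Pi.single j Complex.I)) / 2) = hC (qT S) *ᵥ star z := by
  have e1 : ∀ j : Fin n, (Pi.single j Complex.I : E n) = Complex.I • Pi.single j 1 := fun j => by
      ext i; by_cases h : i = j
      · subst h; simp
      · simp [h]
  have e2 : ∀ (v w : E n), qT S (Complex.I • v) w = - qT S v (Complex.I • w) := fun v w => by
    rw [← qT_inv S v, smul_smul, Complex.I_mul_I]; simp
  set T := qT S with hT
  have hTs : ∀ v w, T v w = T w v := qT_sym hS
  funext j
  rw [Matrix.mulVec, dotProduct]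
  conv_lhs => rw [vec_decomp z]
  simp only [map_sum, map_add, map_smul, ContinuousLinearMap.sum_apply, ContinuousLinearMap.add_apply, ContinuousLinearMap.smul_apply,
    smul_eq_mul, Complex.ofReal_sum, Finset.mul_sum, ← Finset.sum_sub_distrib, Finset.sum_div]
  refine Finset.sum_congr rfl fun k _ => ?_
  rw [hC_apply]
  simp only [e1, e2, qT_inv, Pi.star_apply, RCLike.star_def, ← hT]
  have i1 : T (Complex.I • Pi.single k 1) (Complex.I • Pi.single j 1) = T (Pi.single k 1) (Pi.single j 1) := by rw [hT, qT_inv]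
  have i2 : T (Complex.I • Pi.single j 1) (Complex.I • Pi.single k 1) = T (Pi.single k 1) (Pi.single j 1) := by rw [hT, qT_inv, qT_sym hS]
  have i3 : T (Pi.single j 1) (Complex.I • Pi.single k 1) = - T (Pi.single k 1) (Complex.I • Pi.single j 1) := by
    rw [hTs, e2]
  have i4 : T (Complex.I • Pi.single k 1) (Complex.I • Complex.I • Pi.single j 1) = T (Pi.single k 1) (Complex.I • Pi.single j 1) := by rw [hT, qT_inv]
  rw [i3, hTs (Pi.single j 1) (Pi.single k 1)]
  have : (starRingEnd ℂ) (z k) = ((z k).re : ℂ) - Complex.I * (z k).im := by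
    apply Complex.ext <;> simp
  rw [this]
  simp only [smul_smul, Complex.I_mul_I, neg_smul, one_smul, map_neg]
  rw [hTs (Pi.single j 1) (Pi.single k 1)]
  push_cast
  linear_combination -((z k).im : ℂ) * (T (Pi.single k 1) (Complex.I • Pi.single j 1) : ℂ) / 2 * Complex.I_sq

theorem dt_det {S : Bil n} (hS : ∀ v w, S v w = S w v) : (hC S).det = (dt S : ℂ) := herm_det_real (hC_herm hS)

theorem qT_bd {l K : ℝ} (hl : 0 < l) {S : Bil n} (he : Ell l (hC S)) (hb : ‖S‖ ≤ K) : ‖qT S‖ ≤ K / l ^ n := by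
  have hK : 0 ≤ K := (norm_nonneg _).trans hb
  have hd : l ^ n ≤ dt S := Ell.det_ge hl he
  have hl0 : 0 < l ^ n := by positivity
  refine ContinuousLinearMap.opNorm_le_bound₂ _ (by positivity) fun v w => ?_
  rw [qT_apply, Real.norm_eq_abs, abs_mul, abs_of_nonneg (inv_nonneg.2 (by linarith : 0 ≤ 2 * dt S))]
  have h1 : |S v w| ≤ K * ‖v‖ * ‖w‖ := (S.le_opNorm₂ v w).trans (by gcongr)
  have h2 : |S (Complex.I • v) (Complex.I • w)| ≤ K * ‖v‖ * ‖w‖ := by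
    refine (S.le_opNorm₂ _ _).trans ?_
    rw [norm_smul, norm_smul, Complex.norm_I, one_mul, one_mul]; gcongr
  have h3 : |S v w + S (Complex.I • v) (Complex.I • w)| ≤ 2 * (K * ‖v‖ * ‖w‖) := (abs_add_le _ _).trans (by linarith)
  calc (2 * dt S)⁻¹ * |S v w + S (Complex.I • v) (Complex.I • w)| ≤ (2 * l ^ n)⁻¹ * (2 * (K * ‖v‖ * ‖w‖)) := by
        gcongr
    _ = K / l ^ n * ‖v‖ * ‖w‖ := by field_simp

theorem qT_low (n : ℕ) {l K : ℝ} (hl : 0 < l) (hK : 0 ≤ K) : ∃ lam > 0, ∀ S : Bil n, (∀ v w, S v w = S w v) → Ell l (hC S) → ‖S‖ ≤ K →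
    ∀ z, lam * ‖z‖ ^ 2 ≤ qd 0 0 (qT S) z := by
  obtain ⟨D, hD0, hD⟩ := dt_bd n hK
  refine ⟨l / (D + 1), by positivity, fun S hs he hb z => ?_⟩
  have hd : l ^ n ≤ dt S := Ell.det_ge hl he
  have hd0 : 0 < dt S := lt_of_lt_of_le (by positivity) hd
  have hdD : dt S ≤ D + 1 := by linarith [(abs_le.1 (hD S hb)).2]
  have h1 : l * ‖z‖ ^ 2 ≤ qf (hC S) (star z) := by
    refine le_trans ?_ (he.2 (star z))
    have : ∑ i, ‖(star z) i‖ ^ 2 = q z := by rw [q_eq]; simp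
    rw [this]
    exact mul_le_mul_of_nonneg_left (norm_le_q z) hl.le
  have h2 : qd 0 0 (qT S) z = (dt S)⁻¹ * qf (hC S) (star z) := by
    rw [qf_hC hs, qd, qT_apply, mul_inv]; simp; ring
  rw [h2]
  calc l / (D + 1) * ‖z‖ ^ 2 = (D + 1)⁻¹ * (l * ‖z‖ ^ 2) := by field_simp
    _ ≤ (dt S)⁻¹ * qf (hC S) (star z) := by gcongr

theorem qT_adj {l : ℝ} (hl : 0 < l) {S : Bil n} (hs : ∀ v w, S v w = S w v) (he : Ell l (hC S)) :
    (hC S).adjugate * hC (qT S) = 1 := by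
  have hd0 : (dt S : ℂ) ≠ 0 := by
    have : l ^ n ≤ dt S := Ell.det_ge hl he
    have : 0 < dt S := lt_of_lt_of_le (by positivity) this
    exact_mod_cast this.ne'
  rw [qT_hC, Matrix.mul_smul, Matrix.adjugate_mul, dt_det hs, smul_smul, inv_mul_cancel₀ hd0, one_smul]

theorem qT_L {l : ℝ} (hl : 0 < l) {S : Bil n} (hs : ∀ v w, S v w = S w v) (he : Ell l (hC S)) :
    LB (hC S).adjugate (qT S) = n := by
  rw [LB, qT_adj hl hs he]; simp

theorem qT_tp {l : ℝ} (hl : 0 < l) {S : Bil n} (hs : ∀ v w, S v w = S w v) (he : Ell l (hC S)) (z : E n) :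
    LB (hC S).adjugate (tp (qT S z) (qT S z)) = qd 0 0 (qT S) z := by
  rw [LB_tp, qT_vec hs, ← qf_conj, (hC_herm (qT_sym hs)).eq, Matrix.mul_assoc, qT_adj hl hs he, Matrix.mul_one,
    qf_hC (qT_sym hs), qT_inv, qd]
  simp; ring

theorem rad_LC {T : Bil n} {f : ℝ → ℝ} (hf : ContDiff ℝ 2 f) : LC (fun x => f (qd 0 0 T x)) :=
  (qd_lc 0 0 T).comp fun _ => hf.contDiffAt

theorem rad_D2 {T : Bil n} (hT : ∀ v w, T v w = T w v) {f : ℝ → ℝ} (hf : ContDiff ℝ 2 f) (x : E n) :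
    D2 (fun x => f (qd 0 0 T x)) x = deriv f (qd 0 0 T x) • T + deriv (deriv f) (qd 0 0 T x) • tp (T x) (T x) := by
  rw [D2_comp (qd_lc 0 0 T) (fun _ => hf.contDiffAt) (sm_ae (qd_smooth 0 0 T) x), qd_D2 0 0 hT, qd_fderiv 0 0 hT]
  simp

theorem rad_L {l : ℝ} (hl : 0 < l) {S : Bil n} (hs : ∀ v w, S v w = S w v) (he : Ell l (hC S)) {f : ℝ → ℝ} (hf : ContDiff ℝ 2 f) (x : E n) :
    LB (hC S).adjugate (D2 (fun x => f (qd 0 0 (qT S) x)) x) =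
      n * deriv f (qd 0 0 (qT S) x) + qd 0 0 (qT S) x * deriv (deriv f) (qd 0 0 (qT S) x) := by
  rw [rad_D2 (qT_sym hs) hf, LB_add, LB_smul, LB_smul, qT_L hl hs he, qT_tp hl hs he]; ring

theorem tp_norm (p r : E n →L[ℝ] ℝ) : ‖tp p r‖ ≤ ‖p‖ * ‖r‖ := by
  rw [tp, ContinuousLinearMap.norm_smulRight_apply]

theorem qd_even (T : Bil n) (x : E n) : qd 0 0 T (-x) = qd 0 0 T x := by simp [qd]

theorem qd_even' (T : Bil n) (x y : E n) : qd 0 0 T (x - y) = qd 0 0 T (y - x) := by rw [← qd_even, neg_sub]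

/-- bound for the second derivative of a radial function -/
theorem rad_bd {T : Bil n} (hT : ∀ v w, T v w = T w v) {T0 lam b C : ℝ} (hT0 : ‖T‖ ≤ T0) (hlam : 0 < lam)
    (hlow : ∀ z, lam * ‖z‖ ^ 2 ≤ qd 0 0 T z) (hb : b ≤ lam) (hC0 : 0 ≤ C)
    {f : ℝ → ℝ} (hf : ContDiff ℝ 2 f) (hz : ∀ s, b ≤ s → f s = 0)
    (hC : ∀ s, 0 ≤ s → |f s| ≤ C ∧ |deriv f s| ≤ C ∧ |deriv (deriv f) s| ≤ C) (x : E n) :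
    ‖D2 (fun x => f (qd 0 0 T x)) x‖ ≤ C * (T0 + T0 ^ 2) := by
  have hTn : 0 ≤ T0 := (norm_nonneg _).trans hT0
  have hq0 : 0 ≤ qd 0 0 T x := le_trans (by positivity) (hlow x)
  by_cases hx : ‖x‖ ≤ 1
  · rw [rad_D2 hT hf]
    obtain ⟨-, h1, h2⟩ := hC _ hq0
    have hTx : ‖T x‖ ≤ T0 := (T.le_opNorm x).trans (by nlinarith [norm_nonneg x, norm_nonneg T])
    have h3 : ‖tp (T x) (T x)‖ ≤ T0 ^ 2 := (tp_norm _ _).trans (by nlinarith [norm_nonneg (T x)])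
    refine (norm_add_le _ _).trans ?_
    rw [norm_smul, norm_smul, Real.norm_eq_abs, Real.norm_eq_abs]
    have := mul_le_mul h1 hT0 (norm_nonneg _) hC0
    have := mul_le_mul h2 h3 (norm_nonneg _) hC0
    linarith
  · push Not at hx
    have : (fun x => f (qd 0 0 T x)) =ᶠ[𝓝 x] fun _ => 0 := by
      filter_upwards [(isOpen_lt continuous_const continuous_norm).mem_nhds hx] with y hy
      refine hz _ (le_trans ?_ (hlow y))
      have hy' : 1 < ‖y‖ := hy
      have hy2 : 1 ≤ ‖y‖ ^ 2 := by nlinarith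
      nlinarith
    rw [D2_congr this, D2_const, norm_zero]; positivity

/-- the properties of the one dimensional profile -/
structure Eta (n : ℕ) (a : ℝ) (η : ℝ → ℝ) : Prop where
  pos : 0 < a
  sm : ContDiff ℝ (⊤ : ℕ∞) η
  nn : ∀ s, 0 ≤ η s
  zero : ∀ s, s ≤ a / 4 ∨ a ≤ s → η s = 0
  low : ∃ m > 0, ∀ s, |s - 5 * a / 8| ≤ a / 8 → m ≤ η s
  int : Integrable (fun s => s ^ (n - 1) * η s)
  one : ∫ s, s ^ (n - 1) * η s = 1

theorem Eta.ex (n : ℕ) {a : ℝ} (ha : 0 < a) : ∃ η, Eta n a η := by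
  obtain ⟨η, h1, h2, h3, h4, h5, h6⟩ := exists_eta n ha
  exact ⟨η, ha, h1, h2, h3, h4, h5, h6⟩

theorem Eta.c2 {a : ℝ} {η : ℝ → ℝ} (h : Eta n a η) : ContDiff ℝ 2 η := contDiff_infty.1 h.sm 2

/-- radius bound for the support -/
theorem rad_supp {T : Bil n} {lam b r : ℝ} (hlam : 0 < lam) (hr : 0 ≤ r)
    (hlow : ∀ z, lam * ‖z‖ ^ 2 ≤ qd 0 0 T z) (hb : b ≤ lam * r ^ 2) {f : ℝ → ℝ} (hz : ∀ s, b ≤ s → f s = 0) {x : E n}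
    (hx : r ≤ ‖x‖) : f (qd 0 0 T x) = 0 := by
  refine hz _ (hb.trans (le_trans ?_ (hlow x)))
  gcongr

theorem kdiff (hn : 0 < n) {l K lam a b : ℝ} (hl : 0 < l) (hK : 0 ≤ K) (hlam : 0 < lam) (hab : a ≤ b) (hb : b ≤ lam * (3/8) ^ 2)
    {ηa ηb : ℝ → ℝ} (ha : Eta n a ηa) (hηb : Eta n b ηb) : ∃ C, 0 < C ∧ ∀ σ ε u c p, ∀ S : Bil n, Hyp l K σ ε u c p S →
      (∀ z, lam * ‖z‖ ^ 2 ≤ qd 0 0 (qT S) z) →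
      (∫ x, ηb (qd 0 0 (qT S) x) = ∫ x, ηa (qd 0 0 (qT S) x)) ∧ ∀ x, ‖x‖ ≤ 1/2 →
      |mol (fun x => ηb (qd 0 0 (qT S) x)) (fun x => u x - qd c p S x) x - mol (fun x => ηa (qd 0 0 (qT S) x)) (fun x => u x - qd c p S x) x|
        ≤ C * (σ + ε * √(ε + σ)) := by
  have hδc : Continuous (fun s => ηb s - ηa s) := hηb.sm.continuous.sub ha.sm.continuous
  obtain ⟨Γ, hΓ, hΓz, hΓe⟩ := exists_Gam hn ha.pos hab hδc (fun s hs => by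
    have h1 : ηb s = 0 := hηb.zero s (by rcases hs with h | h; left; linarith; right; exact h)
    have h2 : ηa s = 0 := ha.zero s (by rcases hs with h | h; left; linarith; right; linarith)
    simp [h1, h2]) (by
    have : (fun s => s ^ (n - 1) * (ηb s - ηa s)) = fun s => s ^ (n - 1) * ηb s - s ^ (n - 1) * ηa s := by funext s; ring
    rw [this, integral_sub hηb.int ha.int, hηb.one, ha.one, sub_self])
  obtain ⟨CG, hCG0, hCG⟩ := c2_bd hΓ b hΓz
  obtain ⟨Cb, hCb0, hCb⟩ := Fb n hl hK
  set T0 := K / l ^ n with hT0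
  have hT00 : 0 ≤ T0 := by positivity
  refine ⟨Cb * (CG * (T0 + T0 ^ 2)) + CG * (V1 n + 1) ^ 2 + 1, by positivity, fun σ ε u c p S H hlow => ?_⟩
  have hTs := qT_sym H.sym
  have hTb := qT_bd hl H.ellS H.bdS
  set Q := qd 0 0 (qT S) with hQ
  have hQc : Continuous Q := (qd_smooth 0 0 (qT S)).continuous
  have hQ0 : ∀ x, 0 ≤ Q x := fun x => le_trans (by positivity) (hlow x)
  have hLe : ∀ x, LB (hC S).adjugate (D2 (fun x => Γ (Q x)) x) = ηb (Q x) - ηa (Q x) := fun x => by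
    rw [hQ, rad_L hl H.sym H.ellS hΓ, hΓe]
  have hsz : ∀ f : ℝ → ℝ, (∀ s, b ≤ s → f s = 0) → ∀ x, 3/8 ≤ ‖x‖ → f (Q x) = 0 := fun f hf x hx =>
    rad_supp hlam (by norm_num) hlow hb hf hx
  have hcsb : HasCompactSupport (fun x => ηb (Q x)) := cs_of_zero (R := 3/8) fun x hx => hsz ηb (fun s hs => hηb.zero s (Or.inr hs)) x hx.le
  have hcsa : HasCompactSupport (fun x => ηa (Q x)) := cs_of_zero (R := 3/8) fun x hx => hsz ηa (fun s hs => ha.zero s (Or.inr (hab.trans hs))) x hx.le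
  have hcb : Continuous (fun x => ηb (Q x)) := hηb.sm.continuous.comp hQc
  have hca : Continuous (fun x => ηa (Q x)) := ha.sm.continuous.comp hQc
  constructor
  · have hcs : HasCompactSupport (fun x => Γ (Q x)) := cs_of_zero (R := 3/8) fun x hx => hsz Γ hΓz x hx.le
    have := (LU_int_zero (qd_lc 0 0 S) (rad_LC (T := qT S) hΓ) hcs).2
    simp only [LU, qd_D2 0 0 H.sym] at this
    rw [integral_congr_ae (Eventually.of_forall hLe), integral_sub (hcb.integrable_of_hasCompactSupport hcsb)
      (hca.integrable_of_hasCompactSupport hcsa)] at this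
    linarith
  · intro x hx
    set w := fun x => u x - qd c p S x with hw
    have hwc : Continuous w := (H.lc.sub (qd_lc c p S)).cont
    set ψ : E n → ℝ := fun y => Γ (Q (y - x)) with hψ
    have hψD : ∀ y, D2 ψ y = D2 (fun x => Γ (Q x)) (y - x) := fun y => D2_shift (fun x => Γ (Q x)) x y
    have hψlc : LC ψ := by
      have := (rad_LC (T := qT S) hΓ).aff (-x) 1
      refine (show ψ = _ from ?_) ▸ this
      funext y; simp only [hψ, hQ, one_smul]; congr 2; abel
    have hψz : ∀ y, 7/8 < ‖y‖ → ψ y = 0 := fun y hy => hsz Γ hΓz _ (by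
      have := norm_sub_norm_le y x
      linarith)
    have hFb := Hyp.hε H
    have h1 := hCb σ ε u c p S H ψ hψlc hψz (CG * (T0 + T0 ^ 2)) (by positivity) (Eventually.of_forall fun y => by
      rw [hψD]
      exact rad_bd hTs hTb hlam hlow (by nlinarith) hCG0 hΓ hΓz hCG _)
    have h2 : |∫ y, ψ y * (dt (D2 u y) - dt S)| ≤ (CG * σ) * ((V1 n + 1) * (V1 n + 1)) := by
      have hV := V1_nonneg (n := n)
      refine l1_le (w := fun _ => 1) continuous_const (by positivity) (mul_nonneg hCG0 H.hσ) ?_ ?_ ?_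
      · have : L2 (fun _ : E n => (1:ℝ)) = V1 n := by simp [L2, V1, Measure.real]
        rw [this]; nlinarith
      · filter_upwards [H.det] with y hy hy1
        rw [abs_mul, abs_one, mul_one]
        exact mul_le_mul (hCG _ (hQ0 _)).1 (hy hy1) (abs_nonneg _) hCG0
      · exact Eventually.of_forall fun y hy => by rw [hψz y (by linarith), zero_mul]
    have h3 : mol (fun x => ηb (Q x)) w x - mol (fun x => ηa (Q x)) w x = ∫ y, w y * LB (hC S).adjugate (D2 ψ y) := by
      have i1 := mol_int (lbm_cont hwc) hcb hcsb x
      have i2 := mol_int (lbm_cont hwc) hca hcsa x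
      rw [mol, mol, ← integral_sub i1 i2, ← integral_sub_left_eq_self _ _ x]
      refine integral_congr_ae (Eventually.of_forall fun y => ?_)
      simp only [smul_eq_mul, sub_sub_cancel, hψD, hLe]
      rw [show Q (x - y) = Q (y - x) from qd_even' _ _ _]; ring
    rw [h3]
    have h4 := abs_sub_abs_le_abs_sub (∫ y, w y * LB (hC S).adjugate (D2 ψ y)) (∫ y, ψ y * (dt (D2 u y) - dt S))
    have hs0 := H.hσ
    have hX : 0 ≤ ε * √(ε + σ) := mul_nonneg hFb.le (Real.sqrt_nonneg _)
    have hA : 0 ≤ Cb * (CG * (T0 + T0 ^ 2)) := by positivity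
    have hB : 0 ≤ CG * (V1 n + 1) ^ 2 := by positivity
    nlinarith [mul_nonneg hA hs0, mul_nonneg hB hX]

theorem qd_diff {T : Bil n} (hT : ∀ v w, T v w = T w v) (x y : E n) : qd 0 0 T x - qd 0 0 T y = T (x - y) (x + y) / 2 := by
  simp [qd, hT y x]; ring

theorem qd_diff_le {T : Bil n} (hT : ∀ v w, T v w = T w v) {T0 M : ℝ} (hT0 : ‖T‖ ≤ T0) {x y : E n} (hM : ‖x + y‖ ≤ 2 * M) :
    |qd 0 0 T x - qd 0 0 T y| ≤ T0 * M * ‖x - y‖ := by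
  have h0 : 0 ≤ T0 := (norm_nonneg _).trans hT0
  rw [qd_diff hT, abs_div, abs_two]
  have : |T (x - y) (x + y)| ≤ T0 * ‖x - y‖ * (2 * M) := (T.le_opNorm₂ _ _).trans (by gcongr)
  linarith

theorem mass_low (hn : 0 < n) {lam b T0 : ℝ} (hlam : 0 < lam) (hT00 : 0 ≤ T0) (hb : b ≤ lam) {η : ℝ → ℝ} (hη : Eta n b η) :
    ∃ c0 > 0, ∀ T : Bil n, (∀ v w, T v w = T w v) → ‖T‖ ≤ T0 → (∀ z, lam * ‖z‖ ^ 2 ≤ qd 0 0 T z) → c0 ≤ ∫ x, η (qd 0 0 T x) := by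
  obtain ⟨m, hm, hml⟩ := hη.low
  have hb0 := hη.pos
  set r1 := min 1 (b / (8 * (2 * T0 + 1))) with hr1
  have hr0 : 0 < r1 := lt_min one_pos (by positivity)
  have hr11 : r1 ≤ 1 := min_le_left _ _
  have hr12 : r1 * (2 * T0 + 1) ≤ b / 8 := by
    have : r1 ≤ b / (8 * (2 * T0 + 1)) := min_le_right _ _
    rw [le_div_iff₀ (by positivity)] at this
    linarith
  have hvol : 0 < (volume (Metric.ball (0 : E n) r1)).toReal :=
    ENNReal.toReal_pos (Metric.measure_ball_pos _ _ hr0).ne' measure_ball_lt_top.ne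
  refine ⟨m * (volume (Metric.ball (0 : E n) r1)).toReal, by positivity, fun T hT hTb hlow => ?_⟩
  set e : E n := Pi.single ⟨0, hn⟩ 1 with he
  have hen : ‖e‖ = 1 := by rw [he]; simp [Pi.norm_single]
  set q0 := qd 0 0 T e with hq0
  have hq : lam ≤ q0 := by have := hlow e; rw [hen] at this; linarith
  have hqp : 0 < q0 := by linarith
  set τ := √(5 * b / (8 * q0)) with hτ
  have hτ2 : τ ^ 2 * q0 = 5 * b / 8 := by rw [hτ, Real.sq_sqrt (by positivity)]; field_simp
  have hτ0 : 0 ≤ τ := Real.sqrt_nonneg _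
  have hτ1 : τ ≤ 1 := by
    rw [hτ, Real.sqrt_le_left zero_le_one, one_pow, div_le_one (by positivity)]; linarith
  have hQz : qd 0 0 T (τ • e) = 5 * b / 8 := by
    rw [← hτ2, hq0]; simp [qd]; ring
  have hitg : Integrable (fun x => η (qd 0 0 T x)) :=
    (hη.sm.continuous.comp (qd_smooth 0 0 T).continuous).integrable_of_hasCompactSupport
      (cs_of_zero (R := 1) fun x hx => rad_supp hlam zero_le_one hlow (by linarith) (fun s hs => hη.zero s (Or.inr hs)) hx.le)
  have hind : ∫ x, (Metric.ball (τ • e) r1).indicator (fun _ => m) x = m * (volume (Metric.ball (0 : E n) r1)).toReal := by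
    rw [integral_indicator Metric.isOpen_ball.measurableSet, setIntegral_const, smul_eq_mul, mul_comm, Measure.real, Measure.addHaar_ball_center]
  rw [← hind]
  refine integral_mono ((integrable_indicator_iff Metric.isOpen_ball.measurableSet).2 (integrableOn_const measure_ball_lt_top.ne)) hitg fun x => ?_
  by_cases hx : x ∈ Metric.ball (τ • e) r1
  · rw [Set.indicator_of_mem hx]
    refine hml _ ?_
    rw [← hQz]
    have hxd : ‖x - τ • e‖ < r1 := by rwa [mem_ball_iff_norm] at hx
    have hte : ‖τ • e‖ ≤ 1 := by rw [norm_smul, hen, Real.norm_of_nonneg hτ0]; linarith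
    have hs : ‖x + τ • e‖ ≤ 2 * 2 := by
      have : x + τ • e = (x - τ • e) + τ • e + τ • e := by abel
      rw [this]
      exact (norm_add₃_le).trans (by linarith)
    refine (qd_diff_le hT hTb hs).trans ?_
    nlinarith [norm_nonneg (x - τ • e)]
  · rw [Set.indicator_of_notMem hx]; exact hη.nn _

theorem eta_bds {b : ℝ} {η : ℝ → ℝ} (hη : Eta n b η) : ∃ C, 0 ≤ C ∧ (∀ s, 0 ≤ s → |η s| ≤ C ∧ |deriv η s| ≤ C ∧ |deriv (deriv η) s| ≤ C) ∧
    ∀ s t, 0 ≤ s → 0 ≤ t → |deriv η s - deriv η t| ≤ C * |s - t| ∧ |deriv (deriv η) s - deriv (deriv η) t| ≤ C * |s - t| := by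
  have h3 : ContDiff ℝ 3 η := contDiff_infty.1 hη.sm 3
  have h2 : ContDiff ℝ 2 (deriv η) := by
    rw [show (3 : WithTop ℕ∞) = 2 + 1 from by norm_num, contDiff_succ_iff_deriv] at h3
    exact h3.2.2
  have h1 : ContDiff ℝ 1 (deriv (deriv η)) := by
    rw [show (2 : WithTop ℕ∞) = 1 + 1 from by norm_num, contDiff_succ_iff_deriv] at h2
    exact h2.2.2
  obtain ⟨C1, c1, d1⟩ := c2_bd hη.c2 b (fun s hs => hη.zero s (Or.inr hs))
  obtain ⟨C2, c2, d2⟩ := c2_bd h2 (b + 1) (fun s hs => by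
    have : η =ᶠ[𝓝 s] fun _ => 0 := by
      filter_upwards [Ioi_mem_nhds (show b < s by linarith)] with t ht using hη.zero t (Or.inr (le_of_lt ht))
    rw [this.deriv_eq]; simp)
  refine ⟨C1 + C2, by positivity, fun s hs => ?_, fun s t hs ht => ⟨?_, ?_⟩⟩
  · obtain ⟨x1, x2, x3⟩ := d1 s hs
    exact ⟨by linarith, by linarith, by linarith⟩
  · have := (convex_Ici (0:ℝ)).norm_image_sub_le_of_norm_deriv_le (f := deriv η) (C := C1 + C2) (x := t) (y := s)
      (fun x _ => (h2.differentiable (by simp)) x) (fun x hx => by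
        have := (d2 x hx).2.1; rw [Real.norm_eq_abs]; linarith) ht hs
    simpa using this
  · have := (convex_Ici (0:ℝ)).norm_image_sub_le_of_norm_deriv_le (f := deriv (deriv η)) (C := C1 + C2) (x := t) (y := s)
      (fun x _ => (h1.differentiable (by simp)) x) (fun x hx => by
        have := (d2 x hx).2.2; rw [Real.norm_eq_abs]; linarith) ht hs
    simpa using this

theorem tp_sub (p r : E n →L[ℝ] ℝ) : tp p p - tp r r = tp (p - r) p + tp r (p - r) := by
  ext v w
  simp only [ContinuousLinearMap.sub_apply, ContinuousLinearMap.add_apply, tp_apply]; ring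

theorem rad_lip {lam b T0 : ℝ} (hlam : 0 < lam) (hT00 : 0 ≤ T0) {η : ℝ → ℝ} (hη : Eta n b η) :
    ∃ C > 0, ∀ T : Bil n, (∀ v w, T v w = T w v) → ‖T‖ ≤ T0 → (∀ z, lam * ‖z‖ ^ 2 ≤ qd 0 0 T z) →
      ∀ x y, ‖x‖ ≤ 2 → ‖y‖ ≤ 2 → ‖D2 (fun x => η (qd 0 0 T x)) x - D2 (fun x => η (qd 0 0 T x)) y‖ ≤ C * ‖x - y‖ := by
  obtain ⟨C, hC, h1, h2⟩ := eta_bds hη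
  refine ⟨C * (2 * T0) * T0 + C * (2 * T0) * (2 * T0 * (2 * T0)) + C * (4 * T0 * T0) + 1, by positivity, fun T hT hTb hlow x y hx hy => ?_⟩
  rw [rad_D2 hT hη.c2, rad_D2 hT hη.c2]
  have q1 : 0 ≤ qd 0 0 T x := le_trans (by positivity) (hlow x)
  have q2 : 0 ≤ qd 0 0 T y := le_trans (by positivity) (hlow y)
  have hqd : |qd 0 0 T x - qd 0 0 T y| ≤ T0 * 2 * ‖x - y‖ := qd_diff_le hT hTb ((norm_add_le _ _).trans (by linarith))
  obtain ⟨l1, l2⟩ := h2 _ _ q1 q2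
  obtain ⟨-, -, b2⟩ := h1 _ q2
  set fx := deriv η (qd 0 0 T x)
  set fy := deriv η (qd 0 0 T y)
  set gx := deriv (deriv η) (qd 0 0 T x)
  set gy := deriv (deriv η) (qd 0 0 T y)
  set d := ‖x - y‖
  have hd0 : 0 ≤ d := norm_nonneg _
  have e : fx • T + gx • tp (T x) (T x) - (fy • T + gy • tp (T y) (T y)) =
      (fx - fy) • T + (gx - gy) • tp (T x) (T x) + gy • (tp (T x) (T x) - tp (T y) (T y)) := by module
  have n1 : |fx - fy| ≤ C * (T0 * 2 * d) := l1.trans (by gcongr)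
  have n2 : |gx - gy| ≤ C * (T0 * 2 * d) := l2.trans (by gcongr)
  have nT : ∀ z : E n, ‖z‖ ≤ 2 → ‖T z‖ ≤ 2 * T0 := fun z hz => (T.le_opNorm z).trans (by nlinarith [norm_nonneg z, norm_nonneg T])
  have nx := nT x hx
  have ny := nT y hy
  have nd : ‖T x - T y‖ ≤ T0 * d := by rw [← map_sub]; exact (T.le_opNorm _).trans (by gcongr)
  have m1 : ‖tp (T x) (T x)‖ ≤ 2 * T0 * (2 * T0) := (tp_norm _ _).trans (by gcongr)
  have m2 : ‖tp (T x) (T x) - tp (T y) (T y)‖ ≤ 4 * T0 * T0 * d := by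
    rw [tp_sub]
    refine (norm_add_le _ _).trans ?_
    have a1 : ‖tp (T x - T y) (T x)‖ ≤ (T0 * d) * (2 * T0) := (tp_norm _ _).trans (by gcongr)
    have a2 : ‖tp (T y) (T x - T y)‖ ≤ (2 * T0) * (T0 * d) := (tp_norm _ _).trans (by gcongr)
    linarith
  rw [e]
  refine norm_add₃_le.trans ?_
  rw [norm_smul, norm_smul, norm_smul, Real.norm_eq_abs, Real.norm_eq_abs, Real.norm_eq_abs]
  have z1 : |fx - fy| * ‖T‖ ≤ C * (T0 * 2 * d) * T0 := by gcongr
  have z2 : |gx - gy| * ‖tp (T x) (T x)‖ ≤ C * (T0 * 2 * d) * (2 * T0 * (2 * T0)) := by gcongr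
  have z3 : |gy| * ‖tp (T x) (T x) - tp (T y) (T y)‖ ≤ C * (4 * T0 * T0 * d) := by gcongr
  nlinarith

/-- Jensen for squares -/
theorem sq_int_le {X : Type*} [MeasurableSpace X] {μ : Measure X} {k v : X → ℝ} (hk : ∀ x, 0 ≤ k x) (h0 : Integrable k μ) (h1 : ∫ x, k x ∂μ = 1)
    (h2 : Integrable (fun x => k x * v x) μ) (h3 : Integrable (fun x => k x * v x ^ 2) μ) :
    (∫ x, k x * v x ∂μ) ^ 2 ≤ ∫ x, k x * v x ^ 2 ∂μ := by
  set m := ∫ x, k x * v x ∂μ with hm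
  have h : 0 ≤ ∫ x, k x * (v x - m) ^ 2 ∂μ := integral_nonneg fun x => mul_nonneg (hk x) (sq_nonneg _)
  have e : (fun x => k x * (v x - m) ^ 2) = fun x => (k x * v x ^ 2 - (2 * m) * (k x * v x)) + m ^ 2 * k x := by
    funext x; ring
  have hs : Integrable (fun x => k x * v x ^ 2 - (2 * m) * (k x * v x)) μ := h3.sub (h2.const_mul _)
  rw [e, integral_add hs (h0.const_mul _), integral_sub h3 (h2.const_mul _), integral_const_mul,
    integral_const_mul, h1, ← hm] at h
  nlinarith

/-- pointwise difference quotient bound -/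
theorem dq_sq {w : E n → ℝ} (hw : LC w) (x t : E n) :
    (w (x - t) - w x) ^ 2 ≤ ‖t‖ ^ 2 * ∫ s in (0:ℝ)..1, ‖fderiv ℝ w (x - s • t)‖ ^ 2 := by
  have hc : Continuous (fun s : ℝ => fderiv ℝ w (x - s • t)) := hw.contD.comp (by fun_prop)
  have hd : ∀ s ∈ Set.uIcc (0:ℝ) 1, HasDerivAt (fun s : ℝ => w (x - s • t)) (fderiv ℝ w (x - s • t) (-t)) s := by
    intro s _
    have h1 : HasDerivAt (fun s : ℝ => x - s • t) (-t) s := by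
      have := ((hasDerivAt_id s).smul_const t).const_sub x
      simpa using this
    exact (hw.diff (x - s • t)).hasFDerivAt.comp_hasDerivAt s h1
  have hg : Continuous (fun s : ℝ => fderiv ℝ w (x - s • t) (-t)) := hc.clm_apply continuous_const
  have hftc := intervalIntegral.integral_eq_sub_of_hasDerivAt hd (hg.intervalIntegrable _ _)
  simp only [one_smul, zero_smul, sub_zero] at hftc
  rw [← hftc, ← intervalIntegral.integral_const_mul, intervalIntegral.integral_of_le zero_le_one, intervalIntegral.integral_of_le zero_le_one]
  have hi : ∀ f : ℝ → ℝ, Continuous f → Integrable f (volume.restrict (Set.Ioc (0:ℝ) 1)) := fun f hf =>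
    (hf.integrableOn_Icc (a := 0) (b := 1)).mono_set Set.Ioc_subset_Icc_self
  have h := sq_int_le (μ := volume.restrict (Set.Ioc (0:ℝ) 1)) (k := fun _ => 1) (v := fun s => fderiv ℝ w (x - s • t) (-t))
    (fun _ => zero_le_one) (hi _ continuous_const) (by simp) (hi _ (by fun_prop)) (hi _ (by fun_prop))
  simp only [one_mul] at h
  refine h.trans (integral_mono (hi _ (by fun_prop)) (hi _ (by fun_prop)) fun s => ?_)
  have := (fderiv ℝ w (x - s • t)).le_opNorm (-t)
  rw [norm_neg, Real.norm_eq_abs] at this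
  calc (fderiv ℝ w (x - s • t) (-t)) ^ 2 = |fderiv ℝ w (x - s • t) (-t)| ^ 2 := (sq_abs _).symm
    _ ≤ (‖fderiv ℝ w (x - s • t)‖ * ‖t‖) ^ 2 := by gcongr
    _ = _ := by ring

theorem TR1 {w : E n → ℝ} (hw : LC w) {r0 : ℝ} (hr : r0 ≤ 3/8) {t : E n} (ht : ‖t‖ ≤ r0) :
    ∫⁻ x in Metric.ball (0 : E n) (1/2), ENNReal.ofReal ((w (x - t) - w x) ^ 2) ≤
      ENNReal.ofReal (r0 ^ 2 * ∫ x, ps x * ‖fderiv ℝ w x‖ ^ 2) := by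
  set Φ : E n → ℝ := fun x => ps x * ‖fderiv ℝ w x‖ ^ 2 with hΦ
  have hΦc : Continuous Φ := ps_smooth.continuous.mul (hw.contD.norm.pow 2)
  have hΦ0 : ∀ x, 0 ≤ Φ x := fun x => mul_nonneg (ps_nonneg x) (sq_nonneg _)
  have hr0 : 0 ≤ r0 := (norm_nonneg _).trans ht
  have hp : ∀ x ∈ Metric.ball (0 : E n) (1/2), ENNReal.ofReal ((w (x - t) - w x) ^ 2) ≤
      ENNReal.ofReal (r0 ^ 2) * ∫⁻ s in Set.Ioc (0:ℝ) 1, ENNReal.ofReal (Φ (x - s • t)) := by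
    intro x hx
    have hx' : ‖x‖ < 1/2 := by simpa using hx
    have hc : Continuous (fun s : ℝ => Φ (x - s • t)) := hΦc.comp (by fun_prop)
    rw [← ofReal_integral_eq_lintegral_ofReal ((hc.integrableOn_Icc (a := 0) (b := 1)).mono_set Set.Ioc_subset_Icc_self)
      (Eventually.of_forall fun s => hΦ0 _), ← ENNReal.ofReal_mul (by positivity)]
    refine ENNReal.ofReal_le_ofReal ((dq_sq hw x t).trans ?_)
    rw [intervalIntegral.integral_of_le zero_le_one]
    have e : ∫ s in Set.Ioc (0:ℝ) 1, ‖fderiv ℝ w (x - s • t)‖ ^ 2 = ∫ s in Set.Ioc (0:ℝ) 1, Φ (x - s • t) := by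
      refine setIntegral_congr_fun measurableSet_Ioc fun s hs => ?_
      simp only [hΦ]
      rw [ps_one, one_mul]
      refine (norm_sub_le _ _).trans ?_
      rw [norm_smul, Real.norm_of_nonneg hs.1.le]
      nlinarith [hs.2, norm_nonneg t]
    rw [e]
    have : 0 ≤ ∫ s in Set.Ioc (0:ℝ) 1, Φ (x - s • t) := integral_nonneg fun s => hΦ0 _
    gcongr
  calc _ ≤ ∫⁻ x in Metric.ball (0 : E n) (1/2), ENNReal.ofReal (r0 ^ 2) * ∫⁻ s in Set.Ioc (0:ℝ) 1, ENNReal.ofReal (Φ (x - s • t)) :=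
        setLIntegral_mono' Metric.isOpen_ball.measurableSet hp
    _ ≤ ∫⁻ x, ENNReal.ofReal (r0 ^ 2) * ∫⁻ s in Set.Ioc (0:ℝ) 1, ENNReal.ofReal (Φ (x - s • t)) := setLIntegral_le_lintegral _ _
    _ = ENNReal.ofReal (r0 ^ 2) * ∫⁻ x, ∫⁻ s in Set.Ioc (0:ℝ) 1, ENNReal.ofReal (Φ (x - s • t)) := by
        rw [lintegral_const_mul' _ _ ENNReal.ofReal_ne_top]
    _ = ENNReal.ofReal (r0 ^ 2) * ∫⁻ s in Set.Ioc (0:ℝ) 1, ∫⁻ x, ENNReal.ofReal (Φ (x - s • t)) := by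
        rw [lintegral_lintegral_swap]
        have : Continuous (fun p : E n × ℝ => Φ (p.1 - p.2 • t)) := hΦc.comp (by fun_prop)
        exact (ENNReal.continuous_ofReal.comp this).aemeasurable
    _ = ENNReal.ofReal (r0 ^ 2) * ∫⁻ s in Set.Ioc (0:ℝ) 1, ENNReal.ofReal (∫ x, Φ x) := by
        congr 1
        refine lintegral_congr fun s => ?_
        rw [lintegral_sub_right_eq_self (fun x => ENNReal.ofReal (Φ x)) (s • t),
          ofReal_integral_eq_lintegral_ofReal (gradsq_int hw) (Eventually.of_forall hΦ0)]
    _ = _ := by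
        rw [lintegral_const, Measure.restrict_apply MeasurableSet.univ, Set.univ_inter, Real.volume_Ioc, sub_zero, ENNReal.ofReal_one,
          mul_one, ENNReal.ofReal_mul (by positivity)]

theorem TR {w : E n → ℝ} (hw : LC w) {r0 : ℝ} (hr : r0 ≤ 3/8) {k : E n → ℝ} (hk : Continuous k) (hk0 : ∀ x, 0 ≤ k x)
    (hk1 : ∫ x, k x = 1) (hz : ∀ x, r0 < ‖x‖ → k x = 0) :
    ∫ x in Metric.ball (0 : E n) (1/2), (mol k w x - w x) ^ 2 ≤ r0 ^ 2 * ∫ x, ps x * ‖fderiv ℝ w x‖ ^ 2 := by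
  have hcs : HasCompactSupport k := cs_of_zero hz
  have hki : Integrable k := hk.integrable_of_hasCompactSupport hcs
  have hΦ : 0 ≤ ∫ x, ps x * ‖fderiv ℝ w x‖ ^ 2 := integral_nonneg fun x => mul_nonneg (ps_nonneg x) (sq_nonneg _)
  set A := r0 ^ 2 * ∫ x, ps x * ‖fderiv ℝ w x‖ ^ 2 with hA
  have hA0 : 0 ≤ A := by positivity
  have hmc : Continuous (mol k w) := continuous_iff_continuousAt.2 fun x => (mol_hasFDerivAt hw.ll hk hcs x).continuousAt
  have hp : ∀ x, ENNReal.ofReal ((mol k w x - w x) ^ 2) ≤ ∫⁻ t, ENNReal.ofReal (k t) * ENNReal.ofReal ((w (x - t) - w x) ^ 2) := by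
    intro x
    have hcw : Continuous (fun t => w (x - t) - w x) := (hw.cont.comp (by fun_prop)).sub continuous_const
    have i1 : Integrable (fun t => k t * (w (x - t) - w x)) := (hk.mul hcw).integrable_of_hasCompactSupport hcs.mul_right
    have i2 : Integrable (fun t => k t * (w (x - t) - w x) ^ 2) := (hk.mul (hcw.pow 2)).integrable_of_hasCompactSupport hcs.mul_right
    have e : mol k w x - w x = ∫ t, k t * (w (x - t) - w x) := by
      have : (fun t => k t * (w (x - t) - w x)) = fun t => k t * w (x - t) - k t * w x := by funext t; ring
      have im : Integrable (fun t => k t * w (x - t)) := mol_int (lbm_cont hw.cont) hk hcs x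
      rw [this, integral_sub im (hki.mul_const _), integral_mul_const, hk1, one_mul]
      rfl
    rw [e]
    refine (ENNReal.ofReal_le_ofReal (sq_int_le hk0 hki hk1 i1 i2)).trans (le_of_eq ?_)
    rw [ofReal_integral_eq_lintegral_ofReal i2 (Eventually.of_forall fun t => mul_nonneg (hk0 t) (sq_nonneg _))]
    exact lintegral_congr fun t => ENNReal.ofReal_mul (hk0 t)
  have main : ∫⁻ x in Metric.ball (0 : E n) (1/2), ENNReal.ofReal ((mol k w x - w x) ^ 2) ≤ ENNReal.ofReal A := by
    calc _ ≤ ∫⁻ x in Metric.ball (0 : E n) (1/2), ∫⁻ t, ENNReal.ofReal (k t) * ENNReal.ofReal ((w (x - t) - w x) ^ 2) :=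
          lintegral_mono hp
      _ = ∫⁻ t, ∫⁻ x in Metric.ball (0 : E n) (1/2), ENNReal.ofReal (k t) * ENNReal.ofReal ((w (x - t) - w x) ^ 2) := by
          rw [lintegral_lintegral_swap]
          have h1 : Continuous (fun p : E n × E n => k p.2) := hk.comp continuous_snd
          have h2 : Continuous (fun p : E n × E n => (w (p.1 - p.2) - w p.1) ^ 2) :=
            ((hw.cont.comp (by fun_prop)).sub (hw.cont.comp (by fun_prop))).pow 2
          exact ((ENNReal.continuous_ofReal.comp h1).measurable.mul (ENNReal.continuous_ofReal.comp h2).measurable).aemeasurable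
      _ ≤ ∫⁻ t, ENNReal.ofReal (k t) * ENNReal.ofReal A := by
          refine lintegral_mono fun t => ?_
          rw [lintegral_const_mul' _ _ ENNReal.ofReal_ne_top]
          by_cases ht : ‖t‖ ≤ r0
          · exact mul_le_mul_right (TR1 hw hr ht) _
          · rw [hz t (not_le.1 ht)]; simp
      _ = ENNReal.ofReal A := by
          rw [lintegral_mul_const' _ _ ENNReal.ofReal_ne_top, ← ofReal_integral_eq_lintegral_ofReal hki (Eventually.of_forall hk0), hk1]; simp
  have hi : IntegrableOn (fun x => (mol k w x - w x) ^ 2) (Metric.ball (0 : E n) (1/2)) :=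
    (((hmc.sub hw.cont).pow 2).continuousOn.integrableOn_compact (isCompact_closedBall (0 : E n) (1/2))).mono_set Metric.ball_subset_closedBall
  rw [← ofReal_integral_eq_lintegral_ofReal hi (Eventually.of_forall fun x => sq_nonneg _)] at main
  exact (ENNReal.ofReal_le_ofReal_iff hA0).1 main

theorem dt_taylor (n : ℕ) {K : ℝ} (hK : 0 ≤ K) : ∃ C, 0 ≤ C ∧ ∀ S T : Bil n, ‖S‖ ≤ K → ‖T‖ ≤ K →
    |dt (S + T) - dt S - LB (hC S).adjugate T| ≤ C * ‖T‖ ^ 2 := by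
  obtain ⟨C, hC0, hC1⟩ := adj_lip n (2 * K) (by positivity)
  refine ⟨n * n * C, by positivity, fun S T hS hT => ?_⟩
  have hT0 := norm_nonneg T
  obtain ⟨t, ht, h⟩ := exists_hasDerivAt_eq_slope (fun s : ℝ => dt (S + s • T)) (fun t => LB (hC (S + t • T)).adjugate T) zero_lt_one
    (fun t _ => (dt_hasDeriv S T t).continuousAt.continuousWithinAt) (fun t _ => dt_hasDeriv S T t)
  simp only [one_smul, zero_smul, add_zero, sub_zero, div_one] at h
  have e : dt (S + T) - dt S - LB (hC S).adjugate T = (((hC (S + t • T)).adjugate - (hC S).adjugate) * hC T).trace.re := by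
    rw [← h, LB, LB, Matrix.sub_mul, Matrix.trace_sub, Complex.sub_re]
  have hb : ∀ i j, ‖((hC (S + t • T)).adjugate - (hC S).adjugate) i j‖ ≤ C * ‖T‖ := by
    intro i j
    have htT : ‖t • T‖ ≤ ‖T‖ := by
      rw [norm_smul, Real.norm_of_nonneg ht.1.le]; nlinarith [ht.2]
    refine hC1 _ _ ‖T‖ hT0 (hC_norm_le ((norm_add_le _ _).trans (by linarith))) (hC_norm_le (by linarith)) (fun i j => ?_) i j
    rw [hC_add, Matrix.add_apply, add_sub_cancel_left]
    exact hC_norm_le htT i j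
  rw [e]
  refine (trace_bd hb (fun i j => hC_norm_le le_rfl i j) (by positivity)).trans (le_of_eq ?_)
  ring

/-- regular averaging kernel -/
structure Ker (M : ℝ) (k : E n → ℝ) : Prop where
  sm : ContDiff ℝ (⊤ : ℕ∞) k
  nn : ∀ x, 0 ≤ k x
  one : ∫ x, k x = 1
  zero : ∀ x, 3/8 < ‖x‖ → k x = 0
  even : ∀ x, k (-x) = k x
  bd : ∀ x, ‖D2 k x‖ ≤ M
  lip : ∀ x y, ‖x‖ ≤ 2 → ‖y‖ ≤ 2 → ‖D2 k x - D2 k y‖ ≤ M * ‖x - y‖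

theorem D2_neg {k : E n → ℝ} (hk : LC k) (he : ∀ x, k (-x) = k x) (hd : ∀ x, DifferentiableAt ℝ (fderiv ℝ k) x) (x : E n) : D2 k (-x) = D2 k x := by
  have h := D2_aff hk 0 (-1) (x := x) (hd _)
  have e : (fun x => k (0 + (-1 : ℝ) • x)) = k := by funext y; simp [he]
  rw [e] at h
  rw [h]; simp

/-- linear functional version of `LB` -/
noncomputable def LBL (B : Matrix (Fin n) (Fin n) ℂ) : Bil n →L[ℝ] ℝ :=
  LinearMap.toContinuousLinearMap
    { toFun := LB B, map_add' := LB_add B, map_smul' := fun c S => by rw [LB_smul]; rfl }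

theorem LBL_apply (B : Matrix (Fin n) (Fin n) ℂ) (S : Bil n) : LBL B S = LB B S := rfl

/-- vector valued version of `l1_le` -/
theorem l1_vec {F : Type*} [NormedAddCommGroup F] [NormedSpace ℝ F] {w : E n → ℝ} {G : E n → F} (hw : Continuous w) {ε H : ℝ} (hε : 0 < ε) (hH : 0 ≤ H)
    (h2 : L2 w ≤ ε ^ 2) (hF : ∀ x, ‖x‖ < 1 → ‖G x‖ ≤ H) (hz : ∀ x, 1 ≤ ‖x‖ → G x = 0) :
    ‖∫ x, w x • G x‖ ≤ H * (ε * (V1 n + 1)) := by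
  refine (norm_integral_le_integral_norm _).trans ((le_abs_self _).trans ?_)
  refine l1_le hw hε hH h2 (Eventually.of_forall fun x hx => ?_) (Eventually.of_forall fun x hx => ?_)
  · rw [abs_of_nonneg (norm_nonneg _), norm_smul, Real.norm_eq_abs, mul_comm]
    exact mul_le_mul_of_nonneg_right (hF x hx) (abs_nonneg _)
  · rw [hz x hx]; simp

theorem Fw (n : ℕ) {l K M : ℝ} (hl : 0 < l) (hK : 0 ≤ K) (hM : 0 ≤ M) : ∃ C, 0 < C ∧ ∀ σ ε u c p, ∀ S : Bil n, Hyp l K σ ε u c p S → ε ≤ 1 →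
    ∀ k, Ker M k → ∃ c' p', ∃ S' : Bil n, (∀ v w, S' v w = S' w v) ∧
      (∀ y, ‖y‖ < 1/2 → |mol k (fun x => u x - qd c p S x) y - (qd c' p' S' y - qd c p S y)| ≤ C * ε * ‖y‖ ^ 3) ∧
      ∀ F0 τ, (∀ᵐ x, ‖x‖ < 1 → |dt (D2 u x) - F0| ≤ τ) → |dt S' - F0| ≤ τ + C * (ε * √(ε + σ) + ε ^ 2) := by
  obtain ⟨Cb, hCb0, hCb⟩ := Fb n hl hK
  have hV := V1_nonneg (n := n)
  set A := M * (V1 n + 1) with hA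
  have hA0 : 0 ≤ A := by positivity
  obtain ⟨Ct, hCt0, hCt⟩ := dt_taylor n (K := K + A) (by positivity)
  refine ⟨A + Cb * M + Ct * A ^ 2 + 1, by positivity, fun σ ε u c p S H hε1 k hk => ?_⟩
  have hε := H.hε
  set w := fun x => u x - qd c p S x with hw
  have hwlc : LC w := H.lc.sub (qd_lc c p S)
  have hwc : Continuous w := hwlc.cont
  have hcs : HasCompactSupport k := cs_of_zero hk.zero
  have hW : ContDiff ℝ (⊤ : ℕ∞) (mol k w) := mol_contDiff (lbm_cont hwc) hk.sm hcs
  have hWlc := LC.of_smooth hW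
  set W := mol k w with hWd
  have hkD : ∀ x, 3/8 < ‖x‖ → D2 k x = 0 := fun x hx => D2_zero_out hk.zero hx
  have hD : ∀ x, D2 W x = ∫ t, w t • D2 k (x - t) := fun x => molD2 hwc hk.sm hcs x
  have hfar : ∀ x t : E n, ‖x‖ ≤ 1/2 → 1 ≤ ‖t‖ → D2 k (x - t) = 0 := fun x t hx ht => hkD _ (by
    have := norm_sub_norm_le t x
    rw [norm_sub_rev] at this; linarith)
  have hDc : Continuous (D2 k) := sm_D2_cont hk.sm
  have hkDcs : HasCompactSupport (D2 k) := by
    refine HasCompactSupport.intro (isCompact_closedBall (0 : E n) (3/8)) fun x hx => hkD x ?_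
    simpa using hx
  have hitg : ∀ x, Integrable (fun t => w t • D2 k (x - t)) := fun x => by
    refine (hwc.smul (hDc.comp (by fun_prop))).integrable_of_hasCompactSupport ?_
    refine HasCompactSupport.smul_left ?_
    exact hkDcs.comp_homeomorph (Homeomorph.subLeft x)
  have hD0 : ‖D2 W 0‖ ≤ A * ε := by
    rw [hD]
    refine (l1_vec hwc hε hM H.l2 (fun t _ => hk.bd _) (fun t ht => hfar 0 t (by simp) ht)).trans (le_of_eq ?_)
    rw [hA]; ring
  have hDl : ∀ x, ‖x‖ ≤ 1/2 → ‖D2 W x - D2 W 0‖ ≤ A * ε * ‖x‖ := by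
    intro x hx
    rw [hD, hD, ← integral_sub (hitg _) (hitg _)]
    have e : (fun t => w t • D2 k (x - t) - w t • D2 k (0 - t)) = fun t => w t • (D2 k (x - t) - D2 k (0 - t)) := by
      funext t; rw [smul_sub]
    rw [e]
    refine (l1_vec (H := M * ‖x‖) hwc hε (by positivity) H.l2 (fun t ht => ?_) (fun t ht => ?_)).trans (le_of_eq ?_)
    · have := hk.lip (x - t) (0 - t) ((norm_sub_le _ _).trans (by linarith)) ((norm_sub_le _ _).trans (by simp; linarith))
      simpa using this
    · rw [hfar x t hx ht, hfar 0 t (by simp) ht, sub_zero]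
    · rw [hA]; ring
  have hDs : ∀ v z, D2 W 0 v z = D2 W 0 z v := D2_symm' hWlc.diff 0
  refine ⟨c + W 0, p + fderiv ℝ W 0, S + D2 W 0, fun v z => by simp [H.sym v z, hDs v z], fun y hy => ?_, fun F0 τ hF => ?_⟩
  · set P := qd (W 0) (fderiv ℝ W 0) (D2 W 0) with hP
    have e1 : qd (c + W 0) (p + fderiv ℝ W 0) (S + D2 W 0) y - qd c p S y = P y := by simp [qd, hP]; ring
    rw [e1]
    have hvlc : LC (fun x => W x - P x) := hWlc.sub (qd_lc _ _ _)
    have hvD : ∀ x, D2 (fun x => W x - P x) x = D2 W x - D2 W 0 := fun x => by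
      rw [D2_sub hWlc (qd_lc _ _ _) (sm_ae hW x) (sm_ae (qd_smooth _ _ _) x), qd_D2 _ _ hDs]
    by_cases hy0 : y = 0
    · subst hy0; simp [hP, qd]
    have hyp : 0 < ‖y‖ := norm_pos_iff.2 hy0
    have hbd : ∀ R, ‖y‖ < R → R ≤ 1/2 → |W y - P y| ≤ A * ε * R * ‖y‖ ^ 2 := by
      intro R hR hR2
      have hR0 : 0 < R := hyp.trans hR
      have h := taylor2 hvlc (a := 0) (R := R) (K := A * ε * R) (by positivity) (Eventually.of_forall fun x hx => by
        rw [hvD]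
        have hx' : ‖x‖ < R := by simpa using hx
        refine (hDl x (by linarith)).trans ?_
        gcongr) (x := 0) (y := y) (by simp; linarith) (by simpa using hR)
      have hf0 : fderiv ℝ (fun x => W x - P x) 0 = 0 := by
        have := ((hWlc.diff 0).hasFDerivAt.sub ((qd_lc (W 0) (fderiv ℝ W 0) (D2 W 0)).diff 0).hasFDerivAt).fderiv
        rw [qd_fderiv _ _ hDs] at this
        simp only [map_zero, add_zero, sub_self] at this
        exact this
      rw [hf0] at h
      simpa [hP, qd] using h
    have hlim : |W y - P y| ≤ A * ε * ‖y‖ * ‖y‖ ^ 2 := by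
      have ht : Tendsto (fun R : ℝ => A * ε * R * ‖y‖ ^ 2) (𝓝[>] ‖y‖) (𝓝 (A * ε * ‖y‖ * ‖y‖ ^ 2)) := by
        have : Continuous (fun R : ℝ => A * ε * R * ‖y‖ ^ 2) := by fun_prop
        exact (this.tendsto _).mono_left nhdsWithin_le_nhds
      refine ge_of_tendsto ht ?_
      filter_upwards [self_mem_nhdsWithin, mem_nhdsWithin_of_mem_nhds (Iio_mem_nhds hy)] with R h1 h2
      exact hbd R h1 (le_of_lt h2)
    refine hlim.trans ?_
    have : A * ε * ‖y‖ * ‖y‖ ^ 2 = A * (ε * ‖y‖ ^ 3) := by ring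
    rw [this, mul_assoc (A + Cb * M + Ct * A ^ 2 + 1)]
    refine mul_le_mul_of_nonneg_right ?_ (by positivity : (0:ℝ) ≤ ε * ‖y‖ ^ 3)
    have : 0 ≤ Cb * M + Ct * A ^ 2 := by positivity
    linarith
  · have hDA : ‖D2 W 0‖ ≤ K + A := by nlinarith
    have h1 := hCt S (D2 W 0) (by linarith [H.bdS]) hDA
    have hsq : Ct * ‖D2 W 0‖ ^ 2 ≤ Ct * A ^ 2 * ε ^ 2 := by
      have : ‖D2 W 0‖ ^ 2 ≤ (A * ε) ^ 2 := by gcongr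
      nlinarith
    have h2 := hCb σ ε u c p S H k (LC.of_smooth hk.sm) (fun x hx => hk.zero x (by linarith)) M hM (Eventually.of_forall hk.bd)
    have h3 : ∫ x, (u x - qd c p S x) * LB (hC S).adjugate (D2 k x) = LB (hC S).adjugate (D2 W 0) := by
      rw [hD, ← LBL_apply, ← (LBL (hC S).adjugate).integral_comp_comm (hitg 0)]
      refine integral_congr_ae (Eventually.of_forall fun t => ?_)
      simp only [map_smul, LBL_apply, smul_eq_mul, zero_sub]
      rw [D2_neg (LC.of_smooth hk.sm) hk.even (sm_ae hk.sm)]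
    rw [h3] at h2
    have hki : Integrable k := hk.sm.continuous.integrable_of_hasCompactSupport hcs
    have h4 : |(∫ x, k x * (dt (D2 u x) - dt S)) - (F0 - dt S)| ≤ τ := by
      have e : F0 - dt S = ∫ x, k x * (F0 - dt S) := by rw [integral_mul_const, hk.one, one_mul]
      obtain ⟨KK, hKK0, hKK⟩ := H.lc.lbm.bd 1
      obtain ⟨CD, hCD0, hCD⟩ := dt_bd n hKK0
      obtain ⟨B, hB⟩ := hk.sm.continuous.bounded_above_of_compact_support hcs
      have hi : Integrable (fun x => k x * (dt (D2 u x) - dt S)) := by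
        refine int_of_bd (R := 1) (C := B * (CD + |dt S|)) (hk.sm.continuous.aestronglyMeasurable.mul ((dtm H.lc.lbm.meas).sub aestronglyMeasurable_const)) (fun x hx => ?_) (fun x hx => ?_)
        · rw [abs_mul]
          have := hCD _ (hKK x hx)
          have h5 : |dt (D2 u x) - dt S| ≤ CD + |dt S| := (abs_sub _ _).trans (by linarith)
          exact mul_le_mul (hB x) h5 (abs_nonneg _) ((norm_nonneg _).trans (hB x))
        · rw [hk.zero x (by linarith), zero_mul]
      rw [e, ← integral_sub hi (hki.mul_const _)]
      have h6 : ∫ x, k x * τ = τ := by rw [integral_mul_const, hk.one, one_mul]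
      rw [← h6]
      rw [← Real.norm_eq_abs]
      refine norm_integral_le_of_norm_le (hki.mul_const _) ?_
      filter_upwards [hF] with x hx
      by_cases hx1 : ‖x‖ < 1
      · have : k x * (dt (D2 u x) - dt S) - k x * (F0 - dt S) = k x * (dt (D2 u x) - F0) := by ring
        rw [this, norm_mul, Real.norm_of_nonneg (hk.nn x), Real.norm_eq_abs]
        exact mul_le_mul_of_nonneg_left (hx hx1) (hk.nn x)
      · rw [hk.zero x (by linarith)]; simp
    have hsum : dt (S + D2 W 0) - F0 = (dt (S + D2 W 0) - dt S - LB (hC S).adjugate (D2 W 0)) +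
      (LB (hC S).adjugate (D2 W 0) - ∫ x, k x * (dt (D2 u x) - dt S)) + ((∫ x, k x * (dt (D2 u x) - dt S)) - (F0 - dt S)) := by ring
    rw [hsum]
    refine (abs_add_three _ _ _).trans ?_
    have hX : 0 ≤ ε * √(ε + σ) := mul_nonneg hε.le (Real.sqrt_nonneg _)
    have p1 : 0 ≤ Cb * M := by positivity
    have p2 : 0 ≤ Ct * A ^ 2 := by positivity
    nlinarith [mul_nonneg p2 hX, mul_nonneg p1 (sq_nonneg ε), mul_nonneg hA0 hX, mul_nonneg hA0 (sq_nonneg ε), sq_nonneg ε]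

theorem mol_cmul (c : ℝ) (k : E n → ℝ) (w : E n → ℝ) (x : E n) : mol (fun x => c * k x) w x = c * mol k w x := by
  unfold mol
  rw [← integral_const_mul]
  refine integral_congr_ae (Eventually.of_forall fun t => ?_)
  simp [mul_assoc]

theorem Fk (hn : 0 < n) {l K : ℝ} (hl : 0 < l) (hK : 0 ≤ K) : ∃ C1, 0 < C1 ∧ ∀ r0, 0 < r0 → r0 ≤ 3/8 → ∃ C2, 0 < C2 ∧
    ∀ σ ε u c p, ∀ S : Bil n, Hyp l K σ ε u c p S → ε ≤ 1 → ∃ c' p', ∃ S' : Bil n, (∀ v w, S' v w = S' w v) ∧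
      (∃ A : E n → ℝ, Continuous A ∧ ∫ x in Metric.ball (0 : E n) (1/2), A x ^ 2 ≤ r0 ^ 2 * (C1 * (ε ^ 2 + ε * σ)) ∧
        ∀ y, ‖y‖ < 1/2 → |u y - qd c' p' S' y| ≤ |A y| + C1 * ε * ‖y‖ ^ 3 + C2 * (σ + ε * √(ε + σ))) ∧
      ∀ F0 τ, (∀ᵐ x, ‖x‖ < 1 → |dt (D2 u x) - F0| ≤ τ) → |dt S' - F0| ≤ τ + C1 * (ε * √(ε + σ) + ε ^ 2) := by
  obtain ⟨lam, hlam, hlow⟩ := qT_low n hl hK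
  set b := lam * (3/8 : ℝ) ^ 2 with hb
  have hb0 : 0 < b := by positivity
  have hbl : b ≤ lam := by rw [hb]; nlinarith
  set T0 := K / l ^ n with hT0
  have hT00 : 0 ≤ T0 := by positivity
  obtain ⟨ηb, hηb⟩ := Eta.ex n hb0
  obtain ⟨c0, hc0, hmass⟩ := mass_low hn hlam hT00 hbl hηb
  obtain ⟨Ce, hCe0, hCe, -⟩ := eta_bds hηb
  obtain ⟨Cl, hCl0, hCl⟩ := rad_lip hlam hT00 hηb
  set M := c0⁻¹ * (Ce * (T0 + T0 ^ 2) + Cl) with hM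
  have hM0 : 0 ≤ M := by positivity
  obtain ⟨Cw, hCw0, hCw⟩ := Fw n hl hK hM0
  obtain ⟨Cc, hCc0, hCc⟩ := Fc n hl hK
  refine ⟨Cw + Cc, by positivity, fun r0 hr0 hr38 => ?_⟩
  have ha0 : 0 < lam * r0 ^ 2 := by positivity
  obtain ⟨ηa, hηa⟩ := Eta.ex n ha0
  have hab : lam * r0 ^ 2 ≤ b := by rw [hb]; gcongr
  obtain ⟨Cd, hCd0, hCd⟩ := kdiff hn hl hK hlam hab le_rfl hηa hηb
  refine ⟨c0⁻¹ * Cd, by positivity, fun σ ε u c p S H hε1 => ?_⟩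
  have hTs := qT_sym H.sym
  have hTb := qT_bd hl H.ellS H.bdS
  have hTl := hlow S H.sym H.ellS H.bdS
  obtain ⟨hmab, hd⟩ := hCd σ ε u c p S H hTl
  have hcm := hmass (qT S) hTs hTb hTl
  set cm := ∫ x, ηb (qd 0 0 (qT S) x) with hcmd
  have hcm0 : 0 < cm := hc0.trans_le hcm
  have hinv : cm⁻¹ ≤ c0⁻¹ := inv_anti₀ hc0 hcm
  have hQs : ContDiff ℝ (⊤ : ℕ∞) (qd 0 0 (qT S)) := qd_smooth _ _ _
  have hker : Ker M (fun x => cm⁻¹ * ηb (qd 0 0 (qT S) x)) := by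
    refine ⟨contDiff_const.mul (hηb.sm.comp hQs), fun x => mul_nonneg (by positivity) (hηb.nn _), ?_, fun x hx => ?_, fun x => ?_, fun x => ?_, fun x y hx hy => ?_⟩
    · rw [integral_const_mul, ← hcmd, inv_mul_cancel₀ hcm0.ne']
    · rw [rad_supp hlam (by norm_num) hTl le_rfl (fun s hs => hηb.zero s (Or.inr hs)) hx.le, mul_zero]
    · simp only [qd_even]
    · rw [D2_smul _ (rad_LC hηb.c2), norm_smul, Real.norm_of_nonneg (by positivity)]
      have h1 := rad_bd hTs hTb hlam hTl hbl hCe0 hηb.c2 (fun s hs => hηb.zero s (Or.inr hs)) hCe x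
      rw [hM]
      refine mul_le_mul hinv (h1.trans (by linarith)) (norm_nonneg _) (by positivity)
    · rw [D2_smul _ (rad_LC hηb.c2), D2_smul _ (rad_LC hηb.c2), ← smul_sub, norm_smul, Real.norm_of_nonneg (by positivity)]
      have h1 := hCl (qT S) hTs hTb hTl x y hx hy
      rw [hM, mul_assoc]
      refine mul_le_mul hinv (h1.trans ?_) (norm_nonneg _) (by positivity)
      have : 0 ≤ Ce * (T0 + T0 ^ 2) * ‖x - y‖ := by positivity
      linarith
  obtain ⟨c', p', S', hS', hW, hdet⟩ := hCw σ ε u c p S H hε1 _ hker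
  have hwlc : LC (fun x => u x - qd c p S x) := H.lc.sub (qd_lc c p S)
  set kA : E n → ℝ := fun x => cm⁻¹ * ηa (qd 0 0 (qT S) x) with hkA
  have hkAs : ContDiff ℝ (⊤ : ℕ∞) kA := contDiff_const.mul (hηa.sm.comp hQs)
  have hkAz : ∀ x, r0 < ‖x‖ → kA x = 0 := fun x hx => by
    rw [hkA]; simp only
    rw [rad_supp hlam hr0.le hTl le_rfl (fun s hs => hηa.zero s (Or.inr hs)) hx.le, mul_zero]
  have hkA1 : ∫ x, kA x = 1 := by
    rw [hkA]; rw [integral_const_mul, ← hmab, inv_mul_cancel₀ hcm0.ne']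
  have hTR := TR hwlc hr38 hkAs.continuous (fun x => mul_nonneg (by positivity) (hηa.nn _)) hkA1 hkAz
  have hσ := H.hσ
  have hε := H.hε
  refine ⟨c', p', S', hS', ⟨fun x => mol kA (fun x => u x - qd c p S x) x - (u x - qd c p S x),
    (mol_contDiff (lbm_cont hwlc.cont) hkAs (cs_of_zero hkAz)).continuous.sub hwlc.cont, hTR.trans ?_, fun y hy => ?_⟩, fun F0 τ hF => ?_⟩
  · refine mul_le_mul_of_nonneg_left ((hCc σ ε u c p S H).trans ?_) (by positivity)
    gcongr; linarith
  · have h1 := hW y hy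
    have h2 := hd y hy.le
    rw [mol_cmul] at h1
    have h3 : mol kA (fun x => u x - qd c p S x) y = cm⁻¹ * mol (fun x => ηa (qd 0 0 (qT S) x)) (fun x => u x - qd c p S x) y := mol_cmul _ _ _ _
    beta_reduce
    rw [h3]
    set Xb := mol (fun x => ηb (qd 0 0 (qT S) x)) (fun x => u x - qd c p S x) y
    set Xa := mol (fun x => ηa (qd 0 0 (qT S) x)) (fun x => u x - qd c p S x) y
    have e : u y - qd c' p' S' y = -(cm⁻¹ * Xa - (u y - qd c p S y)) + (cm⁻¹ * Xb - (qd c' p' S' y - qd c p S y)) + -(cm⁻¹ * (Xb - Xa)) := by ring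
    rw [e]
    refine (abs_add_three _ _ _).trans ?_
    rw [abs_neg, abs_neg]
    have h4 : |cm⁻¹ * (Xb - Xa)| ≤ c0⁻¹ * Cd * (σ + ε * √(ε + σ)) := by
      rw [abs_mul, abs_of_nonneg (by positivity), mul_assoc]
      exact mul_le_mul hinv h2 (abs_nonneg _) (by positivity)
    have h5 : 0 ≤ Cc * ε * ‖y‖ ^ 3 := by positivity
    linarith
  · refine (hdet F0 τ hF).trans ?_
    gcongr; linarith

noncomputable def Lam (v : E n → ℝ) : Bil n := D2 (mol (kb n 1) v) 0

theorem kb1_zero {x : E n} (hx : 1/2 < ‖x‖) : kb n 1 x = 0 := by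
  by_contra h
  have := kb_supp 1 h
  norm_num at this
  linarith

theorem kb1_D2 {x : E n} (hx : 1 ≤ ‖x‖) : D2 (kb n 1) x = 0 :=
  D2_zero_out (R := 1/2) (fun _ h => kb1_zero h) (by linarith)

theorem Lam_eq {v : E n → ℝ} (hv : Continuous v) : Lam v = ∫ t, v t • D2 (kb n 1) (0 - t) :=
  molD2 hv (kb_smooth 1) (kb_cs 1) 0

theorem Lam_int {v : E n → ℝ} (hv : Continuous v) : Integrable (fun t => v t • D2 (kb n 1) (0 - t)) := by
  refine (hv.smul ((sm_D2_cont (kb_smooth 1)).comp (by fun_prop))).integrable_of_hasCompactSupport ?_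
  refine HasCompactSupport.intro (isCompact_closedBall (0 : E n) 1) fun x hx => ?_
  have : 1 < ‖x‖ := by simpa using hx
  show v x • D2 (kb n 1) (0 - x) = 0
  rw [kb1_D2 (by simpa using this.le), smul_zero]

theorem Lam_bd (n : ℕ) : ∃ C, 0 < C ∧ ∀ v : E n → ℝ, Continuous v → ∀ ε, 0 < ε → L2 v ≤ ε ^ 2 → ‖Lam v‖ ≤ C * ε := by
  obtain ⟨M, hM, hM1⟩ := D2_bd_cs (kb_smooth (n := n) 1) (kb_cs 1)
  have hV := V1_nonneg (n := n)
  refine ⟨M * (V1 n + 1) + 1, by positivity, fun v hv ε hε h2 => ?_⟩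
  rw [Lam_eq hv]
  refine (l1_vec hv hε hM h2 (fun x _ => hM1 _) fun x hx => kb1_D2 (by simpa using hx)).trans ?_
  nlinarith

theorem Lam_sub {u v : E n → ℝ} (hu : Continuous u) (hv : Continuous v) : Lam (fun x => u x - v x) = Lam u - Lam v := by
  rw [Lam_eq hu, Lam_eq hv, Lam_eq (v := fun x => u x - v x) (hu.sub hv), ← integral_sub (Lam_int hu) (Lam_int hv)]
  refine integral_congr_ae (Eventually.of_forall fun t => ?_)
  simp only [sub_smul]

theorem Lam_mem {v : E n → ℝ} (hv : LC v) {C : Set (Bil n)} (hC1 : Convex ℝ C) (hC2 : IsClosed C)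
    (h : ∀ᵐ y, ‖y‖ < 1 → D2 v y ∈ C) : Lam v ∈ C := by
  unfold Lam
  rw [mol_D2 hv (kb_cont 1) (kb_cs 1)]
  refine mol_mem hv.lbm (kb_cont 1) (kb_cs 1) (kb_nonneg 1) (kb_int 1) hC1 hC2 ?_
  filter_upwards [h] with y hy hk
  refine hy ?_
  by_contra h1
  exact hk (kb1_zero (by simp; linarith))

theorem Lam_qd (c : ℝ) (p : E n →L[ℝ] ℝ) {S : Bil n} (hS : ∀ v w, S v w = S w v) : Lam (qd c p S) = S :=
  Lam_mem (C := {S}) (qd_lc c p S) (convex_singleton S) isClosed_singleton (Eventually.of_forall fun y _ => qd_D2 c p hS y)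

/-- quadratic zoom -/
noncomputable def zm (x : E n) (r : ℝ) (u : E n → ℝ) (z : E n) : ℝ := (r ^ 2)⁻¹ * u (x + r • z)

theorem zm_lc {u : E n → ℝ} (hu : LC u) (x : E n) (r : ℝ) : LC (zm x r u) := (hu.aff x r).smul _

theorem zm_D2 {u : E n → ℝ} (hu : LC u) (x : E n) {r : ℝ} (hr : r ≠ 0) {z : E n} (hd : DifferentiableAt ℝ (fderiv ℝ u) (x + r • z)) :
    D2 (zm x r u) z = D2 u (x + r • z) := by
  have := D2_smul (r ^ 2)⁻¹ (hu.aff x r) z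
  rw [D2_aff hu x r hd, smul_smul, inv_mul_cancel₀ (by positivity), one_smul] at this
  exact this

theorem zm_ae {u : E n → ℝ} (hu : LC u) (x : E n) {r : ℝ} (hr : r ≠ 0) : ∀ᵐ z, D2 (zm x r u) z = D2 u (x + r • z) := by
  filter_upwards [ae_aff hu.ae x hr] with z hz
  exact zm_D2 hu x hr hz

theorem zm_zm (u : E n → ℝ) (x y : E n) (r s : ℝ) : zm y s (zm x r u) = zm (x + r • y) (r * s) u := by
  funext z
  simp only [zm, smul_add, smul_smul, add_assoc]
  rw [mul_pow, mul_inv]; ring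

theorem zm_one (u : E n → ℝ) : zm 0 1 u = u := by funext z; simp [zm]

theorem zm_of {u : E n → ℝ} (hu : LC u) {x : E n} {r R : ℝ} (hr : 0 < r) {P : Bil n → Prop} (h : ∀ᵐ y, ‖y - x‖ < r * R → P (D2 u y)) :
    ∀ᵐ z, ‖z‖ < R → P (D2 (zm x r u) z) := by
  filter_upwards [ae_aff h x hr.ne', zm_ae hu x hr.ne'] with z h1 h2 hz
  rw [h2]; refine h1 ?_
  rw [add_sub_cancel_left, norm_smul, Real.norm_of_nonneg hr.le]; gcongr

theorem zm_qd (c : ℝ) (p : E n →L[ℝ] ℝ) (S : Bil n) {r : ℝ} (hr : r ≠ 0) : zm 0 r (qd c p S) = qd ((r ^ 2)⁻¹ * c) (r⁻¹ • p) S := by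
  funext z; simp [zm, qd]; field_simp

theorem qd_zm (c : ℝ) (p : E n →L[ℝ] ℝ) (S : Bil n) {r : ℝ} (hr : r ≠ 0) (z : E n) :
    qd ((r ^ 2)⁻¹ * c) (r⁻¹ • p) S z = (r ^ 2)⁻¹ * qd c p S (r • z) := by
  rw [← zm_qd c p S hr]; simp [zm]

structure Cls (l K F0 τ R : ℝ) (u : E n → ℝ) : Prop where
  lc : LC u
  ell : ∀ᵐ x, ‖x‖ < R → Ell l (hC (D2 u x))
  bd : ∀ᵐ x, ‖x‖ < R → ‖D2 u x‖ ≤ K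
  det : ∀ᵐ x, ‖x‖ < R → |dt (D2 u x) - F0| ≤ τ

def Fl (F0 κ ε : ℝ) (u : E n → ℝ) : Prop := ∃ c p, ∃ S : Bil n, (∀ v w, S v w = S w v) ∧ |dt S - F0| ≤ κ * ε ∧
  L2 (fun x => u x - qd c p S x) ≤ ε ^ 2

theorem ell_pert {l δ : ℝ} {S T : Bil n} (hT : Ell l (hC T)) (h : ‖S - T‖ ≤ δ) (hδ : n * δ ≤ l / 2) (hS : ∀ v w, S v w = S w v) : Ell (l / 2) (hC S) := by
  refine ⟨hC_herm hS, fun c => ?_⟩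
  have h1 := hT.2 c
  have h2 := abs_qf_le (A := hC (S - T)) (L := δ) (fun i j => hC_norm_le h i j) c
  have h3 : qf (hC S) c = qf (hC T) c + qf (hC (S - T)) c := by rw [← qf_add, ← hC_add, add_sub_cancel]
  have h4 : 0 ≤ ∑ i, ‖c i‖ ^ 2 := Finset.sum_nonneg fun _ _ => sq_nonneg _
  have h5 := (abs_le.1 h2).1
  have := mul_le_mul_of_nonneg_right hδ h4
  linarith

theorem Sell (n : ℕ) {l K : ℝ} (hl : 0 < l) : ∃ ε0, 0 < ε0 ∧ ∀ F0 τ ε u, ∀ c p, ∀ S : Bil n, Cls l K F0 τ 1 u → 0 < ε → ε ≤ ε0 →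
    (∀ v w, S v w = S w v) → L2 (fun x => u x - qd c p S x) ≤ ε ^ 2 → Ell (l / 2) (hC S) ∧ ‖S‖ ≤ K + 1 := by
  obtain ⟨C, hC0, hC1⟩ := Lam_bd n
  refine ⟨min (1 / C) (l / (2 * C * (n + 1))), by positivity, fun F0 τ ε u c p S H hε hε0 hS h2 => ?_⟩
  have h := hC1 _ (H.lc.cont.sub (qd_lc c p S).cont) ε hε h2
  have e : Lam (fun x => u x - qd c p S x) = Lam u - S := by rw [Lam_sub H.lc.cont (qd_lc c p S).cont, Lam_qd c p hS]
  have h : ‖Lam u - S‖ ≤ C * ε := by rw [← e]; exact h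
  have h1 : Ell l (hC (Lam u)) := Lam_mem H.lc (ell_convex l) (ell_closed l) H.ell
  have h3 : Lam u ∈ Metric.closedBall (0 : Bil n) K := Lam_mem H.lc (convex_closedBall _ _) Metric.isClosed_closedBall (by
    filter_upwards [H.bd] with x hx hx1
    simpa using hx hx1)
  have h4 : C * ε ≤ 1 := by
    have := (le_min_iff.1 hε0).1
    rw [le_div_iff₀ hC0] at this; linarith
  have h5 : n * (C * ε) ≤ l / 2 := by
    have := (le_min_iff.1 hε0).2
    rw [le_div_iff₀ (by positivity)] at this
    have : 0 ≤ C * ε := by positivity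
    nlinarith
  refine ⟨ell_pert h1 (by rw [norm_sub_rev]; exact h) h5 hS, ?_⟩
  have : ‖Lam u‖ ≤ K := by simpa using h3
  have := norm_sub_norm_le S (Lam u)
  rw [norm_sub_rev] at this
  linarith

theorem small_ex (A : ℝ) {c b : ℝ} (hc : 0 < c) (hb : 0 < b) : ∃ x, 0 < x ∧ x ≤ b ∧ A * x ≤ c := by
  refine ⟨min b (c / (|A| + 1)), by positivity, min_le_left _ _, ?_⟩
  have h1 : min b (c / (|A| + 1)) ≤ c / (|A| + 1) := min_le_right _ _
  have h0 : 0 ≤ min b (c / (|A| + 1)) := by positivity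
  rw [le_div_iff₀ (by positivity)] at h1
  nlinarith [le_abs_self A]

theorem L2_zoom {A : E n → ℝ} (hA : Continuous A) {ρ : ℝ} (hρ : 0 < ρ) (hρ2 : ρ ≤ 1/2) :
    ∫ z in Metric.ball (0 : E n) 1, A (ρ • z) ^ 2 ≤ (ρ ^ Module.finrank ℝ (E n))⁻¹ * ∫ x in Metric.ball (0 : E n) (1/2), A x ^ 2 := by
  rw [Measure.setIntegral_comp_smul_of_pos volume (fun x => A x ^ 2) _ hρ, smul_eq_mul]
  refine mul_le_mul_of_nonneg_left ?_ (by positivity)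
  rw [smul_unitBall_of_pos hρ]
  refine setIntegral_mono_set ?_ (Eventually.of_forall fun x => sq_nonneg _) (Metric.ball_subset_ball hρ2).eventuallyLE
  exact (((hA.pow 2).continuousOn.integrableOn_compact (isCompact_closedBall (0 : E n) (1/2))).mono_set Metric.ball_subset_closedBall)

theorem ball_int {A : E n → ℝ} (hA : Continuous A) (r : ℝ) : IntegrableOn A (Metric.ball (0 : E n) r) :=
  (hA.continuousOn.integrableOn_compact (isCompact_closedBall (0 : E n) r)).mono_set Metric.ball_subset_closedBall

theorem L2_le_of {v A : E n → ℝ} (hv : Continuous v) (hA : Continuous A) {B : ℝ} 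
    (h : ∀ z, ‖z‖ < 1 → v z ^ 2 ≤ A z ^ 2 + B) : L2 v ≤ L2 A + V1 n * B := by
  unfold L2
  have e : V1 n * B = ∫ x in Metric.ball (0 : E n) 1, B := by
    rw [setIntegral_const, smul_eq_mul]; rfl
  have hi := ball_int (A := fun x => A x ^ 2) (hA.pow 2) 1
  rw [e, ← integral_add hi (ball_int continuous_const 1)]
  refine setIntegral_mono_on (ball_int (A := fun x => v x ^ 2) (hv.pow 2) 1) (hi.add (ball_int continuous_const 1)) Metric.isOpen_ball.measurableSet fun x hx => ?_
  exact h x (by simpa using hx)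

theorem rho_ex {α : ℝ} (hα : α < 1) (A : ℝ) : ∃ ρ : ℝ, 0 < ρ ∧ ρ < 1/2 ∧ A * ρ ^ 2 ≤ (ρ ^ α) ^ 2 := by
  have h1 : Tendsto (fun ρ : ℝ => |A| * ρ ^ (2 - 2 * α)) (𝓝[>] 0) (𝓝 (|A| * 0)) := by
    refine Tendsto.const_mul _ ?_
    have h : Tendsto (fun ρ : ℝ => ρ ^ (2 - 2 * α)) (𝓝 0) (𝓝 ((0:ℝ) ^ (2 - 2 * α))) :=
      (Real.continuousAt_rpow_const 0 (2 - 2 * α) (Or.inr (by linarith))).tendsto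
    rw [Real.zero_rpow (by linarith)] at h
    exact h.mono_left nhdsWithin_le_nhds
  rw [mul_zero] at h1
  have g1 : ∀ᶠ ρ : ℝ in 𝓝[>] 0, 0 < ρ := self_mem_nhdsWithin
  have g2 : ∀ᶠ ρ : ℝ in 𝓝[>] 0, ρ < 1/2 := mem_nhdsWithin_of_mem_nhds (Iio_mem_nhds (show (0:ℝ) < 1/2 by norm_num))
  obtain ⟨ρ, hr1, hr2, hr3⟩ := ((h1.eventually (Iio_mem_nhds one_pos)).and (g1.and g2)).exists
  have hr1 : |A| * ρ ^ (2 - 2 * α) < 1 := hr1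
  refine ⟨ρ, hr2, hr3, ?_⟩
  have e : ρ ^ (2:ℕ) = ρ ^ (2 - 2 * α) * (ρ ^ α) ^ 2 := by
    rw [← Real.rpow_natCast, ← Real.rpow_natCast (ρ ^ α), ← Real.rpow_mul hr2.le, ← Real.rpow_add hr2]
    congr 1; push_cast; ring
  rw [e, ← mul_assoc]
  have hp : 0 < (ρ ^ α) ^ 2 := by positivity
  have : A * ρ ^ (2 - 2 * α) ≤ 1 := (mul_le_mul_of_nonneg_right (le_abs_self A) (Real.rpow_nonneg hr2.le _)).trans hr1.le
  nlinarith

theorem sq3 (a b c : ℝ) : (a + b + c) ^ 2 ≤ 3 * (a ^ 2 + b ^ 2 + c ^ 2) := by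
  nlinarith [sq_nonneg (a - b), sq_nonneg (a - c), sq_nonneg (b - c)]

set_option maxHeartbeats 1000000 in
theorem Fimp (hn : 0 < n) {l K α : ℝ} (hl : 0 < l) (hK : 0 ≤ K) (hα0 : 0 < α) (hα : α < 1) : ∃ ρ ε0 κ : ℝ, 0 < ρ ∧ ρ < 1/2 ∧ 0 < ε0 ∧ ε0 ≤ 1 ∧ 0 < κ ∧
    ∀ F0 ε : ℝ, ∀ u : E n → ℝ, 0 < ε → ε ≤ ε0 → Cls l K F0 (κ * ρ ^ α / 2 * ε) 1 u → Fl F0 κ ε u → Fl F0 κ (ρ ^ α * ε) (zm 0 ρ u) := by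
  obtain ⟨C1, hC1, hF⟩ := Fk hn (half_pos hl) (show 0 ≤ K + 1 by linarith)
  obtain ⟨εs, hεs, hS⟩ := Sell n (l := l) (K := K) hl
  have hV := V1_nonneg (n := n)
  obtain ⟨ρ, hρ, hρ2, hρA⟩ := rho_ex hα (9 * (V1 n * C1 ^ 2))
  set a := ρ ^ α with ha
  have ha0 : 0 < a := by positivity
  have ha1 : a ≤ 1 := Real.rpow_le_one hρ.le (by linarith) hα0.le
  set N := Module.finrank ℝ (E n) with hN
  set P := (ρ ^ 4)⁻¹ with hP
  have hP0 : 0 < P := by positivity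
  set G := 18 * P * (ρ ^ N)⁻¹ * C1 with hG
  have hG0 : 0 < G := by positivity
  obtain ⟨r0, hr0, hr1, hr2⟩ := small_ex G (show 0 < a ^ 2 by positivity) (show (0:ℝ) < 3/8 by norm_num)
  obtain ⟨C2, hC2, hF⟩ := hF r0 hr0 hr1
  obtain ⟨κ, hκ, hκ1, hκ2⟩ := small_ex (81 * P * V1 n * C2 ^ 2) (show 0 < a ^ 2 by positivity) (show (0:ℝ) < 1/2 by norm_num)
  obtain ⟨s, hs, hs1, hs2⟩ := small_ex (4 * C1) (show 0 < κ * a by positivity) hκ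
  refine ⟨ρ, min (s ^ 2 / 2) εs, κ, hρ, hρ2, by positivity, ?_, hκ, fun F0 ε u hε hε0 H hfl => ?_⟩
  · refine (min_le_left _ _).trans ?_; nlinarith
  obtain ⟨c, p, S, hSs, hSd, hSl⟩ := hfl
  have hεs2 : ε ≤ s ^ 2 / 2 := hε0.trans (min_le_left _ _)
  obtain ⟨hSe, hSb⟩ := hS F0 _ ε u c p S H hε (hε0.trans (min_le_right _ _)) hSs hSl
  have hε1 : ε ≤ 1 := by nlinarith
  set σ := 2 * κ * ε with hσ
  have hσε : σ ≤ ε := by rw [hσ]; nlinarith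
  have hσ0 : 0 < σ := by positivity
  have hyp : Hyp (l / 2) (K + 1) σ ε u c p S := by
    refine ⟨H.lc, ?_, ?_, hSs, hSe, hSb, ?_, hSl, hσ0.le, hε⟩
    · filter_upwards [H.ell] with x hx h1
      refine ⟨(hx h1).1, fun c => le_trans ?_ ((hx h1).2 c)⟩
      have : 0 ≤ ∑ i, ‖c i‖ ^ 2 := Finset.sum_nonneg fun _ _ => sq_nonneg _
      nlinarith
    · filter_upwards [H.bd] with x hx h1
      linarith [hx h1]
    · filter_upwards [H.det] with x hx h1
      have h2 := hx h1
      have h3 := abs_sub_le (dt (D2 u x)) F0 (dt S)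
      rw [abs_sub_comm F0] at h3
      have : κ * a / 2 * ε ≤ κ * ε := by
        refine mul_le_mul_of_nonneg_right ?_ hε.le
        nlinarith
      rw [hσ]; linarith
  obtain ⟨c', p', S', hS', ⟨A, hAc, hA2, hAb⟩, hdet⟩ := hF σ ε u c p S hyp hε1
  have hsq : √(ε + σ) ≤ s := by
    rw [show s = √(s ^ 2) from (Real.sqrt_sq hs.le).symm]
    exact Real.sqrt_le_sqrt (by linarith)
  refine ⟨(ρ ^ 2)⁻¹ * c', ρ⁻¹ • p', S', hS', ?_, ?_⟩
  · refine (hdet F0 _ H.det).trans ?_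
    have h0 : ε * √(ε + σ) ≤ ε * s := mul_le_mul_of_nonneg_left hsq hε.le
    have h0' : ε ≤ s := by nlinarith
    have h1 : ε * √(ε + σ) + ε ^ 2 ≤ 2 * s * ε := by nlinarith
    have h2 : C1 * (ε * √(ε + σ) + ε ^ 2) ≤ C1 * (2 * s * ε) := by gcongr
    have h3 : 4 * C1 * s * ε ≤ κ * a * ε := mul_le_mul_of_nonneg_right hs2 hε.le
    linarith
  · have hX : σ + ε * √(ε + σ) ≤ 3 * κ * ε := by nlinarith
    have hX0 : 0 ≤ σ + ε * √(ε + σ) := by positivity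
    set X := σ + ε * √(ε + σ) with hXd
    set A' : E n → ℝ := fun z => √(3 * P) * A (ρ • z) with hA'
    have hA'c : Continuous A' := continuous_const.mul (hAc.comp (by fun_prop))
    have hPs : √(3 * P) ^ 2 = 3 * P := Real.sq_sqrt (by positivity)
    have hv : L2 (fun x => zm 0 ρ u x - qd ((ρ ^ 2)⁻¹ * c') (ρ⁻¹ • p') S' x) ≤ L2 A' + V1 n * (3 * P * ((C1 * ε * ρ ^ 3) ^ 2 + (C2 * X) ^ 2)) := by
      refine L2_le_of ((zm_lc H.lc 0 ρ).cont.sub (qd_lc _ _ _).cont) hA'c fun z hz => ?_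
      show (zm 0 ρ u z - qd ((ρ ^ 2)⁻¹ * c') (ρ⁻¹ • p') S' z) ^ 2 ≤ _
      rw [qd_zm c' p' S' hρ.ne', zm, zero_add, ← mul_sub, mul_pow, hA']
      have hz1 : ‖ρ • z‖ ≤ ρ := by rw [norm_smul, Real.norm_of_nonneg hρ.le]; nlinarith
      have h1 := hAb (ρ • z) (by linarith)
      have h2 : C1 * ε * ‖ρ • z‖ ^ 3 ≤ C1 * ε * ρ ^ 3 := by gcongr
      have h3 : (u (ρ • z) - qd c' p' S' (ρ • z)) ^ 2 ≤ (|A (ρ • z)| + C1 * ε * ρ ^ 3 + C2 * X) ^ 2 := by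
        rw [← sq_abs (u _ - _)]
        gcongr; linarith
      have h4 := h3.trans (sq3 _ _ _)
      rw [sq_abs] at h4
      have e : ((ρ ^ 2)⁻¹) ^ 2 = P := by rw [hP, inv_pow, ← pow_mul]
      rw [e]
      simp only [mul_pow √(3 * P), hPs]
      have h5 := mul_le_mul_of_nonneg_left h4 hP0.le
      linarith
    have hA'2 : L2 A' ≤ 3 * P * ((ρ ^ N)⁻¹ * (r0 ^ 2 * (C1 * (ε ^ 2 + ε * σ)))) := by
      have e : L2 A' = 3 * P * ∫ z in Metric.ball (0 : E n) 1, A (ρ • z) ^ 2 := by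
        unfold L2
        rw [← integral_const_mul]
        simp only [hA', mul_pow, hPs]
      rw [e]
      have := L2_zoom hAc hρ hρ2.le
      refine mul_le_mul_of_nonneg_left (this.trans ?_) (by positivity)
      exact mul_le_mul_of_nonneg_left hA2 (by positivity)
    refine hv.trans ?_
    have t1 : 3 * P * ((ρ ^ N)⁻¹ * (r0 ^ 2 * (C1 * (ε ^ 2 + ε * σ)))) ≤ a ^ 2 * ε ^ 2 / 3 := by
      have h1 : ε ^ 2 + ε * σ ≤ 2 * ε ^ 2 := by nlinarith
      have h2 : r0 ^ 2 ≤ r0 := by nlinarith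
      calc 3 * P * ((ρ ^ N)⁻¹ * (r0 ^ 2 * (C1 * (ε ^ 2 + ε * σ)))) ≤ 3 * P * ((ρ ^ N)⁻¹ * (r0 * (C1 * (2 * ε ^ 2)))) := by gcongr
        _ = (G * r0) * ε ^ 2 / 3 := by rw [hG]; ring
        _ ≤ _ := by
          have := mul_le_mul_of_nonneg_right hr2 (sq_nonneg ε)
          linarith
    have t2 : V1 n * (3 * P * (C1 * ε * ρ ^ 3) ^ 2) ≤ a ^ 2 * ε ^ 2 / 3 := by
      have : V1 n * (3 * P * (C1 * ε * ρ ^ 3) ^ 2) = (9 * (V1 n * C1 ^ 2) * ρ ^ 2) * ε ^ 2 / 3 := by rw [hP]; field_simp; ring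
      rw [this]
      have := mul_le_mul_of_nonneg_right hρA (sq_nonneg ε)
      linarith
    have t3 : V1 n * (3 * P * (C2 * X) ^ 2) ≤ a ^ 2 * ε ^ 2 / 3 := by
      calc V1 n * (3 * P * (C2 * X) ^ 2) ≤ V1 n * (3 * P * (C2 * (3 * κ * ε)) ^ 2) := by gcongr
        _ = (81 * P * V1 n * C2 ^ 2 * κ) * κ * ε ^ 2 / 3 := by ring
        _ ≤ (a ^ 2) * 1 * ε ^ 2 / 3 := by
          have h6 : 81 * P * V1 n * C2 ^ 2 * κ * κ ≤ a ^ 2 * 1 := mul_le_mul hκ2 (by linarith) hκ.le (by positivity)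
          have := mul_le_mul_of_nonneg_right h6 (sq_nonneg ε)
          linarith
        _ = _ := by ring
    rw [mul_pow]
    linarith

theorem zm_qd' (c : ℝ) (p : E n →L[ℝ] ℝ) {S : Bil n} (hS : ∀ v w, S v w = S w v) (h : E n) {r : ℝ} (hr : r ≠ 0) :
    zm h r (qd c p S) = qd ((r ^ 2)⁻¹ * qd c p S h) (r⁻¹ • (p + S h)) S := by
  funext z
  have := hS z h
  simp [zm, qd, this]; field_simp; ring

theorem zm_sub (h : E n) (r : ℝ) (u v : E n → ℝ) (z : E n) : zm h r (fun x => u x - v x) z = zm h r u z - zm h r v z := by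
  simp [zm, mul_sub]

/-- the constant for recentering -/
noncomputable def Rc (n : ℕ) (ρ : ℝ) : ℝ := (ρ ^ 4)⁻¹ * (ρ ^ Module.finrank ℝ (E n))⁻¹

theorem Rc_ge {ρ : ℝ} (hρ : 0 < ρ) (h1 : ρ ≤ 1) : 1 ≤ Rc n ρ := by
  unfold Rc
  have a1 : 1 ≤ (ρ ^ 4)⁻¹ := (one_le_inv₀ (by positivity)).2 (pow_le_one₀ hρ.le h1)
  have a2 : 1 ≤ (ρ ^ Module.finrank ℝ (E n))⁻¹ := (one_le_inv₀ (by positivity)).2 (pow_le_one₀ hρ.le h1)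
  nlinarith

theorem L2_zm {v : E n → ℝ} (hv : Continuous v) {h : E n} {ρ : ℝ} (hρ : 0 < ρ) (hh : ‖h‖ + ρ ≤ 1) : L2 (zm h ρ v) ≤ Rc n ρ * L2 v := by
  unfold L2 Rc zm
  simp only [mul_pow]
  rw [integral_const_mul, Measure.setIntegral_comp_smul_of_pos volume (fun x => v (h + x) ^ 2) _ hρ, smul_eq_mul, smul_unitBall_of_pos hρ,
    show ((ρ ^ 2)⁻¹) ^ 2 = (ρ ^ 4)⁻¹ by rw [inv_pow, ← pow_mul], mul_assoc]
  refine mul_le_mul_of_nonneg_left (mul_le_mul_of_nonneg_left ?_ (by positivity)) (by positivity)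
  have e : ∫ x in Metric.ball (0 : E n) ρ, v (h + x) ^ 2 = ∫ x in Metric.ball h ρ, v x ^ 2 := by
    rw [← integral_indicator Metric.isOpen_ball.measurableSet, ← integral_indicator Metric.isOpen_ball.measurableSet,
      ← integral_add_left_eq_self ((Metric.ball h ρ).indicator fun x => v x ^ 2) h]
    refine integral_congr_ae (Eventually.of_forall fun x => ?_)
    simp only [Set.indicator, Metric.mem_ball, dist_eq_norm, sub_zero, add_sub_cancel_left]
  rw [e]
  refine setIntegral_mono_set (ball_int (A := fun x => v x ^ 2) (hv.pow 2) 1) (Eventually.of_forall fun x => sq_nonneg _) (HasSubset.Subset.eventuallyLE ?_)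
  intro x hx
  simp only [Metric.mem_ball, dist_eq_norm, sub_zero] at hx ⊢
  have := norm_add_le (x - h) h
  rw [sub_add_cancel] at this; linarith

/-- recentering of the quadratic approximation -/
theorem recenter {u : E n → ℝ} (hu : Continuous u) {c : ℝ} {p : E n →L[ℝ] ℝ} {S : Bil n} (hS : ∀ v w, S v w = S w v) {ε ρ : ℝ} (hε : 0 < ε)
    (hρ : 0 < ρ) {h : E n} (hh : ‖h‖ + ρ ≤ 1) (h2 : L2 (fun x => u x - qd c p S x) ≤ ε ^ 2) :
    ∃ c' p', L2 (fun x => zm h ρ u x - qd c' p' S x) ≤ (Rc n ρ * ε) ^ 2 := by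
  refine ⟨(ρ ^ 2)⁻¹ * qd c p S h, ρ⁻¹ • (p + S h), ?_⟩
  rw [← zm_qd' c p hS h hρ.ne']
  have e : (fun x => zm h ρ u x - zm h ρ (qd c p S) x) = zm h ρ (fun x => u x - qd c p S x) := by
    funext z; rw [zm_sub]
  rw [e]
  have := Rc_ge (n := n) hρ (by linarith [norm_nonneg h])
  refine (L2_zm (hu.sub (qd_lc c p S).cont) hρ hh).trans ?_
  calc Rc n ρ * L2 (fun x => u x - qd c p S x) ≤ Rc n ρ * ε ^ 2 := by gcongr
    _ ≤ Rc n ρ * (Rc n ρ * ε ^ 2) := le_mul_of_one_le_left (by positivity) this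
    _ = _ := by ring

theorem Lam_near {C : ℝ} (hC : ∀ v : E n → ℝ, Continuous v → ∀ ε, 0 < ε → L2 v ≤ ε ^ 2 → ‖Lam v‖ ≤ C * ε) {u : E n → ℝ} (hu : Continuous u)
    {c : ℝ} {p : E n →L[ℝ] ℝ} {S : Bil n} (hS : ∀ v w, S v w = S w v) {ε : ℝ} (hε : 0 < ε) (h2 : L2 (fun x => u x - qd c p S x) ≤ ε ^ 2) :
    ‖Lam u - S‖ ≤ C * ε := by
  have := hC _ (hu.sub (qd_lc c p S).cont) ε hε h2
  have e : Lam (fun x => u x - qd c p S x) = Lam u - S := by rw [Lam_sub hu (qd_lc c p S).cont, Lam_qd c p hS]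
  rw [← e]; exact this

theorem Lam_tendsto {u : E n → ℝ} (hu : LC u) {y : E n} (hy : DifferentiableAt ℝ (fderiv ℝ u) y) {r : ℕ → ℝ} (hr : ∀ k, 0 < r k) (hr0 : Tendsto r atTop (𝓝 0)) :
    Tendsto (fun k => Lam (zm y (r k) u)) atTop (𝓝 (D2 u y)) := by
  obtain ⟨C, hC0, hC⟩ := Lam_bd n
  have hS : ∀ v w, D2 u y v w = D2 u y w v := D2_symm' hu.diff y
  rw [Metric.tendsto_atTop]
  intro η hη
  have hV := V1_nonneg (n := n)
  set e := η / (2 * C * (V1 n + 1)) with he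
  have he0 : 0 < e := by positivity
  have h1 := hy.hasFDerivAt.isLittleO.def he0
  obtain ⟨δ, hδ, h1⟩ := Metric.eventually_nhds_iff.1 h1
  obtain ⟨N, hN⟩ := (Metric.tendsto_atTop.1 hr0) δ hδ
  refine ⟨N, fun k hk => ?_⟩
  have hrk := hN k hk
  have hp := hr k
  rw [Real.dist_eq, sub_zero, abs_of_pos hp] at hrk
  have hmv : ∀ z : E n, ‖z‖ < 1 → |u (y + r k • z) - qd (u y) (fderiv ℝ u y) (D2 u y) (r k • z)| ≤ e * r k ^ 2 := by
    intro z hz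
    set f : E n → ℝ := fun x => u (y + x) - qd (u y) (fderiv ℝ u y) (D2 u y) x with hf
    have hfd : ∀ x ∈ Metric.ball (0 : E n) (r k), HasFDerivWithinAt f (fderiv ℝ u (y + x) - (fderiv ℝ u y + D2 u y x)) (Metric.ball (0 : E n) (r k)) x := by
      intro x _
      have a1 : HasFDerivAt (fun x => u (y + x)) (fderiv ℝ u (y + x)) x := by
        have := ((hu.diff (y + x)).hasFDerivAt).comp x ((hasFDerivAt_id x).const_add y)
        simpa [Function.comp_def] using this
      have a2 := ((qd_lc (u y) (fderiv ℝ u y) (D2 u y)).diff x).hasFDerivAt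
      rw [qd_fderiv _ _ hS] at a2
      exact (a1.sub a2).hasFDerivWithinAt
    have hb : ∀ x ∈ Metric.ball (0 : E n) (r k), ‖fderiv ℝ u (y + x) - (fderiv ℝ u y + D2 u y x)‖ ≤ e * r k := by
      intro x hx
      have hx' : ‖x‖ < r k := by simpa using hx
      have := h1 (y := y + x) (by rw [dist_eq_norm, add_sub_cancel_left]; linarith)
      rw [add_sub_cancel_left] at this
      have e1 : fderiv ℝ u (y + x) - (fderiv ℝ u y + D2 u y x) = fderiv ℝ u (y + x) - fderiv ℝ u y - fderiv ℝ (fderiv ℝ u) y x := by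
        rw [sub_sub]; rfl
      rw [e1]
      exact this.trans (by gcongr)
    have hz' : ‖r k • z‖ ≤ r k := by rw [norm_smul, Real.norm_of_nonneg hp.le]; nlinarith
    have hm : r k • z ∈ Metric.ball (0 : E n) (r k) := by
      simp only [Metric.mem_ball, dist_zero_right, norm_smul, Real.norm_of_nonneg hp.le]; nlinarith
    have := (convex_ball (0 : E n) (r k)).norm_image_sub_le_of_norm_hasFDerivWithin_le hfd hb (Metric.mem_ball_self hp) hm
    have hf0 : f 0 = 0 := by simp [hf, qd]
    rw [hf0, sub_zero, sub_zero, Real.norm_eq_abs] at this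
    refine this.trans ?_
    have : e * r k * ‖r k • z‖ ≤ e * r k * r k := by gcongr
    linarith [this, show e * r k * r k = e * r k ^ 2 by ring]
  have h2 : L2 (fun z => zm y (r k) u z - qd ((r k ^ 2)⁻¹ * u y) ((r k)⁻¹ • fderiv ℝ u y) (D2 u y) z) ≤ (e * (V1 n + 1)) ^ 2 := by
    have := L2_le_of (A := fun _ : E n => (0:ℝ)) (B := e ^ 2) ((zm_lc hu y (r k)).cont.sub (qd_lc ((r k ^ 2)⁻¹ * u y) ((r k)⁻¹ • fderiv ℝ u y) (D2 u y)).cont) continuous_const (fun z hz => by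
      show (zm y (r k) u z - qd ((r k ^ 2)⁻¹ * u y) ((r k)⁻¹ • fderiv ℝ u y) (D2 u y) z) ^ 2 ≤ _
      rw [qd_zm _ _ _ hp.ne', zm, ← mul_sub, ← sq_abs, abs_mul, abs_of_pos (by positivity)]
      have h3 := hmv z hz
      have h4 : (r k ^ 2)⁻¹ * |u (y + r k • z) - qd (u y) (fderiv ℝ u y) (D2 u y) (r k • z)| ≤ e := by
        rw [inv_mul_le_iff₀ (by positivity)]; linarith
      have : ((r k ^ 2)⁻¹ * |u (y + r k • z) - qd (u y) (fderiv ℝ u y) (D2 u y) (r k • z)|) ^ 2 ≤ e ^ 2 := by gcongr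
      simpa using this)
    refine le_trans this ?_
    have e0 : L2 (fun _ : E n => (0:ℝ)) = 0 := by simp [L2]
    rw [e0, mul_pow]
    nlinarith [sq_nonneg e, sq_nonneg (V1 n)]
  have h3 := Lam_near hC (zm_lc hu y (r k)).cont hS (by positivity) h2
  rw [dist_eq_norm]
  refine h3.trans_lt ?_
  have : C * (e * (V1 n + 1)) = η / 2 := by rw [he]; field_simp
  rw [this]; linarith

theorem Lam_symm {v : E n → ℝ} (hv : LC v) (a b : E n) : Lam v a b = Lam v b a :=
  D2_symm' ((hv.mol_smooth 1).differentiable (by simp)) 0 a b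

/-- one step of the Campanato iteration -/
theorem camp_step (n : ℕ) {ρ : ℝ} (hρ : 0 < ρ) (hρ2 : ρ < 1/2) :
    ∃ B, 0 < B ∧ ∀ φ : E n → ℝ, LC φ → ∀ (x y : E n) (r ε : ℝ), 0 < r → 0 < ε → ‖x - y‖ ≤ r / 2 →
      (∃ c p, ∃ S : Bil n, (∀ v w, S v w = S w v) ∧ L2 (fun z => zm x r φ z - qd c p S z) ≤ ε ^ 2) →
      ‖Lam (zm x r φ) - Lam (zm y (ρ * r) φ)‖ ≤ B * ε := by
  obtain ⟨C, hC0, hC⟩ := Lam_bd n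
  have hRc := Rc_ge (n := n) hρ (by linarith)
  refine ⟨C * (1 + Rc n ρ), by positivity, fun φ hφ x y r ε hr hε hxy ⟨c, p, S, hS, h2⟩ => ?_⟩
  have h1 := Lam_near hC (zm_lc hφ x r).cont hS hε h2
  have hh : ‖r⁻¹ • (y - x)‖ + ρ ≤ 1 := by
    rw [norm_smul, Real.norm_of_nonneg (by positivity), norm_sub_rev]
    have : r⁻¹ * ‖x - y‖ ≤ 1/2 := by rw [inv_mul_le_iff₀ hr]; linarith
    linarith
  obtain ⟨c', p', h3⟩ := recenter (zm_lc hφ x r).cont hS hε hρ hh h2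
  rw [zm_zm] at h3
  have e : x + r • r⁻¹ • (y - x) = y := by rw [smul_smul, mul_inv_cancel₀ hr.ne', one_smul, add_sub_cancel]
  rw [e, mul_comm r ρ] at h3
  have h4 := Lam_near hC (zm_lc hφ y (ρ * r)).cont hS (by positivity) h3
  calc ‖Lam (zm x r φ) - Lam (zm y (ρ * r) φ)‖ = ‖(Lam (zm x r φ) - S) - (Lam (zm y (ρ * r) φ) - S)‖ := by congr 1; abel
    _ ≤ C * ε + C * (Rc n ρ * ε) := (norm_sub_le _ _).trans (add_le_add h1 h4)
    _ = _ := by ring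

theorem Camp (n : ℕ) {ρ α : ℝ} (hρ : 0 < ρ) (hρ2 : ρ < 1/2) (hα0 : 0 < α) :
    ∃ C, 0 < C ∧ ∀ φ : E n → ℝ, LC φ → ∀ (x0 : E n) (R r1 D : ℝ), 0 < r1 → 0 < D →
      (∀ x, ‖x - x0‖ < R → ∀ k : ℕ, ∃ c p, ∃ S : Bil n, (∀ v w, S v w = S w v) ∧
        L2 (fun z => zm x (ρ ^ k * r1) φ z - qd c p S z) ≤ (D * (ρ ^ α) ^ k) ^ 2) →
      (∀ x, ‖x - x0‖ < R → DifferentiableAt ℝ (fderiv ℝ φ) x) ∧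
      ∀ x y, ‖x - x0‖ < R → ‖y - x0‖ < R → ‖x - y‖ ≤ r1 / 2 → ‖D2 φ x - D2 φ y‖ ≤ C * D * (‖x - y‖ / r1) ^ α := by
  obtain ⟨B, hB, hstep⟩ := camp_step n hρ hρ2
  set a := ρ ^ α with ha
  have ha0 : 0 < a := Real.rpow_pos_of_pos hρ _
  have ha1 : a < 1 := Real.rpow_lt_one hρ.le (by linarith) hα0
  have ha2 : 0 < 1 - a := by linarith
  set C1 := B * (2 / (1 - a) + 1) with hC1
  have hC1p : 0 < C1 := by positivity
  refine ⟨C1 * a⁻¹ * 2 ^ α, by positivity, fun φ hφ x0 R r1 D hr1 hD H => ?_⟩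
  have hst : ∀ x y, ‖x - x0‖ < R → ∀ k : ℕ, ‖x - y‖ ≤ ρ ^ k * r1 / 2 →
      ‖Lam (zm x (ρ ^ k * r1) φ) - Lam (zm y (ρ ^ (k + 1) * r1) φ)‖ ≤ B * D * a ^ k := by
    intro x y hx k hk
    have := hstep φ hφ x y (ρ ^ k * r1) (D * a ^ k) (by positivity) (by positivity) hk (H x hx k)
    rw [show ρ * (ρ ^ k * r1) = ρ ^ (k + 1) * r1 by ring] at this
    linarith
  have hst' : ∀ x, ‖x - x0‖ < R → ∀ k : ℕ, dist (Lam (zm x (ρ ^ k * r1) φ)) (Lam (zm x (ρ ^ (k + 1) * r1) φ)) ≤ B * D * a ^ k := by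
    intro x hx k
    rw [dist_eq_norm]
    exact hst x x hx k (by rw [sub_self, norm_zero]; positivity)
  have hlim : ∀ x, ‖x - x0‖ < R → ∃ A : Bil n, Tendsto (fun k : ℕ => Lam (zm x (ρ ^ k * r1) φ)) atTop (𝓝 A) := fun x hx =>
    cauchySeq_tendsto_of_complete (cauchySeq_of_le_geometric a (B * D) ha1 (hst' x hx))
  choose! A hA using hlim
  have hd : ∀ x, ‖x - x0‖ < R → ∀ k : ℕ, ‖Lam (zm x (ρ ^ k * r1) φ) - A x‖ ≤ B * D * a ^ k / (1 - a) := by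
    intro x hx k
    rw [← dist_eq_norm]
    exact dist_le_of_le_geometric_of_tendsto a (B * D) ha1 (hst' x hx) (hA x hx) k
  have hAk : ∀ x y, ‖x - x0‖ < R → ‖y - x0‖ < R → ∀ k : ℕ, ‖x - y‖ ≤ ρ ^ k * r1 / 2 → ‖A x - A y‖ ≤ C1 * D * a ^ k := by
    intro x y hx hy k hk
    have t1 := hd x hx k
    have t2 := hd y hy (k + 1)
    have t3 := hst x y hx k hk
    have e : A x - A y = (Lam (zm x (ρ ^ k * r1) φ) - Lam (zm y (ρ ^ (k + 1) * r1) φ)) + (Lam (zm y (ρ ^ (k + 1) * r1) φ) - A y) - (Lam (zm x (ρ ^ k * r1) φ) - A x) := by abel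
    have t4 : B * D * a ^ (k + 1) / (1 - a) ≤ B * D * a ^ k / (1 - a) := by
      gcongr ?_ / _
      exact mul_le_mul_of_nonneg_left (pow_le_pow_of_le_one ha0.le ha1.le (Nat.le_succ k)) (by positivity)
    rw [e]
    calc _ ≤ B * D * a ^ k + B * D * a ^ (k + 1) / (1 - a) + B * D * a ^ k / (1 - a) :=
          (norm_sub_le _ _).trans (add_le_add ((norm_add_le _ _).trans (add_le_add t3 t2)) t1)
      _ ≤ B * D * a ^ k + B * D * a ^ k / (1 - a) + B * D * a ^ k / (1 - a) := by gcongr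
      _ = _ := by rw [hC1]; field_simp; ring
  have hHol : ∀ x y, ‖x - x0‖ < R → ‖y - x0‖ < R → ‖x - y‖ ≤ r1 / 2 → ‖A x - A y‖ ≤ C1 * a⁻¹ * 2 ^ α * D * (‖x - y‖ / r1) ^ α := by
    intro x y hx hy hxy
    rcases eq_or_ne x y with rfl | hne
    · rw [sub_self, sub_self, norm_zero, norm_zero, zero_div]; positivity
    have hp : 0 < ‖x - y‖ := norm_pos_iff.2 (sub_ne_zero.2 hne)
    obtain ⟨k, hk1, hk2⟩ := exists_nat_pow_near_of_lt_one (x := 2 * (‖x - y‖ / r1)) (y := ρ) (by positivity)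
      (by rw [← mul_div_assoc, div_le_one hr1]; linarith) hρ (by linarith)
    have hk3 : ‖x - y‖ ≤ ρ ^ k * r1 / 2 := by
      rw [← mul_div_assoc, div_le_iff₀ hr1] at hk2; linarith
    refine (hAk x y hx hy k hk3).trans ?_
    have : a ^ (k + 1) ≤ (2 * (‖x - y‖ / r1)) ^ α := by
      rw [ha, ← Real.rpow_natCast, ← Real.rpow_mul hρ.le, mul_comm, Real.rpow_mul hρ.le, Real.rpow_natCast]
      exact Real.rpow_le_rpow (by positivity) hk1.le hα0.le
    rw [Real.mul_rpow (by norm_num) (by positivity)] at this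
    have e : a ^ k = a⁻¹ * a ^ (k + 1) := by rw [pow_succ]; field_simp
    rw [e]
    calc C1 * D * (a⁻¹ * a ^ (k + 1)) ≤ C1 * D * (a⁻¹ * (2 ^ α * (‖x - y‖ / r1) ^ α)) := by gcongr
      _ = _ := by ring
  have hAs : ∀ x, ‖x - x0‖ < R → ∀ v w, A x v w = A x w v := by
    intro x hx v w
    have t1 := ((bil_eval_cont v w).tendsto _).comp (hA x hx)
    have t2 := ((bil_eval_cont w v).tendsto _).comp (hA x hx)
    refine tendsto_nhds_unique t1 (t2.congr fun k => ?_)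
    exact Lam_symm (zm_lc hφ _ _) _ _
  have hr0 : Tendsto (fun k : ℕ => ρ ^ k * r1) atTop (𝓝 0) := by
    simpa using (tendsto_pow_atTop_nhds_zero_of_lt_one hρ.le (by linarith)).mul_const r1
  have hAe : ∀ x, ‖x - x0‖ < R → DifferentiableAt ℝ (fderiv ℝ φ) x → D2 φ x = A x := fun x hx h =>
    tendsto_nhds_unique (Lam_tendsto hφ h (fun k => by positivity) hr0) (hA x hx)
  have hdiff : ∀ x, ‖x - x0‖ < R → HasFDerivAt (fderiv ℝ φ) (A x) x := by
    intro x hx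
    refine .of_isLittleO (Asymptotics.isLittleO_iff.2 fun c hc => ?_)
    have hcont : Tendsto (fun y : E n => C1 * a⁻¹ * 2 ^ α * D * (‖y - x‖ / r1) ^ α) (𝓝 x) (𝓝 0) := by
      have : Continuous (fun y : E n => C1 * a⁻¹ * 2 ^ α * D * (‖y - x‖ / r1) ^ α) := by
        refine continuous_const.mul (Continuous.rpow_const (by fun_prop) fun y => Or.inr hα0.le)
      have h := this.tendsto x
      simpa [Real.zero_rpow hα0.ne'] using h
    have e1 : ∀ᶠ y in 𝓝 x, C1 * a⁻¹ * 2 ^ α * D * (‖y - x‖ / r1) ^ α < c := hcont.eventually (gt_mem_nhds hc)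
    have e2 : ∀ᶠ y in 𝓝 x, ‖y - x0‖ < R := (continuous_id.sub continuous_const).norm.continuousAt.eventually (gt_mem_nhds hx)
    have e3 : ∀ᶠ y in 𝓝 x, ‖y - x‖ < r1 / 2 := by
      refine (continuous_id.sub continuous_const).norm.continuousAt.eventually (gt_mem_nhds ?_)
      simp [hr1]
    obtain ⟨δ, hδ, hall⟩ := Metric.eventually_nhds_iff.1 (e1.and (e2.and e3))
    have hbd : ∀ᵐ y, ‖y - x‖ < δ → ‖D2 (fun z => φ z - qd 0 0 (A x) z) y‖ ≤ c := by
      filter_upwards [hφ.ae] with y hy hyx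
      obtain ⟨b1, b2, b3⟩ := hall (y := y) (by rw [dist_eq_norm]; exact hyx)
      rw [D2_sub hφ (qd_lc _ _ _) hy (by rw [qd_fderiv _ _ (hAs x hx)]; fun_prop), qd_D2 _ _ (hAs x hx), hAe y b2 hy]
      exact (hHol y x b2 hx b3.le).trans b1.le
    filter_upwards [Metric.ball_mem_nhds x hδ] with y hy
    have := lip_of_D2 (hφ.sub (qd_lc 0 0 (A x))) hbd (x := y) (y := x) (by rw [← dist_eq_norm]; exact hy) (by simpa using hδ)
    refine le_trans (le_of_eq ?_) this
    have e4 : ∀ z, fderiv ℝ (fun z => φ z - qd 0 0 (A x) z) z = fderiv ℝ φ z - A x z := by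
      intro z
      have := fderiv_sub (hφ.diff z) ((qd_lc 0 0 (A x)).diff z)
      rw [qd_fderiv _ _ (hAs x hx)] at this
      simp only [zero_add] at this
      exact this
    rw [e4, e4, map_sub]; congr 1; abel
  have hD2 : ∀ x, ‖x - x0‖ < R → D2 φ x = A x := fun x hx => (hdiff x hx).fderiv
  refine ⟨fun x hx => (hdiff x hx).differentiableAt, fun x y hx hy hxy => ?_⟩
  rw [hD2 x hx, hD2 y hy]
  exact hHol x y hx hy hxy

/-- the constants of the improvement of flatness lemma -/
structure FC (n : ℕ) (l K α ρ ε0 κ : ℝ) : Prop where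
  n0 : 0 < n
  l0 : 0 < l
  K0 : 0 ≤ K
  a0 : 0 < α
  r0 : 0 < ρ
  r2 : ρ < 1/2
  e0 : 0 < ε0
  e1 : ε0 ≤ 1
  k0 : 0 < κ
  imp : ∀ F0 ε : ℝ, ∀ u : E n → ℝ, 0 < ε → ε ≤ ε0 → Cls l K F0 (κ * ρ ^ α / 2 * ε) 1 u →
      Fl F0 κ ε u → Fl F0 κ (ρ ^ α * ε) (zm 0 ρ u)

theorem FC_ex (hn : 0 < n) {l K α : ℝ} (hl : 0 < l) (hK : 0 ≤ K) (hα0 : 0 < α) (hα : α < 1) :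
    ∃ ρ ε0 κ : ℝ, FC n l K α ρ ε0 κ := by
  obtain ⟨ρ, ε0, κ, h1, h2, h3, h4, h5, h6⟩ := Fimp hn hl hK hα0 hα
  exact ⟨ρ, ε0, κ, hn, hl, hK, hα0, h1, h2, h3, h4, h5, h6⟩

variable {l K α ρ ε0 κ : ℝ}

theorem FC.apos (h : FC n l K α ρ ε0 κ) : 0 < ρ ^ α := Real.rpow_pos_of_pos h.r0 _
theorem FC.alt (h : FC n l K α ρ ε0 κ) : ρ ^ α < 1 := Real.rpow_lt_one h.r0.le (by linarith [h.r2]) h.a0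

theorem Fiter (h : FC n l K α ρ ε0 κ) {u : E n → ℝ} {F0 ε : ℝ} (hε : 0 < ε) (hε0 : ε ≤ ε0)
    (hcls : ∀ k : ℕ, Cls l K F0 (κ * ρ ^ α / 2 * ((ρ ^ α) ^ k * ε)) 1 (zm 0 (ρ ^ k) u)) (hfl : Fl F0 κ ε u) (k : ℕ) :
    Fl F0 κ ((ρ ^ α) ^ k * ε) (zm 0 (ρ ^ k) u) := by
  have ha := h.apos
  have ha1 := h.alt
  induction k with
  | zero => simpa [zm_one] using hfl
  | succ k ih =>
    have hle : (ρ ^ α) ^ k * ε ≤ ε0 := le_trans (mul_le_of_le_one_left hε.le (pow_le_one₀ ha.le ha1.le)) hε0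
    have := h.imp F0 _ _ (by positivity) hle (hcls k) ih
    rw [zm_zm] at this
    simp only [smul_zero, add_zero, ← pow_succ] at this
    rw [pow_succ' (ρ ^ α), mul_assoc]
    exact this

theorem Fl_mono {F0 ε ε' : ℝ} {u : E n → ℝ} (hκ : 0 < κ) (hε : 0 < ε) (h : ε ≤ ε') (hf : Fl F0 κ ε u) : Fl F0 κ ε' u := by
  obtain ⟨c, p, S, hS, h1, h2⟩ := hf
  exact ⟨c, p, S, hS, h1.trans (by gcongr), h2.trans (by gcongr)⟩

theorem Fl_recenter {F0 ε s : ℝ} {u : E n → ℝ} (hu : LC u) (hκ : 0 < κ) (hε : 0 < ε) (hs : 0 < s) {z : E n} (hz : ‖z‖ + s ≤ 1)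
    (hf : Fl F0 κ ε u) : Fl F0 κ (Rc n s * ε) (zm z s u) := by
  obtain ⟨c, p, S, hS, h1, h2⟩ := hf
  obtain ⟨c', p', h3⟩ := recenter hu.cont hS hε hs hz h2
  have hR := Rc_ge (n := n) hs (by linarith [norm_nonneg z])
  exact ⟨c', p', S, hS, h1.trans (mul_le_mul_of_nonneg_left (le_mul_of_one_le_left hε.le hR) hκ.le), h3⟩

/-- entire solutions -/
structure Ent (C : Set (Bil n)) (F0 : ℝ) (w : E n → ℝ) : Prop where
  lc : LC w
  mem : ∀ᵐ x, D2 w x ∈ C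
  det : ∀ᵐ x, dt (D2 w x) = F0

theorem Ent.zm {C : Set (Bil n)} {F0 : ℝ} {w : E n → ℝ} (h : Ent C F0 w) (x : E n) {r : ℝ} (hr : r ≠ 0) : Ent C F0 (zm x r w) where
  lc := zm_lc h.lc x r
  mem := by
    filter_upwards [zm_ae h.lc x hr, ae_aff h.mem x hr] with z h1 h2
    rw [h1]; exact h2
  det := by
    filter_upwards [zm_ae h.lc x hr, ae_aff h.det x hr] with z h1 h2
    rw [h1]; exact h2

/-- admissible constraint sets -/
structure Adm (l K : ℝ) (C : Set (Bil n)) : Prop where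
  conv : Convex ℝ C
  cl : IsClosed C
  ell : ∀ S ∈ C, Ell l (hC S)
  bd : ∀ S ∈ C, ‖S‖ ≤ K

theorem Ent.cls {C : Set (Bil n)} {F0 τ R : ℝ} {w : E n → ℝ} (h : Ent C F0 w) (hC : Adm l K C) (hτ : 0 ≤ τ) : Cls l K F0 τ R w where
  lc := h.lc
  ell := by filter_upwards [h.mem] with x hx _ using hC.ell _ hx
  bd := by filter_upwards [h.mem] with x hx _ using hC.bd _ hx
  det := by filter_upwards [h.det] with x hx _; rw [hx]; simpa using hτ

/-- flat entire solutions are regular -/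
theorem FlatReg (h : FC n l K α ρ ε0 κ) : ∃ C, 0 < C ∧ ∀ (𝒞 : Set (Bil n)) (F0 : ℝ) (w : E n → ℝ), Adm l K 𝒞 → Ent 𝒞 F0 w →
    ∀ (x0 : E n) (r : ℝ), 0 < r → Fl F0 κ (ε0 / Rc n ρ) (zm x0 r w) →
      (∀ x, ‖x - x0‖ < r / 2 → DifferentiableAt ℝ (fderiv ℝ w) x) ∧
      ∀ x y, ‖x - x0‖ < r / 2 → ‖y - x0‖ < r / 2 → ‖x - y‖ ≤ ρ * r / 2 → ‖D2 w x - D2 w y‖ ≤ C * (‖x - y‖ / r) ^ α := by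
  obtain ⟨C, hC0, hC⟩ := Camp n h.r0 h.r2 h.a0
  have ha := h.apos
  have hρ := h.r0
  have he := h.e0
  refine ⟨C * ε0 * (ρ⁻¹) ^ α, by positivity, fun 𝒞 F0 w hA hw x0 r hr hf => ?_⟩
  have hR := Rc_ge (n := n) h.r0 (by linarith [h.r2])
  have hk := h.k0
  have key : ∀ x, ‖x - x0‖ < r / 2 → ∀ k : ℕ, Fl F0 κ ((ρ ^ α) ^ k * ε0) (zm x (ρ ^ k * (ρ * r)) w) := by
    intro x hx k
    have hz : ‖r⁻¹ • (x - x0)‖ + ρ ≤ 1 := by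
      rw [norm_smul, Real.norm_of_nonneg (by positivity)]
      have : r⁻¹ * ‖x - x0‖ ≤ 1/2 := by rw [inv_mul_le_iff₀ hr]; linarith
      linarith [h.r2]
    have h1 := Fl_recenter (hw.zm x0 hr.ne').lc h.k0 (by positivity) h.r0 hz hf
    rw [zm_zm, mul_div_cancel₀ _ (by positivity)] at h1
    have e : x0 + r • r⁻¹ • (x - x0) = x := by rw [smul_smul, mul_inv_cancel₀ hr.ne', one_smul, add_sub_cancel]
    rw [e] at h1
    have := Fiter h h.e0 le_rfl (fun k => ((hw.zm x (r := r * ρ) (by positivity)).zm 0 (r := ρ ^ k) (by positivity)).cls hA (by positivity)) h1 k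
    rw [zm_zm, smul_zero, add_zero] at this
    rwa [show ρ ^ k * (ρ * r) = r * ρ * ρ ^ k by ring]
  obtain ⟨d1, d2⟩ := hC w hw.lc x0 (r / 2) (ρ * r) ε0 (by positivity) h.e0 (fun x hx k => by
    obtain ⟨c, p, S, hS, _, h2⟩ := key x hx k
    exact ⟨c, p, S, hS, by rw [mul_comm ε0]; exact h2⟩)
  refine ⟨d1, fun x y hx hy hxy => (d2 x y hx hy hxy).trans (le_of_eq ?_)⟩
  rw [show ‖x - y‖ / (ρ * r) = ρ⁻¹ * (‖x - y‖ / r) by field_simp, Real.mul_rpow (by positivity) (by positivity)]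
  ring

end CMA

namespace CMA
open MeasureTheory Filter Topology
open scoped ComplexOrder Matrix
set_option maxSynthPendingDepth 3
variable {n : ℕ} {l K α ρ ε0 κ : ℝ}

/-- second difference -/
noncomputable def Dt (ξ : E n) (w : E n → ℝ) (x : E n) : ℝ := w (x + ξ) + w (x - ξ) - 2 * w x

theorem Dt_eq (ξ : E n) (w : E n → ℝ) : Dt ξ w = fun x => (w (ξ + (1:ℝ) • x) + w (-ξ + (1:ℝ) • x)) - 2 * w x := by
  funext x; simp [Dt, add_comm, sub_eq_add_neg]

theorem Dt_lc {w : E n → ℝ} (hw : LC w) (ξ : E n) : LC (Dt ξ w) := by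
  rw [Dt_eq]; exact ((hw.aff ξ 1).add (hw.aff (-ξ) 1)).sub (hw.smul 2)

theorem Dt_D2 {w : E n → ℝ} (hw : LC w) (ξ : E n) :
    ∀ᵐ x, D2 (Dt ξ w) x = (D2 w (ξ + (1:ℝ) • x) - D2 w x) + (D2 w (-ξ + (1:ℝ) • x) - D2 w x) := by
  have h1 := ae_aff hw.ae ξ (r := 1) one_ne_zero
  have h2 := ae_aff hw.ae (-ξ) (r := 1) one_ne_zero
  filter_upwards [h1, h2, hw.ae, (hw.aff ξ 1).ae, (hw.aff (-ξ) 1).ae, ((hw.aff ξ 1).add (hw.aff (-ξ) 1)).ae, (hw.smul 2).ae] with x a1 a2 a3 a4 a5 a6 a7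
  rw [Dt_eq, D2_sub ((hw.aff ξ 1).add (hw.aff (-ξ) 1)) (hw.smul 2) a6 a7, D2_add (hw.aff ξ 1) (hw.aff (-ξ) 1) a4 a5, D2_aff hw ξ 1 a1, D2_aff hw (-ξ) 1 a2, D2_smul 2 hw]
  simp only [one_pow, one_smul, two_smul]; abel

/-- concavity -/
theorem LB_conc (hl : 0 < l) {S T : Bil n} (hS : Ell l (hC S)) (hT : Ell l (hC T)) (hSK : ‖S‖ ≤ K) (hTK : ‖T‖ ≤ K) (h : dt S = dt T) :
    0 ≤ LB (hC T).adjugate (S - T) := by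
  obtain ⟨c, hc, h1⟩ := A1 n hl K
  have h2 := h1 _ _ hS hT (hC_norm_le hSK) (hC_norm_le hTK)
  have h3 : (hC S).det.re = (hC T).det.re := h
  rw [h3, sub_self, sub_zero] at h2
  have h4 : 0 ≤ c * nsq (hC S - hC T) := mul_nonneg hc.le (Finset.sum_nonneg fun i _ => Finset.sum_nonneg fun j _ => sq_nonneg _)
  have hd := hT.det_ge hl
  have hd0 : 0 < (hC T).det.re := lt_of_lt_of_le (by positivity) hd
  have hne : (hC T).det ≠ 0 := fun h0 => by rw [h0] at hd0; simp at hd0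
  have e : (hC T).adjugate = (hC T).det • (hC T)⁻¹ := by
    rw [Matrix.inv_def, smul_smul, Ring.inverse_eq_inv', mul_inv_cancel₀ hne, one_smul]
  unfold LB
  rw [e, hC_sub, Matrix.smul_mul, Matrix.trace_smul, herm_det_real hT.1, smul_eq_mul, Complex.re_ofReal_mul]
  exact mul_nonneg hd0.le (h4.trans h2)

theorem Dt_sub {𝒞 : Set (Bil n)} {F0 : ℝ} {w : E n → ℝ} (hl : 0 < l) (hA : Adm l K 𝒞) (hw : Ent 𝒞 F0 w) (ξ : E n) :
    ∀ᵐ x, 0 ≤ LU w (Dt ξ w) x := by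
  have g := hw.mem.and hw.det
  filter_upwards [Dt_D2 hw.lc ξ, g, ae_aff g ξ (r := 1) one_ne_zero, ae_aff g (-ξ) (r := 1) one_ne_zero] with x h1 h2 h3 h4
  unfold LU
  rw [h1, LB_add]
  exact add_nonneg (LB_conc hl (hA.ell _ h3.1) (hA.ell _ h2.1) (hA.bd _ h3.1) (hA.bd _ h2.1) (h3.2.trans h2.2.symm))
    (LB_conc hl (hA.ell _ h4.1) (hA.ell _ h2.1) (hA.bd _ h4.1) (hA.bd _ h2.1) (h4.2.trans h2.2.symm))

theorem Dt_zm (ξ x : E n) (t s : ℝ) (w : E n → ℝ) : Dt (t • ξ) (zm x s w) 0 = (s ^ 2)⁻¹ * Dt ((s * t) • ξ) w x := by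
  simp only [Dt, zm, zero_add, zero_sub, smul_zero, add_zero, smul_neg, smul_smul, ← sub_eq_add_neg]; ring

theorem qd_sub_D2 {w : E n → ℝ} (hw : LC w) (c : ℝ) (p : E n →L[ℝ] ℝ) {S : Bil n} (hS : ∀ v w, S v w = S w v) {x : E n} (hx : DifferentiableAt ℝ (fderiv ℝ w) x) :
    D2 (fun z => w z - qd c p S z) x = D2 w x - S := by
  rw [D2_sub hw (qd_lc _ _ _) hx (by rw [qd_fderiv _ _ hS]; fun_prop), qd_D2 _ _ hS]

theorem Dt_near {w : E n → ℝ} (hw : LC w) {S : Bil n} (hS : ∀ v w, S v w = S w v) {x ξ : E n} {R η : ℝ} (hη : 0 ≤ η)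
    (h : ∀ᵐ y, ‖y - x‖ < R → ‖D2 w y - S‖ ≤ η) (hξ : ‖ξ‖ < R) : |Dt ξ w x - S ξ ξ| ≤ 2 * η * ‖ξ‖ ^ 2 := by
  have hb : ∀ᵐ y, ‖y - x‖ < R → ‖D2 (fun z => w z - qd 0 0 S z) y‖ ≤ η := by
    filter_upwards [hw.ae, h] with y h1 h2
    rw [qd_sub_D2 hw 0 0 hS h1]; exact h2
  have hu := hw.sub (qd_lc 0 0 S)
  have hR : 0 < R := lt_of_le_of_lt (norm_nonneg _) hξ
  have a1 := taylor2 hu hη hb (x := x) (y := x + ξ) (by simpa using hR) (by simpa using hξ)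
  have a2 := taylor2 hu hη hb (x := x) (y := x - ξ) (by simpa using hR) (by simpa using hξ)
  rw [add_sub_cancel_left] at a1
  rw [sub_sub_cancel_left, norm_neg, map_neg] at a2
  have e : Dt ξ w x - S ξ ξ = ((w (x + ξ) - qd 0 0 S (x + ξ)) - (w x - qd 0 0 S x) - fderiv ℝ (fun z => w z - qd 0 0 S z) x ξ)
    + ((w (x - ξ) - qd 0 0 S (x - ξ)) - (w x - qd 0 0 S x) - - fderiv ℝ (fun z => w z - qd 0 0 S z) x ξ) := by
    simp [Dt, qd]; have := hS x ξ; linarith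
  rw [e]
  refine (abs_add_le _ _).trans ?_
  linarith

theorem const_quad {w : E n → ℝ} (hw : LC w) {S : Bil n} (hS : ∀ v w, S v w = S w v) (h : ∀ᵐ y, D2 w y = S) :
    w = qd (w 0) (fderiv ℝ w 0) S := by
  funext x
  have hb : ∀ᵐ y, ‖y - 0‖ < ‖x‖ + 1 → ‖D2 (fun z => w z - qd 0 0 S z) y‖ ≤ 0 := by
    filter_upwards [hw.ae, h] with y h1 h2 _
    rw [qd_sub_D2 hw 0 0 hS h1, h2, sub_self, norm_zero]
  have a1 := taylor2 (hw.sub (qd_lc 0 0 S)) le_rfl hb (x := 0) (y := x) (by rw [sub_self, norm_zero]; positivity) (by simp)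
  have e4 : fderiv ℝ (fun z => w z - qd 0 0 S z) 0 = fderiv ℝ w 0 := by
    have := fderiv_sub (hw.diff 0) ((qd_lc 0 0 S).diff 0)
    rw [qd_fderiv _ _ hS] at this
    simp only [zero_add, map_zero, sub_zero] at this
    exact this
  rw [e4, zero_mul, sub_zero] at a1
  have := abs_nonpos_iff.1 a1
  simp [qd] at this ⊢; linarith

theorem Ent.ex {𝒞 : Set (Bil n)} {F0 : ℝ} {w : E n → ℝ} (hw : Ent 𝒞 F0 w) : ∃ x, DifferentiableAt ℝ (fderiv ℝ w) x ∧ D2 w x ∈ 𝒞 ∧ dt (D2 w x) = F0 :=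
  (hw.lc.ae.and (hw.mem.and hw.det)).exists

/-- flat at arbitrarily large scales implies quadratic -/
theorem large_quad (h : FC n l K α ρ ε0 κ) {𝒞 : Set (Bil n)} {F0 : ℝ} {w : E n → ℝ} (hA : Adm l K 𝒞) (hw : Ent 𝒞 F0 w) (x0 : E n)
    (hf : ∀ R : ℝ, ∃ r, R ≤ r ∧ 0 < r ∧ Fl F0 κ (ε0 / Rc n ρ) (zm x0 r w)) :
    ∃ c p, ∃ S : Bil n, (∀ v w, S v w = S w v) ∧ dt S = F0 ∧ w = qd c p S := by
  obtain ⟨C, hC0, hC⟩ := FlatReg h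
  have hρ := h.r0
  obtain ⟨x1, _, _, hx1⟩ := hw.ex
  refine ⟨_, _, D2 w x1, D2_symm' hw.lc.diff x1, hx1, const_quad hw.lc (D2_symm' hw.lc.diff x1) (Eventually.of_forall fun y => ?_)⟩
  rw [← sub_eq_zero, ← norm_le_zero_iff]
  have hlim : Tendsto (fun r : ℝ => C * (‖y - x1‖ / r) ^ α) atTop (𝓝 0) := by
    have : Tendsto (fun r : ℝ => (‖y - x1‖ / r) ^ α) atTop (𝓝 (0 ^ α)) :=
      (tendsto_const_nhds.div_atTop tendsto_id).rpow_const (Or.inr h.a0.le)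
    rw [Real.zero_rpow h.a0.ne'] at this
    simpa using this.const_mul C
  refine le_of_forall_pos_le_add fun η hη => ?_
  obtain ⟨R0, hR0⟩ := Filter.eventually_atTop.1 (hlim.eventually (gt_mem_nhds hη))
  obtain ⟨r, hr, hr0, hfl⟩ := hf (max R0 (max (2 * (‖y - x1‖ / ρ)) (2 * ‖y - x0‖ + 2 * ‖x1 - x0‖ + 1)))
  have h1 : R0 ≤ r := (le_max_left _ _).trans hr
  have h2 : 2 * (‖y - x1‖ / ρ) ≤ r := ((le_max_left _ _).trans (le_max_right _ _)).trans hr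
  have h3 : 2 * ‖y - x0‖ + 2 * ‖x1 - x0‖ + 1 ≤ r := ((le_max_right _ _).trans (le_max_right _ _)).trans hr
  have := (hC 𝒞 F0 w hA hw x0 r hr0 hfl).2 y x1 (by linarith [norm_nonneg (x1 - x0)]) (by linarith [norm_nonneg (y - x0)]) (by
    rw [← mul_div_assoc, div_le_iff₀ hρ] at h2; linarith)
  linarith [hR0 r h1]

/-- strict flatness -/
def SFl (F0 κ ε : ℝ) (u : E n → ℝ) : Prop :=
  ∃ c p, ∃ S : Bil n, (∀ v w, S v w = S w v) ∧ |dt S - F0| ≤ κ * ε ∧ L2 (fun x => u x - qd c p S x) < ε ^ 2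

theorem SFl.fl {F0 κ ε : ℝ} {u : E n → ℝ} (h : SFl F0 κ ε u) : Fl F0 κ ε u := by
  obtain ⟨c, p, S, hS, h1, h2⟩ := h
  exact ⟨c, p, S, hS, h1, h2.le⟩

theorem SFl_qd {F0 κ ε : ℝ} (hκ : 0 < κ) (hε : 0 < ε) {c : ℝ} {p : E n →L[ℝ] ℝ} {S : Bil n} (hS : ∀ v w, S v w = S w v) (hd : dt S = F0) : SFl F0 κ ε (qd c p S) := by
  refine ⟨c, p, S, hS, by rw [hd, sub_self, abs_zero]; positivity, ?_⟩
  simp only [sub_self, L2]; simp; positivity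

theorem SFl_add {F0 κ ε : ℝ} {u : E n → ℝ} (c0 : ℝ) (p0 : E n →L[ℝ] ℝ) (h : SFl F0 κ ε u) : SFl F0 κ ε (fun x => u x - qd c0 p0 0 x) := by
  obtain ⟨c, p, S, hS, h1, h2⟩ := h
  refine ⟨c - c0, p - p0, S, hS, h1, lt_of_eq_of_lt ?_ h2⟩
  congr 1; funext x; simp [qd]; ring

theorem L2_smul (c : ℝ) (v : E n → ℝ) : L2 (fun x => c * v x) = c ^ 2 * L2 v := by
  unfold L2; simp only [mul_pow]; rw [integral_const_mul]

theorem SFl_near {F0 κ ε : ℝ} {u : E n → ℝ} (hu : Continuous u) (h : SFl F0 κ ε u) :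
    ∃ η, 0 < η ∧ ∀ v : E n → ℝ, Continuous v → (∀ z, ‖z‖ < 1 → |v z - u z| ≤ η) → SFl F0 κ ε v := by
  obtain ⟨c, p, S, hS, h1, h2⟩ := h
  have hcont : Continuous fun x => u x - qd c p S x := hu.sub (qd_lc c p S).cont
  obtain ⟨M, hM⟩ := (isCompact_closedBall (0 : E n) 1).exists_bound_of_continuousOn hcont.continuousOn
  have hM0 : 0 ≤ M := (norm_nonneg _).trans (hM 0 (by simp))
  have hV := V1_nonneg (n := n)
  obtain ⟨η, hη, hη1, hη2⟩ := small_ex (V1 n * (2 * M + 1)) (c := (ε ^ 2 - L2 (fun x => u x - qd c p S x)) / 2) (b := 1) (by linarith) one_pos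
  refine ⟨η, hη, fun v hv hvu => ⟨c, p, S, hS, h1, ?_⟩⟩
  have := L2_le_of (v := fun x => v x - qd c p S x) (B := (2 * M + 1) * η) (hv.sub (qd_lc c p S).cont) hcont (fun z hz => by
    have a1 := hvu z hz
    have a2 := hM z (by simpa using hz.le)
    rw [Real.norm_eq_abs] at a2
    have e : v z - qd c p S z = (u z - qd c p S z) + (v z - u z) := by ring
    have b1 : (u z - qd c p S z) * (v z - u z) ≤ M * η := by
      refine (le_abs_self _).trans ?_
      rw [abs_mul]; gcongr
    have b2 : (v z - u z) ^ 2 ≤ η := by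
      rw [← sq_abs]
      calc |v z - u z| ^ 2 ≤ η ^ 2 := by gcongr
        _ ≤ η := by nlinarith
    rw [e]; nlinarith)
  have e : V1 n * ((2 * M + 1) * η) = V1 n * (2 * M + 1) * η := by ring
  linarith

theorem Fl_near2 {F0 κ ε : ℝ} {u v : E n → ℝ} (hκ : 0 < κ) (hε : 0 < ε) (hu : Continuous u) (hv : Continuous v) (h : Fl F0 κ ε u) {η : ℝ} (hη : V1 n * η ^ 2 ≤ ε ^ 2)
    (hvu : ∀ z, ‖z‖ < 1 → |v z - u z| ≤ η) : Fl F0 κ (2 * ε) v := by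
  obtain ⟨c, p, S, hS, h1, h2⟩ := h
  refine ⟨c, p, S, hS, h1.trans (by nlinarith [mul_pos hκ hε]), ?_⟩
  have hcont : Continuous fun x => u x - qd c p S x := hu.sub (qd_lc c p S).cont
  have := L2_le_of (v := fun x => v x - qd c p S x) (A := fun x => Real.sqrt 2 * (u x - qd c p S x)) (B := 2 * η ^ 2) (hv.sub (qd_lc c p S).cont) (hcont.const_mul _) (fun z hz => by
    have a1 := hvu z hz
    have e : v z - qd c p S z = (u z - qd c p S z) + (v z - u z) := by ring
    have b2 : (v z - u z) ^ 2 ≤ η ^ 2 := by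
      rw [← sq_abs]; gcongr
    rw [e, mul_pow, Real.sq_sqrt (by norm_num)]; nlinarith [sq_nonneg ((u z - qd c p S z) - (v z - u z))])
  rw [L2_smul, Real.sq_sqrt (by norm_num)] at this
  nlinarith

/-- affine normalization -/
noncomputable def nrm (w : E n → ℝ) (x : E n) : ℝ := w x - qd (w 0) (fderiv ℝ w 0) 0 x

theorem zero_sym : ∀ v w : E n, (0 : Bil n) v w = (0 : Bil n) w v := by simp

theorem nrm_lc {w : E n → ℝ} (hw : LC w) : LC (nrm w) := hw.sub (qd_lc _ _ _)

theorem nrm_D2 {w : E n → ℝ} (hw : LC w) {x : E n} (hx : DifferentiableAt ℝ (fderiv ℝ w) x) : D2 (nrm w) x = D2 w x := by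
  have := qd_sub_D2 hw (w 0) (fderiv ℝ w 0) zero_sym hx
  rw [sub_zero] at this; exact this

theorem nrm_zero (w : E n → ℝ) : nrm w 0 = 0 := by simp [nrm, qd]

theorem nrm_fderiv {w : E n → ℝ} (hw : LC w) : fderiv ℝ (nrm w) 0 = 0 := by
  have := fderiv_sub (hw.diff 0) ((qd_lc (w 0) (fderiv ℝ w 0) 0).diff 0)
  rw [qd_fderiv _ _ zero_sym] at this
  simp only [map_zero, add_zero, sub_self] at this
  exact this

theorem nrm_Dt (w : E n → ℝ) (ξ x : E n) : Dt ξ (nrm w) x = Dt ξ w x := by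
  simp [Dt, nrm, qd]; ring

theorem nrm_zm (w : E n → ℝ) {r : ℝ} (hr : r ≠ 0) : zm 0 r (nrm w) = fun x => zm 0 r w x - qd ((r ^ 2)⁻¹ * w 0) (r⁻¹ • fderiv ℝ w 0) 0 x := by
  funext x
  unfold nrm
  rw [zm_sub, zm_qd _ _ _ hr]

/-- the class of entire solutions that are nowhere flat at large scales -/
structure SP (𝒞 : Set (Bil n)) (F0 κ ε : ℝ) (w : E n → ℝ) : Prop where
  ent : Ent 𝒞 F0 w
  nf : ∀ r, 1 ≤ r → ¬ SFl F0 κ ε (zm 0 r w)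

theorem SFl_of_nrm {F0 κ ε : ℝ} {w : E n → ℝ} {r : ℝ} (hr : r ≠ 0) (h : SFl F0 κ ε (zm 0 r (nrm w))) : SFl F0 κ ε (zm 0 r w) := by
  rw [nrm_zm w hr] at h
  have := SFl_add (-((r ^ 2)⁻¹ * w 0)) (-(r⁻¹ • fderiv ℝ w 0)) h
  refine cast (congrArg _ ?_) this
  funext x; simp [qd]; ring

theorem Ent.nrm {𝒞 : Set (Bil n)} {F0 : ℝ} {w : E n → ℝ} (h : Ent 𝒞 F0 w) : Ent 𝒞 F0 (nrm w) where
  lc := nrm_lc h.lc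
  mem := by filter_upwards [h.mem, h.lc.ae] with x h1 h2; rw [nrm_D2 h.lc h2]; exact h1
  det := by filter_upwards [h.det, h.lc.ae] with x h1 h2; rw [nrm_D2 h.lc h2]; exact h1

theorem zm_near {u v : E n → ℝ} {r η : ℝ} (hr : 0 < r) (h : ∀ x, ‖x‖ ≤ r → |u x - v x| ≤ r ^ 2 * η) (z : E n) (hz : ‖z‖ < 1) :
    |zm 0 r u z - zm 0 r v z| ≤ η := by
  rw [zm, zm, ← mul_sub, abs_mul, abs_of_pos (by positivity), inv_mul_le_iff₀ (by positivity)]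
  refine h _ ?_
  rw [zero_add, norm_smul, Real.norm_of_nonneg hr.le]; nlinarith

theorem SP_lim {𝒞 : Set (Bil n)} {F0 ε : ℝ} (hK : 0 ≤ K) (hA : Adm l K 𝒞) {w : ℕ → E n → ℝ} (hw : ∀ k, SP 𝒞 F0 κ ε (w k)) :
    ∃ v, SP 𝒞 F0 κ ε v ∧ ∀ r η : ℝ, 0 < η → ∀ᶠ k in (hyperfilter ℕ : Filter ℕ), ∀ x, ‖x‖ ≤ r → |nrm (w k) x - v x| ≤ η := by
  obtain ⟨v, h1, _, _, h2, h3, h4⟩ := compactness hA.conv hA.cl hK hA.bd (u := fun k => nrm (w k)) (fun k => (hw k).ent.nrm.lc)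
    (fun k => nrm_zero _) (fun k => nrm_fderiv (hw k).ent.lc) (R := fun k : ℕ => (k : ℝ)) (δ := fun _ => 0) tendsto_natCast_atTop_atTop
    tendsto_const_nhds (F0 := F0) (fun k => by filter_upwards [(hw k).ent.nrm.mem] with x hx _ using hx)
    (fun k => by filter_upwards [(hw k).ent.nrm.det] with x hx _; rw [hx]; simp)
  refine ⟨v, ⟨⟨h1, h2, h3⟩, fun r hr hs => ?_⟩, h4⟩
  have hr0 : 0 < r := by linarith
  obtain ⟨η, hη, hn⟩ := SFl_near (zm_lc h1 0 r).cont hs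
  obtain ⟨k, hk⟩ := (h4 r (r ^ 2 * η) (by positivity)).exists
  exact (hw k).nf r hr (SFl_of_nrm hr0.ne' (hn _ (zm_lc (hw k).ent.nrm.lc 0 r).cont (zm_near hr0 hk)))

theorem SP_zoom {𝒞 : Set (Bil n)} {F0 ε : ℝ} {w : E n → ℝ} (hw : SP 𝒞 F0 κ ε w) (x : E n) {s : ℝ} (hs : 0 < s)
    (h : ∀ r, s ≤ r → ¬ SFl F0 κ ε (zm x r w)) : SP 𝒞 F0 κ ε (zm x s w) := by
  refine ⟨hw.ent.zm x hs.ne', fun r hr => ?_⟩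
  rw [zm_zm, smul_zero, add_zero]
  exact h _ (by nlinarith)

theorem s0_ex (h : FC n l K α ρ ε0 κ) {𝒞 : Set (Bil n)} {F0 ε : ℝ} (hε : 0 < ε) (hε0 : ε ≤ ε0 / Rc n ρ) {w : E n → ℝ} (hA : Adm l K 𝒞) (hw : SP 𝒞 F0 κ ε w) (x : E n) :
    ∃ s0, 0 < s0 ∧ ∀ r, s0 ≤ r → ¬ SFl F0 κ ε (zm x r w) := by
  by_contra hcon
  push Not at hcon
  obtain ⟨c, p, S, hS, hd, rfl⟩ := large_quad h hA hw.ent x (fun R => by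
    obtain ⟨r, hr, hf⟩ := hcon (max R 1) (by positivity)
    exact ⟨r, (le_max_left _ _).trans hr, lt_of_lt_of_le (by positivity) hr, Fl_mono h.k0 hε hε0 hf.fl⟩)
  have := hw.nf 1 le_rfl
  rw [zm_one] at this
  exact this (SFl_qd h.k0 hε hS hd)

theorem Dt_bd {𝒞 : Set (Bil n)} {F0 : ℝ} {w : E n → ℝ} (hK : 0 ≤ K) (hA : Adm l K 𝒞) (hw : Ent 𝒞 F0 w) (ξ x : E n) : |Dt ξ w x| ≤ 2 * K * ‖ξ‖ ^ 2 := by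
  have := Dt_near hw.lc (S := 0) zero_sym (x := x) (ξ := ξ) (R := ‖ξ‖ + 1) hK (by
    filter_upwards [hw.mem] with y hy _; rw [sub_zero]; exact hA.bd _ hy) (by linarith)
  simpa using this

theorem sup_ex (h : FC n l K α ρ ε0 κ) {𝒞 : Set (Bil n)} {F0 ε : ℝ} (hε : 0 < ε) (hε0 : ε ≤ ε0 / Rc n ρ) (hA : Adm l K 𝒞)
    (hne : ∃ w, SP 𝒞 F0 κ ε w) (ξ : E n) :
    ∃ M : ℝ, (∀ w, SP 𝒞 F0 κ ε w → ∀ x t, 0 < t → Dt (t • ξ) w x ≤ M * t ^ 2) ∧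
      ∀ η, 0 < η → ∃ w t, SP 𝒞 F0 κ ε w ∧ 0 < t ∧ t ≤ 1 ∧ (M - η) * t ^ 2 ≤ Dt (t • ξ) w 0 ∧
        (t = 1 ∨ ∃ r, 1/4 ≤ r ∧ r ≤ 1/2 ∧ SFl F0 κ ε (zm 0 r w)) := by
  set Q : Set ℝ := {q | ∃ w t, SP 𝒞 F0 κ ε w ∧ 0 < t ∧ t ≤ 1 ∧ q = Dt (t • ξ) w 0 / t ^ 2} with hQ
  have hQb : BddAbove Q := by
    refine ⟨2 * K * ‖ξ‖ ^ 2, ?_⟩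
    rintro _ ⟨w, t, hw, ht, _, rfl⟩
    rw [div_le_iff₀ (by positivity)]
    refine (le_abs_self _).trans ((Dt_bd h.K0 hA hw.ent _ _).trans (le_of_eq ?_))
    rw [norm_smul, Real.norm_of_nonneg ht.le]; ring
  have hQn : Q.Nonempty := by
    obtain ⟨w, hw⟩ := hne
    exact ⟨_, w, 1, hw, one_pos, le_rfl, rfl⟩
  have hz : ∀ (w : E n → ℝ) (x : E n) (s t : ℝ), 0 < s → 0 < t → Dt ((t / s) • ξ) (zm x s w) 0 / (t / s) ^ 2 = Dt (t • ξ) w x / t ^ 2 := by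
    intro w x s t hs ht
    rw [Dt_zm, mul_div_cancel₀ _ hs.ne']; field_simp
  refine ⟨sSup Q, fun w hw x t ht => ?_, fun η hη => ?_⟩
  · obtain ⟨s0, hs0, hs⟩ := s0_ex h hε hε0 hA hw x
    have hm : 0 < max t s0 := lt_max_of_lt_left ht
    have := le_csSup hQb ⟨_, t / max t s0, SP_zoom hw x hm (fun r hr => hs r ((le_max_right _ _).trans hr)), by positivity,
      (div_le_one hm).2 (le_max_left _ _), rfl⟩
    rw [hz w x _ t hm ht, div_le_iff₀ (by positivity)] at this
    exact this
  · obtain ⟨q, ⟨w, t, hw, ht, ht1, rfl⟩, hq⟩ := exists_lt_of_lt_csSup hQn (show sSup Q - η < sSup Q by linarith)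
    by_cases hcase : ∀ r, t ≤ r → ¬ SFl F0 κ ε (zm 0 r w)
    · refine ⟨_, 1, SP_zoom hw 0 ht hcase, one_pos, le_rfl, ?_, Or.inl rfl⟩
      have := hz w 0 t t ht ht
      rw [div_self ht.ne', one_pow, div_one] at this
      rw [this]; linarith
    push Not at hcase
    obtain ⟨r0, hr0, hf0⟩ := hcase
    set F : Set ℝ := {r | 0 < r ∧ SFl F0 κ ε (zm 0 r w)} with hF
    have hFb : BddAbove F := ⟨1, fun r hr => by by_contra hc; exact hw.nf r (by linarith) hr.2⟩
    have hr0F : r0 ∈ F := ⟨by linarith, hf0⟩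
    set σ := sSup F with hσ
    have hσr : r0 ≤ σ := le_csSup hFb hr0F
    have hσ0 : 0 < σ := by linarith
    obtain ⟨r1, hr1, hr2⟩ := exists_lt_of_lt_csSup ⟨r0, hr0F⟩ (show σ / 2 < σ by linarith)
    have hr3 : r1 ≤ σ := le_csSup hFb hr1
    refine ⟨_, t / (2 * σ), SP_zoom hw 0 (s := 2 * σ) (by positivity) (fun r hr hc => ?_), by positivity, (div_le_one (by positivity)).2 (by linarith), ?_, Or.inr ⟨r1 / (2 * σ), ?_, ?_, ?_⟩⟩
    · have : r ≤ σ := le_csSup hFb ⟨by linarith, hc⟩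
      linarith
    · rw [← le_div_iff₀ (by positivity), hz w 0 _ t (by positivity) ht]; linarith
    · rw [le_div_iff₀ (by positivity)]; linarith
    · rw [div_le_iff₀ (by positivity)]; linarith
    · rw [zm_zm, smul_zero, add_zero, mul_div_cancel₀ _ (by positivity)]; exact hr1.2

theorem peano {u : E n → ℝ} (hu : LC u) {y : E n} (hy : DifferentiableAt ℝ (fderiv ℝ u) y) {e : ℝ} (he0 : 0 < e) :
    ∃ δ, 0 < δ ∧ ∀ h : E n, ‖h‖ < δ → |u (y + h) - qd (u y) (fderiv ℝ u y) (D2 u y) h| ≤ e * ‖h‖ ^ 2 := by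
  have hS : ∀ v w, D2 u y v w = D2 u y w v := D2_symm' hu.diff y
  have h1 := hy.hasFDerivAt.isLittleO.def he0
  obtain ⟨δ, hδ, h1⟩ := Metric.eventually_nhds_iff.1 h1
  refine ⟨δ, hδ, fun h hh => ?_⟩
  set f : E n → ℝ := fun x => u (y + x) - qd (u y) (fderiv ℝ u y) (D2 u y) x with hf
  have hfd : ∀ x ∈ Metric.closedBall (0 : E n) ‖h‖, HasFDerivWithinAt f (fderiv ℝ u (y + x) - (fderiv ℝ u y + D2 u y x)) (Metric.closedBall (0 : E n) ‖h‖) x := by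
    intro x _
    have a1 : HasFDerivAt (fun x => u (y + x)) (fderiv ℝ u (y + x)) x := by
      have := ((hu.diff (y + x)).hasFDerivAt).comp x ((hasFDerivAt_id x).const_add y)
      simpa [Function.comp_def] using this
    have a2 := ((qd_lc (u y) (fderiv ℝ u y) (D2 u y)).diff x).hasFDerivAt
    rw [qd_fderiv _ _ hS] at a2
    exact (a1.sub a2).hasFDerivWithinAt
  have hb : ∀ x ∈ Metric.closedBall (0 : E n) ‖h‖, ‖fderiv ℝ u (y + x) - (fderiv ℝ u y + D2 u y x)‖ ≤ e * ‖h‖ := by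
    intro x hx
    have hx' : ‖x‖ ≤ ‖h‖ := by simpa using hx
    have := h1 (y := y + x) (by rw [dist_eq_norm, add_sub_cancel_left]; linarith)
    rw [add_sub_cancel_left] at this
    have e1 : fderiv ℝ u (y + x) - (fderiv ℝ u y + D2 u y x) = fderiv ℝ u (y + x) - fderiv ℝ u y - fderiv ℝ (fderiv ℝ u) y x := by
      rw [sub_sub]; rfl
    rw [e1]
    exact this.trans (by gcongr)
  have := (convex_closedBall (0 : E n) ‖h‖).norm_image_sub_le_of_norm_hasFDerivWithin_le hfd hb (Metric.mem_closedBall_self (norm_nonneg _)) (y := h) (by simp)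
  have hf0 : f 0 = 0 := by simp [hf, qd]
  rw [hf0, sub_zero, sub_zero, Real.norm_eq_abs] at this
  linarith [show e * ‖h‖ * ‖h‖ = e * ‖h‖ ^ 2 by ring]

theorem Dt_half (ξ : E n) (w : E n → ℝ) (t : ℝ) (x : E n) : Dt (t • ξ) w x =
    Dt ((t / 2) • ξ) w (x + (t / 2) • ξ) + 2 * Dt ((t / 2) • ξ) w x + Dt ((t / 2) • ξ) w (x - (t / 2) • ξ) := by
  have e : t • ξ = (t / 2) • ξ + (t / 2) • ξ := by rw [← add_smul]; congr 1; ring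
  rw [e]
  simp only [Dt, ← add_assoc, sub_add_eq_sub_sub, sub_add_cancel, add_sub_cancel_right]; ring

/-- supersolution property of `m - c * Dt` -/
theorem Dt_super {𝒞 : Set (Bil n)} {F0 : ℝ} {w : E n → ℝ} (hl : 0 < l) (hA : Adm l K 𝒞) (hw : Ent 𝒞 F0 w) (ξ : E n) (m : ℝ) {c : ℝ} (hc : 0 ≤ c) :
    LC (fun x => m - c * Dt ξ w x) ∧ ∀ᵐ x, LU w (fun x => m - c * Dt ξ w x) x ≤ 0 := by
  have h1 := (Dt_lc hw.lc ξ).smul c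
  refine ⟨(LC.const m).sub h1, ?_⟩
  filter_upwards [Dt_sub hl hA hw ξ, h1.ae, (LC.const (n := n) m).ae] with x a1 a2 a3
  rw [LU_sub (LC.const m) h1 a3 a2, LU_const, LU_smul c (Dt_lc hw.lc ξ)]
  have := mul_nonneg hc a1
  linarith

theorem Ent_smp {𝒞 : Set (Bil n)} {F0 : ℝ} {w : E n → ℝ} (hl : 0 < l) (hK : 0 ≤ K) (hA : Adm l K 𝒞) (hw : Ent 𝒞 F0 w) {v : E n → ℝ} {r : ℝ} (hvc : ContinuousOn v (Metric.ball 0 r))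
    (hv0 : ∀ x, ‖x‖ < r → 0 ≤ v x)
    (happ : ∀ δ > 0, ∃ v' : E n → ℝ, LC v' ∧ (∀ x, ‖x‖ < r → |v' x - v x| ≤ δ) ∧ ∀ᵐ x, ‖x‖ < r → LU w v' x ≤ 0)
    (h0 : v 0 = 0) : ∀ y, (n + 1) * ‖y‖ < r → v y = 0 :=
  smp hw.lc hl hK (by filter_upwards [hw.mem] with x hx using hA.ell _ hx) (by filter_upwards [hw.mem] with x hx using hA.bd _ hx) hvc hv0 happ h0

theorem caseA (hl : 0 < l) (hK : 0 ≤ K) {𝒞 : Set (Bil n)} {F0 : ℝ} {w : E n → ℝ} (hA : Adm l K 𝒞) (hw : Ent 𝒞 F0 w) {ξ : E n} {M : ℝ}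
    (hM : ∀ x t, 0 < t → Dt (t • ξ) w x ≤ M * t ^ 2) {t : ℝ} (ht : 0 < t) (h0 : Dt (t • ξ) w 0 = M * t ^ 2) :
    ∀ᵐ x, D2 w x ξ ξ = M := by
  have h1 : ∀ x, Dt (t • ξ) w x = M * t ^ 2 := by
    intro x
    obtain ⟨s1, s2⟩ := Dt_super hl hA hw (t • ξ) (M * t ^ 2) (c := 1) zero_le_one
    have := Ent_smp hl hK hA hw (v := fun x => M * t ^ 2 - 1 * Dt (t • ξ) w x) (r := (n + 1) * ‖x‖ + 1) s1.cont.continuousOn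
      (fun y _ => by linarith [hM y t ht]) (fun δ hδ => ⟨_, s1, fun y _ => by simp [hδ.le], by filter_upwards [s2] with y hy _ using hy⟩)
      (by simp [h0]) x (by linarith)
    linarith
  have h2 : ∀ j : ℕ, ∀ x, Dt ((t / 2 ^ j) • ξ) w x = M * (t / 2 ^ j) ^ 2 := by
    intro j
    induction j with
    | zero => simpa using h1
    | succ j ih =>
      intro x
      have e : t / 2 ^ (j + 1) = t / 2 ^ j / 2 := by rw [pow_succ]; field_simp
      have hp : 0 < t / 2 ^ j / 2 := by positivity
      have a0 := ih x
      rw [Dt_half] at a0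
      have a1 := hM (x + (t / 2 ^ j / 2) • ξ) _ hp
      have a2 := hM (x - (t / 2 ^ j / 2) • ξ) _ hp
      have a3 := hM x _ hp
      rw [e]
      nlinarith
  have ht0 : Tendsto (fun j : ℕ => t / 2 ^ j) atTop (𝓝 0) := by
    have := (tendsto_pow_atTop_nhds_zero_of_lt_one (r := (1/2 : ℝ)) (by norm_num) (by norm_num)).const_mul t
    simpa [div_eq_mul_inv] using this
  filter_upwards [hw.lc.ae] with x hx
  have : |D2 w x ξ ξ - M| ≤ 0 := by
    refine le_of_forall_pos_le_add fun η hη => ?_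
    set e := η / (2 * (‖ξ‖ ^ 2 + 1)) with he
    obtain ⟨δ, hδ, hp⟩ := peano hw.lc hx (e := e) (by positivity)
    have ht1 : Tendsto (fun j : ℕ => t / 2 ^ j * ‖ξ‖) atTop (𝓝 0) := by simpa using ht0.mul_const ‖ξ‖
    obtain ⟨j, hj⟩ := (ht1.eventually (gt_mem_nhds hδ)).exists
    set s := t / 2 ^ j with hs
    have hs0 : 0 < s := by positivity
    have hn : ‖s • ξ‖ = s * ‖ξ‖ := by rw [norm_smul, Real.norm_of_nonneg hs0.le]
    have b1 := hp (s • ξ) (by rw [hn]; exact hj)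
    have b2 := hp (-(s • ξ)) (by rw [norm_neg, hn]; exact hj)
    have b3 := h2 j x
    rw [norm_neg] at b2
    rw [hn] at b1 b2
    have e1 : s ^ 2 * (D2 w x ξ ξ - M) = - ((w (x + s • ξ) - qd (w x) (fderiv ℝ w x) (D2 w x) (s • ξ)) + (w (x + -(s • ξ)) - qd (w x) (fderiv ℝ w x) (D2 w x) (-(s • ξ)))) := by
      simp only [Dt, sub_eq_add_neg] at b3
      simp only [qd, map_neg, map_smul, ContinuousLinearMap.neg_apply, ContinuousLinearMap.smul_apply, smul_eq_mul]
      nlinarith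
    have e2 : s ^ 2 * |D2 w x ξ ξ - M| ≤ s ^ 2 * η := by
      rw [← abs_of_pos (show 0 < s ^ 2 by positivity), ← abs_mul, e1, abs_neg, abs_of_pos (show 0 < s ^ 2 by positivity)]
      refine (abs_add_le _ _).trans ((add_le_add b1 b2).trans ?_)
      have : 2 * e * (‖ξ‖ ^ 2 + 1) = η := by rw [he]; field_simp
      have he0 : 0 < e := by positivity
      nlinarith [sq_nonneg s, mul_nonneg he0.le (sq_nonneg s)]
    rw [zero_add]
    exact le_of_mul_le_mul_left e2 (by positivity)
  exact sub_eq_zero.1 (abs_nonpos_iff.1 this)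

theorem flat_hol (h : FC n l K α ρ ε0 κ) : ∃ C R : ℝ, 0 < C ∧ 0 < R ∧ ∀ (𝒞 : Set (Bil n)) (F0 : ℝ) (w : E n → ℝ), Adm l K 𝒞 → Ent 𝒞 F0 w → ∀ r : ℝ, 1/4 ≤ r → r ≤ 1/2 →
    Fl F0 κ (ε0 / Rc n ρ) (zm 0 r w) → ∀ x y, ‖x‖ < R → ‖y‖ < R → ‖D2 w x - D2 w y‖ ≤ C * ‖x - y‖ ^ α := by
  obtain ⟨C, hC, H⟩ := FlatReg h
  refine ⟨C * 4 ^ α, ρ / 16, by positivity, by linarith [h.r0], fun 𝒞 F0 w hA hw r hr hr2 hf x y hx hy => ?_⟩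
  have r0 := h.r0
  have r2 := h.r2
  have hxy : ‖x - y‖ ≤ ρ * r / 2 := (norm_sub_le _ _).trans (by nlinarith)
  refine ((H 𝒞 F0 w hA hw 0 r (by linarith) hf).2 x y (by rw [sub_zero]; linarith) (by rw [sub_zero]; linarith) hxy).trans ?_
  rw [mul_assoc, ← Real.mul_rpow (by norm_num) (norm_nonneg _)]
  refine mul_le_mul_of_nonneg_left (Real.rpow_le_rpow (by positivity) ?_ h.a0.le) hC.le
  rw [div_le_iff₀ (by linarith)]
  nlinarith [norm_nonneg (x - y)]

theorem flat_Dt (h : FC n l K α ρ ε0 κ) (ξ : E n) : ∃ C R T : ℝ, 0 < C ∧ 0 < R ∧ 0 < T ∧ ∀ (𝒞 : Set (Bil n)) (F0 : ℝ) (w : E n → ℝ), Adm l K 𝒞 → Ent 𝒞 F0 w → ∀ r : ℝ, 1/4 ≤ r → r ≤ 1/2 →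
    Fl F0 κ (ε0 / Rc n ρ) (zm 0 r w) → ContinuousOn (D2 w) (Metric.ball 0 R) ∧ ∀ x t, ‖x‖ < R → 0 < t → t < T → |Dt (t • ξ) w x - t ^ 2 * D2 w x ξ ξ| ≤ C * t ^ α * t ^ 2 := by
  obtain ⟨C, R, hC, hR, H⟩ := flat_hol h
  refine ⟨2 * C * (‖ξ‖ + 1) ^ α * ‖ξ‖ ^ 2 + 1, R / 2, R / 2 / (‖ξ‖ + 1), by positivity, by positivity, by positivity, fun 𝒞 F0 w hA hw r hr hr2 hf => ?_⟩
  have G := H 𝒞 F0 w hA hw r hr hr2 hf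
  constructor
  · intro x hx
    have hx' : ‖x‖ < R / 2 := by simpa using hx
    refine ContinuousAt.continuousWithinAt ?_
    rw [ContinuousAt, tendsto_iff_norm_sub_tendsto_zero]
    have h1 : Tendsto (fun y => C * ‖y - x‖ ^ α) (𝓝 x) (𝓝 0) := by
      have : Continuous fun y : E n => C * ‖y - x‖ ^ α := continuous_const.mul ((continuous_id.sub continuous_const).norm.rpow_const fun _ => Or.inr h.a0.le)
      simpa [Real.zero_rpow h.a0.ne'] using this.tendsto x
    refine squeeze_zero' (Eventually.of_forall fun _ => norm_nonneg _) ?_ h1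
    have : Metric.ball (0 : E n) R ∈ 𝓝 x := Metric.isOpen_ball.mem_nhds (by rw [mem_ball_zero_iff]; linarith)
    filter_upwards [this] with y hy
    exact G y x (by simpa using hy) (by linarith)
  · intro x t hx ht hT
    have hT' : t * (‖ξ‖ + 1) < R / 2 := (lt_div_iff₀ (by positivity)).1 hT
    have hn : ‖t • ξ‖ = t * ‖ξ‖ := by rw [norm_smul, Real.norm_of_nonneg ht.le]
    have := Dt_near hw.lc (S := D2 w x) (D2_symm' hw.lc.diff x) (x := x) (ξ := t • ξ) (R := t * (‖ξ‖ + 1)) (η := C * (t * (‖ξ‖ + 1)) ^ α) (by positivity)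
      (Eventually.of_forall fun y hy => by
        have hy2 : ‖y‖ < R := by have := norm_sub_norm_le y x; linarith
        refine (G y x hy2 (by linarith)).trans ?_
        exact mul_le_mul_of_nonneg_left (Real.rpow_le_rpow (norm_nonneg _) hy.le h.a0.le) hC.le) (by rw [hn]; linarith)
    have e : D2 w x (t • ξ) (t • ξ) = t ^ 2 * D2 w x ξ ξ := by
      simp only [map_smul, ContinuousLinearMap.smul_apply, smul_eq_mul]; ring
    rw [e, hn, Real.mul_rpow ht.le (by positivity)] at this
    refine this.trans ?_
    have : 0 ≤ t ^ α * t ^ 2 := by positivity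
    nlinarith

theorem caseB (h : FC n l K α ρ ε0 κ) {𝒞 : Set (Bil n)} {F0 : ℝ} {w : E n → ℝ} (hA : Adm l K 𝒞) (hw : Ent 𝒞 F0 w) {ξ : E n} {M : ℝ}
    (hM : ∀ x t, 0 < t → Dt (t • ξ) w x ≤ M * t ^ 2) {r : ℝ} (hr : 1/4 ≤ r) (hr2 : r ≤ 1/2) (hf : Fl F0 κ (ε0 / Rc n ρ) (zm 0 r w))
    {B T0 : ℝ} (hT0 : 0 < T0) (hB : ∀ t, 0 < t → t < T0 → (M - B * t ^ α) * t ^ 2 ≤ Dt (t • ξ) w 0) : ∃ t, 0 < t ∧ Dt (t • ξ) w 0 = M * t ^ 2 := by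
  obtain ⟨C, R, T, hC, hR, hT, H⟩ := flat_Dt h ξ
  obtain ⟨hcont, G⟩ := H 𝒞 F0 w hA hw r hr hr2 hf
  have a0 := h.a0
  have small : ∀ A δ : ℝ, 0 < δ → ∀ᶠ t in 𝓝[>] (0:ℝ), A * t ^ α < δ := by
    intro A δ hδ
    have : Tendsto (fun t : ℝ => A * t ^ α) (𝓝[>] 0) (𝓝 0) := by
      have : Continuous fun t : ℝ => A * t ^ α := continuous_const.mul (continuous_id.rpow_const fun _ => Or.inr h.a0.le)
      have := (this.tendsto 0).mono_left (nhdsWithin_le_nhds (s := Set.Ioi 0))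
      simpa [Real.zero_rpow h.a0.ne'] using this
    exact this.eventually (gt_mem_nhds hδ)
  have lt : ∀ T' : ℝ, 0 < T' → ∀ᶠ t in 𝓝[>] (0:ℝ), 0 < t ∧ t < T' := fun T' hT' => by
    filter_upwards [Ioo_mem_nhdsGT hT'] with t ht using ht
  have v0 : ∀ x, ‖x‖ < R → D2 w x ξ ξ ≤ M := by
    intro x hx
    refine le_of_forall_pos_le_add fun δ hδ => ?_
    obtain ⟨t, ⟨h1, h2⟩, h3⟩ := ((lt T hT).and (small C δ hδ)).exists
    have a1 := (abs_le.1 (G x t hx h1 h2)).1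
    have a2 := hM x t h1
    have : t ^ 2 * D2 w x ξ ξ ≤ t ^ 2 * (M + C * t ^ α) := by nlinarith
    have := le_of_mul_le_mul_left this (by positivity)
    linarith
  have v00 : M ≤ D2 w 0 ξ ξ := by
    refine le_of_forall_pos_le_add fun δ hδ => ?_
    obtain ⟨t, ⟨⟨h1, h2⟩, h3⟩, h4⟩ := (((lt T hT).and (lt T0 hT0)).and (small (B + C) δ hδ)).exists
    have a1 := (abs_le.1 (G 0 t (by simpa using hR) h1 h2)).2
    have a2 := hB t h3.1 h3.2
    have : t ^ 2 * M ≤ t ^ 2 * (D2 w 0 ξ ξ + (B + C) * t ^ α) := by nlinarith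
    have := le_of_mul_le_mul_left this (by positivity)
    linarith
  have vz : ∀ x, (n + 1) * ‖x‖ < R → M - D2 w x ξ ξ = 0 := by
    refine Ent_smp h.l0 h.K0 hA hw (v := fun x => M - D2 w x ξ ξ) ?_ (fun x hx => by linarith [v0 x hx]) ?_ (by linarith [v0 0 (by simpa using hR)])
    · exact continuousOn_const.sub ((bil_eval_cont ξ ξ).comp_continuousOn hcont)
    · intro δ hδ
      obtain ⟨t, ⟨h1, h2⟩, h3⟩ := ((lt T hT).and (small C δ hδ)).exists
      obtain ⟨s1, s2⟩ := Dt_super h.l0 hA hw (t • ξ) M (c := (t ^ 2)⁻¹) (by positivity)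
      refine ⟨_, s1, fun x hx => ?_, by filter_upwards [s2] with y hy _ using hy⟩
      have a1 := G x t hx h1 h2
      have e : M - (t ^ 2)⁻¹ * Dt (t • ξ) w x - (M - D2 w x ξ ξ) = - ((t ^ 2)⁻¹ * (Dt (t • ξ) w x - t ^ 2 * D2 w x ξ ξ)) := by
        field_simp; ring
      show |M - (t ^ 2)⁻¹ * Dt (t • ξ) w x - (M - D2 w x ξ ξ)| ≤ δ
      rw [e, abs_neg, abs_mul, abs_of_pos (by positivity : 0 < (t ^ 2)⁻¹), inv_mul_le_iff₀ (by positivity)]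
      nlinarith [sq_nonneg t]
  set R2 := R / (n + 1) with hR2
  have hR2' : 0 < R2 := by positivity
  have key : ∀ j : ℕ, ∀ x t, 0 < t → t < T → ‖x‖ + 2 * t * ‖ξ‖ < R2 → |Dt (t • ξ) w x - M * t ^ 2| ≤ C * (t / 2 ^ j) ^ α * t ^ 2 := by
    intro j
    induction j with
    | zero =>
      intro x t ht htT hx
      have hx1 : ‖x‖ < R2 := by nlinarith [norm_nonneg ξ]
      have hx2 : (n + 1) * ‖x‖ < R := by rw [hR2, lt_div_iff₀ (by positivity)] at hx1; linarith
      have hx3 : ‖x‖ < R := by nlinarith [norm_nonneg x, (Nat.cast_nonneg n : (0:ℝ) ≤ n)]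
      have := G x t hx3 ht htT
      rw [← sub_eq_zero.1 (vz x hx2)] at this
      simpa [mul_comm M] using this
    | succ j ih =>
      intro x t ht htT hx
      have hn : ‖(t/2) • ξ‖ = t/2 * ‖ξ‖ := by rw [norm_smul, Real.norm_of_nonneg (by positivity)]
      have ht2 : 0 < t * ‖ξ‖ ∨ t * ‖ξ‖ = 0 := (by positivity : 0 ≤ t * ‖ξ‖).lt_or_eq.imp id Eq.symm
      have ht3 : 0 ≤ t * ‖ξ‖ := by positivity
      have b1 := ih (x + (t/2) • ξ) (t/2) (by positivity) (by linarith) (by have := norm_add_le x ((t/2) • ξ); rw [hn] at this; linarith)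
      have b2 := ih (x - (t/2) • ξ) (t/2) (by positivity) (by linarith) (by have := norm_sub_le x ((t/2) • ξ); rw [hn] at this; linarith)
      have b3 := ih x (t/2) (by positivity) (by linarith) (by linarith)
      have e : t / 2 / 2 ^ j = t / 2 ^ (j + 1) := by rw [pow_succ]; field_simp
      rw [e] at b1 b2 b3
      rw [Dt_half]
      rw [abs_le] at *
      constructor <;> nlinarith
  obtain ⟨t, ⟨h1, h2⟩, h3⟩ := ((lt T hT).and (lt (R2 / (2 * ‖ξ‖ + 1)) (by positivity))).exists
  refine ⟨t, h1, sub_eq_zero.1 (abs_nonpos_iff.1 ?_)⟩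
  have lim : Tendsto (fun j : ℕ => C * (t / 2 ^ j) ^ α * t ^ 2) atTop (𝓝 0) := by
    have ht0 : Tendsto (fun j : ℕ => t / 2 ^ j) atTop (𝓝 0) := by
      have := (tendsto_pow_atTop_nhds_zero_of_lt_one (r := (1/2 : ℝ)) (by norm_num) (by norm_num)).const_mul t
      simpa [div_eq_mul_inv] using this
    have c : Continuous fun s : ℝ => C * s ^ α * t ^ 2 := (continuous_const.mul (continuous_id.rpow_const fun _ => Or.inr h.a0.le)).mul continuous_const
    have := (c.tendsto 0).comp ht0
    simpa [Real.zero_rpow h.a0.ne', Function.comp_def] using this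
  have h4 := (lt_div_iff₀ (by positivity)).1 h3.2
  exact ge_of_tendsto' lim fun j => key j 0 t h1 h2 (by rw [norm_zero]; nlinarith)

theorem attain (h : FC n l K α ρ ε0 κ) {𝒞 : Set (Bil n)} {F0 ε : ℝ} (hε : 0 < ε) (hε0 : 2 * ε ≤ ε0 / Rc n ρ) (hA : Adm l K 𝒞) (hne : ∃ w, SP 𝒞 F0 κ ε w) (ξ : E n) :
    ∃ (M : ℝ) (v : E n → ℝ), SP 𝒞 F0 κ ε v ∧ ∀ᵐ x, D2 v x ξ ξ = M := by
  obtain ⟨M, hM, H⟩ := sup_ex h hε (by linarith) hA hne ξ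
  suffices hs : ∃ v, SP 𝒞 F0 κ ε v ∧ ∃ t, 0 < t ∧ Dt (t • ξ) v 0 = M * t ^ 2 by
    obtain ⟨v, hv, t, ht, h0⟩ := hs
    exact ⟨M, v, hv, caseA h.l0 h.K0 hA hv.ent (hM v hv) ht h0⟩
  choose w t hw ht ht1 hlow halt using fun k : ℕ => H (1 / ((k : ℝ) + 1)) (by positivity)
  obtain ⟨v, hv, hconv⟩ := SP_lim h.K0 hA hw
  refine ⟨v, hv, ?_⟩
  obtain ⟨T, hT⟩ := ulim (a := t) (B := 1) (Eventually.of_forall fun k => by rw [Real.norm_of_nonneg (ht k).le]; exact ht1 k)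
  have hk0 : Tendsto (fun k : ℕ => 1 / ((k : ℝ) + 1)) (hyperfilter ℕ) (𝓝 0) := tendsto_one_div_add_atTop_nhds_zero_nat.mono_left Nat.hyperfilter_le_atTop
  have hT0 : 0 ≤ T := ge_of_tendsto' hT fun k => (ht k).le
  have conv : ∀ η > 0, ∀ᶠ k in (hyperfilter ℕ : Filter ℕ), ∀ s : ℝ, 0 < s → s ≤ 1 → |Dt (s • ξ) (w k) 0 - Dt (s • ξ) v 0| ≤ η := by
    intro η hη
    filter_upwards [hconv ‖ξ‖ (η / 4) (by positivity)] with k hk s hs0 hs1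
    have hn : ‖s • ξ‖ ≤ ‖ξ‖ := by
      rw [norm_smul, Real.norm_of_nonneg hs0.le]; nlinarith [norm_nonneg ξ]
    rw [← nrm_Dt]
    have b1 := hk (0 + s • ξ) (by simpa using hn)
    have b2 := hk (0 - s • ξ) (by simpa using hn)
    have b3 := hk 0 (by simp)
    simp only [Dt]
    rw [abs_le] at *
    constructor <;> linarith [b1.1, b1.2, b2.1, b2.2, b3.1, b3.2]
  rcases hT0.lt_or_eq with hpos | hzero
  · refine ⟨T, hpos, le_antisymm (hM v hv 0 T hpos) (le_of_forall_pos_le_add fun η hη => ?_)⟩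
    have c : Continuous fun s : ℝ => Dt (s • ξ) v 0 := by
      have := hv.ent.lc.cont
      unfold Dt
      fun_prop
    have l1 : Tendsto (fun k : ℕ => (M - 1 / ((k : ℝ) + 1)) * t k ^ 2) (hyperfilter ℕ) (𝓝 ((M - 0) * T ^ 2)) := (tendsto_const_nhds.sub hk0).mul (hT.pow 2)
    have l2 : Tendsto (fun k => Dt (t k • ξ) v 0 + η) (hyperfilter ℕ) (𝓝 (Dt (T • ξ) v 0 + η)) := ((c.tendsto T).comp hT).add_const η
    rw [sub_zero] at l1
    refine le_of_tendsto_of_tendsto l1 l2 ?_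
    filter_upwards [conv η hη] with k hk
    have := (abs_le.1 (hk (t k) (ht k) (ht1 k))).2
    linarith [hlow k]
  · rw [← hzero] at hT
    obtain ⟨C, R, T1, hC, hR, hT1, G⟩ := flat_Dt h ξ
    have hflat : ∀ᶠ k in (hyperfilter ℕ : Filter ℕ), ∃ r, 1/4 ≤ r ∧ r ≤ 1/2 ∧ SFl F0 κ ε (zm 0 r (w k)) := by
      filter_upwards [hT.eventually (gt_mem_nhds one_pos)] with k hk
      exact (halt k).resolve_left hk.ne
    have hfv : ∃ r, 1/4 ≤ r ∧ r ≤ 1/2 ∧ Fl F0 κ (ε0 / Rc n ρ) (zm 0 r v) := by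
      obtain ⟨η, h1, h2, h3⟩ := small_ex (V1 n) (c := ε ^ 2) (b := 1) (by positivity) one_pos
      obtain ⟨k, ⟨r, hr, hr2, hf⟩, hk⟩ := (hflat.and (hconv 1 (η / 16) (by positivity))).exists
      have hr0 : 0 < r := by linarith
      refine ⟨r, hr, hr2, Fl_mono h.k0 (by positivity) hε0 ?_⟩
      have hf2 : Fl F0 κ ε (zm 0 r (nrm (w k))) := by
        rw [nrm_zm _ hr0.ne']
        exact (SFl_add _ _ hf).fl
      refine Fl_near2 h.k0 hε (zm_lc (nrm_lc (hw k).ent.lc) 0 r).cont (zm_lc hv.ent.lc 0 r).cont hf2 (η := η) ?_ ?_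
      · have := V1_nonneg (n := n)
        have : η ^ 2 ≤ η := by nlinarith
        nlinarith
      · intro z hz
        refine zm_near hr0 (fun x hx => ?_) z hz
        rw [abs_sub_comm]
        refine (hk x (by linarith)).trans ?_
        have : (1/16 : ℝ) ≤ r ^ 2 := by nlinarith
        nlinarith
    obtain ⟨r, hr, hr2, hf⟩ := hfv
    refine caseB h hA hv.ent (hM v hv) hr hr2 hf (B := C) (T0 := min T1 1) (lt_min hT1 one_pos) fun s hs hs1 => ?_
    have hs2 : s < T1 := hs1.trans_le (min_le_left _ _)
    have hs3 : s ≤ 1 := hs1.le.trans (min_le_right _ _)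
    refine le_of_forall_pos_le_add fun η hη => ?_
    have cz : Tendsto (fun k => C * t k ^ α) (hyperfilter ℕ) (𝓝 0) := by
      have c : Continuous fun s : ℝ => C * s ^ α := continuous_const.mul (continuous_id.rpow_const fun _ => Or.inr h.a0.le)
      have := (c.tendsto 0).comp hT
      simpa [Real.zero_rpow h.a0.ne', Function.comp_def] using this
    have l1 : Tendsto (fun k : ℕ => (M - 1 / ((k : ℝ) + 1) - C * t k ^ α - C * s ^ α) * s ^ 2) (hyperfilter ℕ) (𝓝 ((M - 0 - 0 - C * s ^ α) * s ^ 2)) :=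
      (((tendsto_const_nhds.sub hk0).sub cz).sub_const _).mul_const _
    rw [sub_zero, sub_zero] at l1
    refine le_of_tendsto l1 ?_
    filter_upwards [conv η hη, hflat, hT.eventually (gt_mem_nhds hT1)] with k hk hfk htk
    obtain ⟨r', hr', hr2', hf'⟩ := hfk
    have g := (G 𝒞 F0 (w k) hA (hw k).ent r' hr' hr2' (Fl_mono h.k0 hε (by linarith) hf'.fl)).2
    have a1 := (abs_le.1 (g 0 (t k) (by simpa using hR) (ht k) htk)).2
    have a2 := (abs_le.1 (g 0 s (by simpa using hR) hs hs2)).1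
    have a3 := (abs_le.1 (hk s hs hs3)).2
    have a4 := hlow k
    have a5 : t k ^ 2 * (M - 1 / ((k : ℝ) + 1) - C * t k ^ α) ≤ t k ^ 2 * D2 (w k) 0 ξ ξ := by nlinarith
    have a6 := le_of_mul_le_mul_left a5 (pow_pos (ht k) 2)
    nlinarith [sq_nonneg s]

theorem SP_dir (h : FC n l K α ρ ε0 κ) {F0 ε : ℝ} (hε : 0 < ε) (hε0 : 2 * ε ≤ ε0 / Rc n ρ) (L : List (E n)) :
    ∀ 𝒞 : Set (Bil n), Adm l K 𝒞 → (∃ w, SP 𝒞 F0 κ ε w) → ∃ (w : E n → ℝ), SP 𝒞 F0 κ ε w ∧ ∃ m : E n → ℝ, ∀ ξ ∈ L, ∀ᵐ x, D2 w x ξ ξ = m ξ := by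
  classical
  induction L with
  | nil => intro 𝒞 hA ⟨w, hw⟩; exact ⟨w, hw, 0, by simp⟩
  | cons ξ L ih =>
    intro 𝒞 hA hne
    obtain ⟨M, v, hv, hvM⟩ := attain h hε hε0 hA hne ξ
    have hA' : Adm l K (𝒞 ∩ {S : Bil n | S ξ ξ = M}) :=
      ⟨hA.conv.inter (by
          intro S hS T hT a b _ _ hab
          simp only [Set.mem_setOf_eq] at *
          simp only [ContinuousLinearMap.add_apply, ContinuousLinearMap.smul_apply, smul_eq_mul, hS, hT]
          rw [← add_mul, hab, one_mul]),
        hA.cl.inter (isClosed_eq (bil_eval_cont ξ ξ) continuous_const), fun S hS => hA.ell S hS.1, fun S hS => hA.bd S hS.1⟩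
    obtain ⟨w, hw, m, hm⟩ := ih _ hA' ⟨v, ⟨hv.ent.lc, by filter_upwards [hv.ent.mem, hvM] with x a b using ⟨a, b⟩, hv.ent.det⟩, hv.nf⟩
    refine ⟨w, ⟨⟨hw.ent.lc, by filter_upwards [hw.ent.mem] with x a using a.1, hw.ent.det⟩, hw.nf⟩, fun ζ => if ζ = ξ then M else m ζ, fun ζ hζ => ?_⟩
    by_cases e : ζ = ξ
    · subst e
      filter_upwards [hw.ent.mem] with x a
      simpa using a.2
    · simp only [e, if_false]
      exact hm ζ ((List.mem_cons.1 hζ).resolve_left e)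

theorem SP_empty (h : FC n l K α ρ ε0 κ) {F0 ε : ℝ} (hε : 0 < ε) (hε0 : 2 * ε ≤ ε0 / Rc n ρ) {𝒞 : Set (Bil n)} (hA : Adm l K 𝒞) (w0 : E n → ℝ) : ¬ SP 𝒞 F0 κ ε w0 := by
  intro hw0
  let b := Module.finBasis ℝ (E n)
  obtain ⟨w, hw, m, hm⟩ := SP_dir h hε hε0 (List.ofFn (fun ij : Fin (Module.finrank ℝ (E n) * Module.finrank ℝ (E n)) => b (finProdFinEquiv.symm ij).1 + b (finProdFinEquiv.symm ij).2)) 𝒞 hA ⟨w0, hw0⟩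
  have hm' : ∀ᵐ x, ∀ i j, D2 w x (b i + b j) (b i + b j) = m (b i + b j) := by
    rw [ae_all_iff]; intro i
    rw [ae_all_iff]; intro j
    refine hm _ ?_
    rw [List.mem_ofFn]
    exact ⟨finProdFinEquiv (i, j), by simp⟩
  have hD : ∀ x y, (∀ i j, D2 w x (b i + b j) (b i + b j) = m (b i + b j)) → (∀ i j, D2 w y (b i + b j) (b i + b j) = m (b i + b j)) → D2 w x = D2 w y := by
    intro x y hx hy
    have sx := D2_symm' hw.ent.lc.diff x
    have sy := D2_symm' hw.ent.lc.diff y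
    have key : ∀ i j, D2 w x (b i) (b j) = D2 w y (b i) (b j) := by
      intro i j
      have e1 : ∀ i j, D2 w x (b i + b j) (b i + b j) = D2 w y (b i + b j) (b i + b j) := fun i j => (hx i j).trans (hy i j).symm
      have e2 := e1 i j
      have e3 := e1 i i
      have e4 := e1 j j
      simp only [map_add, ContinuousLinearMap.add_apply] at e2 e3 e4
      rw [sx (b j) (b i), sy (b j) (b i)] at e2
      linarith
    refine ContinuousLinearMap.coe_injective (b.ext fun i => ?_)
    exact ContinuousLinearMap.coe_injective (b.ext fun j => key i j)
  obtain ⟨x0, hx0, hxd⟩ := (hm'.and hw.ent.det).exists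
  have q := const_quad hw.ent.lc (S := D2 w x0) (D2_symm' hw.ent.lc.diff x0) (by filter_upwards [hm'] with y hy using hD y x0 hy hx0)
  refine hw.nf 1 le_rfl ?_
  rw [zm_one, q]
  exact SFl_qd h.k0 hε (D2_symm' hw.ent.lc.diff x0) hxd

/-- **Liouville theorem.** -/
theorem Liouville (h : FC n l K α ρ ε0 κ) {F0 : ℝ} {𝒞 : Set (Bil n)} (hA : Adm l K 𝒞) {w : E n → ℝ} (hw : Ent 𝒞 F0 w) :
    ∃ c p, ∃ S : Bil n, (∀ v w, S v w = S w v) ∧ dt S = F0 ∧ w = qd c p S := by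
  have hRc : 0 < Rc n ρ := by linarith [Rc_ge (n := n) h.r0 (by linarith [h.r2])]
  have hε : 0 < ε0 / Rc n ρ / 2 := by have := h.e0; positivity
  refine large_quad h hA hw 0 fun R => ?_
  by_contra hcon
  push Not at hcon
  refine SP_empty h hε (by linarith) hA (zm 0 (max R 1) w) ⟨hw.zm 0 (by positivity), fun r hr hS => ?_⟩
  have hm : 0 < max R 1 := by positivity
  have e : zm 0 r (zm 0 (max R 1) w) = zm 0 (max R 1 * r) w := by
    rw [zm_zm]; simp
  rw [e] at hS
  exact hcon (max R 1 * r) (by nlinarith [le_max_left R 1]) (by positivity) (Fl_mono h.k0 hε (by linarith) hS.fl)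

/-- Local data around a point for the equation `dt (D2 ψ + G x) ≈ F x`. -/
structure Loc (l K α : ℝ) (ψ : E n → ℝ) (G : E n → Bil n) (F : E n → ℝ) (x0 : E n) (R0 A : ℝ) : Prop where
  lc : LC ψ
  sym : ∀ x, ‖x - x0‖ < R0 → ∀ v w, G x v w = G x w v
  eqn : ∀ x, ‖x - x0‖ < R0 → ∀ᵐ z, ‖z - x‖ < R0 → Ell l (hC (D2 ψ z + G x)) ∧ ‖D2 ψ z + G x‖ ≤ K ∧ |dt (D2 ψ z + G x) - F x| ≤ A * ‖z - x‖ ^ α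
  cont : ContinuousAt F x0

/-- The function `ψ` plus the quadratic form with Hessian `S`. -/
noncomputable def shf (ψ : E n → ℝ) (S : Bil n) (z : E n) : ℝ := ψ z + qd 0 0 S z

theorem shf_lc {ψ : E n → ℝ} (h : LC ψ) (S : Bil n) : LC (shf ψ S) := h.add (qd_lc _ _ _)

theorem shf_ae {ψ : E n → ℝ} (h : LC ψ) {S : Bil n} (hS : ∀ v w, S v w = S w v) : ∀ᵐ z, D2 (shf ψ S) z = D2 ψ z + S := by
  filter_upwards [h.ae] with z hz
  unfold shf
  have e : (fun z => ψ z + qd 0 0 S z) = fun z => ψ z - qd 0 0 (-S) z := by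
    funext z; simp [qd]; ring
  show D2 (fun z => ψ z + qd 0 0 S z) z = _
  rw [e, qd_sub_D2 h 0 0 (S := -S) (fun v w => by simp [hS v w]) hz, sub_neg_eq_add]

theorem Loc.zoom {ψ : E n → ℝ} {G : E n → Bil n} {F : E n → ℝ} {x0 : E n} {R0 A : ℝ} (h : Loc l K α ψ G F x0 R0 A) (hα : 0 < α) (hA0 : 0 ≤ A) {x : E n} (hx : ‖x - x0‖ < R0)
    {r R : ℝ} (hr : 0 < r) (hR : r * R ≤ R0) : ∀ᵐ z, ‖z‖ < R → Ell l (hC (D2 (zm x r (shf ψ (G x))) z)) ∧ ‖D2 (zm x r (shf ψ (G x))) z‖ ≤ K ∧ |dt (D2 (zm x r (shf ψ (G x))) z) - F x| ≤ A * (r * R) ^ α := by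
  refine zm_of (shf_lc h.lc _) hr (P := fun S => Ell l (hC S) ∧ ‖S‖ ≤ K ∧ |dt S - F x| ≤ A * (r * R) ^ α) ?_
  filter_upwards [shf_ae h.lc (h.sym x hx), h.eqn x hx] with y hy1 hy2 hy3
  rw [hy1]
  obtain ⟨a, b, c⟩ := hy2 (by linarith)
  exact ⟨a, b, c.trans (mul_le_mul_of_nonneg_left (Real.rpow_le_rpow (norm_nonneg _) hy3.le hα.le) hA0)⟩

theorem Fl_of_nrm {F0 ε : ℝ} {w : E n → ℝ} (h : Fl F0 κ ε (nrm w)) : Fl F0 κ ε w := by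
  obtain ⟨c, p, S, hS, hd, hL⟩ := h
  refine ⟨c + w 0, p + fderiv ℝ w 0, S, hS, hd, ?_⟩
  have e : (fun x => w x - qd (c + w 0) (p + fderiv ℝ w 0) S x) = fun x => nrm w x - qd c p S x := by
    funext x; simp [nrm, qd]; ring
  rwa [e]

theorem blow (h : FC n l K α ρ ε0 κ) {ψ : E n → ℝ} {G : E n → Bil n} {F : E n → ℝ} {x0 : E n} {R0 A : ℝ} (hR0 : 0 < R0) (hA0 : 0 ≤ A) (H : Loc l K α ψ G F x0 R0 A) :
    ∃ s, 0 < s ∧ s ≤ R0 ∧ ∀ x r, ‖x - x0‖ < s → 0 < r → r < s → Fl (F x) κ ε0 (zm x r (shf ψ (G x))) := by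
  by_contra hcon
  push Not at hcon
  have hs : ∀ k : ℕ, 0 < R0 / ((k : ℝ) + 2) ^ 2 := fun k => by positivity
  have hs1 : ∀ k : ℕ, R0 / ((k : ℝ) + 2) ^ 2 ≤ R0 := fun k => div_le_self hR0.le (by nlinarith [(Nat.cast_nonneg k : (0:ℝ) ≤ k)])
  choose x r hx hr hrs hnf using fun k : ℕ => hcon _ (hs k) (hs1 k)
  have hx' : ∀ k, ‖x k - x0‖ < R0 := fun k => (hx k).trans_le (hs1 k)
  set w : ℕ → E n → ℝ := fun k => zm (x k) (r k) (shf ψ (G (x k))) with hw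
  have hwlc : ∀ k, LC (w k) := fun k => zm_lc (shf_lc H.lc _) _ _
  have hrR : ∀ k : ℕ, r k * ((k : ℝ) + 2) ≤ R0 / ((k : ℝ) + 2) := by
    intro k
    have := mul_le_mul_of_nonneg_right (hrs k).le (by positivity : (0:ℝ) ≤ (k : ℝ) + 2)
    refine this.trans (le_of_eq ?_)
    field_simp
  have hrR' : ∀ k : ℕ, r k * ((k : ℝ) + 2) ≤ R0 := fun k => (hrR k).trans (div_le_self hR0.le (by linarith [(Nat.cast_nonneg k : (0:ℝ) ≤ k)]))
  have hz := fun k : ℕ => H.zoom h.a0 hA0 (hx' k) (hr k) (hrR' k)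
  have k2 : Tendsto (fun k : ℕ => (k : ℝ) + 2) atTop atTop := tendsto_atTop_add_const_right _ _ tendsto_natCast_atTop_atTop
  have t1 : Tendsto (fun k : ℕ => R0 / ((k : ℝ) + 2)) atTop (𝓝 0) := tendsto_const_nhds.div_atTop k2
  have t2 : Tendsto (fun k : ℕ => R0 / ((k : ℝ) + 2) ^ 2) atTop (𝓝 0) := tendsto_const_nhds.div_atTop ((tendsto_pow_atTop two_ne_zero).comp k2)
  have t3 : Tendsto x atTop (𝓝 x0) := by
    rw [tendsto_iff_norm_sub_tendsto_zero]
    exact squeeze_zero (fun _ => norm_nonneg _) (fun k => (hx k).le) t2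
  have t4 : Tendsto (fun k => F (x k)) atTop (𝓝 (F x0)) := H.cont.tendsto.comp t3
  have t5 : Tendsto (fun k => |F (x k) - F x0|) atTop (𝓝 0) := by
    simpa using (t4.sub_const (F x0)).abs
  have t6 : Tendsto (fun k : ℕ => A * (R0 / ((k : ℝ) + 2)) ^ α) atTop (𝓝 0) := by
    have c : Continuous fun s : ℝ => A * s ^ α := continuous_const.mul (continuous_id.rpow_const fun _ => Or.inr h.a0.le)
    have := (c.tendsto 0).comp t1
    simpa [Real.zero_rpow h.a0.ne', Function.comp_def] using this
  have t7 := t6.add t5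
  rw [add_zero] at t7
  have hAdm : Adm l K ({S : Bil n | Ell l (hC S)} ∩ Metric.closedBall 0 K) :=
    ⟨(ell_convex l).inter (convex_closedBall _ _), (ell_closed l).inter Metric.isClosed_closedBall, fun S hS => hS.1, fun S hS => by simpa using hS.2⟩
  have hD : ∀ k, ∀ᵐ z, D2 (nrm (w k)) z = D2 (w k) z := fun k => by
    filter_upwards [(hwlc k).ae] with z hz using nrm_D2 (hwlc k) hz
  obtain ⟨v, v1, v2, v3, v4, v5, v6⟩ := compactness hAdm.conv hAdm.cl h.K0 hAdm.bd (u := fun k => nrm (w k)) (fun k => nrm_lc (hwlc k)) (fun k => nrm_zero _) (fun k => nrm_fderiv (hwlc k))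
    k2 t7 (F0 := F x0) (fun k => by
      filter_upwards [hD k, hz k] with z e1 e2 e3
      rw [e1]
      exact ⟨(e2 e3).1, by simpa using (e2 e3).2.1⟩) (fun k => by
      filter_upwards [hD k, hz k] with z e1 e2 e3
      rw [e1]
      have := (e2 e3).2.2
      have b : A * (r k * ((k : ℝ) + 2)) ^ α ≤ A * (R0 / ((k : ℝ) + 2)) ^ α :=
        mul_le_mul_of_nonneg_left (Real.rpow_le_rpow (mul_nonneg (hr k).le (by positivity)) (hrR k) h.a0.le) hA0
      refine (abs_sub_le _ (F (x k)) _).trans ?_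
      exact add_le_add (this.trans b) le_rfl)
  obtain ⟨c, p, S, hS, hd, hv⟩ := Liouville h hAdm ⟨v1, v4, v5⟩
  have hε := h.e0
  obtain ⟨η, h1, h2, h3⟩ := small_ex (V1 n) (c := (ε0 / 2) ^ 2) (b := 1) (by positivity) one_pos
  have hev : ∀ᶠ k in (hyperfilter ℕ : Filter ℕ), |F (x k) - F x0| < κ * (ε0 / 2) :=
    Nat.hyperfilter_le_atTop (t5.eventually (gt_mem_nhds (by have := h.k0; positivity)))
  obtain ⟨k, hk1, hk2⟩ := (hev.and (v6 1 η h1)).exists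
  refine hnf k (Fl_of_nrm ?_)
  have fq : Fl (F (x k)) κ (ε0 / 2) (qd c p S) := ⟨c, p, S, hS, by rw [hd, abs_sub_comm]; exact hk1.le, by simp [L2]; positivity⟩
  have := Fl_near2 h.k0 (by positivity) (qd_lc c p S).cont (nrm_lc (hwlc k)).cont fq (η := η) (by
    have := V1_nonneg (n := n)
    have : η ^ 2 ≤ η := by nlinarith
    nlinarith) (fun z hz => by rw [← hv]; exact hk2 z hz.le)
  rwa [mul_div_cancel₀ _ (two_ne_zero' ℝ)] at this

theorem local_reg (hn : 0 < n) (hl : 0 < l) (hK : 0 ≤ K) (hα0 : 0 < α) (hα : α < 1) {ψ : E n → ℝ} {G : E n → Bil n} {F : E n → ℝ} {x0 : E n} {R0 A : ℝ} (hR0 : 0 < R0) (hA0 : 0 ≤ A)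
    (H : Loc l K α ψ G F x0 R0 A) : ∃ s C : ℝ, 0 < s ∧ 0 < C ∧ (∀ x, ‖x - x0‖ < s → DifferentiableAt ℝ (fderiv ℝ ψ) x) ∧
      ∀ x y, ‖x - x0‖ < s → ‖y - x0‖ < s → ‖D2 ψ x - D2 ψ y‖ ≤ C * ‖x - y‖ ^ α := by
  obtain ⟨ρ, ε0, κ, h⟩ := FC_ex hn hl hK hα0 hα
  obtain ⟨s, hs, hsR, hb⟩ := blow h hR0 hA0 H
  obtain ⟨C, hC, camp⟩ := Camp n h.r0 h.r2 hα0
  have r0 := h.r0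
  have e0 := h.e0
  have k0 := h.k0
  have ap := h.apos
  obtain ⟨q, hq1, hq2, hq3⟩ := small_ex A (c := κ * ρ ^ α / 2 * ε0) (b := (s / 2) ^ α) (by positivity) (by positivity)
  set r1 := q ^ (1 / α) with hr1
  have hr10 : 0 < r1 := by positivity
  have hr1a : r1 ^ α = q := by rw [hr1, ← Real.rpow_mul hq1.le]; field_simp; simp
  have hr1s : r1 ≤ s / 2 := (Real.rpow_le_rpow_iff hr10.le (by positivity) hα0).1 (by rwa [hr1a])
  have fl : ∀ x, ‖x - x0‖ < s → ∀ k : ℕ, Fl (F x) κ ((ρ ^ α) ^ k * ε0) (zm x (ρ ^ k * r1) (shf ψ (G x))) := by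
    intro x hx k
    have ez : ∀ k : ℕ, zm 0 (ρ ^ k) (zm x r1 (shf ψ (G x))) = zm x (ρ ^ k * r1) (shf ψ (G x)) := by
      intro k; rw [zm_zm, mul_comm r1]; simp
    rw [← ez]
    refine Fiter h e0 le_rfl (fun k => ?_) (hb x r1 hx hr10 (by linarith)) k
    rw [ez]
    have hp : ρ ^ k ≤ 1 := pow_le_one₀ r0.le (by linarith [h.r2])
    have hrr : 0 < ρ ^ k * r1 := by positivity
    have hz := H.zoom hα0 hA0 (hx.trans_le hsR) hrr (R := 1) (by nlinarith)
    refine ⟨zm_lc (shf_lc H.lc _) _ _, ?_, ?_, ?_⟩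
    · filter_upwards [hz] with z a b using (a b).1
    · filter_upwards [hz] with z a b using (a b).2.1
    · filter_upwards [hz] with z a b
      refine (a b).2.2.trans (le_of_eq_of_le ?_ (mul_le_mul_of_nonneg_left hq3 (pow_nonneg ap.le k)) |>.trans (le_of_eq ?_))
      · rw [mul_one, Real.mul_rpow (by positivity) hr10.le, hr1a, ← Real.rpow_natCast, ← Real.rpow_mul r0.le, mul_comm (k : ℝ), Real.rpow_mul r0.le, Real.rpow_natCast]; ring
      · ring
  obtain ⟨c1, c2⟩ := camp ψ H.lc x0 s r1 ε0 hr10 e0 (fun x hx k => by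
    obtain ⟨c, p, S, hS, -, hL⟩ := fl x hx k
    have hG := H.sym x (hx.trans_le hsR)
    have hrr : ρ ^ k * r1 ≠ 0 := by positivity
    have eq := zm_qd' 0 0 hG x hrr
    refine ⟨c - ((ρ ^ k * r1) ^ 2)⁻¹ * qd 0 0 (G x) x, p - (ρ ^ k * r1)⁻¹ • (0 + G x x), S - G x, fun v w => by simp [hS v w, hG v w], ?_⟩
    rw [mul_comm ε0]
    refine le_of_eq_of_le ?_ hL
    congr 1
    funext z
    have e := congrFun eq z
    have e2 : zm x (ρ ^ k * r1) (shf ψ (G x)) z = zm x (ρ ^ k * r1) ψ z + zm x (ρ ^ k * r1) (qd 0 0 (G x)) z := by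
      simp only [zm, shf]; ring
    rw [e2, e]
    simp only [qd, ContinuousLinearMap.sub_apply]
    ring)
  refine ⟨min s (r1 / 4), C * ε0 / r1 ^ α, by positivity, by positivity, fun x hx => c1 x (hx.trans_le (min_le_left _ _)), fun x y hx hy => ?_⟩
  have hx2 := hx.trans_le (min_le_right _ _)
  have hy2 := hy.trans_le (min_le_right _ _)
  have hxy : ‖x - y‖ ≤ r1 / 2 := by
    have := norm_sub_le (x - x0) (y - x0)
    rw [sub_sub_sub_cancel_right] at this
    linarith
  refine (c2 x y (hx.trans_le (min_le_left _ _)) (hy.trans_le (min_le_left _ _)) hxy).trans (le_of_eq ?_)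
  rw [Real.div_rpow (norm_nonneg _) hr10.le]
  ring

theorem exp_lip {a b M : ℝ} (ha : a ≤ M) (hb : b ≤ M) : |Real.exp a - Real.exp b| ≤ Real.exp M * |a - b| := by
  have key : ∀ a b : ℝ, a ≤ M → Real.exp a - Real.exp b ≤ Real.exp M * |a - b| := by
    intro a b ha
    have h1 := Real.add_one_le_exp (b - a)
    have h2 : Real.exp b = Real.exp a * Real.exp (b - a) := by rw [← Real.exp_add]; ring_nf
    have h3 := Real.exp_pos a
    calc Real.exp a - Real.exp b = Real.exp a * (1 - Real.exp (b - a)) := by rw [h2]; ring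
      _ ≤ Real.exp a * |a - b| := mul_le_mul_of_nonneg_left (by linarith [le_abs_self (a - b)]) h3.le
      _ ≤ _ := mul_le_mul_of_nonneg_right (Real.exp_le_exp.2 ha) (abs_nonneg _)
  rw [abs_le]
  have h1 := key a b ha
  have h2 := key b a hb
  rw [abs_sub_comm] at h2
  constructor <;> linarith

theorem mk_Loc {ψ : E n → ℝ} (hψ : LC ψ) (hα0 : 0 < α) (hα : α < 1) {G : E n → Bil n} {f : E n → ℝ} {x0 : E n} {s L Cf : ℝ} (hs : 0 < s) (hL : 0 ≤ L) (hCf : 0 ≤ Cf)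
    (hsym : ∀ x, ‖x - x0‖ < s → ∀ v w, G x v w = G x w v)
    (hG : ∀ x y, ‖x - x0‖ < s → ‖y - x0‖ < s → ‖G x - G y‖ ≤ L * ‖x - y‖)
    (hf : ∀ x y, ‖x - x0‖ < s → ‖y - x0‖ < s → |f x - f y| ≤ Cf * ‖x - y‖ ^ α)
    (hd0 : 0 < dt (G x0))
    (heq : ∀ᵐ z, ‖z - x0‖ < s → (hC (D2 ψ z + G z)).PosSemidef ∧ dt (D2 ψ z + G z) = Real.exp (f z) * dt (G z)) :
    ∃ l K R0 A, 0 < l ∧ 0 ≤ K ∧ 0 < R0 ∧ 0 ≤ A ∧ Loc l K α ψ G (fun x => Real.exp (f x) * dt (G x)) x0 R0 A := by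
  obtain ⟨K3, hK3, hb3⟩ := hψ.lbm.bd (‖x0‖ + 1)
  set K := K3 + (‖G x0‖ + L) with hK
  have hK0 : 0 ≤ K := by positivity
  obtain ⟨C, hC0, hlip⟩ := dt_lip n hK0
  have hlip' : ∀ S T : Bil n, ‖S‖ ≤ K → ‖T‖ ≤ K → |dt S - dt T| ≤ C * ‖S - T‖ := fun S T a b =>
    hlip S T a b _ (norm_nonneg _) fun i j => by
      have := hC_norm_le (S := S - T) le_rfl i j
      rwa [hC_sub] at this
  obtain ⟨σ, σ1, σ2, σ3⟩ := small_ex (C * L) (c := dt (G x0) / 2) (b := min s (1/2)) (by positivity) (by positivity)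
  have σs : σ ≤ s := σ2.trans (min_le_left _ _)
  have σh : σ ≤ 1/2 := σ2.trans (min_le_right _ _)
  have hx0 : ‖x0 - x0‖ < s := by simpa using hs
  have hGb : ∀ x, ‖x - x0‖ < σ → ‖G x‖ ≤ ‖G x0‖ + L := by
    intro x hx
    have h1 := hG x x0 (by linarith) hx0
    have h2 := norm_sub_norm_le (G x) (G x0)
    nlinarith
  have hGK : ∀ x, ‖x - x0‖ < σ → ‖G x‖ ≤ K := fun x hx => (hGb x hx).trans (by linarith)
  have hrp : ∀ t : ℝ, 0 ≤ t → t ≤ 1 → t ≤ t ^ α := fun t a b => by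
    rcases a.lt_or_eq with a | a
    · simpa using Real.rpow_le_rpow_of_exponent_ge a b hα.le
    · rw [← a, Real.zero_rpow hα0.ne']
  have hr1 : ∀ t : ℝ, 0 ≤ t → t ≤ 1 → t ^ α ≤ 1 := fun t a b => Real.rpow_le_one a b hα0.le
  set M := |f x0| + Cf with hM
  have hfb : ∀ x, ‖x - x0‖ < σ → |f x| ≤ M := by
    intro x hx
    have h1 := hf x x0 (by linarith) hx0
    have h2 := hr1 _ (norm_nonneg (x - x0)) (by linarith)
    have h3 := abs_sub_abs_le_abs_sub (f x) (f x0)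
    nlinarith
  have hdl : ∀ x y, ‖x - x0‖ < σ → ‖y - x0‖ < σ → |dt (G x) - dt (G y)| ≤ C * L * ‖x - y‖ := by
    intro x y hx hy
    have := hlip' _ _ (hGK x hx) (hGK y hy)
    have h1 := mul_le_mul_of_nonneg_left (hG x y (by linarith) (by linarith)) hC0
    linarith
  have hx0σ : ‖x0 - x0‖ < σ := by simpa using σ1
  have hdlow : ∀ x, ‖x - x0‖ < σ → dt (G x0) / 2 ≤ dt (G x) := by
    intro x hx
    have h1 := (abs_le.1 (hdl x x0 hx hx0σ)).1
    have h2 : C * L * ‖x - x0‖ ≤ C * L * σ := mul_le_mul_of_nonneg_left hx.le (by positivity)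
    linarith
  set K2 := dt (G x0) + C * L with hK2
  have hdup : ∀ x, ‖x - x0‖ < σ → |dt (G x)| ≤ K2 := by
    intro x hx
    rw [abs_of_nonneg (by linarith [hdlow x hx])]
    have h1 := (abs_le.1 (hdl x x0 hx hx0σ)).2
    have h2 : C * L * ‖x - x0‖ ≤ C * L * 1 := mul_le_mul_of_nonneg_left (by linarith) (by positivity)
    linarith
  set A1 := Real.exp M * (C * L) + Real.exp M * Cf * K2 with hA1
  have hA10 : 0 ≤ A1 := by positivity
  have hxy1 : ∀ x y : E n, ‖x - x0‖ < σ → ‖y - x0‖ < σ → ‖x - y‖ ≤ 1 := by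
    intro x y hx hy
    have := norm_sub_le (x - x0) (y - x0)
    rw [sub_sub_sub_cancel_right] at this
    linarith
  have hF : ∀ x y, ‖x - x0‖ < σ → ‖y - x0‖ < σ → |Real.exp (f x) * dt (G x) - Real.exp (f y) * dt (G y)| ≤ A1 * ‖x - y‖ ^ α := by
    intro x y hx hy
    have e : Real.exp (f x) * dt (G x) - Real.exp (f y) * dt (G y) = Real.exp (f x) * (dt (G x) - dt (G y)) + (Real.exp (f x) - Real.exp (f y)) * dt (G y) := by ring
    have fx := (le_abs_self _).trans (hfb x hx)
    have fy := (le_abs_self _).trans (hfb y hy)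
    rw [e]
    refine (abs_add_le _ _).trans ?_
    rw [abs_mul, abs_mul, abs_of_pos (Real.exp_pos _)]
    have b1 : Real.exp (f x) * |dt (G x) - dt (G y)| ≤ Real.exp M * (C * L * ‖x - y‖ ^ α) :=
      mul_le_mul (Real.exp_le_exp.2 fx) ((hdl x y hx hy).trans (mul_le_mul_of_nonneg_left (hrp _ (norm_nonneg _) (hxy1 x y hx hy)) (by positivity))) (abs_nonneg _) (Real.exp_pos _).le
    have b2 : |Real.exp (f x) - Real.exp (f y)| * |dt (G y)| ≤ Real.exp M * (Cf * ‖x - y‖ ^ α) * K2 :=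
      mul_le_mul ((exp_lip fx fy).trans (mul_le_mul_of_nonneg_left (hf x y (by linarith) (by linarith)) (Real.exp_pos _).le)) (hdup y hy) (abs_nonneg _) (by positivity)
    rw [hA1]
    linarith
  obtain ⟨l, hl, hell⟩ := ell_of_det n K hK0 (d := Real.exp (-M) * (dt (G x0) / 2)) (by positivity)
  obtain ⟨R0, R1, R2, R3⟩ := small_ex (n * L) (c := l / 2) (b := σ / 2) (by positivity) (by positivity)
  refine ⟨l / 2, K, R0, C * L + A1, by positivity, hK0, R1, by positivity, hψ, fun x hx => hsym x (by linarith), fun x hx => ?_, ?_⟩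
  · filter_upwards [heq] with z hz hzx
    have hxσ : ‖x - x0‖ < σ := by linarith
    have hzσ : ‖z - x0‖ < σ := by
      have := norm_add_le (z - x) (x - x0)
      rw [sub_add_sub_cancel] at this
      linarith
    obtain ⟨p1, p2⟩ := hz (by linarith)
    have hzb : ‖D2 ψ z‖ ≤ K3 := hb3 z (by have := norm_sub_norm_le z x0; linarith)
    have nK : ∀ y, ‖y - x0‖ < σ → ‖D2 ψ z + G y‖ ≤ K := fun y hy => (norm_add_le _ _).trans (add_le_add hzb (hGb y hy))
    have ez : Ell l (hC (D2 ψ z + G z)) := by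
      refine hell _ p1 (fun i j => hC_norm_le (nK z hzσ) i j) ?_
      show _ ≤ dt (D2 ψ z + G z)
      rw [p2]
      exact mul_le_mul (Real.exp_le_exp.2 (by linarith [(abs_le.1 (hfb z hzσ)).1])) (hdlow z hzσ) (by positivity) (Real.exp_pos _).le
    have hGd : ‖(D2 ψ z + G x) - (D2 ψ z + G z)‖ ≤ L * ‖z - x‖ := by
      rw [add_sub_add_left_eq_sub, norm_sub_rev z x]
      exact hG x z (by linarith) (by linarith)
    refine ⟨ell_pert ez hGd ?_ ?_, nK x hxσ, ?_⟩
    · have : n * (L * ‖z - x‖) ≤ n * L * R0 := by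
        rw [← mul_assoc]; exact mul_le_mul_of_nonneg_left hzx.le (by positivity)
      linarith
    · intro v w
      simp only [ContinuousLinearMap.add_apply]
      rw [D2_symm' hψ.diff z v w, hsym x (by linarith) v w]
    · have a1 := hlip' _ _ (nK x hxσ) (nK z hzσ)
      have a2 := mul_le_mul_of_nonneg_left (hGd.trans (mul_le_mul_of_nonneg_left (hrp _ (norm_nonneg _) (hxy1 z x hzσ hxσ)) hL)) hC0
      have a3 := hF z x hzσ hxσ
      rw [p2] at a1
      refine (abs_sub_le _ (Real.exp (f z) * dt (G z)) _).trans ?_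
      linarith
  · rw [ContinuousAt, tendsto_iff_norm_sub_tendsto_zero]
    have h1 : Tendsto (fun y => A1 * ‖y - x0‖ ^ α) (𝓝 x0) (𝓝 0) := by
      have : Continuous fun y : E n => A1 * ‖y - x0‖ ^ α := continuous_const.mul ((continuous_id.sub continuous_const).norm.rpow_const fun _ => Or.inr hα0.le)
      simpa [Real.zero_rpow hα0.ne'] using this.tendsto x0
    refine squeeze_zero' (Eventually.of_forall fun _ => norm_nonneg _) ?_ h1
    filter_upwards [Metric.ball_mem_nhds x0 σ1] with y hy
    exact hF y x0 (by rwa [Metric.mem_ball, dist_eq_norm] at hy) hx0σ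

/-- the symmetric real form attached to a Hermitian matrix -/
noncomputable def gB (g : Matrix (Fin n) (Fin n) ℂ) : Bil n :=
  let a : Fin n → E n →L[ℝ] ℝ := fun j => Complex.reCLM.comp (ContinuousLinearMap.proj (R := ℝ) j)
  let b : Fin n → E n →L[ℝ] ℝ := fun j => Complex.imCLM.comp (ContinuousLinearMap.proj (R := ℝ) j)
  ∑ j, ∑ k, ((2 * (g j k).re) • (tp (a j) (a k) + tp (b j) (b k)) - (2 * (g j k).im) • (tp (b j) (a k) - tp (a j) (b k)))

theorem gB_apply (g : Matrix (Fin n) (Fin n) ℂ) (v w : E n) : gB g v w = ∑ j, ∑ k, 2 * (g j k * v j * star (w k)).re := by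
  simp only [gB, ContinuousLinearMap.sum_apply, ContinuousLinearMap.sub_apply, ContinuousLinearMap.smul_apply, ContinuousLinearMap.add_apply, tp_apply]
  refine Finset.sum_congr rfl fun j _ => Finset.sum_congr rfl fun k _ => ?_
  simp
  ring

theorem gB_symm {g : Matrix (Fin n) (Fin n) ℂ} (hg : g.IsHermitian) (v w : E n) : gB g v w = gB g w v := by
  rw [gB_apply, gB_apply, Finset.sum_comm]
  refine Finset.sum_congr rfl fun j _ => Finset.sum_congr rfl fun k _ => ?_
  rw [← hg.apply j k]
  simp
  ring

theorem gB_single (g : Matrix (Fin n) (Fin n) ℂ) (j k : Fin n) (a b : ℂ) : gB g (Pi.single j a) (Pi.single k b) = 2 * (g j k * a * star b).re := by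
  rw [gB_apply, Finset.sum_eq_single j, Finset.sum_eq_single k]
  · simp
  · intro i _ hi; simp [hi]
  · simp
  · intro i _ hi; simp [hi]
  · simp

theorem hC_gB (g : Matrix (Fin n) (Fin n) ℂ) : hC (gB g) = g := by
  ext j k
  rw [hC_apply]
  simp only [gB_single]
  apply Complex.ext <;> simp <;> ring

theorem gB_c1 {g : E n → Matrix (Fin n) (Fin n) ℂ} {x0 : E n} (h : ∀ j k, ContDiffAt ℝ 1 (fun z => g z j k) x0) : ContDiffAt ℝ 1 (fun z => gB (g z)) x0 := by
  unfold gB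
  refine ContDiffAt.sum fun j _ => ContDiffAt.sum fun k _ => ?_
  have hre : ContDiffAt ℝ 1 (fun z => (g z j k).re) x0 := Complex.reCLM.contDiff.contDiffAt.comp x0 (h j k)
  have him : ContDiffAt ℝ 1 (fun z => (g z j k).im) x0 := Complex.imCLM.contDiff.contDiffAt.comp x0 (h j k)
  exact ((contDiffAt_const.mul hre).smul contDiffAt_const).sub ((contDiffAt_const.mul him).smul contDiffAt_const)

section LLloc
variable {F F' : Type*} [NormedAddCommGroup F] [NormedAddCommGroup F']

def LLat (f : E n → F) (x : E n) : Prop := ∃ K : NNReal, ∃ t ∈ 𝓝 x, LipschitzOnWith K f t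

theorem LLat.comp {h : F → F'} {f : E n → F} {x : E n} (hh : LocallyLipschitz h) (hf : LLat f x) : LLat (fun y => h (f y)) x := by
  obtain ⟨K, t, ht, hf⟩ := hf
  obtain ⟨K', u, hu, hh⟩ := hh (f x)
  exact ⟨K' * K, t ∩ f ⁻¹' u, inter_mem ht (hf.continuousOn.continuousAt ht hu),
    hh.comp (hf.mono Set.inter_subset_left) (fun y hy => hy.2)⟩

theorem LLat.prodMk {g : E n → F'} {f : E n → F} {x : E n} (hf : LLat f x) (hg : LLat g x) : LLat (fun y => (f y, g y)) x := by
  obtain ⟨K, t, ht, hf⟩ := hf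
  obtain ⟨K', u, hu, hg⟩ := hg
  exact ⟨max K K', t ∩ u, inter_mem ht hu, (hf.mono Set.inter_subset_left).prodMk (hg.mono Set.inter_subset_right)⟩

theorem LLat.add [NormedSpace ℝ F] {f g : E n → F} {x : E n} (hf : LLat f x) (hg : LLat g x) : LLat (fun y => f y + g y) x := by
  have h : LocallyLipschitz (fun p : F × F => p.1 + p.2) := (contDiff_fst.add contDiff_snd : ContDiff ℝ 1 _).locallyLipschitz
  exact LLat.comp h (hf.prodMk hg)

theorem LLat.smul [NormedSpace ℝ F] {f : E n → ℝ} {g : E n → F} {x : E n} (hf : LLat f x) (hg : LLat g x) : LLat (fun y => f y • g y) x := by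
  have h : LocallyLipschitz (fun p : ℝ × F => p.1 • p.2) := (contDiff_fst.smul contDiff_snd : ContDiff ℝ 1 _).locallyLipschitz
  exact LLat.comp h (hf.prodMk hg)
end LLloc

theorem cutoff {Ω : Set (E n)} (hΩ : IsOpen Ω) {φ : E n → ℝ} {x0 : E n} (hx0 : x0 ∈ Ω)
    (hd : ∀ z ∈ Ω, DifferentiableAt ℝ φ z)
    (hl : ∃ U ∈ nhds x0, ∃ L : NNReal, LipschitzOnWith L (fderiv ℝ φ) U) :
    ∃ ψ s, LC ψ ∧ 0 < s ∧ Metric.closedBall x0 s ⊆ Ω ∧ ∀ x, ‖x - x0‖ < s → ψ x = φ x := by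
  obtain ⟨U, hU, L, hL⟩ := hl
  obtain ⟨r, hr, hrU⟩ := Metric.mem_nhds_iff.1 (inter_mem hU (hΩ.mem_nhds hx0))
  let b : ContDiffBump x0 := ⟨r / 4, r / 2, by linarith, by linarith⟩
  have hb1 : ContDiff ℝ 2 b := b.contDiff
  have hfb : ContDiff ℝ 1 (fderiv ℝ b) := hb1.fderiv_right (by norm_num)
  have hz : ∀ x, x ∉ Metric.ball x0 r → (b : E n → ℝ) =ᶠ[𝓝 x] fun _ => 0 := by
    intro x hx
    refine notMem_tsupport_iff_eventuallyEq.1 (fun h => hx ?_)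
    rw [b.tsupport_eq] at h
    exact Metric.closedBall_subset_ball (by change r / 2 < r; linarith) h
  have hmem : ∀ x ∈ Metric.ball x0 r, Metric.ball x0 r ∈ 𝓝 x := fun x hx => Metric.isOpen_ball.mem_nhds hx
  have hz2 : ∀ x, x ∉ Metric.ball x0 r → (fun x => b x * φ x) =ᶠ[𝓝 x] fun _ => 0 := by
    intro x hx
    filter_upwards [hz x hx] with y hy
    rw [hy, zero_mul]
  have hfd : fderiv ℝ (fun x => b x * φ x) = fun x => b x • fderiv ℝ φ x + φ x • fderiv ℝ b x := by
    ext1 x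
    by_cases hx : x ∈ Metric.ball x0 r
    · exact fderiv_fun_mul (hb1.differentiable (by norm_num) x) (hd x (hrU hx).2)
    · rw [(hz2 x hx).fderiv_eq, (hz x hx).fderiv_eq, (hz x hx).eq_of_nhds]
      simp
  refine ⟨fun x => b x * φ x, r / 4, ⟨fun x => ?_, fun x => ?_⟩, by linarith, ?_, ?_⟩
  · by_cases hx : x ∈ Metric.ball x0 r
    · exact (hb1.differentiable (by norm_num) x).mul (hd x (hrU hx).2)
    · exact (hz2 x hx).differentiableAt_iff.2 (differentiableAt_const _)
  · by_cases hx : x ∈ Metric.ball x0 r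
    · rw [hfd]
      have h1 : LLat (fderiv ℝ φ) x := ⟨L, _, hmem x hx, hL.mono (fun y hy => (hrU hy).1)⟩
      have h2 : LLat φ x := by
        have : ContDiffAt ℝ 1 φ x := contDiffAt_one_iff.2 ⟨fderiv ℝ φ, _, hmem x hx,
          hL.continuousOn.mono (fun y hy => (hrU hy).1), fun y hy => (hd y (hrU hy).2).hasFDerivAt⟩
        exact this.exists_lipschitzOnWith
      have h3 : LLat b x := (hb1.of_le (by norm_num) : ContDiff ℝ 1 b).locallyLipschitz x
      have h4 : LLat (fderiv ℝ b) x := hfb.locallyLipschitz x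
      exact (h3.smul h1).add (h2.smul h4)
    · refine ⟨0, {y | fderiv ℝ (fun x => b x * φ x) y = 0}, ?_, fun y hy z hz => ?_⟩
      · filter_upwards [(hz2 x hx).fderiv (𝕜 := ℝ)] with y hy
        simpa using hy
      · have hy' : fderiv ℝ (fun x => b x * φ x) y = 0 := hy
        have hz' : fderiv ℝ (fun x => b x * φ x) z = 0 := hz
        rw [hy', hz']; simp
  · intro x hx
    exact (hrU (Metric.closedBall_subset_ball (by linarith) hx)).2
  · intro x hx
    have : b x = 1 := b.one_of_mem_closedBall (by
      change dist x x0 ≤ r / 4; rw [dist_eq_norm]; exact hx.le)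
    simp only [this, one_mul]

theorem loc_thm (hn : 0 < n) {Ω : Set (E n)} (hΩ : IsOpen Ω) (hα0 : 0 < α) (hα1 : α < 1)
    {g : E n → Matrix (Fin n) (Fin n) ℂ}
    (hg_smooth : ∀ j k : Fin n, ContDiffOn ℝ (⊤ : ℕ∞) (fun z => g z j k) Ω)
    (hg_pos : ∀ z ∈ Ω, (g z).PosDef) {φ f : E n → ℝ}
    (hd : ∀ z ∈ Ω, DifferentiableAt ℝ φ z)
    (hl : ∀ z ∈ Ω, ∃ U ∈ nhds z, ∃ L : NNReal, LipschitzOnWith L (fderiv ℝ φ) U)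
    (hf : ∀ K : Set (E n), K ⊆ Ω → IsCompact K → ∃ Cf : NNReal, HolderOnWith Cf α.toNNReal f K)
    (heq : ∀ᵐ z ∂(volume : Measure (E n)), z ∈ Ω → (g z + cHess φ z).PosSemidef ∧
        (g z + cHess φ z).det = (Real.exp (f z) : ℂ) * (g z).det) {x0 : E n} (hx0 : x0 ∈ Ω) :
    ∃ s C, 0 < s ∧ 0 < C ∧ (∀ x, ‖x - x0‖ < s → x ∈ Ω ∧ DifferentiableAt ℝ (fderiv ℝ φ) x) ∧
      ∀ x y, ‖x - x0‖ < s → ‖y - x0‖ < s → ‖D2 φ x - D2 φ y‖ ≤ C * ‖x - y‖ ^ α := by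
  obtain ⟨ψ, s, hψ, hs, hsΩ, hψφ⟩ := cutoff hΩ hx0 hd (hl x0 hx0)
  have hG1 : ContDiffAt ℝ 1 (fun z => gB (g z)) x0 := gB_c1 (fun j k =>
    ((hg_smooth j k).contDiffAt (hΩ.mem_nhds hx0)).of_le (by exact_mod_cast le_top))
  obtain ⟨L, t, ht, hL⟩ := hG1.exists_lipschitzOnWith
  obtain ⟨s', hs', hs't⟩ := Metric.mem_nhds_iff.1 ht
  obtain ⟨Cf, hCf⟩ := hf _ hsΩ (isCompact_closedBall x0 s)
  have hev : ∀ x, ‖x - x0‖ < s → ψ =ᶠ[𝓝 x] φ := by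
    intro x hx
    filter_upwards [Metric.isOpen_ball.mem_nhds (mem_ball_iff_norm.2 hx)] with y hy
    exact hψφ y (mem_ball_iff_norm.1 hy)
  have hΩx : ∀ x, ‖x - x0‖ < s → x ∈ Ω := fun x hx => hsΩ (mem_closedBall_iff_norm.2 hx.le)
  have hdt : ∀ x, dt (gB (g x)) = (g x).det.re := fun x => by unfold dt; rw [hC_gB]
  obtain ⟨l, K, R0, A, hl0, hK, hR0, hA, H⟩ := mk_Loc (x0 := x0) (G := fun z => gB (g z)) (f := f) (s := min s s') (L := L) (Cf := Cf) hψ hα0 hα1 (lt_min hs hs') L.2 Cf.2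
    (fun x hx => gB_symm (hg_pos x (hΩx x (hx.trans_le (min_le_left _ _)))).isHermitian)
    (fun x y hx hy => by
      have := hL.dist_le_mul x (hs't (mem_ball_iff_norm.2 (hx.trans_le (min_le_right _ _)))) y
        (hs't (mem_ball_iff_norm.2 (hy.trans_le (min_le_right _ _))))
      rwa [dist_eq_norm, dist_eq_norm] at this)
    (fun x y hx hy => by
      have := hCf.dist_le (mem_closedBall_iff_norm.2 (hx.trans_le (min_le_left _ _)).le)
        (mem_closedBall_iff_norm.2 (hy.trans_le (min_le_left _ _)).le)
      rwa [dist_eq_norm, dist_eq_norm, Real.coe_toNNReal _ hα0.le, Real.norm_eq_abs] at this)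
    (by rw [hdt]; exact (Complex.pos_iff.1 (hg_pos x0 hx0).det_pos).1)
    (by
      filter_upwards [heq, hψ.ae] with z hz hzd hzs
      have hzs' := hzs.trans_le (min_le_left s s')
      obtain ⟨h1, h2⟩ := hz (hΩx z hzs')
      have hc : cHess φ z = hC (D2 ψ z) := by
        rw [cHess_eq ((hev z hzs').fderiv.differentiableAt_iff.1 hzd)]
        unfold D2; rw [(hev z hzs').fderiv.fderiv_eq]
      have hsum : hC (D2 ψ z + gB (g z)) = g z + cHess φ z := by
        rw [hC_add, hC_gB, hc, add_comm]
      refine ⟨by rw [hsum]; exact h1, ?_⟩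
      rw [hdt]; unfold dt
      rw [hsum, h2, Complex.re_ofReal_mul])
  obtain ⟨r, C, hr, hC, h1, h2⟩ := local_reg hn hl0 hK hα0 hα1 hR0 hA H
  have hD : ∀ x, ‖x - x0‖ < s → D2 φ x = D2 ψ x := fun x hx => by
    unfold D2; rw [(hev x hx).fderiv.fderiv_eq]
  refine ⟨min s r, C, lt_min hs hr, hC, fun x hx => ⟨hΩx x (hx.trans_le (min_le_left _ _)), ?_⟩, fun x y hx hy => ?_⟩
  · exact (hev x (hx.trans_le (min_le_left _ _))).fderiv.differentiableAt_iff.1 (h1 x (hx.trans_le (min_le_right _ _)))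
  · rw [hD x (hx.trans_le (min_le_left _ _)), hD y (hy.trans_le (min_le_left _ _))]
    exact h2 x y (hx.trans_le (min_le_right _ _)) (hy.trans_le (min_le_right _ _))

theorem iter_le (φ : E n → ℝ) (x y : E n) :
    ‖iteratedFDeriv ℝ 2 φ x - iteratedFDeriv ℝ 2 φ y‖ ≤ ‖D2 φ x - D2 φ y‖ := by
  refine ContinuousMultilinearMap.opNorm_le_bound (norm_nonneg _) (fun m => ?_)
  have : (iteratedFDeriv ℝ 2 φ x - iteratedFDeriv ℝ 2 φ y) m = (D2 φ x - D2 φ y) (m 0) (m 1) := by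
    rw [ContinuousMultilinearMap.sub_apply, iteratedFDeriv_two_apply, iteratedFDeriv_two_apply]
    rfl
  rw [this, Fin.prod_univ_two, ← mul_assoc]
  exact ContinuousLinearMap.le_opNorm₂ _ _ _

theorem glob {Ω : Set (E n)} (hΩ : IsOpen Ω) (hα0 : 0 < α) {φ : E n → ℝ}
    (hd : ∀ z ∈ Ω, DifferentiableAt ℝ φ z)
    (hloc : ∀ x0 ∈ Ω, ∃ s C, 0 < s ∧ 0 < C ∧ (∀ x, ‖x - x0‖ < s → x ∈ Ω ∧ DifferentiableAt ℝ (fderiv ℝ φ) x) ∧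
      ∀ x y, ‖x - x0‖ < s → ‖y - x0‖ < s → ‖D2 φ x - D2 φ y‖ ≤ C * ‖x - y‖ ^ α) :
    ContDiffOn ℝ 2 φ Ω ∧ ∀ K : Set (E n), K ⊆ Ω → IsCompact K →
      ∃ Cφ : NNReal, HolderOnWith Cφ α.toNNReal (iteratedFDeriv ℝ 2 φ) K := by
  have hc : ContinuousOn (D2 φ) Ω := by
    intro x0 hx0
    obtain ⟨s, C, hs, hC, -, h2⟩ := hloc x0 hx0
    refine ContinuousAt.continuousWithinAt ?_
    refine tendsto_iff_norm_sub_tendsto_zero.2 ?_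
    have hlim : Tendsto (fun x => C * ‖x - x0‖ ^ α) (𝓝 x0) (𝓝 0) := by
      have h1 : Tendsto (fun x => ‖x - x0‖) (𝓝 x0) (𝓝 0) := tendsto_iff_norm_sub_tendsto_zero.1 tendsto_id
      have h2 := (h1.rpow_const (p := α) (Or.inr hα0.le)).const_mul C
      rwa [Real.zero_rpow hα0.ne', mul_zero] at h2
    refine squeeze_zero' (Eventually.of_forall fun _ => norm_nonneg _) ?_ hlim
    filter_upwards [Metric.ball_mem_nhds x0 hs] with x hx
    exact h2 x x0 (mem_ball_iff_norm.1 hx) (by simpa using hs)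
  constructor
  · have h2 : (2 : WithTop ℕ∞) = 1 + 1 := by norm_num
    rw [h2, contDiffOn_succ_iff_fderiv_of_isOpen hΩ]
    refine ⟨fun x hx => (hd x hx).differentiableWithinAt, by simp, fun x hx => ContDiffAt.contDiffWithinAt ?_⟩
    refine contDiffAt_one_iff.2 ⟨D2 φ, Ω, hΩ.mem_nhds hx, hc, fun y hy => ?_⟩
    obtain ⟨s, C, hs, hC, h1, -⟩ := hloc y hy
    exact (h1 y (by simpa using hs)).2.hasFDerivAt
  · intro K hKΩ hK
    obtain ⟨C, δ, hC, hδ, hCδ⟩ : ∃ C δ : ℝ, 0 ≤ C ∧ 0 < δ ∧ ∀ x ∈ K, ∀ y, ‖x - y‖ < δ → ‖D2 φ x - D2 φ y‖ ≤ C * ‖x - y‖ ^ α := by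
      refine hK.induction_on (p := fun K => ∃ C δ : ℝ, 0 ≤ C ∧ 0 < δ ∧ ∀ x ∈ K, ∀ y, ‖x - y‖ < δ → ‖D2 φ x - D2 φ y‖ ≤ C * ‖x - y‖ ^ α)
        ⟨0, 1, le_rfl, one_pos, by simp⟩ ?_ ?_ ?_
      · rintro s t hst ⟨C, δ, hC, hδ, h⟩
        exact ⟨C, δ, hC, hδ, fun x hx => h x (hst hx)⟩
      · rintro s t ⟨C, δ, hC, hδ, h⟩ ⟨C', δ', hC', hδ', h'⟩
        refine ⟨max C C', min δ δ', hC.trans (le_max_left _ _), lt_min hδ hδ', fun x hx y hxy => ?_⟩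
        have hp : 0 ≤ ‖x - y‖ ^ α := Real.rpow_nonneg (norm_nonneg _) _
        rcases hx with hx | hx
        · exact (h x hx y (hxy.trans_le (min_le_left _ _))).trans (mul_le_mul_of_nonneg_right (le_max_left _ _) hp)
        · exact (h' x hx y (hxy.trans_le (min_le_right _ _))).trans (mul_le_mul_of_nonneg_right (le_max_right _ _) hp)
      · intro x0 hx0
        obtain ⟨s, C, hs, hC, -, h2⟩ := hloc x0 (hKΩ hx0)
        refine ⟨Metric.ball x0 (s / 2), mem_nhdsWithin_of_mem_nhds (Metric.ball_mem_nhds x0 (half_pos hs)), C, s / 2, hC.le, half_pos hs, fun x hx y hxy => ?_⟩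
        have hx' := mem_ball_iff_norm.1 hx
        refine h2 x y (by linarith) ?_
        have : ‖y - x0‖ ≤ ‖x - y‖ + ‖x - x0‖ := by
          rw [norm_sub_rev x y]; exact norm_sub_le_norm_sub_add_norm_sub y x x0
        linarith
    obtain ⟨B, hB⟩ := hK.exists_bound_of_continuousOn (hc.mono hKΩ)
    have hδα := Real.rpow_pos_of_pos hδ α
    have hB0 : 0 ≤ 2 * |B| / δ ^ α := by positivity
    have key : ∀ x ∈ K, ∀ y ∈ K, ‖D2 φ x - D2 φ y‖ ≤ (C + 2 * |B| / δ ^ α) * ‖x - y‖ ^ α := by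
      intro x hx y hy
      have hp : 0 ≤ ‖x - y‖ ^ α := Real.rpow_nonneg (norm_nonneg _) _
      rw [add_mul]
      by_cases hxy : ‖x - y‖ < δ
      · have := hCδ x hx y hxy
        have := mul_nonneg hB0 hp
        linarith
      · have h1 : δ ^ α ≤ ‖x - y‖ ^ α := Real.rpow_le_rpow hδ.le (not_lt.1 hxy) hα0.le
        have h2 : ‖D2 φ x - D2 φ y‖ ≤ 2 * |B| := by
          have := norm_sub_le (D2 φ x) (D2 φ y)
          have := hB x hx; have := hB y hy; have := le_abs_self B
          linarith
        have h3 : 2 * |B| / δ ^ α * δ ^ α = 2 * |B| := div_mul_cancel₀ _ hδα.ne'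
        have h4 := mul_le_mul_of_nonneg_left h1 hB0
        have h5 := mul_nonneg hC hp
        linarith
    refine ⟨(C + 2 * |B| / δ ^ α).toNNReal, fun x hx y hy => ?_⟩
    have hCB : 0 ≤ C + 2 * |B| / δ ^ α := by linarith
    rw [Real.coe_toNNReal _ hα0.le, edist_dist, edist_dist, ENNReal.ofReal_rpow_of_nonneg dist_nonneg hα0.le]
    change _ ≤ ENNReal.ofReal _ * _
    rw [← ENNReal.ofReal_mul hCB]
    refine ENNReal.ofReal_le_ofReal ?_
    rw [dist_eq_norm, dist_eq_norm]
    exact (iter_le φ x y).trans (key x hx y hy)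

end CMA

/-- **Interior `C^{2,α}` regularity for the complex Monge–Ampère equation on Hermitian
manifolds** (the Corollary of the paper, stated on a domain `Ω ⊆ ℂⁿ`): if `g` is a smooth
positive definite Hermitian matrix-valued function on `Ω`, `φ : Ω → ℝ` is differentiable with
locally Lipschitz gradient (so its complex Hessian exists a.e. by Rademacher's theorem), `f` is
`α`-Hölder on compact subsets of `Ω` (`0 < α < 1`), and for a.e. `z ∈ Ω` the matrix
`g(z) + H(φ)(z)` is positive semidefinite with `det(g(z) + H(φ)(z)) = e^{f(z)} det g(z)`, then
`φ` is `C²` on `Ω` and its second derivative is `α`-Hölder on compact subsets of `Ω`. -/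
theorem c2alpha_regularity {n : ℕ} (Ω : Set (Fin n → ℂ)) (hΩ : IsOpen Ω)
    (α : ℝ) (hα0 : 0 < α) (hα1 : α < 1)
    (g : (Fin n → ℂ) → Matrix (Fin n) (Fin n) ℂ)
    (hg_smooth : ∀ j k : Fin n, ContDiffOn ℝ (⊤ : ℕ∞) (fun z => g z j k) Ω)
    (hg_pos : ∀ z ∈ Ω, (g z).PosDef)
    (φ f : (Fin n → ℂ) → ℝ)
    (hφ_diff : ∀ z ∈ Ω, DifferentiableAt ℝ φ z)
    (hφ_lip : ∀ z ∈ Ω, ∃ U ∈ nhds z, ∃ L : NNReal, LipschitzOnWith L (fderiv ℝ φ) U)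
    (hf : ∀ K : Set (Fin n → ℂ), K ⊆ Ω → IsCompact K →
      ∃ Cf : NNReal, HolderOnWith Cf α.toNNReal f K)
    (heq : ∀ᵐ z ∂(MeasureTheory.volume : MeasureTheory.Measure (Fin n → ℂ)),
      z ∈ Ω → (g z + cHess φ z).PosSemidef ∧
        (g z + cHess φ z).det = (Real.exp (f z) : ℂ) * (g z).det) :
    ContDiffOn ℝ 2 φ Ω ∧
    ∀ K : Set (Fin n → ℂ), K ⊆ Ω → IsCompact K →
      ∃ Cφ : NNReal, HolderOnWith Cφ α.toNNReal (iteratedFDeriv ℝ 2 φ) K := by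
  rcases Nat.eq_zero_or_pos n with rfl | hn
  · have h0 : ContDiff ℝ 2 φ := by
      have : φ = fun _ => φ 0 := funext fun x => by rw [Subsingleton.elim x 0]
      rw [this]; exact contDiff_const
    refine ⟨h0.contDiffOn, fun K _ _ => ⟨0, fun x _ y _ => ?_⟩⟩
    rw [Subsingleton.elim x y]; simp
  · exact CMA.glob hΩ hα0 hφ_diff (fun x0 hx0 =>
      CMA.loc_thm hn hΩ hα0 hα1 hg_smooth hg_pos hφ_diff hφ_lip hf heq hx0)
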